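/- Let 0 < R₁ < R₂ < R and let ω = { x ∈ ℝ^d : R₁ < ‖x‖ < R₂ } be the full annulus; set T* = R₁²/(2d). Then for every β > 1 there exists c_β > 0 such that for every T > T* and every solution y of the Baouendi–Grushin equation on [0,T], one has ∫_{B_R × Ω̃} |y(T,·)|² ≤ e^{c_β/(T−T*)^{β}} ∫₀^T ∫_{ω × Ω̃} |y|² (note the improved blow-up exponent β in place of 2β). -/

import Mathlib

open MeasureTheory Metric Set Filter

/-- The Euclidean Laplacian of `f : ℝ^n → ℝ` at `x`. -/
noncomputable def lapl {n : ℕ} (f : EuclideanSpace ℝ (Fin n) → ℝ)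
    (x : EuclideanSpace ℝ (Fin n)) : ℝ :=
  ∑ i, fderiv ℝ (fun z => fderiv ℝ f z (EuclideanSpace.single i 1)) x (EuclideanSpace.single i 1)

/-- `y` is a solution of the Baouendi–Grushin equation on `(0,T) × B_R × Ω̃`. -/
structure IsGrushinSolution (d dt : ℕ) (R T : ℝ) (Ωt : Set (EuclideanSpace ℝ (Fin dt)))
    (y : ℝ → EuclideanSpace ℝ (Fin d) → EuclideanSpace ℝ (Fin dt) → ℝ) : Prop where
  continuousOn : ContinuousOn
    (fun p : ℝ × (EuclideanSpace ℝ (Fin d) × EuclideanSpace ℝ (Fin dt)) => y p.1 p.2.1 p.2.2)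
    (Icc 0 T ×ˢ closure (ball (0 : EuclideanSpace ℝ (Fin d)) R ×ˢ Ωt))
  smoothOn : ContDiffOn ℝ (⊤ : ℕ∞)
    (fun p : ℝ × (EuclideanSpace ℝ (Fin d) × EuclideanSpace ℝ (Fin dt)) => y p.1 p.2.1 p.2.2)
    (Ioo 0 T ×ˢ (ball (0 : EuclideanSpace ℝ (Fin d)) R ×ˢ Ωt))
  eqn : ∀ t ∈ Ioo (0:ℝ) T, ∀ x ∈ ball (0 : EuclideanSpace ℝ (Fin d)) R, ∀ z ∈ Ωt,
    deriv (fun s => y s x z) t - lapl (fun x' => y t x' z) x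
      - ‖x‖ ^ 2 * lapl (fun z' => y t x z') z = 0
  boundary : ∀ t ∈ Ioo (0:ℝ) T,
    ∀ p ∈ frontier (ball (0 : EuclideanSpace ℝ (Fin d)) R ×ˢ Ωt), y t p.1 p.2 = 0

section

set_option linter.unusedSectionVars false

open Real (exp log smoothTransition exp_pos exp_add exp_le_exp exp_nonneg exp_le_one_iff exp_zero
  norm_eq_abs)
open scoped Gradient ContDiff Topology

section L2

variable {α : Type*} [MeasurableSpace α] {μ : Measure α}
  {F : Type*} [NormedAddCommGroup F] [InnerProductSpace ℝ F]

theorem MeasureTheory.MemLp.inner_integrable {f g : α → F} (hf : MemLp f 2 μ) (hg : MemLp g 2 μ) :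
    Integrable (fun x => inner ℝ (f x) (g x)) μ := by
  refine (L2.integrable_inner (𝕜 := ℝ) (hf.toLp f) (hg.toLp g)).congr ?_
  filter_upwards [hf.coeFn_toLp, hg.coeFn_toLp] with x hx hy
  rw [hx, hy]

theorem MeasureTheory.MemLp.integral_inner_eq {f g : α → F} (hf : MemLp f 2 μ) (hg : MemLp g 2 μ) :
    ∫ x, inner ℝ (f x) (g x) ∂μ = inner ℝ (hf.toLp f) (hg.toLp g) := by
  rw [L2.inner_def]
  refine integral_congr_ae ?_
  filter_upwards [hf.coeFn_toLp, hg.coeFn_toLp] with x hx hy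
  rw [hx, hy]

theorem MeasureTheory.MemLp.normSq_integrable {f : α → F} (hf : MemLp f 2 μ) :
    Integrable (fun x => ‖f x‖ ^ 2) μ :=
  (memLp_two_iff_integrable_sq_norm hf.1).1 hf

theorem MeasureTheory.MemLp.mul_integrable {f g : α → ℝ} (hf : MemLp f 2 μ) (hg : MemLp g 2 μ) :
    Integrable (fun x => f x * g x) μ := by
  simpa [mul_comm] using hf.inner_integrable hg

theorem MeasureTheory.MemLp.integral_normSq_eq {f : α → F} (hf : MemLp f 2 μ) :
    ∫ x, ‖f x‖ ^ 2 ∂μ = ‖hf.toLp f‖ ^ 2 := by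
  rw [← real_inner_self_eq_norm_sq, ← hf.integral_inner_eq hf]
  simp

theorem sq_integral_inner_le {f g : α → F} (hf : MemLp f 2 μ) (hg : MemLp g 2 μ) :
    (∫ x, inner ℝ (f x) (g x) ∂μ) ^ 2 ≤ (∫ x, ‖f x‖ ^ 2 ∂μ) * ∫ x, ‖g x‖ ^ 2 ∂μ := by
  rw [hf.integral_inner_eq hg, hf.integral_normSq_eq, hg.integral_normSq_eq, ← mul_pow]
  exact sq_le_sq' (by linarith [abs_le.1 (abs_real_inner_le_norm (hf.toLp f) (hg.toLp g))])
    (real_inner_le_norm _ _)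

theorem sq_integral_mul_le {f g : α → ℝ} (hf : MemLp f 2 μ) (hg : MemLp g 2 μ) :
    (∫ x, f x * g x ∂μ) ^ 2 ≤ (∫ x, f x ^ 2 ∂μ) * ∫ x, g x ^ 2 ∂μ := by
  simpa [mul_comm] using sq_integral_inner_le hf hg

/-- Convergence in `L²` of a sequence of functions, in terms of representatives. -/
def TendstoL2 (μ : Measure α) (f : ℕ → α → F) (g : α → F) : Prop :=
  Tendsto (fun j => ∫ x, ‖f j x - g x‖ ^ 2 ∂μ) atTop (nhds 0)

theorem tendstoL2_iff {f : ℕ → α → F} {g : α → F} (hf : ∀ j, MemLp (f j) 2 μ) (hg : MemLp g 2 μ) :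
    TendstoL2 μ f g ↔ Tendsto (fun j => (hf j).toLp (f j)) atTop (nhds (hg.toLp g)) := by
  rw [tendsto_iff_norm_sub_tendsto_zero]
  have h : (fun j => ∫ x, ‖f j x - g x‖ ^ 2 ∂μ) =
      fun j => ‖(hf j).toLp (f j) - hg.toLp g‖ ^ 2 := by
    funext j
    rw [← MemLp.toLp_sub, ← ((hf j).sub hg).integral_normSq_eq]
    rfl
  unfold TendstoL2
  rw [h]
  constructor
  · intro h0
    have := h0.sqrt
    simpa [Real.sqrt_sq (norm_nonneg _)] using this
  · intro h0
    simpa using h0.pow 2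

theorem TendstoL2.integral_inner {f f' : ℕ → α → F} {g g' : α → F}
    (hf : ∀ j, MemLp (f j) 2 μ) (hg : MemLp g 2 μ) (h : TendstoL2 μ f g)
    (hf' : ∀ j, MemLp (f' j) 2 μ) (hg' : MemLp g' 2 μ) (h' : TendstoL2 μ f' g') :
    Tendsto (fun j => ∫ x, inner ℝ (f j x) (f' j x) ∂μ) atTop
      (nhds (∫ x, inner ℝ (g x) (g' x) ∂μ)) := by
  rw [tendstoL2_iff hf hg] at h
  rw [tendstoL2_iff hf' hg'] at h'
  simp_rw [fun j => (hf j).integral_inner_eq (hf' j), hg.integral_inner_eq hg']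
  exact h.inner h'

theorem TendstoL2.const (g : α → F) : TendstoL2 μ (fun _ => g) g := by
  simp [TendstoL2]

theorem TendstoL2.integral_mul {f : ℕ → α → ℝ} {g p : α → ℝ}
    (hf : ∀ j, MemLp (f j) 2 μ) (hg : MemLp g 2 μ) (h : TendstoL2 μ f g)
    (hp : MemLp p 2 μ) :
    Tendsto (fun j => ∫ x, p x * f j x ∂μ) atTop (nhds (∫ x, p x * g x ∂μ)) := by
  simpa using TendstoL2.integral_inner hf hg h (fun _ => hp) hp (TendstoL2.const p)

theorem TendstoL2.add {f f' : ℕ → α → F} {g g' : α → F}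
    (hf : ∀ j, MemLp (f j) 2 μ) (hg : MemLp g 2 μ) (h : TendstoL2 μ f g)
    (hf' : ∀ j, MemLp (f' j) 2 μ) (hg' : MemLp g' 2 μ) (h' : TendstoL2 μ f' g') :
    TendstoL2 μ (fun j x => f j x + f' j x) (fun x => g x + g' x) := by
  rw [tendstoL2_iff hf hg] at h
  rw [tendstoL2_iff hf' hg'] at h'
  exact (tendstoL2_iff (fun j => (hf j).add (hf' j)) (hg.add hg')).2 (h.add h')

theorem TendstoL2.of_le {F' : Type*} [NormedAddCommGroup F'] [InnerProductSpace ℝ F']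
    {f : ℕ → α → F} {g : α → F} {f' : ℕ → α → F'} {g' : α → F'}
    (hf : ∀ j, MemLp (f j) 2 μ) (hg : MemLp g 2 μ) (h : TendstoL2 μ f g) (C : ℝ)
    (hle : ∀ j x, ‖f' j x - g' x‖ ≤ C * ‖f j x - g x‖) :
    TendstoL2 μ f' g' := by
  have h1 : Tendsto (fun j => C ^ 2 * ∫ x, ‖f j x - g x‖ ^ 2 ∂μ) atTop (nhds 0) := by
    simpa using Tendsto.const_mul (C ^ 2) h
  refine squeeze_zero (fun j => integral_nonneg fun x => by positivity) (fun j => ?_) h1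
  rw [← integral_const_mul]
  refine integral_mono_of_nonneg (Eventually.of_forall fun x => by positivity)
    (((hf j).sub hg).normSq_integrable.const_mul _) (Eventually.of_forall fun x => ?_)
  simp only [← mul_pow]
  exact pow_le_pow_left₀ (norm_nonneg _) (hle j x) 2

end L2

section H01

variable {E : Type*} [NormedAddCommGroup E] [InnerProductSpace ℝ E] [FiniteDimensional ℝ E]

theorem inner_gradient_eq (f : E → ℝ) (x v : E) : inner ℝ (∇ f x) v = fderiv ℝ f x v := by
  simp [gradient]

theorem gradient_eq_zero_of_notMem_tsupport {f : E → ℝ} {x : E} (hx : x ∉ tsupport f) :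
    ∇ f x = 0 := by
  have h := image_eq_zero_of_notMem_tsupport (fun h => hx (tsupport_fderiv_subset ℝ h))
  simp [gradient, h]

theorem gradient_fun_mul {f g : E → ℝ} {x : E} (hf : DifferentiableAt ℝ f x)
    (hg : DifferentiableAt ℝ g x) :
    ∇ (fun x => f x * g x) x = f x • ∇ g x + g x • ∇ f x := by
  simp [gradient, fderiv_fun_mul hf hg]

theorem gradient_fun_add {f g : E → ℝ} {x : E} (hf : DifferentiableAt ℝ f x)
    (hg : DifferentiableAt ℝ g x) :
    ∇ (fun x => f x + g x) x = ∇ f x + ∇ g x := by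
  simp [gradient, fderiv_fun_add hf hg]

theorem gradient_const_mul {f : E → ℝ} {x : E} (c : ℝ) (hf : DifferentiableAt ℝ f x) :
    ∇ (fun x => c * f x) x = c • ∇ f x := by
  simp [gradient, fderiv_const_mul hf]

theorem ContDiff.continuous_gradient {f : E → ℝ} (hf : ContDiff ℝ ∞ f) :
    Continuous (∇ f) :=
  (InnerProductSpace.toDual ℝ E).symm.continuous.comp (hf.continuous_fderiv (by simp))

/-- The gradient of a radial function. -/
theorem gradient_radial {M : ℝ → ℝ} {M' : ℝ} (x₀ x : E) (hM : HasDerivAt M M' (‖x - x₀‖ ^ 2)) :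
    ∇ (fun x => M (‖x - x₀‖ ^ 2)) x = (2 * M') • (x - x₀) := by
  apply HasGradientAt.gradient
  rw [hasGradientAt_iff_hasFDerivAt]
  have h1 : HasFDerivAt (fun x : E => ‖x - x₀‖ ^ 2) (2 • (innerSL ℝ) (x - x₀)) x := by
    simpa using ((hasFDerivAt_id x).sub_const x₀).norm_sq
  refine (hM.comp_hasFDerivAt x h1).congr_fderiv ?_
  ext v
  simp
  ring

theorem contDiff_radial {M : ℝ → ℝ} (hM : ContDiff ℝ ∞ M) (x₀ : E) :
    ContDiff ℝ ∞ (fun x => M (‖x - x₀‖ ^ 2)) :=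
  hM.comp ((contDiff_id.sub contDiff_const).norm_sq ℝ)

/-- Smooth functions with compact support in `O`. -/
structure IsTest (O : Set E) (η : E → ℝ) : Prop where
  smooth : ContDiff ℝ ∞ η
  compact : HasCompactSupport η
  subset : tsupport η ⊆ O

namespace IsTest

variable {O : Set E} {η ζ : E → ℝ}

theorem differentiableAt (h : IsTest O η) (x : E) : DifferentiableAt ℝ η x :=
  h.smooth.differentiable (by simp) x

theorem mono {O' : Set E} (h : IsTest O η) (hO : O ⊆ O') : IsTest O' η :=
  ⟨h.smooth, h.compact, h.subset.trans hO⟩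

theorem gradient_compact (h : IsTest O η) : HasCompactSupport (∇ η) :=
  h.compact.of_isClosed_subset isClosed_closure
    (closure_minimal (fun x hx => by
      by_contra hc
      exact hx (gradient_eq_zero_of_notMem_tsupport hc)) isClosed_closure)

theorem eq_zero (h : IsTest O η) {x : E} (hx : x ∉ O) : η x = 0 :=
  image_eq_zero_of_notMem_tsupport fun hc => hx (h.subset hc)

theorem gradient_eq_zero (h : IsTest O η) {x : E} (hx : x ∉ O) : ∇ η x = 0 :=
  gradient_eq_zero_of_notMem_tsupport fun hc => hx (h.subset hc)

theorem add (h : IsTest O η) (h' : IsTest O ζ) : IsTest O (fun x => η x + ζ x) where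
  smooth := h.smooth.add h'.smooth
  compact := h.compact.add h'.compact
  subset := (tsupport_add η ζ).trans (union_subset h.subset h'.subset)

theorem smooth_mul {O' : Set E} {m : E → ℝ} (h : IsTest O η) (hm : ContDiff ℝ ∞ m)
    (hO : tsupport m ∩ O ⊆ O') : IsTest O' (fun x => m x * η x) where
  smooth := hm.mul h.smooth
  compact := h.compact.mul_left
  subset := fun _ hx => hO ⟨tsupport_mul_subset_left hx, h.subset (tsupport_mul_subset_right hx)⟩

theorem const_mul (h : IsTest O η) (c : ℝ) : IsTest O (fun x => c * η x) :=
  h.smooth_mul contDiff_const inter_subset_right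

variable [MeasurableSpace E] [BorelSpace E]

theorem memLp (h : IsTest O η) : MemLp η 2 (volume : Measure E) :=
  h.smooth.continuous.memLp_of_hasCompactSupport h.compact

theorem memLp_gradient (h : IsTest O η) : MemLp (∇ η) 2 (volume : Measure E) :=
  h.smooth.continuous_gradient.memLp_of_hasCompactSupport h.gradient_compact

end IsTest

variable [MeasurableSpace E] [BorelSpace E]

theorem Bornology.IsBounded.exists_bound_of_continuous {F : Type*} [NormedAddCommGroup F]
    {O : Set E} (hO : Bornology.IsBounded O) {m : E → F} (hm : Continuous m) :
    ∃ C : ℝ, 0 ≤ C ∧ ∀ x ∈ O, ‖m x‖ ≤ C := by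
  obtain ⟨C, hC⟩ := (hO.isCompact_closure).exists_bound_of_continuousOn hm.continuousOn
  exact ⟨max C 0, le_max_right _ _, fun x hx => (hC x (subset_closure hx)).trans (le_max_left _ _)⟩

theorem MeasureTheory.MemLp.continuous_smul {F : Type*} [NormedAddCommGroup F] [NormedSpace ℝ F]
    {O : Set E} (hO : Bornology.IsBounded O) {f : E → F} (hf : MemLp f 2 (volume : Measure E))
    (h0 : ∀ x ∉ O, f x = 0) {m : E → ℝ} (hm : Continuous m) :
    MemLp (fun x => m x • f x) 2 (volume : Measure E) := by
  obtain ⟨C, -, hC⟩ := hO.exists_bound_of_continuous hm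
  refine hf.of_le_mul (c := C) (hm.aestronglyMeasurable.smul hf.1)
    (Eventually.of_forall fun x => ?_)
  by_cases hx : x ∈ O
  · rw [norm_smul]; exact mul_le_mul_of_nonneg_right (hC x hx) (norm_nonneg _)
  · simp [h0 x hx]

theorem MeasureTheory.MemLp.smul_continuous {F : Type*} [NormedAddCommGroup F] [NormedSpace ℝ F]
    {O : Set E} (hO : Bornology.IsBounded O) {f : E → ℝ} (hf : MemLp f 2 (volume : Measure E))
    (h0 : ∀ x ∉ O, f x = 0) {m : E → F} (hm : Continuous m) :
    MemLp (fun x => f x • m x) 2 (volume : Measure E) := by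
  obtain ⟨C, -, hC⟩ := hO.exists_bound_of_continuous hm
  refine hf.of_le_mul (c := C) (hf.1.smul hm.aestronglyMeasurable)
    (Eventually.of_forall fun x => ?_)
  by_cases hx : x ∈ O
  · rw [norm_smul, mul_comm]; exact mul_le_mul_of_nonneg_right (hC x hx) (norm_nonneg _)
  · simp [h0 x hx]

theorem MeasureTheory.MemLp.inner_continuous {O : Set E} (hO : Bornology.IsBounded O) {f : E → E}
    (hf : MemLp f 2 (volume : Measure E)) (h0 : ∀ x ∉ O, f x = 0) {m : E → E}
    (hm : Continuous m) :
    MemLp (fun x => inner ℝ (m x) (f x)) 2 (volume : Measure E) := by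
  obtain ⟨C, -, hC⟩ := hO.exists_bound_of_continuous hm
  refine hf.of_le_mul (c := C) (hm.aestronglyMeasurable.inner hf.1)
    (Eventually.of_forall fun x => ?_)
  by_cases hx : x ∈ O
  · exact (norm_inner_le_norm _ _).trans (mul_le_mul_of_nonneg_right (hC x hx) (norm_nonneg _))
  · simp [h0 x hx]

/-- `f` belongs to `H¹₀(O)` with gradient `g`: both are `L²`-limits of test functions on `O` and of
their gradients, and both vanish outside of `O`. -/
structure IsH01 (O : Set E) (f : E → ℝ) (g : E → E) : Prop where
  memLp : MemLp f 2 (volume : Measure E)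
  memLp_grad : MemLp g 2 (volume : Measure E)
  zero : ∀ x ∉ O, f x = 0
  zero_grad : ∀ x ∉ O, g x = 0
  approx : ∃ η : ℕ → E → ℝ, (∀ j, IsTest O (η j)) ∧ TendstoL2 volume η f ∧
    TendstoL2 volume (fun j => ∇ (η j)) g

theorem IsTest.isH01 {O : Set E} {η : E → ℝ} (h : IsTest O η) : IsH01 O η (∇ η) where
  memLp := h.memLp
  memLp_grad := h.memLp_gradient
  zero := fun _ hx => h.eq_zero hx
  zero_grad := fun _ hx => h.gradient_eq_zero hx
  approx := ⟨fun _ => η, fun _ => h, TendstoL2.const _, TendstoL2.const _⟩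

namespace IsH01

variable {O : Set E} {f f' : E → ℝ} {g g' : E → E}

theorem add (h : IsH01 O f g) (h' : IsH01 O f' g') :
    IsH01 O (fun x => f x + f' x) (fun x => g x + g' x) where
  memLp := h.memLp.add h'.memLp
  memLp_grad := h.memLp_grad.add h'.memLp_grad
  zero := fun x hx => by simp [h.zero x hx, h'.zero x hx]
  zero_grad := fun x hx => by simp [h.zero_grad x hx, h'.zero_grad x hx]
  approx := by
    obtain ⟨η, h1, h2, h3⟩ := h.approx
    obtain ⟨ζ, k1, k2, k3⟩ := h'.approx
    refine ⟨fun j x => η j x + ζ j x, fun j => (h1 j).add (k1 j),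
      h2.add (fun j => (h1 j).memLp) h.memLp (fun j => (k1 j).memLp) h'.memLp k2, ?_⟩
    have := h3.add (fun j => (h1 j).memLp_gradient) h.memLp_grad (fun j => (k1 j).memLp_gradient)
      h'.memLp_grad k3
    convert this using 3 with j x
    exact gradient_fun_add ((h1 j).differentiableAt x) ((k1 j).differentiableAt x)

theorem smooth_mul (h : IsH01 O f g) (hO : Bornology.IsBounded O) {O' : Set E} {m : E → ℝ}
    (hm : ContDiff ℝ ∞ m) (hO' : tsupport m ∩ O ⊆ O') :
    IsH01 O' (fun x => m x * f x) (fun x => m x • g x + f x • ∇ m x) where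
  memLp := by simpa using h.memLp.continuous_smul hO h.zero hm.continuous
  memLp_grad := (h.memLp_grad.continuous_smul hO h.zero_grad hm.continuous).add
    (h.memLp.smul_continuous hO h.zero hm.continuous_gradient)
  zero := fun x hx => by
    by_cases hxO : x ∈ O
    · rw [image_eq_zero_of_notMem_tsupport fun hc => hx (hO' ⟨hc, hxO⟩), zero_mul]
    · rw [h.zero x hxO, mul_zero]
  zero_grad := fun x hx => by
    by_cases hxO : x ∈ O
    · have hc : x ∉ tsupport m := fun hc => hx (hO' ⟨hc, hxO⟩)
      rw [image_eq_zero_of_notMem_tsupport hc, gradient_eq_zero_of_notMem_tsupport hc]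
      simp
    · simp [h.zero x hxO, h.zero_grad x hxO]
  approx := by
    obtain ⟨η, h1, h2, h3⟩ := h.approx
    obtain ⟨C, hC0, hC⟩ := hO.exists_bound_of_continuous hm.continuous
    obtain ⟨D, hD0, hD⟩ := hO.exists_bound_of_continuous hm.continuous_gradient
    refine ⟨fun j x => m x * η j x, fun j => (h1 j).smooth_mul hm hO', ?_, ?_⟩
    · refine h2.of_le (fun j => (h1 j).memLp) h.memLp C fun j x => ?_
      by_cases hx : x ∈ O
      · rw [← mul_sub, norm_mul]
        exact mul_le_mul_of_nonneg_right (hC x hx) (norm_nonneg _)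
      · simp [h.zero x hx, (h1 j).eq_zero hx]
    · have e : (fun j => ∇ fun x => m x * η j x) =
          fun j x => m x • ∇ (η j) x + η j x • ∇ m x := by
        funext j x
        exact gradient_fun_mul (hm.differentiable (by simp) x) ((h1 j).differentiableAt x)
      rw [e]
      refine TendstoL2.add (fun j => ?_) ?_ ?_ (fun j => ?_) ?_ ?_
      · exact (h1 j).memLp_gradient.continuous_smul hO (fun x => (h1 j).gradient_eq_zero)
          hm.continuous
      · exact h.memLp_grad.continuous_smul hO h.zero_grad hm.continuous
      · refine h3.of_le (fun j => (h1 j).memLp_gradient) h.memLp_grad C fun j x => ?_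
        by_cases hx : x ∈ O
        · rw [← smul_sub, norm_smul]
          exact mul_le_mul_of_nonneg_right (hC x hx) (norm_nonneg _)
        · simp [h.zero_grad x hx, (h1 j).gradient_eq_zero hx]
      · exact (h1 j).memLp.smul_continuous hO (fun x => (h1 j).eq_zero) hm.continuous_gradient
      · exact h.memLp.smul_continuous hO h.zero hm.continuous_gradient
      · refine h2.of_le (fun j => (h1 j).memLp) h.memLp D fun j x => ?_
        by_cases hx : x ∈ O
        · rw [← sub_smul, norm_smul, mul_comm]
          exact mul_le_mul_of_nonneg_right (hD x hx) (norm_nonneg _)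
        · simp [h.zero x hx, (h1 j).eq_zero hx]

theorem const_mul (h : IsH01 O f g) (c : ℝ) :
    IsH01 O (fun x => c * f x) (fun x => c • g x) where
  memLp := h.memLp.const_mul c
  memLp_grad := h.memLp_grad.const_smul c
  zero := fun x hx => by simp [h.zero x hx]
  zero_grad := fun x hx => by simp [h.zero_grad x hx]
  approx := by
    obtain ⟨η, h1, h2, h3⟩ := h.approx
    refine ⟨fun j x => c * η j x, fun j => (h1 j).const_mul c, ?_, ?_⟩
    · refine h2.of_le (fun j => (h1 j).memLp) h.memLp |c| fun j x => ?_
      rw [← mul_sub, norm_mul, norm_eq_abs]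
    · refine h3.of_le (fun j => (h1 j).memLp_gradient) h.memLp_grad |c| fun j x => ?_
      rw [gradient_const_mul c ((h1 j).differentiableAt x), ← smul_sub, norm_smul,
        norm_eq_abs]

theorem of_zero : IsH01 O (fun _ => 0) (fun _ => 0) where
  memLp := by simp
  memLp_grad := by simp
  zero := fun _ _ => rfl
  zero_grad := fun _ _ => rfl
  approx := ⟨fun _ _ => 0, fun _ => ⟨contDiff_const, HasCompactSupport.zero, by simp [tsupport]⟩,
    TendstoL2.const _, by simpa [gradient] using TendstoL2.const (fun _ : E => (0:E))⟩

theorem sum {ι : Type*} (s : Finset ι) {f : ι → E → ℝ} {g : ι → E → E}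
    (h : ∀ i ∈ s, IsH01 O (f i) (g i)) :
    IsH01 O (fun x => ∑ i ∈ s, f i x) (fun x => ∑ i ∈ s, g i x) := by
  classical
  induction s using Finset.induction_on with
  | empty => simpa using of_zero
  | insert a s ha ih =>
    simp only [Finset.sum_insert ha]
    exact (h a (by simp)).add (ih fun i hi => h i (by simp [hi]))

/-- A weak identity against test functions extends to `H¹₀`. -/
theorem ext_weak (h : IsH01 O f g) {P : E → E} {p : E → ℝ}
    (hP : MemLp P 2 (volume : Measure E)) (hp : MemLp p 2 (volume : Measure E))
    (hw : ∀ η, IsTest O η → (∫ x, inner ℝ (P x) (∇ η x)) + ∫ x, p x * η x = 0) :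
    (∫ x, inner ℝ (P x) (g x)) + ∫ x, p x * f x = 0 := by
  obtain ⟨η, h1, h2, h3⟩ := h.approx
  have l1 := TendstoL2.integral_inner (fun _ => hP) hP (TendstoL2.const P)
    (fun j => (h1 j).memLp_gradient) h.memLp_grad h3
  have l2 := h2.integral_mul (fun j => (h1 j).memLp) h.memLp hp
  have l3 := l1.add l2
  simp only [hw _ (h1 _)] at l3
  exact (tendsto_nhds_unique l3 tendsto_const_nhds)

end IsH01

end H01

section Virial

variable {E : Type*} [NormedAddCommGroup E] [InnerProductSpace ℝ E] [FiniteDimensional ℝ E]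
  [MeasurableSpace E] [BorelSpace E]

theorem IsTest.integral_fderiv_eq_zero {O : Set E} {w : E → ℝ} (h : IsTest O w) (v : E) :
    ∫ x, fderiv ℝ w x v = 0 := by
  have hc : Continuous (fun x => fderiv ℝ w x v) :=
    (h.smooth.continuous_fderiv (by simp)).clm_apply continuous_const
  have hs : HasCompactSupport (fun x => fderiv ℝ w x v) := h.compact.fderiv_apply ℝ v
  have := integral_mul_fderiv_eq_neg_fderiv_mul_of_integrable (μ := (volume : Measure E))
    (f := fun _ => (1 : ℝ)) (g := w) (v := v) (by simp)
    (by simpa using hc.integrable_of_hasCompactSupport hs)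
    (by simpa using h.smooth.continuous.integrable_of_hasCompactSupport h.compact)
    (fun x _ => differentiableAt_const _) (fun x _ => h.differentiableAt x)
  simpa using this

theorem IsTest.integral_inner_gradient {O : Set E} {w : E → ℝ} (h : IsTest O w) (x₀ : E) :
    ∫ x, (inner ℝ (x - x₀) (∇ w x) + Module.finrank ℝ E * w x) = 0 := by
  let b := stdOrthonormalBasis ℝ E
  have hl : ∀ i, ContDiff ℝ ∞ (fun x : E => inner ℝ (x - x₀) (b i)) := fun i =>
    (contDiff_id.sub contDiff_const).inner ℝ contDiff_const
  have hW : ∀ i, IsTest O (fun x => inner ℝ (x - x₀) (b i) * w x) := fun i =>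
    h.smooth_mul (hl i) inter_subset_right
  have hd : ∀ i x, fderiv ℝ (fun x => inner ℝ (x - x₀) (b i) * w x) x (b i) =
      inner ℝ (x - x₀) (b i) * inner ℝ (b i) (∇ w x) + w x := by
    intro i x
    rw [fderiv_fun_mul ((hl i).differentiable (by simp) x) (h.differentiableAt x),
      real_inner_comm (∇ w x), inner_gradient_eq]
    have h2 : HasFDerivAt (fun x : E => inner ℝ (x - x₀) (b i)) (innerSL ℝ (b i)) x := by
      have := (innerSL ℝ (b i)).hasFDerivAt.comp x ((hasFDerivAt_id x).sub_const x₀)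
      refine this.congr_of_eventuallyEq (Eventually.of_forall fun z => ?_)
      simp [real_inner_comm]
    rw [h2.fderiv]
    simp
  have hi : ∀ i, Integrable (fun x => inner ℝ (x - x₀) (b i) * inner ℝ (b i) (∇ w x) + w x)
      (volume : Measure E) := fun i => by
    simp_rw [← hd]
    exact (((hW i).smooth.continuous_fderiv (by simp)).clm_apply
      continuous_const).integrable_of_hasCompactSupport ((hW i).compact.fderiv_apply ℝ _)
  have hs : ∀ x, inner ℝ (x - x₀) (∇ w x) + Module.finrank ℝ E * w x =
      ∑ i, (inner ℝ (x - x₀) (b i) * inner ℝ (b i) (∇ w x) + w x) := by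
    intro x
    rw [Finset.sum_add_distrib, b.sum_inner_mul_inner]
    simp
  simp_rw [hs]
  rw [integral_finsetSum _ fun i _ => hi i]
  refine Finset.sum_eq_zero fun i _ => ?_
  simp_rw [← hd]
  exact (hW i).integral_fderiv_eq_zero _

variable {O : Set E} {f f' : E → ℝ} {g g' : E → E} {k : E → ℝ}

theorem IsTest.virial {η ζ : E → ℝ} (h : IsTest O η) (h' : IsTest O ζ)
    (hk : ContDiff ℝ ∞ k) (x₀ : E) :
    ∫ x, (k x * η x * inner ℝ (x - x₀) (∇ ζ x) + (k x * inner ℝ (x - x₀) (∇ η x)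
      + (Module.finrank ℝ E * k x + inner ℝ (∇ k x) (x - x₀)) * η x) * ζ x) = 0 := by
  have hw := h'.smooth_mul (O' := O) (h.smooth_mul (O' := O) hk inter_subset_right).smooth
    inter_subset_right
  rw [← hw.integral_inner_gradient x₀]
  congr 1
  funext x
  have dk := hk.differentiable (by simp) x
  rw [gradient_fun_mul (f := fun x => k x * η x) (dk.mul (h.differentiableAt x))
    (h'.differentiableAt x),
    gradient_fun_mul dk (h.differentiableAt x)]
  simp only [inner_add_right, inner_smul_right, real_inner_comm (x - x₀)]
  ring

/-- The field `k f (x - x₀)` has divergence `k ⟪x - x₀, g⟫ + (d k + ⟪∇ k, x - x₀⟫) f`. -/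
theorem IsH01.virial (hO : Bornology.IsBounded O) (h : IsH01 O f g) (h' : IsH01 O f' g')
    (hk : ContDiff ℝ ∞ k) (x₀ : E) :
    (∫ x, inner ℝ (f x • (k x • (x - x₀))) (g' x)) + (∫ x, (k x * inner ℝ (x - x₀) (g x)
      + (Module.finrank ℝ E * k x + inner ℝ (∇ k x) (x - x₀)) * f x) * f' x) = 0 := by
  have cy : Continuous (fun x : E => x - x₀) := continuous_id.sub continuous_const
  have ckc : Continuous (fun x => Module.finrank ℝ E * k x + inner ℝ (∇ k x) (x - x₀)) :=
    (continuous_const.mul hk.continuous).add (hk.continuous_gradient.inner cy)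
  have hP : ∀ {f g}, IsH01 O f g →
      MemLp (fun x => f x • (k x • (x - x₀))) 2 (volume : Measure E) := fun h =>
    h.memLp.smul_continuous hO h.zero (hk.continuous.smul cy)
  have hp : ∀ {f g}, IsH01 O f g → MemLp (fun x => k x * inner ℝ (x - x₀) (g x)
      + (Module.finrank ℝ E * k x + inner ℝ (∇ k x) (x - x₀)) * f x) 2 (volume : Measure E) := by
    intro f g h
    refine MemLp.add ?_ (by simpa using h.memLp.continuous_smul hO h.zero ckc)
    refine MemLp.continuous_smul hO (h.memLp_grad.inner_continuous hO h.zero_grad cy)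
      (fun x hx => ?_) hk.continuous
    simp [h.zero_grad x hx]
  refine h'.ext_weak (hP h) (hp h) fun ζ hζ => ?_
  have h1 := h.ext_weak (hP hζ.isH01) (hp hζ.isH01) fun η hη => ?_
  · rw [← integral_add ((hP hζ.isH01).inner_integrable h.memLp_grad)
      ((hp hζ.isH01).mul_integrable h.memLp)] at h1
    rw [← integral_add ((hP h).inner_integrable hζ.memLp_gradient)
      ((hp h).mul_integrable hζ.memLp), ← h1]
    congr 1
    funext x
    simp only [inner_smul_left, RCLike.conj_to_real]
    ring
  · rw [← integral_add ((hP hζ.isH01).inner_integrable hη.memLp_gradient)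
      ((hp hζ.isH01).mul_integrable hη.memLp), ← hη.virial hζ hk x₀]
    congr 1
    funext x
    simp only [inner_smul_left, RCLike.conj_to_real]
    ring

end Virial

section Laplacian

variable {E : Type*} [NormedAddCommGroup E] [InnerProductSpace ℝ E] [FiniteDimensional ℝ E]
  [MeasurableSpace E] [BorelSpace E]

variable {f f' : E → ℝ} {g g' : E → E} {O : Set E}

/-- A Hermite-type inequality (uncertainty principle) in `H¹₀`. -/
theorem IsH01.hermite (hO : Bornology.IsBounded O) (h : IsH01 O f g) (x₀ : E) (μ : ℝ) :
    μ * Module.finrank ℝ E * ∫ x, f x ^ 2 ≤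
      (∫ x, ‖g x‖ ^ 2) + μ ^ 2 * ∫ x, ‖x - x₀‖ ^ 2 * f x ^ 2 := by
  have hv := h.virial hO h (k := fun _ => 1) contDiff_const x₀
  have cy : Continuous (fun x : E => x - x₀) := continuous_id.sub continuous_const
  have m1 : MemLp (fun x => f x • (x - x₀)) 2 (volume : Measure E) :=
    h.memLp.smul_continuous hO h.zero cy
  have m2 := h.memLp_grad.inner_continuous hO h.zero_grad cy
  have i1 := m1.inner_integrable h.memLp_grad
  have i2 := h.memLp.mul_integrable h.memLp
  have i3 : Integrable (fun x => ‖x - x₀‖ ^ 2 * f x ^ 2) (volume : Measure E) := by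
    have := m1.normSq_integrable
    simp only [norm_smul, mul_pow] at this
    simpa [mul_comm] using this
  have i4 := h.memLp_grad.normSq_integrable
  have i5 := m2.mul_integrable h.memLp
  have e : (∫ x, inner ℝ (f x • (x - x₀)) (g x)) =
      ∫ x, inner ℝ (x - x₀) (g x) * f x := by
    congr 1; funext x; simp [inner_smul_left]; ring
  have hg0 : ∇ (fun _ : E => (1 : ℝ)) = fun _ => 0 := by funext x; simp [gradient]
  simp only [one_smul, one_mul, mul_one, hg0, inner_zero_left, add_zero, add_mul, mul_assoc] at hv
  rw [integral_add i5 (i2.const_mul _), integral_const_mul, e] at hv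
  have key : 0 ≤ ∫ x, (‖g x‖ ^ 2 + μ ^ 2 * (‖x - x₀‖ ^ 2 * f x ^ 2)
      + 2 * μ * (inner ℝ (x - x₀) (g x) * f x)) := by
    refine integral_nonneg fun x => ?_
    have : 0 ≤ ‖g x + (μ * f x) • (x - x₀)‖ ^ 2 := by positivity
    rw [norm_add_sq_real, norm_smul, inner_smul_right, mul_pow, norm_eq_abs, sq_abs,
      real_inner_comm] at this
    simp only [Pi.zero_apply]
    linarith
  rw [integral_add (i4.fun_add (i3.const_mul _)) (i5.const_mul _), integral_add i4 (i3.const_mul _),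
    integral_const_mul, integral_const_mul] at key
  simp only [pow_two (f _)] at *
  linear_combination key + μ * hv

theorem IsH01.poincare {x₀ : E} {R : ℝ} (hR : 0 < R) (hO : O ⊆ ball x₀ R) (h : IsH01 O f g) :
    (Module.finrank ℝ E) ^ 2 / (4 * R ^ 2) * ∫ x, f x ^ 2 ≤ ∫ x, ‖g x‖ ^ 2 := by
  have hb : Bornology.IsBounded O := isBounded_ball.subset hO
  have h1 := h.hermite hb x₀ (Module.finrank ℝ E / (2 * R ^ 2))
  have h2 : ∫ x, ‖x - x₀‖ ^ 2 * f x ^ 2 ≤ R ^ 2 * ∫ x, f x ^ 2 := by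
    rw [← integral_const_mul]
    refine integral_mono_of_nonneg (Eventually.of_forall fun x => by positivity)
      (h.memLp.integrable_sq.const_mul _) (Eventually.of_forall fun x => ?_)
    by_cases hx : x ∈ O
    · have := mem_ball_iff_norm.1 (hO hx)
      dsimp only
      gcongr
    · simp [h.zero x hx]
  have h3 := mul_le_mul_of_nonneg_left h2 (sq_nonneg (Module.finrank ℝ E / (2 * R ^ 2) : ℝ))
  have e : (Module.finrank ℝ E / (2 * R ^ 2) : ℝ) * Module.finrank ℝ E
      - (Module.finrank ℝ E / (2 * R ^ 2) : ℝ) ^ 2 * R ^ 2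
      = (Module.finrank ℝ E) ^ 2 / (4 * R ^ 2) := by
    field_simp
    ring
  rw [← e]
  linarith

/-- `f ∈ H¹₀(O)` has gradient `g` and (weak) Laplacian `L ∈ L²(O)`. -/
structure HasLap (O : Set E) (f : E → ℝ) (g : E → E) (L : E → ℝ) : Prop where
  isH01 : IsH01 O f g
  memLp : MemLp L 2 (volume : Measure E)
  zero : ∀ x ∉ O, L x = 0
  weak : ∀ η, IsTest O η → (∫ x, inner ℝ (g x) (∇ η x)) + ∫ x, L x * η x = 0

namespace HasLap

variable {L L' : E → ℝ}

theorem weak_ext (h : HasLap O f g L) (h' : IsH01 O f' g') :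
    (∫ x, inner ℝ (g x) (g' x)) + ∫ x, L x * f' x = 0 :=
  h'.ext_weak h.isH01.memLp_grad h.memLp h.weak

theorem add (h : HasLap O f g L) (h' : HasLap O f' g' L') :
    HasLap O (fun x => f x + f' x) (fun x => g x + g' x) (fun x => L x + L' x) where
  isH01 := h.isH01.add h'.isH01
  memLp := h.memLp.add h'.memLp
  zero := fun x hx => by simp [h.zero x hx, h'.zero x hx]
  weak := fun η hη => by
    simp only [inner_add_left, add_mul]
    rw [integral_add (h.isH01.memLp_grad.inner_integrable hη.memLp_gradient)
      (h'.isH01.memLp_grad.inner_integrable hη.memLp_gradient),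
      integral_add (h.memLp.mul_integrable hη.memLp) (h'.memLp.mul_integrable hη.memLp)]
    linarith [h.weak η hη, h'.weak η hη]

theorem const_mul (h : HasLap O f g L) (c : ℝ) :
    HasLap O (fun x => c * f x) (fun x => c • g x) (fun x => c * L x) where
  isH01 := h.isH01.const_mul c
  memLp := h.memLp.const_mul c
  zero := fun x hx => by simp [h.zero x hx]
  weak := fun η hη => by
    simp only [inner_smul_left, mul_assoc, RCLike.conj_to_real]
    rw [integral_const_mul, integral_const_mul]
    linear_combination c * h.weak η hη

theorem of_zero : HasLap O (fun _ => 0) (fun _ => 0) (fun _ => 0) where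
  isH01 := IsH01.of_zero
  memLp := by simp
  zero := fun _ _ => rfl
  weak := fun η hη => by simp

theorem sum {ι : Type*} (s : Finset ι) {f : ι → E → ℝ} {g : ι → E → E} {L : ι → E → ℝ}
    (h : ∀ i ∈ s, HasLap O (f i) (g i) (L i)) :
    HasLap O (fun x => ∑ i ∈ s, f i x) (fun x => ∑ i ∈ s, g i x) (fun x => ∑ i ∈ s, L i x) := by
  classical
  induction s using Finset.induction_on with
  | empty => simpa using of_zero
  | insert a s ha ih =>
    simp only [Finset.sum_insert ha]
    exact (h a (by simp)).add (ih fun i hi => h i (by simp [hi]))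

/-- Multiplication by a smooth function `m` with radial gradient `k • (x - x₀)`. -/
theorem radial_mul (h : HasLap O f g L) (hO : Bornology.IsBounded O) {O' : Set E} (hOO : O' ⊆ O)
    {m k : E → ℝ} (hm : ContDiff ℝ ∞ m) (hk : ContDiff ℝ ∞ k) {x₀ : E}
    (hmk : ∀ x, ∇ m x = k x • (x - x₀)) (hO' : tsupport m ∩ O ⊆ O') :
    HasLap O' (fun x => m x * f x) (fun x => m x • g x + f x • (k x • (x - x₀)))
      (fun x => m x * L x + (2 * (k x * inner ℝ (x - x₀) (g x)) +
        (Module.finrank ℝ E * k x + inner ℝ (∇ k x) (x - x₀)) * f x)) := by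
  have H := h.isH01.smooth_mul hO hm hO'
  simp only [hmk] at H
  have cy : Continuous (fun x : E => x - x₀) := continuous_id.sub continuous_const
  have ckc : Continuous (fun x => Module.finrank ℝ E * k x + inner ℝ (∇ k x) (x - x₀)) :=
    (continuous_const.mul hk.continuous).add (hk.continuous_gradient.inner cy)
  have m1 : MemLp (fun x => m x * L x) 2 (volume : Measure E) := by
    simpa using h.memLp.continuous_smul hO h.zero hm.continuous
  have m2 : MemLp (fun x => k x * inner ℝ (x - x₀) (g x)) 2 (volume : Measure E) :=
    (h.isH01.memLp_grad.inner_continuous hO h.isH01.zero_grad cy).continuous_smul hO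
      (fun x hx => by simp [h.isH01.zero_grad x hx]) hk.continuous
  have m3 : MemLp (fun x => (Module.finrank ℝ E * k x + inner ℝ (∇ k x) (x - x₀)) * f x) 2
      (volume : Measure E) := by
    simpa using h.isH01.memLp.continuous_smul hO h.isH01.zero ckc
  have m4 : MemLp (fun x => f x • (k x • (x - x₀))) 2 (volume : Measure E) :=
    h.isH01.memLp.smul_continuous hO h.isH01.zero (hk.continuous.smul cy)
  have m5 : MemLp (fun x => m x • g x) 2 (volume : Measure E) :=
    h.isH01.memLp_grad.continuous_smul hO h.isH01.zero_grad hm.continuous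
  refine ⟨H, m1.add ((m2.const_mul 2).add m3), fun x hx => ?_, fun η hη => ?_⟩
  · by_cases hxO : x ∈ O
    · have hc : x ∉ tsupport m := fun hc => hx (hO' ⟨hc, hxO⟩)
      have hm0 : m =ᶠ[nhds x] fun _ => 0 := by
        rwa [notMem_tsupport_iff_eventuallyEq] at hc
      have hk0 : ∀ᶠ z in nhds x, k z • (z - x₀) = 0 := by
        filter_upwards [hm0.eventuallyEq_nhds] with z hz
        rw [← hmk, gradient, hz.fderiv_eq]
        simp
      have hkz : ∀ᶠ z in nhds x, k z = 0 ∨ z = x₀ := by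
        filter_upwards [hk0] with z hz
        rcases smul_eq_zero.1 hz with h | h
        · exact Or.inl h
        · exact Or.inr (sub_eq_zero.1 h)
      have hx1 : m x = 0 := hm0.self_of_nhds
      by_cases hxx : x = x₀
      · subst hxx
        have hfin : (k x) * Module.finrank ℝ E * f x = 0 := by
          by_cases hd : Module.finrank ℝ E = 0
          · simp [hd]
          · have : k x = 0 := by
              have : Nontrivial E := Module.nontrivial_of_finrank_pos (Nat.pos_of_ne_zero hd)
              have hne : (nhdsWithin x {x}ᶜ).NeBot := Module.punctured_nhds_neBot ℝ E x
              have t1 : Tendsto k (nhdsWithin x {x}ᶜ) (nhds (k x)) :=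
                hk.continuous.continuousAt.tendsto.mono_left nhdsWithin_le_nhds
              refine tendsto_nhds_unique t1 (tendsto_const_nhds.congr' ?_)
              filter_upwards [nhdsWithin_le_nhds hkz, self_mem_nhdsWithin] with z hz hz'
              exact (hz.resolve_right hz').symm
            simp [this]
        simp [hx1]
        rcases mul_eq_zero.1 hfin with h1 | h1
        · rcases mul_eq_zero.1 h1 with h2 | h2
          · exact Or.inl (Or.inr h2)
          · exact Or.inl (Or.inl (by exact_mod_cast h2))
        · exact Or.inr h1
      · have hkx : k =ᶠ[nhds x] fun _ => 0 := by
          filter_upwards [hkz, isOpen_ne.mem_nhds hxx] with z hz hz'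
          exact hz.resolve_right hz'
        have : ∇ k x = 0 := by rw [gradient, hkx.fderiv_eq]; simp
        simp [hx1, this, hkx.self_of_nhds]
    · simp [h.zero x hxO, h.isH01.zero_grad x hxO, h.isH01.zero x hxO]
  · have hη' := hη.mono hOO
    have w1 := h.weak _ (hη'.smooth_mul (O' := O) hm inter_subset_right)
    have w2 := h.isH01.virial hO hη'.isH01 hk x₀
    have m6 := hη'.memLp_gradient.continuous_smul hO (fun x => hη'.gradient_eq_zero) hm.continuous
    have m7 : MemLp (fun x => η x • (k x • (x - x₀))) 2 (volume : Measure E) :=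
      hη'.memLp.smul_continuous hO (fun x => hη'.eq_zero) (hk.continuous.smul cy)
    have e1 : ∀ x, ∇ (fun x => m x * η x) x = m x • ∇ η x + η x • (k x • (x - x₀)) := fun x => by
      rw [gradient_fun_mul (hm.differentiable (by simp) x) (hη.differentiableAt x), hmk]
    have e2 : ∀ x, L x * (m x * η x) = m x * L x * η x := fun x => by ring
    have e3 : (∫ x, inner ℝ (g x) (η x • (k x • (x - x₀)))) =
        ∫ x, k x * inner ℝ (x - x₀) (g x) * η x := by
      congr 1; funext x
      simp only [inner_smul_right, real_inner_comm (x - x₀)]; ring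
    have e4 : (∫ x, inner ℝ (m x • g x) (∇ η x)) = ∫ x, inner ℝ (g x) (m x • ∇ η x) := by
      congr 1; funext x
      simp only [inner_smul_right, inner_smul_left, RCLike.conj_to_real]
    simp only [e1, inner_add_right, e2] at w1
    rw [integral_add (h.isH01.memLp_grad.inner_integrable m6)
      (h.isH01.memLp_grad.inner_integrable m7), e3] at w1
    simp only [add_mul (k _ * _)] at w2
    rw [integral_add (m2.mul_integrable hη.memLp) (m3.mul_integrable hη.memLp)] at w2
    have e5 : ∀ x, (m x * L x + (2 * (k x * inner ℝ (x - x₀) (g x)) +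
        (Module.finrank ℝ E * k x + inner ℝ (∇ k x) (x - x₀)) * f x)) * η x =
        m x * L x * η x + (2 * (k x * inner ℝ (x - x₀) (g x) * η x) +
        (Module.finrank ℝ E * k x + inner ℝ (∇ k x) (x - x₀)) * f x * η x) := fun x => by ring
    simp only [inner_add_left, e5]
    rw [integral_add (m5.inner_integrable hη.memLp_gradient)
      (m4.inner_integrable hη.memLp_gradient), e4,
      integral_add (m1.mul_integrable hη.memLp) (Integrable.fun_add
        ((m2.mul_integrable hη.memLp).const_mul 2) (m3.mul_integrable hη.memLp)),
      integral_add ((m2.mul_integrable hη.memLp).const_mul 2) (m3.mul_integrable hη.memLp),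
      integral_const_mul]
    linarith

end HasLap

end Laplacian

section Dilation

variable {E : Type*} [NormedAddCommGroup E] [InnerProductSpace ℝ E] [FiniteDimensional ℝ E]
  [MeasurableSpace E] [BorelSpace E]

/-- The dilation of ratio `l` centred at `x₀`. -/
def dil (x₀ : E) (l : ℝ) (x : E) : E := x₀ + l • (x - x₀)

theorem continuous_dil (x₀ : E) (l : ℝ) : Continuous (dil x₀ l) := by
  unfold dil; fun_prop

theorem dil_one (x₀ x : E) : dil x₀ 1 x = x := by simp [dil]

theorem integral_comp_dil (x₀ : E) {l : ℝ} (hl : 0 < l) (f : E → ℝ) :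
    ∫ x, f (dil x₀ l x) = (l ^ Module.finrank ℝ E)⁻¹ * ∫ x, f x := by
  have h1 := integral_sub_right_eq_self (μ := (volume : Measure E))
    (fun z => f (x₀ + l • z)) x₀
  have h2 := Measure.integral_comp_smul (μ := (volume : Measure E)) (fun z => f (x₀ + z)) l
  rw [integral_add_left_eq_self (fun z => f z) x₀] at h2
  unfold dil
  rw [h1, h2, abs_of_pos (by positivity), smul_eq_mul]

theorem map_dil (x₀ : E) {l : ℝ} (hl : 0 < l) :
    Measure.map (dil x₀ l) (volume : Measure E) =
      ENNReal.ofReal (abs (l ^ Module.finrank ℝ E)⁻¹) • volume := by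
  have e : dil x₀ l = (fun x => x₀ + x) ∘ (fun x => l • x) ∘ (fun x => x - x₀) := rfl
  rw [e, ← Measure.map_map (by fun_prop) (by fun_prop), ← Measure.map_map (by fun_prop)
    (by fun_prop), map_sub_right_eq_self, Measure.map_addHaar_smul _ hl.ne', Measure.map_smul,
    map_add_left_eq_self]

theorem MeasureTheory.MemLp.comp_dil {F : Type*} [NormedAddCommGroup F] {f : E → F}
    (hf : MemLp f 2 (volume : Measure E)) (x₀ : E) {l : ℝ} (hl : 0 < l) :
    MemLp (fun x => f (dil x₀ l x)) 2 (volume : Measure E) := by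
  refine MemLp.comp_of_map (f := dil x₀ l) ?_ (continuous_dil x₀ l).aemeasurable
  rw [map_dil x₀ hl]
  exact hf.smul_measure ENNReal.ofReal_ne_top

theorem gradient_comp_dil {η : E → ℝ} (hη : Differentiable ℝ η) (x₀ : E) (l : ℝ) (x : E) :
    ∇ (fun x => η (dil x₀ l x)) x = l • ∇ η (dil x₀ l x) := by
  apply HasGradientAt.gradient
  rw [hasGradientAt_iff_hasFDerivAt]
  have h1 : HasFDerivAt (dil x₀ l) (l • ContinuousLinearMap.id ℝ E) x :=
    (((hasFDerivAt_id x).sub_const x₀).const_smul l).const_add x₀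
  refine ((hη _).hasFDerivAt.comp x h1).congr_fderiv ?_
  ext v
  simp

theorem hasDerivAt_comp_dil {η : E → ℝ} (hη : Differentiable ℝ η) (x₀ x : E) (l : ℝ) :
    HasDerivAt (fun l => η (dil x₀ l x)) (inner ℝ (x - x₀) (∇ η (dil x₀ l x))) l := by
  have h1 : HasDerivAt (fun l : ℝ => dil x₀ l x) (x - x₀) l := by
    exact (((hasDerivAt_id l).smul_const (x - x₀)).const_add x₀).congr_deriv (one_smul _ _)
  have := (hη (dil x₀ l x)).hasFDerivAt.comp_hasDerivAt l h1
  rwa [← inner_gradient_eq, real_inner_comm] at this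

variable {O O' : Set E} {f : E → ℝ} {g : E → E}

theorem IsTest.comp_dil {η : E → ℝ} (h : IsTest O' η) (x₀ : E) {l : ℝ} (hl : 0 < l)
    (hO : ∀ x, dil x₀ l x ∈ O' → x ∈ O) : IsTest O (fun x => η (dil x₀ l x)) where
  smooth := h.smooth.comp (by unfold dil; fun_prop)
  compact := by
    refine HasCompactSupport.intro' (K := dil x₀ l⁻¹ '' tsupport η)
      (h.compact.isCompact.image (continuous_dil _ _))
      (h.compact.isCompact.image (continuous_dil _ _)).isClosed fun x hx => ?_
    refine image_eq_zero_of_notMem_tsupport fun hc => hx ⟨_, hc, ?_⟩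
    simp [dil, smul_smul, inv_mul_cancel₀ hl.ne']
  subset := fun x hx => hO x (h.subset (tsupport_comp_subset_preimage η (continuous_dil x₀ l) hx))

theorem TendstoL2.comp_dil {F : Type*} [NormedAddCommGroup F] [InnerProductSpace ℝ F]
    {f : ℕ → E → F} {g : E → F} (h : TendstoL2 volume f g) (x₀ : E) {l : ℝ} (hl : 0 < l) :
    TendstoL2 volume (fun j x => f j (dil x₀ l x)) (fun x => g (dil x₀ l x)) := by
  unfold TendstoL2 at *
  simp_rw [fun j => integral_comp_dil x₀ hl (fun x => ‖f j x - g x‖ ^ 2)]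
  simpa using h.const_mul ((l ^ Module.finrank ℝ E)⁻¹)

theorem IsH01.comp_dil (h : IsH01 O' f g) (x₀ : E) {l : ℝ} (hl : 0 < l)
    (hO : ∀ x, dil x₀ l x ∈ O' → x ∈ O) :
    IsH01 O (fun x => f (dil x₀ l x)) (fun x => l • g (dil x₀ l x)) where
  memLp := h.memLp.comp_dil x₀ hl
  memLp_grad := (h.memLp_grad.comp_dil x₀ hl).const_smul l
  zero := fun x hx => h.zero _ fun hc => hx (hO x hc)
  zero_grad := fun x hx => by rw [h.zero_grad _ fun hc => hx (hO x hc), smul_zero]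
  approx := by
    obtain ⟨η, h1, h2, h3⟩ := h.approx
    refine ⟨fun j x => η j (dil x₀ l x), fun j => (h1 j).comp_dil x₀ hl hO,
      h2.comp_dil x₀ hl, ?_⟩
    refine TendstoL2.of_le (fun j => (h1 j).memLp_gradient.comp_dil x₀ hl)
      (h.memLp_grad.comp_dil x₀ hl) (h3.comp_dil x₀ hl) l fun j x => ?_
    rw [gradient_comp_dil (h1 j).differentiableAt, ← smul_sub, norm_smul, norm_eq_abs,
      abs_of_pos hl]

/-- The derivative of `l ↦ ∫ p (η ∘ dil l)` for a test function `η`. -/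
theorem IsTest.hasDerivAt_integral_dil {η : E → ℝ} (h : IsTest O' η) (hO : Bornology.IsBounded O)
    {p : E → ℝ} (hp : MemLp p 2 (volume : Measure E)) (h0 : ∀ x ∉ O, p x = 0) (x₀ : E) {l : ℝ}
    (hl : 0 < l) :
    HasDerivAt (fun l => ∫ x, p x * η (dil x₀ l x))
      (∫ x, p x * inner ℝ (x - x₀) (∇ η (dil x₀ l x))) l := by
  have cy : Continuous (fun x : E => x - x₀) := continuous_id.sub continuous_const
  obtain ⟨C, hC0, hC⟩ := hO.exists_bound_of_continuous cy
  obtain ⟨D, hD⟩ := h.gradient_compact.exists_bound_of_continuous h.smooth.continuous_gradient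
  have hp1 : Integrable p volume := by
    have h2 : MemLp p 1 (volume.restrict O) :=
      haveI : IsFiniteMeasure (volume.restrict O) := ⟨by simpa using hO.measure_lt_top⟩
      (hp.restrict O).mono_exponent (by norm_num)
    have h3 : IntegrableOn p O := memLp_one_iff_integrable.1 h2
    exact h3.integrable_of_forall_notMem_eq_zero h0
  refine (hasDerivAt_integral_of_dominated_loc_of_deriv_le (s := univ)
    (bound := fun x => ‖p x‖ * (C * D)) (F := fun l x => p x * η (dil x₀ l x))
    (F' := fun l x => p x * inner ℝ (x - x₀) (∇ η (dil x₀ l x))) univ_mem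
    (Eventually.of_forall fun l => ?_) ?_ ?_ ?_ ?_ ?_).2
  · exact hp.1.mul (h.smooth.continuous.comp (continuous_dil x₀ l)).aestronglyMeasurable
  · exact hp.mul_integrable (h.memLp.comp_dil x₀ hl)
  · exact hp.1.mul (cy.inner
      (h.smooth.continuous_gradient.comp (continuous_dil x₀ l))).aestronglyMeasurable
  · refine Eventually.of_forall fun x l _ => ?_
    by_cases hx : x ∈ O
    · rw [norm_mul]
      refine mul_le_mul_of_nonneg_left ((norm_inner_le_norm _ _).trans ?_) (norm_nonneg _)
      exact mul_le_mul (hC x hx) (hD _) (norm_nonneg _) hC0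
    · simp [h0 x hx]
  · exact hp1.norm.mul_const _
  · exact Eventually.of_forall fun x l _ =>
      (hasDerivAt_comp_dil h.differentiableAt x₀ x l).const_mul _

/-- The derivative at `l = 1` of `l ↦ ∫ p (f ∘ dil l)` for `f ∈ H¹₀`. -/
theorem IsH01.hasDerivAt_integral_dil (h : IsH01 O' f g) (hO : Bornology.IsBounded O)
    {p : E → ℝ} (hp : MemLp p 2 (volume : Measure E)) (h0 : ∀ x ∉ O, p x = 0) (x₀ : E) :
    HasDerivAt (fun l => ∫ x, p x * f (dil x₀ l x)) (∫ x, p x * inner ℝ (x - x₀) (g x)) 1 := by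
  have cy : Continuous (fun x : E => x - x₀) := continuous_id.sub continuous_const
  obtain ⟨η, h1, h2, h3⟩ := h.approx
  have hpy : MemLp (fun x => p x • (x - x₀)) 2 (volume : Measure E) := hp.smul_continuous hO h0 cy
  have key := hasDerivAt_of_tendstoUniformlyOn (l := atTop) (s := Ioo (1/2 : ℝ) 2)
    (f := fun j l => ∫ x, p x * η j (dil x₀ l x))
    (f' := fun j l => ∫ x, p x * inner ℝ (x - x₀) (∇ (η j) (dil x₀ l x)))
    (g := fun l => ∫ x, p x * f (dil x₀ l x))
    (g' := fun l => ∫ x, p x * inner ℝ (x - x₀) (g (dil x₀ l x))) isOpen_Ioo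
    ?_ (Eventually.of_forall fun j l hl => (h1 j).hasDerivAt_integral_dil hO hp h0 x₀
      (by have := hl.1; linarith)) ?_ (x := 1) (by norm_num)
  · simpa [dil_one] using key
  · rw [Metric.tendstoUniformlyOn_iff]
    intro ε hε
    set P := ∫ x, ‖p x • (x - x₀)‖ ^ 2 with hP
    have hPn : 0 ≤ P := integral_nonneg fun x => by positivity
    set c : ℝ := ((1/2 : ℝ) ^ Module.finrank ℝ E)⁻¹ with hc
    have hc0 : 0 < c := by positivity
    have ht : Tendsto (fun j => P * (c * ∫ x, ‖∇ (η j) x - g x‖ ^ 2)) atTop (𝓝 0) := by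
      simpa using (Tendsto.const_mul c h3).const_mul P
    filter_upwards [ht.eventually_lt_const (show (0:ℝ) < ε ^ 2 by positivity)] with j hj l hl
    have hl0 : 0 < l := by have := hl.1; linarith
    have m1 := (h1 j).memLp_gradient.comp_dil x₀ hl0
    have m2 := h.memLp_grad.comp_dil x₀ hl0
    have e : (∫ x, p x * inner ℝ (x - x₀) (g (dil x₀ l x))) -
        (∫ x, p x * inner ℝ (x - x₀) (∇ (η j) (dil x₀ l x))) =
        - ∫ x, inner ℝ (p x • (x - x₀)) (∇ (η j) (dil x₀ l x) - g (dil x₀ l x)) := by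
      simp only [inner_sub_right]
      rw [integral_sub (hpy.inner_integrable m1) (hpy.inner_integrable m2)]
      simp only [inner_smul_left, RCLike.conj_to_real]
      ring
    rw [Real.dist_eq, e, abs_neg]
    refine abs_lt_of_sq_lt_sq ((sq_integral_inner_le hpy (m1.sub m2)).trans_lt
      (lt_of_le_of_lt ?_ hj)) hε.le
    refine mul_le_mul_of_nonneg_left ?_ hPn
    refine (integral_comp_dil x₀ hl0 (fun x => ‖∇ (η j) x - g x‖ ^ 2)).trans_le ?_
    refine mul_le_mul_of_nonneg_right ?_ (integral_nonneg fun x => by positivity)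
    exact inv_anti₀ (by positivity) (pow_le_pow_left₀ (by norm_num) hl.1.le _)
  · intro l hl
    have hl0 : 0 < l := by have := hl.1; linarith
    exact (h2.comp_dil x₀ hl0).integral_mul (fun j => (h1 j).memLp.comp_dil x₀ hl0)
      (h.memLp.comp_dil x₀ hl0) hp

end Dilation

section Rellich

variable {E : Type*} [NormedAddCommGroup E] [InnerProductSpace ℝ E] [FiniteDimensional ℝ E]
  [MeasurableSpace E] [BorelSpace E] {O : Set E} {v : E → ℝ} {G : E → E} {g : E → ℝ}

theorem HasLap.dil_le (h : HasLap O v G g) {x₀ : E} {l : ℝ} (hl : 0 < l)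
    (H : IsH01 O (fun x => v (dil x₀ l x)) (fun x => l • G (dil x₀ l x))) :
    (1 - l / 2 * (1 + (l ^ Module.finrank ℝ E)⁻¹)) * (∫ x, ‖G x‖ ^ 2) ≤
      (∫ x, g x * v (dil x₀ l x)) - ∫ x, g x * v (dil x₀ 1 x) := by
  have h1 := h.weak_ext H
  have h2 := h.weak_ext h.isH01
  have h3 : (∫ x, inner ℝ (G x) (G x)) = ∫ x, ‖G x‖ ^ 2 := by simp
  have m := h.isH01.memLp_grad
  have m' := m.comp_dil x₀ hl
  have h4 : (∫ x, inner ℝ (G x) (l • G (dil x₀ l x))) ≤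
      ∫ x, (l / 2 * ‖G x‖ ^ 2 + l / 2 * ‖G (dil x₀ l x)‖ ^ 2) := by
    refine integral_mono (m.inner_integrable (m'.const_smul l))
      ((m.normSq_integrable.const_mul _).fun_add (m'.normSq_integrable.const_mul _)) fun x => ?_
    have := norm_sub_sq_real (G x) (G (dil x₀ l x))
    simp only [inner_smul_right]
    nlinarith [sq_nonneg ‖G x - G (dil x₀ l x)‖]
  rw [integral_add (m.normSq_integrable.const_mul _) (m'.normSq_integrable.const_mul _),
    integral_const_mul, integral_const_mul, integral_comp_dil x₀ hl (fun x => ‖G x‖ ^ 2)] at h4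
  simp only [dil_one]
  rw [h3] at h2
  linarith

theorem hasDerivAt_dil_aux (d : ℕ) :
    HasDerivAt (fun l : ℝ => 1 - l / 2 * (1 + (l ^ d)⁻¹)) ((d : ℝ) / 2 - 1) 1 := by
  have h1 : HasDerivAt (fun l : ℝ => l ^ d) (d : ℝ) 1 := by simpa using hasDerivAt_pow d (1 : ℝ)
  have h2 := ((hasDerivAt_id (1 : ℝ)).div_const 2).mul ((h1.inv (by simp)).const_add 1)
  refine (h2.const_sub 1).congr_deriv ?_
  simp
  ring

variable {x₀ : E}

theorem HasLap.hasDerivAt_dil (h : HasLap O v G g) (hO : Bornology.IsBounded O) :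
    HasDerivAt (fun l => (∫ x, g x * v (dil x₀ l x)) - (∫ x, g x * v (dil x₀ 1 x))
      - (1 - l / 2 * (1 + (l ^ Module.finrank ℝ E)⁻¹)) * (∫ x, ‖G x‖ ^ 2))
      ((∫ x, g x * inner ℝ (x - x₀) (G x)) -
        (Module.finrank ℝ E / 2 - 1) * ∫ x, ‖G x‖ ^ 2) 1 :=
  ((h.isH01.hasDerivAt_integral_dil hO h.memLp h.zero x₀).sub_const _).sub
    ((hasDerivAt_dil_aux _).mul_const _)

/-- One half of the Rellich-Pohozaev identity, when the outward dilations of `v` about `x₀` stay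
in `H¹₀(O)`. -/
theorem HasLap.rellich_ge (h : HasLap O v G g) (hO : Bornology.IsBounded O)
    (H : ∀ᶠ l in 𝓝[>] (1 : ℝ), IsH01 O (fun x => v (dil x₀ l x)) (fun x => l • G (dil x₀ l x))) :
    (Module.finrank ℝ E / 2 - 1) * (∫ x, ‖G x‖ ^ 2) ≤ ∫ x, g x * inner ℝ (x - x₀) (G x) := by
  have hd := (h.hasDerivAt_dil (x₀ := x₀) hO).tendsto_slope.mono_left
    (nhdsWithin_mono 1 (fun x hx => ne_of_gt hx : Ioi (1 : ℝ) ⊆ {1}ᶜ))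
  refine sub_nonneg.1 (ge_of_tendsto hd ?_)
  filter_upwards [H, self_mem_nhdsWithin] with l hl hl1
  have hl1' : (1 : ℝ) < l := hl1
  have := h.dil_le (zero_lt_one.trans hl1') hl
  rw [slope_def_field]
  simp only [sub_self, one_div, one_pow, inv_one, zero_sub]
  refine div_nonneg ?_ (by linarith)
  linarith

theorem HasLap.rellich_le (h : HasLap O v G g) (hO : Bornology.IsBounded O)
    (H : ∀ᶠ l in 𝓝[<] (1 : ℝ), IsH01 O (fun x => v (dil x₀ l x)) (fun x => l • G (dil x₀ l x))) :
    ∫ x, g x * inner ℝ (x - x₀) (G x) ≤ (Module.finrank ℝ E / 2 - 1) * (∫ x, ‖G x‖ ^ 2) := by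
  have hd := (h.hasDerivAt_dil (x₀ := x₀) hO).tendsto_slope.mono_left
    (nhdsWithin_mono 1 (fun x hx => ne_of_lt hx : Iio (1 : ℝ) ⊆ {1}ᶜ))
  refine sub_nonpos.1 (le_of_tendsto hd ?_)
  filter_upwards [H, self_mem_nhdsWithin, nhdsWithin_le_nhds (lt_mem_nhds (zero_lt_one' ℝ))]
    with l hl hl1 hl0
  have hl1' : l < (1 : ℝ) := hl1
  have := h.dil_le hl0 hl
  rw [slope_def_field]
  simp only [sub_self, one_div, one_pow, inv_one, zero_sub]
  refine div_nonpos_of_nonneg_of_nonpos ?_ (by linarith)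
  linarith

/-- On a ball containing `x₀`. -/
theorem HasLap.rellich_ball {x₁ : E} {R : ℝ} (h : HasLap (ball x₁ R) v G g)
    (hx₀ : x₀ ∈ ball x₁ R) :
    (Module.finrank ℝ E / 2 - 1) * (∫ x, ‖G x‖ ^ 2) ≤ ∫ x, g x * inner ℝ (x - x₀) (G x) := by
  refine h.rellich_ge isBounded_ball ?_
  filter_upwards [self_mem_nhdsWithin] with l (hl : 1 < l)
  refine h.isH01.comp_dil x₀ (zero_lt_one.trans hl) fun x hx => ?_
  have e : x = (1 - l⁻¹) • x₀ + l⁻¹ • dil x₀ l x := by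
    have : l ≠ 0 := by positivity
    simp only [dil, smul_add, smul_smul, inv_mul_cancel₀ this, one_smul, sub_smul]
    abel
  rw [e]
  exact convex_ball x₁ R hx₀ hx (sub_nonneg.2 (inv_le_one_of_one_le₀ hl.le)) (by positivity)
    (by ring)

/-- For a function supported in a smaller concentric ball. -/
theorem HasLap.rellich_interior {R R' : ℝ} (hRR : R' < R)
    (h : HasLap (ball x₀ R) v G g) (h' : IsH01 (ball x₀ R') v G) :
    ∫ x, g x * inner ℝ (x - x₀) (G x) ≤ (Module.finrank ℝ E / 2 - 1) * (∫ x, ‖G x‖ ^ 2) := by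
  refine h.rellich_le isBounded_ball ?_
  have ht : Tendsto (fun l : ℝ => l * R) (𝓝 1) (𝓝 R) := by
    have : Continuous (fun l : ℝ => l * R) := by fun_prop
    simpa using this.tendsto 1
  filter_upwards [nhdsWithin_le_nhds (lt_mem_nhds (zero_lt_one' ℝ)),
    nhdsWithin_le_nhds (ht.eventually_const_lt hRR)] with l hl hl'
  refine h'.comp_dil x₀ hl fun x hx => ?_
  rw [mem_ball_iff_norm] at *
  simp only [dil, add_sub_cancel_left, norm_smul, norm_eq_abs, abs_of_pos hl] at hx
  exact lt_of_mul_lt_mul_left (hx.trans hl') hl.le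

end Rellich

section Flow

variable {E : Type*} [NormedAddCommGroup E] [InnerProductSpace ℝ E] [FiniteDimensional ℝ E]
  [MeasurableSpace E] [BorelSpace E]

theorem integrable_prod_of_continuous_bounded {X Y : Type*} [TopologicalSpace X]
    [TopologicalSpace Y] [MeasurableSpace X] [MeasurableSpace Y] [BorelSpace X] [BorelSpace Y]
    [SecondCountableTopology X] [SecondCountableTopology Y]
    {μ : Measure X} {ν : Measure Y} [IsFiniteMeasure μ] [IsFiniteMeasure ν]
    {f : X × Y → ℝ} (hf : Continuous f) {C : ℝ} (hC : ∀ p, ‖f p‖ ≤ C) :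
    Integrable f (μ.prod ν) :=
  Integrable.of_bound hf.aestronglyMeasurable C (Eventually.of_forall hC)

theorem sq_intervalIntegral_le {f : ℝ → ℝ} (hf : Continuous f) :
    (∫ s in Ioc (0:ℝ) 1, f s) ^ 2 ≤ ∫ s in Ioc (0:ℝ) 1, f s ^ 2 := by
  have hm : MemLp f 2 (volume.restrict (Ioc (0:ℝ) 1)) := by
    refine (memLp_two_iff_integrable_sq hf.aestronglyMeasurable).2 ?_
    exact ((hf.pow 2).integrableOn_Icc (a := 0) (b := 1)).mono_set Ioc_subset_Icc_self
  have h1 : MemLp (fun _ : ℝ => (1:ℝ)) 2 (volume.restrict (Ioc (0:ℝ) 1)) := memLp_const 1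
  simpa using sq_integral_mul_le hm h1

theorem IsTest.integral_sq_translate_le {O : Set E} (hO : Bornology.IsBounded O) {η : E → ℝ}
    (h : IsTest O η) (a : E) :
    ∫ x in O, (η (x + a) - η x) ^ 2 ≤ ‖a‖ ^ 2 * ∫ x, ‖∇ η x‖ ^ 2 := by
  have : IsFiniteMeasure (volume.restrict O) :=
    ⟨by simpa using hO.measure_lt_top⟩
  obtain ⟨C, hC⟩ := h.gradient_compact.exists_bound_of_continuous h.smooth.continuous_gradient
  have hgc := h.smooth.continuous_gradient
  have hcont : Continuous fun p : E × ℝ => ‖∇ η (p.1 + p.2 • a)‖ ^ 2 := by fun_prop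
  have hb : ∀ p : E × ℝ, ‖‖∇ η (p.1 + p.2 • a)‖ ^ 2‖ ≤ C ^ 2 := fun p => by
    rw [norm_pow, norm_norm]
    exact pow_le_pow_left₀ (norm_nonneg _) (hC _) 2
  have hint := integrable_prod_of_continuous_bounded
    (μ := volume.restrict O) (ν := volume.restrict (Ioc (0:ℝ) 1)) hcont hb
  have key : ∀ x, (η (x + a) - η x) ^ 2 ≤
      ‖a‖ ^ 2 * ∫ s in Ioc (0:ℝ) 1, ‖∇ η (x + s • a)‖ ^ 2 := by
    intro x
    have hd : ∀ s : ℝ, HasDerivAt (fun s : ℝ => η (x + s • a)) (inner ℝ (∇ η (x + s • a)) a) s := by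
      intro s
      rw [inner_gradient_eq]
      have h1 : HasDerivAt (fun s : ℝ => x + s • a) a s := by
        simpa using ((hasDerivAt_id s).smul_const a).const_add x
      exact (h.differentiableAt _).hasFDerivAt.comp_hasDerivAt s h1
    have hc : Continuous fun s : ℝ => inner ℝ (∇ η (x + s • a)) a := by fun_prop
    have h2 : η (x + a) - η x = ∫ s in Ioc (0:ℝ) 1, inner ℝ (∇ η (x + s • a)) a := by
      rw [← intervalIntegral.integral_of_le zero_le_one,
        intervalIntegral.integral_eq_sub_of_hasDerivAt (fun s _ => hd s)
          (hc.intervalIntegrable _ _)]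
      simp
    rw [h2]
    refine (sq_intervalIntegral_le hc).trans ?_
    rw [← integral_const_mul]
    have i1 : IntegrableOn (fun s : ℝ => ‖a‖ ^ 2 * ‖∇ η (x + s • a)‖ ^ 2) (Ioc (0:ℝ) 1) :=
      ((by fun_prop : Continuous fun s : ℝ => ‖a‖ ^ 2 * ‖∇ η (x + s • a)‖ ^ 2).integrableOn_Icc
        (a := 0) (b := 1)).mono_set Ioc_subset_Icc_self
    refine integral_mono_of_nonneg (Eventually.of_forall fun s => by positivity) i1
      (Eventually.of_forall fun s => ?_)
    have h3 := abs_real_inner_le_norm (∇ η (x + s • a)) a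
    have h4 : |inner ℝ (∇ η (x + s • a)) a| ^ 2 ≤ (‖∇ η (x + s • a)‖ * ‖a‖) ^ 2 :=
      pow_le_pow_left₀ (abs_nonneg _) h3 2
    rw [sq_abs] at h4
    dsimp only
    linarith [mul_pow ‖∇ η (x + s • a)‖ ‖a‖ 2]
  calc ∫ x in O, (η (x + a) - η x) ^ 2
      ≤ ∫ x in O, ‖a‖ ^ 2 * ∫ s in Ioc (0:ℝ) 1, ‖∇ η (x + s • a)‖ ^ 2 :=
        integral_mono_of_nonneg (Eventually.of_forall fun x => by positivity)
          (hint.integral_prod_left.const_mul _) (Eventually.of_forall key)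
    _ = ‖a‖ ^ 2 * ∫ s in Ioc (0:ℝ) 1, ∫ x in O, ‖∇ η (x + s • a)‖ ^ 2 := by
        rw [integral_const_mul, integral_integral_swap hint]
    _ ≤ ‖a‖ ^ 2 * ∫ s in Ioc (0:ℝ) 1, ∫ x, ‖∇ η x‖ ^ 2 := by
        refine mul_le_mul_of_nonneg_left ?_ (by positivity)
        refine integral_mono_of_nonneg
          (Eventually.of_forall fun s => integral_nonneg fun x => by positivity)
          (integrable_const _) (Eventually.of_forall fun s => ?_)
        have h5 : ∫ x, ‖∇ η x‖ ^ 2 = ∫ x, ‖∇ η (x + s • a)‖ ^ 2 :=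
          (integral_add_right_eq_self (fun x => ‖∇ η x‖ ^ 2) (s • a)).symm
        dsimp only
        rw [h5]
        exact setIntegral_le_integral (h.memLp_gradient.normSq_integrable.comp_add_right _)
          (Eventually.of_forall fun x => by positivity)
    _ = ‖a‖ ^ 2 * ∫ x, ‖∇ η x‖ ^ 2 := by simp

theorem IsTest.integral_average_sq_le {O : Set E} (hO : Bornology.IsBounded O) {η : E → ℝ}
    (h : IsTest O η) (r : ℝ) :
    Integrable (fun x => ∫ a in ball (0:E) r, (η (x + a) - η x) ^ 2) (volume.restrict O) ∧
    ∫ x in O, ∫ a in ball (0:E) r, (η (x + a) - η x) ^ 2 ≤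
      volume.real (ball (0:E) r) * (r ^ 2 * ∫ x, ‖∇ η x‖ ^ 2) := by
  have : IsFiniteMeasure (volume.restrict O) := ⟨by simpa using hO.measure_lt_top⟩
  have : IsFiniteMeasure (volume.restrict (ball (0:E) r)) := ⟨by simpa using measure_ball_lt_top⟩
  obtain ⟨C, hC⟩ := h.compact.exists_bound_of_continuous h.smooth.continuous
  have hc := h.smooth.continuous
  have hcont : Continuous fun p : E × E => (η (p.1 + p.2) - η p.1) ^ 2 := by fun_prop
  have hb : ∀ p : E × E, ‖(η (p.1 + p.2) - η p.1) ^ 2‖ ≤ (C + C) ^ 2 := fun p => by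
    rw [norm_pow]
    exact pow_le_pow_left₀ (norm_nonneg _) ((norm_sub_le _ _).trans (add_le_add (hC _) (hC _))) 2
  have hint := integrable_prod_of_continuous_bounded
    (μ := volume.restrict O) (ν := volume.restrict (ball (0:E) r)) hcont hb
  refine ⟨hint.integral_prod_left, ?_⟩
  rw [integral_integral_swap hint]
  calc ∫ a in ball (0:E) r, ∫ x in O, (η (x + a) - η x) ^ 2
      ≤ ∫ a in ball (0:E) r, (r ^ 2 * ∫ x, ‖∇ η x‖ ^ 2) := by
        refine setIntegral_mono_on hint.swap.integral_prod_left (integrable_const _)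
          measurableSet_ball fun a ha => (h.integral_sq_translate_le hO a).trans ?_
        refine mul_le_mul_of_nonneg_right (pow_le_pow_left₀ (norm_nonneg _) ?_ 2)
          (integral_nonneg fun x => by positivity)
        simpa using (mem_ball_zero_iff.1 ha).le
    _ = _ := by simp [Measure.real]

theorem Orthonormal.countable_of_separable {H : Type*} [NormedAddCommGroup H]
    [InnerProductSpace ℝ H] [TopologicalSpace.SeparableSpace H] {ι : Type*} {v : ι → H}
    (hv : Orthonormal ℝ v) : Countable ι := by
  refine Pairwise.countable_of_isOpen_disjoint (s := fun i => ball (v i) (1 / 2)) ?_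
    (fun i => isOpen_ball) (fun i => nonempty_ball.2 (by norm_num))
  intro i j hij
  apply ball_disjoint_ball
  have h1 : ‖v i - v j‖ ^ 2 = 2 := by
    rw [@norm_sub_sq_real, hv.1 i, hv.1 j, hv.2 hij]
    norm_num
  rw [dist_eq_norm]
  nlinarith [norm_nonneg (v i - v j)]

theorem LinearMap.IsSymmetric.exists_eigenbasis.{u} {H : Type u} [NormedAddCommGroup H]
    [InnerProductSpace ℝ H] [CompleteSpace H] [TopologicalSpace.SeparableSpace H]
    {K : H →L[ℝ] H} (hK : IsCompactOperator K) (hs : (K : H →ₗ[ℝ] H).IsSymmetric) :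
    ∃ (ι : Type u) (_ : Countable ι) (b : HilbertBasis ι ℝ H) (κ : ι → ℝ),
      ∀ i, K (b i) = κ i • b i := by
  classical
  have hcl : ∀ κ : ℝ, CompleteSpace (Module.End.eigenspace (K : H →ₗ[ℝ] H) κ) := by
    intro κ
    have : IsClosed ((Module.End.eigenspace (K : H →ₗ[ℝ] H) κ : Submodule ℝ H) : Set H) := by
      have h1 : ((Module.End.eigenspace (K : H →ₗ[ℝ] H) κ : Submodule ℝ H) : Set H) =
          {x | K x = κ • x} := by
        ext x
        simp
      rw [h1]
      exact isClosed_eq K.continuous (by fun_prop)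
    exact this.completeSpace_coe
  choose w b hb using fun κ : ℝ =>
    exists_hilbertBasis ℝ (Module.End.eigenspace (K : H →ₗ[ℝ] H) κ)
  have hfam := hs.orthogonalFamily_eigenspaces
  have hon := hfam.orthonormal_sigma_orthonormal (fun κ => (b κ).orthonormal)
  have hcount := hon.countable_of_separable
  simp only [Submodule.coe_subtypeₗᵢ, Submodule.coe_subtype] at hon
  have hbot : (Submodule.span ℝ (Set.range fun a : Σ κ : ℝ, w κ =>
      ((b a.1 a.2 : Module.End.eigenspace (K : H →ₗ[ℝ] H) a.1) : H)))ᗮ = ⊥ := by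
    rw [Submodule.eq_bot_iff]
    intro f hf
    have h1 : f ∈ (⨆ κ, Module.End.eigenspace (K : H →ₗ[ℝ] H) κ)ᗮ := by
      rw [← Submodule.iInf_orthogonal, Submodule.mem_iInf]
      intro κ
      rw [Submodule.mem_orthogonal]
      have := hcl κ
      intro u hu
      set U := Module.End.eigenspace (K : H →ₗ[ℝ] H) κ
      have h2 : inner ℝ (U.orthogonalProjectionOnto f) (⟨u, hu⟩ : U) = 0 := by
        rw [← (b κ).tsum_inner_mul_inner]
        convert tsum_zero with i
        have h3 : inner ℝ (U.orthogonalProjectionOnto f) (b κ i) = inner ℝ f (b κ i : H) := by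
          simp
        rw [h3, real_inner_comm, (Submodule.mem_orthogonal _ _).1 hf _
          (Submodule.subset_span ⟨⟨κ, i⟩, rfl⟩), zero_mul]
      have h4 : inner ℝ (U.orthogonalProjectionOnto f) (⟨u, hu⟩ : U) = inner ℝ f u := by simp
      rw [real_inner_comm, ← h4, h2]
    have h2 := ContinuousLinearMap.orthogonalComplement_iSup_eigenspaces_eq_bot hK hs
    rw [h2] at h1
    simpa using h1
  refine ⟨Σ κ : ℝ, w κ, hcount, HilbertBasis.mkOfOrthogonalEqBot hon hbot, fun a => a.1, ?_⟩
  intro a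
  rw [HilbertBasis.coe_mkOfOrthogonalEqBot]
  exact Module.End.mem_eigenspace_iff.1 (b a.1 a.2).2

theorem volume_real_ball_pos (x : E) {h : ℝ} (hh : 0 < h) : 0 < volume.real (ball x h) :=
  ENNReal.toReal_pos (measure_ball_pos _ _ hh).ne' measure_ball_lt_top.ne

theorem sq_sub_average_le {η : E → ℝ} (hη : Continuous η) {x p : E} {h : ℝ} (hh : 0 < h)
    (hx : x ∈ ball p h) :
    (η x - (volume.real (ball (0:E) h))⁻¹ * ∫ y in ball p h, η y) ^ 2 ≤
      (volume.real (ball (0:E) h))⁻¹ * ∫ a in ball (0:E) (2 * h), (η (x + a) - η x) ^ 2 := by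
  set b := volume.real (ball (0:E) h) with hb
  have hb0 : 0 < b := volume_real_ball_pos 0 hh
  have hbp : volume.real (ball p h) = b := by
    rw [hb, Measure.real, Measure.real, Measure.addHaar_ball_center]
  have hf : IsFiniteMeasure (volume.restrict (ball p h)) := ⟨by simpa using measure_ball_lt_top⟩
  have hint : ∀ f : E → ℝ, Continuous f → ∀ q : E, ∀ r : ℝ, IntegrableOn f (ball q r) :=
    fun f hf q r => (hf.continuousOn.integrableOn_compact (isCompact_closedBall q r)).mono_set
      ball_subset_closedBall
  have h1 : η x - b⁻¹ * ∫ y in ball p h, η y = b⁻¹ * ∫ y in ball p h, (η x - η y) := by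
    rw [integral_sub (hint _ continuous_const _ _) (hint _ hη _ _)]
    simp [hbp]
    field_simp
  have hc : Continuous fun y => η x - η y := by fun_prop
  have h2 : (∫ y in ball p h, (η x - η y)) ^ 2 ≤ b * ∫ y in ball p h, (η x - η y) ^ 2 := by
    have m1 : MemLp (fun y => η x - η y) 2 (volume.restrict (ball p h)) :=
      (memLp_two_iff_integrable_sq hc.aestronglyMeasurable).2 (hint _ (hc.pow 2) _ _)
    have m2 : MemLp (fun _ : E => (1:ℝ)) 2 (volume.restrict (ball p h)) := memLp_const 1
    have := sq_integral_mul_le m2 m1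
    simpa [hbp] using this
  have h3 : ∫ y in ball p h, (η x - η y) ^ 2 ≤ ∫ y in ball x (2 * h), (η y - η x) ^ 2 := by
    have hc' : Continuous fun y => (η y - η x) ^ 2 := by fun_prop
    have : ∫ y in ball p h, (η x - η y) ^ 2 = ∫ y in ball p h, (η y - η x) ^ 2 := by
      congr 1; funext y; ring
    rw [this]
    refine setIntegral_mono_set (hint _ hc' _ _) (Eventually.of_forall fun y => by positivity)
      (LE.le.eventuallyLE fun y hy => ?_)
    have := dist_triangle y p x
    rw [mem_ball] at hx hy ⊢
    rw [dist_comm p x] at this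
    linarith
  have h4 : ∫ y in ball x (2 * h), (η y - η x) ^ 2 =
      ∫ a in ball (0:E) (2 * h), (η (x + a) - η x) ^ 2 := by
    rw [← integral_indicator measurableSet_ball, ← integral_indicator measurableSet_ball,
      ← integral_add_left_eq_self _ x]
    congr 1
    funext a
    by_cases ha : a ∈ ball (0:E) (2 * h)
    · rw [indicator_of_mem ha, indicator_of_mem]
      simpa using ha
    · rw [indicator_of_notMem ha, indicator_of_notMem]
      simpa using ha
  rw [h1, mul_pow, ← h4]
  calc b⁻¹ ^ 2 * (∫ y in ball p h, (η x - η y)) ^ 2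
      ≤ b⁻¹ ^ 2 * (b * ∫ y in ball x (2 * h), (η y - η x) ^ 2) := by gcongr; exact h2.trans (by gcongr)
    _ = _ := by field_simp

theorem exists_finite_measurable_partition {O : Set E} (hO : Bornology.IsBounded O)
    (hOm : MeasurableSet O) {h : ℝ} (hh : 0 < h) :
    ∃ (n : ℕ) (p : ℕ → E) (A : ℕ → Set E), (∀ i, MeasurableSet (A i)) ∧
      (∀ i, A i ⊆ O ∩ ball (p i) h) ∧ Pairwise (Function.onFun Disjoint A) ∧
      ∀ x ∈ O, ∃ i < n, x ∈ A i := by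
  have hd := TopologicalSpace.denseRange_denseSeq E
  set p := TopologicalSpace.denseSeq E
  obtain ⟨s, hs⟩ := hO.isCompact_closure.elim_finite_subcover (fun i : ℕ => ball (p i) h)
    (fun i => isOpen_ball) (fun x _ => by
      obtain ⟨i, hi⟩ := hd.exists_dist_lt x hh
      exact mem_iUnion.2 ⟨i, hi⟩)
  classical
  set f : ℕ → Set E := fun i => if i ∈ s then O ∩ ball (p i) h else ∅ with hf
  have hfm : ∀ i, MeasurableSet (f i) := fun i => by
    by_cases hi : i ∈ s
    · simpa [hf, hi] using hOm.inter measurableSet_ball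
    · simp [hf, hi]
  refine ⟨s.sup id + 1, p, disjointed f, MeasurableSet.disjointed hfm, fun i => ?_,
    disjoint_disjointed f, fun x hx => ?_⟩
  · refine (disjointed_subset f i).trans ?_
    by_cases hi : i ∈ s <;> simp [hf, hi]
  · obtain ⟨i, hi, hxi⟩ := mem_iUnion₂.1 (hs (subset_closure hx))
    have h1 : x ∈ ⋃ i, disjointed f i := by
      rw [iUnion_disjointed]
      exact mem_iUnion.2 ⟨i, by simpa [hf, hi] using ⟨hx, hxi⟩⟩
    obtain ⟨k, hk⟩ := mem_iUnion.1 h1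
    refine ⟨k, ?_, hk⟩
    have h2 := disjointed_subset f k hk
    have h3 : k ∈ s := by
      by_contra hc
      simp [hf, hc] at h2
    exact Nat.lt_succ_of_le (Finset.le_sup (f := id) h3)

theorem exists_compact_average {O : Set E} (hO : Bornology.IsBounded O) (hOm : MeasurableSet O)
    {h : ℝ} (hh : 0 < h) :
    ∃ B : Lp ℝ 2 (volume : Measure E) →L[ℝ] Lp ℝ 2 (volume : Measure E),
      IsCompactOperator B ∧ ∀ (η : E → ℝ) (f : Lp ℝ 2 (volume : Measure E)), IsTest O η →
        f =ᵐ[volume] η →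
        ‖f - B f‖ ^ 2 ≤ 4 * 2 ^ Module.finrank ℝ E * h ^ 2 * ∫ x, ‖∇ η x‖ ^ 2 := by
  obtain ⟨n, p, A, hAm, hA, hdisj, hcov⟩ := exists_finite_measurable_partition hO hOm hh
  set b := volume.real (ball (0:E) h) with hb
  have hb0 : 0 < b := volume_real_ball_pos 0 hh
  have hAf : ∀ i, volume (A i) ≠ ⊤ := fun i =>
    (hO.subset ((hA i).trans inter_subset_left)).measure_lt_top.ne
  set w : ℕ → Lp ℝ 2 (volume : Measure E) := fun i =>
    indicatorConstLp 2 (measurableSet_ball (x := p i) (ε := h)) measure_ball_lt_top.ne (1:ℝ)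
  set u : ℕ → Lp ℝ 2 (volume : Measure E) := fun i => indicatorConstLp 2 (hAm i) (hAf i) b⁻¹
  refine ⟨∑ i ∈ Finset.range n, (ContinuousLinearMap.toSpanSingleton ℝ (u i)).comp
    (innerSL ℝ (w i)), ?_, ?_⟩
  · have : ∀ s : Finset ℕ, IsCompactOperator ⇑(∑ i ∈ s,
      (ContinuousLinearMap.toSpanSingleton ℝ (u i)).comp (innerSL ℝ (w i))) := by
      intro s
      classical
      induction s using Finset.induction_on with
      | empty => simpa using isCompactOperator_zero
      | insert a s ha ih =>
        rw [Finset.sum_insert ha]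
        refine IsCompactOperator.add ?_ ih
        exact (isCompactOperator_of_locallyCompactSpace_rng
          (ContinuousLinearMap.toSpanSingleton ℝ (u a))).comp_clm (innerSL ℝ (w a))
    exact this _
  · intro η f hη hf
    set c : ℕ → ℝ := fun i => ∫ y in ball (p i) h, η y with hc
    have hBf : ((∑ i ∈ Finset.range n, (ContinuousLinearMap.toSpanSingleton ℝ (u i)).comp
        (innerSL ℝ (w i))) f) = ∑ i ∈ Finset.range n, c i • u i := by
      simp only [sum_apply, ContinuousLinearMap.comp_apply,
        ContinuousLinearMap.toSpanSingleton_apply, innerSL_apply_apply]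
      refine Finset.sum_congr rfl fun i _ => ?_
      congr 1
      rw [L2.inner_indicatorConstLp_one]
      exact integral_congr_ae (ae_restrict_of_ae hf)
    rw [hBf]
    have hae : ∀ᵐ x, (f - ∑ i ∈ Finset.range n, c i • u i : Lp ℝ 2 (volume : Measure E)) x =
        η x - ∑ i ∈ Finset.range n, c i * (A i).indicator (fun _ => b⁻¹) x := by
      have h1 : ∀ᵐ x, ∀ i, u i x = (A i).indicator (fun _ => b⁻¹) x :=
        ae_all_iff.2 fun i => indicatorConstLp_coeFn
      have h2 : ∀ᵐ x, ∀ i, (c i • u i : Lp ℝ 2 (volume : Measure E)) x = c i • u i x :=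
        ae_all_iff.2 fun i => Lp.coeFn_smul _ _
      filter_upwards [hf, h1, h2, Lp.coeFn_sub f (∑ i ∈ Finset.range n, c i • u i),
        Lp.coeFn_finsetSum (Finset.range n) (fun i => c i • u i)] with x e1 e2 e3 e4 e5
      rw [e4, Pi.sub_apply, e1, e5]
      simp only [Finset.sum_apply, e3, e2, smul_eq_mul]
    have hn : ‖f - ∑ i ∈ Finset.range n, c i • u i‖ ^ 2 = ∫ x,
        (η x - ∑ i ∈ Finset.range n, c i * (A i).indicator (fun _ => b⁻¹) x) ^ 2 := by
      rw [← real_inner_self_eq_norm_sq, L2.inner_def]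
      refine integral_congr_ae ?_
      filter_upwards [hae] with x hx
      rw [hx]
      simp [sq]
    rw [hn]
    have hsum : ∀ x, ∀ i < n, x ∈ A i →
        ∑ j ∈ Finset.range n, c j * (A j).indicator (fun _ => b⁻¹) x = c i * b⁻¹ := by
      intro x i hi hx
      rw [Finset.sum_eq_single i]
      · rw [indicator_of_mem hx]
      · intro j _ hj
        rw [indicator_of_notMem, mul_zero]
        exact fun hxj => (disjoint_left.1 (hdisj hj) hxj) hx
      · intro hc; exact absurd (Finset.mem_range.2 hi) hc
    obtain ⟨hi1, hi2⟩ := hη.integral_average_sq_le hO (2 * h)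
    have hout : ∀ x ∉ O,
        (η x - ∑ i ∈ Finset.range n, c i * (A i).indicator (fun _ => b⁻¹) x) ^ 2 = 0 := by
      intro x hx
      rw [hη.eq_zero hx, Finset.sum_eq_zero]
      · simp
      · intro i _
        rw [indicator_of_notMem (fun hc => hx ((hA i hc).1)), mul_zero]
    rw [← setIntegral_eq_integral_of_forall_compl_eq_zero hout]
    have hvol : volume.real (ball (0:E) (2 * h)) = 2 ^ Module.finrank ℝ E * b := by
      rw [hb, Measure.real, Measure.real, Measure.addHaar_ball_mul_of_pos _ _ two_pos,
        ENNReal.toReal_mul, ENNReal.toReal_ofReal (by positivity)]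
    calc ∫ x in O, (η x - ∑ i ∈ Finset.range n, c i * (A i).indicator (fun _ => b⁻¹) x) ^ 2
        ≤ ∫ x in O, b⁻¹ * ∫ a in ball (0:E) (2 * h), (η (x + a) - η x) ^ 2 := by
          refine integral_mono_of_nonneg (Eventually.of_forall fun x => by positivity)
            (hi1.const_mul _) ((ae_restrict_iff' hOm).2 (Eventually.of_forall fun x hx => ?_))
          obtain ⟨i, hi, hxi⟩ := hcov x hx
          dsimp only
          rw [hsum x i hi hxi, mul_comm (c i)]
          exact sq_sub_average_le hη.smooth.continuous hh (hA i hxi).2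
      _ = b⁻¹ * ∫ x in O, ∫ a in ball (0:E) (2 * h), (η (x + a) - η x) ^ 2 :=
          integral_const_mul _ _
      _ ≤ b⁻¹ * (volume.real (ball (0:E) (2 * h)) * ((2 * h) ^ 2 * ∫ x, ‖∇ η x‖ ^ 2)) := by
          gcongr
      _ = _ := by
          rw [hvol]
          field_simp
          ring

theorem TendstoL2.ae_eq_indicator {F : Type*} [NormedAddCommGroup F] [InnerProductSpace ℝ F]
    {O : Set E} (hO : MeasurableSet O) {η : ℕ → E → F} {f : E → F}
    (hη : ∀ j, MemLp (η j) 2 (volume : Measure E)) (hf : MemLp f 2 (volume : Measure E))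
    (h0 : ∀ j, ∀ x ∉ O, η j x = 0) (h : TendstoL2 volume η f) :
    f =ᵐ[volume] O.indicator f := by
  have hi : MemLp (O.indicator f) 2 (volume : Measure E) := hf.indicator hO
  have h1 : TendstoL2 volume η (O.indicator f) := by
    refine TendstoL2.of_le hη hf h 1 fun j x => ?_
    by_cases hx : x ∈ O
    · simp [hx]
    · simp [hx, h0 j x hx]
  rw [tendstoL2_iff hη hf] at h
  rw [tendstoL2_iff hη hi] at h1
  exact (MemLp.toLp_eq_toLp_iff hf hi).1 (tendsto_nhds_unique h h1)

variable (E) in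
/-- Triples made of a function, a vector field and a function, all square integrable. -/
abbrev EnergySpace :=
  WithLp 2 (Lp ℝ 2 (volume : Measure E) ×
    WithLp 2 (Lp E 2 (volume : Measure E) × Lp ℝ 2 (volume : Measure E)))

/-- The triples `(η, ∇ η, ϖ η)` for test functions `η`. -/
def testEnergy (O : Set E) (ϖ : E → ℝ) : Submodule ℝ (EnergySpace E) where
  carrier := {e | ∃ η, IsTest O η ∧ e.fst =ᵐ[volume] η ∧ e.snd.fst =ᵐ[volume] ∇ η ∧
    e.snd.snd =ᵐ[volume] fun x => ϖ x * η x}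
  add_mem' := by
    rintro a b ⟨η, h1, h2, h3, h4⟩ ⟨ζ, k1, k2, k3, k4⟩
    refine ⟨fun x => η x + ζ x, h1.add k1, ?_, ?_, ?_⟩
    · rw [WithLp.add_fst]
      filter_upwards [Lp.coeFn_add a.fst b.fst, h2, k2] with x e1 e2 e3
      rw [e1, Pi.add_apply, e2, e3]
    · rw [WithLp.add_snd, WithLp.add_fst]
      filter_upwards [Lp.coeFn_add a.snd.fst b.snd.fst, h3, k3] with x e1 e2 e3
      rw [e1, Pi.add_apply, e2, e3, gradient_fun_add (h1.differentiableAt x)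
        (k1.differentiableAt x)]
    · rw [WithLp.add_snd, WithLp.add_snd]
      filter_upwards [Lp.coeFn_add a.snd.snd b.snd.snd, h4, k4] with x e1 e2 e3
      rw [e1, Pi.add_apply, e2, e3, mul_add]
  zero_mem' := by
    refine ⟨fun _ => 0, ⟨contDiff_const, HasCompactSupport.zero, by simp [tsupport]⟩, ?_, ?_, ?_⟩
    · exact Lp.coeFn_zero ℝ 2 volume
    · filter_upwards [Lp.coeFn_zero E 2 (volume : Measure E)] with x hx
      simp [gradient]
    · filter_upwards [Lp.coeFn_zero ℝ 2 (volume : Measure E)] with x hx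
      simp
  smul_mem' := by
    rintro c a ⟨η, h1, h2, h3, h4⟩
    refine ⟨fun x => c * η x, h1.const_mul c, ?_, ?_, ?_⟩
    · rw [WithLp.smul_fst]
      filter_upwards [Lp.coeFn_smul c a.fst, h2] with x e1 e2
      rw [e1, Pi.smul_apply, e2, smul_eq_mul]
    · rw [WithLp.smul_snd, WithLp.smul_fst]
      filter_upwards [Lp.coeFn_smul c a.snd.fst, h3] with x e1 e2
      rw [e1, Pi.smul_apply, e2, gradient_const_mul c (h1.differentiableAt x)]
    · rw [WithLp.smul_snd, WithLp.smul_snd]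
      filter_upwards [Lp.coeFn_smul c a.snd.snd, h4] with x e1 e2
      rw [e1, Pi.smul_apply, e2, smul_eq_mul]
      ring

theorem IsTest.exists_mem_testEnergy {O : Set E} {η : E → ℝ} (h : IsTest O η) {ϖ : E → ℝ}
    (hϖ : Continuous ϖ) :
    ∃ e ∈ testEnergy O ϖ, e.fst =ᵐ[volume] η ∧ e.snd.fst =ᵐ[volume] ∇ η ∧
      e.snd.snd =ᵐ[volume] fun x => ϖ x * η x := by
  have h3 : MemLp (fun x => ϖ x * η x) 2 (volume : Measure E) :=
    (hϖ.mul h.smooth.continuous).memLp_of_hasCompactSupport h.compact.mul_left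
  refine ⟨WithLp.toLp 2 (h.memLp.toLp η, WithLp.toLp 2 (h.memLp_gradient.toLp (∇ η), h3.toLp _)),
    ⟨η, h, h.memLp.coeFn_toLp, h.memLp_gradient.coeFn_toLp, h3.coeFn_toLp⟩,
    h.memLp.coeFn_toLp, h.memLp_gradient.coeFn_toLp, h3.coeFn_toLp⟩

theorem tendstoL2_of_tendsto_Lp {F : Type*} [NormedAddCommGroup F] [InnerProductSpace ℝ F]
    {η : ℕ → E → F} {e : ℕ → Lp F 2 (volume : Measure E)} {f : Lp F 2 (volume : Measure E)}
    (he : ∀ j, e j =ᵐ[volume] η j) (h : Tendsto e atTop (𝓝 f)) :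
    (∀ j, MemLp (η j) 2 (volume : Measure E)) ∧ TendstoL2 volume η f := by
  have hη : ∀ j, MemLp (η j) 2 (volume : Measure E) := fun j =>
    (memLp_congr_ae (he j)).1 (Lp.memLp (e j))
  refine ⟨hη, (tendstoL2_iff hη (Lp.memLp f)).2 ?_⟩
  rw [Lp.toLp_coeFn]
  convert h using 2 with j
  rw [← Lp.toLp_coeFn (e j) (Lp.memLp _)]
  exact (MemLp.toLp_eq_toLp_iff _ _).2 (he j).symm

theorem exists_isH01_of_mem_closure {O : Set E} (hO : Bornology.IsBounded O)
    (hOm : MeasurableSet O) {ϖ : E → ℝ} (hϖ : Continuous ϖ) {v : EnergySpace E}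
    (hv : v ∈ (testEnergy O ϖ).topologicalClosure) :
    ∃ f g, IsH01 O f g ∧ v.fst =ᵐ[volume] f ∧ v.snd.fst =ᵐ[volume] g ∧
      v.snd.snd =ᵐ[volume] fun x => ϖ x * f x := by
  rw [← SetLike.mem_coe, Submodule.topologicalClosure_coe, mem_closure_iff_seq_limit] at hv
  obtain ⟨e, he, hlim⟩ := hv
  choose η h1 h2 h3 h4 using he
  have l1 : Tendsto (fun j => (e j).fst) atTop (𝓝 v.fst) :=
    ((WithLp.fstL 2 ℝ _ _).continuous.tendsto v).comp hlim
  have l0 : Tendsto (fun j => (e j).snd) atTop (𝓝 v.snd) :=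
    ((WithLp.sndL 2 ℝ _ _).continuous.tendsto v).comp hlim
  have l2 : Tendsto (fun j => (e j).snd.fst) atTop (𝓝 v.snd.fst) :=
    ((WithLp.fstL 2 ℝ _ _).continuous.tendsto v.snd).comp l0
  have l3 : Tendsto (fun j => (e j).snd.snd) atTop (𝓝 v.snd.snd) :=
    ((WithLp.sndL 2 ℝ _ _).continuous.tendsto v.snd).comp l0
  obtain ⟨m1, t1⟩ := tendstoL2_of_tendsto_Lp h2 l1
  obtain ⟨m2, t2⟩ := tendstoL2_of_tendsto_Lp h3 l2
  obtain ⟨m3, t3⟩ := tendstoL2_of_tendsto_Lp h4 l3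
  have a1 := t1.ae_eq_indicator hOm m1 (Lp.memLp _) (fun j x hx => (h1 j).eq_zero hx)
  have a2 := t2.ae_eq_indicator hOm m2 (Lp.memLp _) (fun j x hx => (h1 j).gradient_eq_zero hx)
  have i1 : MemLp (O.indicator v.fst) 2 (volume : Measure E) := (Lp.memLp _).indicator hOm
  have i2 : MemLp (O.indicator v.snd.fst) 2 (volume : Measure E) := (Lp.memLp _).indicator hOm
  have s1 : TendstoL2 volume η (O.indicator v.fst) := by
    refine TendstoL2.of_le m1 (Lp.memLp _) t1 1 fun j x => ?_
    by_cases hx : x ∈ O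
    · simp [hx]
    · simp [hx, (h1 j).eq_zero hx]
  have s2 : TendstoL2 volume (fun j => ∇ (η j)) (O.indicator v.snd.fst) := by
    refine TendstoL2.of_le m2 (Lp.memLp _) t2 1 fun j x => ?_
    by_cases hx : x ∈ O
    · simp [hx]
    · simp [hx, (h1 j).gradient_eq_zero hx]
  refine ⟨O.indicator v.fst, O.indicator v.snd.fst,
    ⟨i1, i2, fun x hx => by simp [hx], fun x hx => by simp [hx], η, h1, s1, s2⟩, a1, a2, ?_⟩
  obtain ⟨C, -, hC⟩ := hO.exists_bound_of_continuous hϖ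
  have i3 : MemLp (fun x => ϖ x * O.indicator v.fst x) 2 (volume : Measure E) := by
    simpa using i1.continuous_smul hO (fun x hx => by simp [hx]) hϖ
  have s3 : TendstoL2 volume (fun j x => ϖ x * η j x) (fun x => ϖ x * O.indicator v.fst x) := by
    refine TendstoL2.of_le m1 i1 s1 C fun j x => ?_
    by_cases hx : x ∈ O
    · rw [← mul_sub, norm_mul]
      exact mul_le_mul_of_nonneg_right (hC x hx) (norm_nonneg _)
    · simp [hx, (h1 j).eq_zero hx]
  rw [tendstoL2_iff m3 i3] at s3
  rw [tendstoL2_iff m3 (Lp.memLp _)] at t3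
  exact (MemLp.toLp_eq_toLp_iff (Lp.memLp _) i3).1 (tendsto_nhds_unique t3 s3)

theorem integral_inner_congr_Lp {F : Type*} [NormedAddCommGroup F] [InnerProductSpace ℝ F]
    {a b : Lp F 2 (volume : Measure E)} {f g : E → F} (ha : a =ᵐ[volume] f) (hb : b =ᵐ[volume] g) :
    inner ℝ a b = ∫ x, inner ℝ (f x) (g x) := by
  rw [L2.inner_def]
  refine integral_congr_ae ?_
  filter_upwards [ha, hb] with x h1 h2
  rw [h1, h2]

theorem exists_finite_rank_energy_le {O : Set E} (hO : Bornology.IsBounded O)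
    (hOm : MeasurableSet O) (ϖ : E → ℝ) {h : ℝ} (hh : 0 < h) :
    ∃ B : Lp ℝ 2 (volume : Measure E) →L[ℝ] Lp ℝ 2 (volume : Measure E), IsCompactOperator B ∧
      ∀ v ∈ (testEnergy O ϖ).topologicalClosure,
      ‖v.fst - B v.fst‖ ≤ √(4 * 2 ^ Module.finrank ℝ E) * h * ‖v‖ := by
  obtain ⟨B, hB1, hB2⟩ := exists_compact_average hO hOm hh
  set C : ℝ := 4 * 2 ^ Module.finrank ℝ E with hC
  have hC0 : 0 ≤ C := by positivity
  have hcl : IsClosed {v : EnergySpace E | ‖v.fst - B v.fst‖ ≤ √C * h * ‖v‖} := by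
    have c1 : Continuous fun v : EnergySpace E => v.fst := (WithLp.fstL 2 ℝ _ _).continuous
    exact isClosed_le (c1.sub (B.continuous.comp c1)).norm (continuous_const.mul continuous_norm)
  refine ⟨B, hB1, fun v hv =>
    closure_minimal (s := (testEnergy O ϖ : Set (EnergySpace E))) ?_ hcl hv⟩
  rintro v ⟨η, h1, h2, h3, -⟩
  have e1 := hB2 η v.fst h1 h2
  have e2 : ∫ x, ‖∇ η x‖ ^ 2 = ‖v.snd.fst‖ ^ 2 := by
    rw [← real_inner_self_eq_norm_sq, integral_inner_congr_Lp h3 h3]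
    simp
  have e3 : ‖v.snd.fst‖ ^ 2 ≤ ‖v‖ ^ 2 := by
    rw [WithLp.prod_norm_sq_eq_of_L2 v, WithLp.prod_norm_sq_eq_of_L2 v.snd]
    nlinarith [sq_nonneg ‖v.fst‖, sq_nonneg ‖v.snd.snd‖]
  rw [e2] at e1
  refine (sq_le_sq₀ (norm_nonneg _) (by positivity)).1 ?_
  rw [mul_pow, mul_pow, Real.sq_sqrt hC0]
  exact e1.trans (by gcongr)

theorem isCompactOperator_of_approx {V H : Type*} [NormedAddCommGroup V] [NormedSpace ℝ V]
    [NormedAddCommGroup H] [NormedSpace ℝ H] [CompleteSpace H] (J : V →L[ℝ] H) {C : ℝ} (hC : 0 ≤ C)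
    (h : ∀ r > 0, ∃ B : H →L[ℝ] H, IsCompactOperator B ∧ ∀ v, ‖J v - B (J v)‖ ≤ C * r * ‖v‖) :
    IsCompactOperator J := by
  have hpos : ∀ n : ℕ, (0:ℝ) < 1 / ((n:ℝ) + 1) := fun n => by positivity
  choose B hB1 hB2 using fun n : ℕ => h _ (hpos n)
  have hlim : Tendsto (fun n => (B n).comp J) atTop (𝓝 J) := by
    rw [tendsto_iff_norm_sub_tendsto_zero]
    have hz : Tendsto (fun n : ℕ => C * (1 / ((n:ℝ) + 1))) atTop (𝓝 0) := by
      simpa using tendsto_one_div_add_atTop_nhds_zero_nat.const_mul C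
    refine squeeze_zero (fun n => norm_nonneg _) (fun n => ?_) hz
    refine ContinuousLinearMap.opNorm_le_bound _ (by have := hpos n; positivity) fun v => ?_
    have h1 := hB2 n v
    rw [norm_sub_rev] at h1
    exact h1
  exact isCompactOperator_of_tendsto hlim (Eventually.of_forall fun n => (hB1 n).comp_clm J)

theorem exists_restrict_clm.{u, v} {X : Type u} {H : Type v} [NormedAddCommGroup X]
    [InnerProductSpace ℝ X] [CompleteSpace X] [NormedAddCommGroup H] [NormedSpace ℝ H]
    (U : Submodule ℝ X) (hU : IsClosed (U : Set X)) (π : X →L[ℝ] H) :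
    ∃ (V : Type u) (_ : NormedAddCommGroup V) (_ : InnerProductSpace ℝ V) (_ : CompleteSpace V)
      (emb : V → X) (J : V →L[ℝ] H), (∀ v, emb v ∈ U) ∧
      (∀ v w, inner ℝ v w = inner ℝ (emb v) (emb w)) ∧ (∀ v, J v = π (emb v)) ∧
      ∀ e ∈ U, ∃ v, emb v = e :=
  ⟨U, inferInstance, inferInstance, hU.completeSpace_coe, fun v => v, π.comp U.subtypeL,
    fun v => v.2, fun _ _ => rfl, fun _ => rfl, fun e he => ⟨⟨e, he⟩, rfl⟩⟩

/-- The form domain of `-Δ + ϖ²` on `O`, presented abstractly. -/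
theorem exists_energy_domain.{u} {E : Type u} [NormedAddCommGroup E] [InnerProductSpace ℝ E]
    [FiniteDimensional ℝ E] [MeasurableSpace E] [BorelSpace E] {O : Set E}
    (hO : Bornology.IsBounded O) (hOm : MeasurableSet O) {ϖ : E → ℝ} (hϖ : Continuous ϖ) :
    ∃ (V : Type u) (_ : NormedAddCommGroup V) (_ : InnerProductSpace ℝ V) (_ : CompleteSpace V)
      (J : V →L[ℝ] Lp ℝ 2 (volume : Measure E)) (g : V → Lp E 2 (volume : Measure E))
      (p : V → Lp ℝ 2 (volume : Measure E)), IsCompactOperator J ∧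
      (∀ v w, inner ℝ v w = inner ℝ (J v) (J w) + (inner ℝ (g v) (g w) + inner ℝ (p v) (p w))) ∧
      (∀ v, ∃ f f', IsH01 O f f' ∧ J v =ᵐ[volume] f ∧ g v =ᵐ[volume] f' ∧
        p v =ᵐ[volume] fun x => ϖ x * f x) ∧
      ∀ η, IsTest O η → ∃ v, J v =ᵐ[volume] η ∧ g v =ᵐ[volume] ∇ η ∧
        p v =ᵐ[volume] fun x => ϖ x * η x := by
  obtain ⟨V, i1, i2, i3, emb, J, h1, h2, h3, h4⟩ :=
    exists_restrict_clm (testEnergy O ϖ).topologicalClosure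
      (Submodule.isClosed_topologicalClosure _) (WithLp.fstL 2 ℝ (Lp ℝ 2 (volume : Measure E))
        (WithLp 2 (Lp E 2 (volume : Measure E) × Lp ℝ 2 (volume : Measure E))))
  have h3' : ∀ v, J v = (emb v).fst := h3
  refine ⟨V, i1, i2, i3, J, fun v => (emb v).snd.fst, fun v => (emb v).snd.snd, ?_, ?_, ?_, ?_⟩
  · refine isCompactOperator_of_approx J (C := √(4 * 2 ^ Module.finrank ℝ E)) (by positivity) ?_
    intro r hr
    obtain ⟨B, hB, h⟩ := exists_finite_rank_energy_le hO hOm ϖ hr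
    refine ⟨B, hB, fun v => ?_⟩
    have hn : ‖v‖ = ‖emb v‖ := by
      rw [@norm_eq_sqrt_real_inner, @norm_eq_sqrt_real_inner, h2]
    rw [hn, h3']
    exact h _ (h1 v)
  · intro v w
    rw [h2, h3', h3', WithLp.prod_inner_apply, WithLp.prod_inner_apply]
    rfl
  · intro v
    rw [h3']
    exact exists_isH01_of_mem_closure hO hOm hϖ (h1 v)
  · intro η hη
    obtain ⟨e, he, e1, e2, e3⟩ := hη.exists_mem_testEnergy hϖ
    obtain ⟨v, hv⟩ := h4 e (Submodule.le_topologicalClosure _ he)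
    subst hv
    refine ⟨v, ?_⟩
    rw [h3']
    exact ⟨e1, e2, e3⟩

/-- An `L²(O)`-orthonormal basis of eigenfunctions of `-Δ + ϖ²` with Dirichlet condition in `O`. -/
structure IsEigenbasis (O : Set E) (ϖ : E → ℝ) {ι : Type*} (ψ : ι → E → ℝ) (G : ι → E → E)
    (lam : ι → ℝ) : Prop where
  hasLap : ∀ i, HasLap O (ψ i) (G i) (fun x => (ϖ x ^ 2 - lam i) * ψ i x)
  norm_one : ∀ i, ∫ x, ψ i x * ψ i x = 1
  orthogonal : ∀ i j, i ≠ j → ∫ x, ψ i x * ψ j x = 0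
  parseval : ∀ f : E → ℝ, MemLp f 2 volume → (∀ x ∉ O, f x = 0) →
    HasSum (fun i => (∫ x, f x * ψ i x) ^ 2) (∫ x, f x ^ 2)

theorem exists_eigenbasis_of_isCompactOperator.{u, v} {V : Type v} {H : Type u}
    [NormedAddCommGroup V] [InnerProductSpace ℝ V] [CompleteSpace V]
    [NormedAddCommGroup H] [InnerProductSpace ℝ H] [CompleteSpace H]
    [TopologicalSpace.SeparableSpace H] (J : V →L[ℝ] H) (hJ : IsCompactOperator J) :
    ∃ (ι : Type u) (_ : Countable ι) (b : HilbertBasis ι ℝ H) (κ : ι → ℝ) (A : H → V),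
      (∀ f w, inner ℝ (A f) w = inner ℝ f (J w)) ∧ (∀ i, J (A (b i)) = κ i • b i) ∧
      ∀ i, ‖A (b i)‖ ^ 2 = κ i := by
  set A := ContinuousLinearMap.adjoint J
  have hadj : ∀ f w, inner ℝ (A f) w = inner ℝ f (J w) := fun f w =>
    ContinuousLinearMap.adjoint_inner_left J w f
  have hKs : ((J.comp A : H →L[ℝ] H) : H →ₗ[ℝ] H).IsSymmetric := by
    intro f g
    change inner ℝ (J (A f)) g = inner ℝ f (J (A g))
    rw [← hadj, real_inner_comm, ← hadj, real_inner_comm]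
  obtain ⟨ι, hι, b, κ, hb⟩ := hKs.exists_eigenbasis (hJ.comp_clm A)
  have hb' : ∀ i, J (A (b i)) = κ i • b i := hb
  refine ⟨ι, hι, b, κ, A, hadj, hb', fun i => ?_⟩
  rw [← real_inner_self_eq_norm_sq, hadj, hb', real_inner_smul_right,
    real_inner_self_eq_norm_sq, b.orthonormal.1 i]
  simp

theorem exists_isEigenbasis.{u} {E : Type u} [NormedAddCommGroup E] [InnerProductSpace ℝ E]
    [FiniteDimensional ℝ E] [MeasurableSpace E] [BorelSpace E] {O : Set E} (hO : IsOpen O)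
    (hOb : Bornology.IsBounded O) {ϖ : E → ℝ} (hϖ : Continuous ϖ) :
    ∃ (ι : Type u) (_ : Countable ι) (ψ : ι → E → ℝ) (G : ι → E → E) (lam : ι → ℝ),
      IsEigenbasis O ϖ ψ G lam := by
  have hOm := hO.measurableSet
  have hsc : SecondCountableTopology E :=
    have := FiniteDimensional.proper ℝ E
    secondCountable_of_proper
  have h2top : Fact ((2 : ENNReal) ≠ ⊤) := ⟨by norm_num⟩
  have hsec : SecondCountableTopology (Lp ℝ 2 (volume : Measure E)) :=
    Lp.SecondCountableTopology
  obtain ⟨V, i1, i2, i3, J, g, p, hJc, hVin, hVrep, hVtest⟩ := exists_energy_domain hOb hOm hϖ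
  obtain ⟨ι, hι, b, κ, A, hadj, hb', hAA⟩ := exists_eigenbasis_of_isCompactOperator J hJc
  have hb1 : ∀ i, ‖b i‖ = 1 := fun i => b.orthonormal.1 i
  have hJA : ∀ i : {i // κ i ≠ 0}, J ((κ i)⁻¹ • A (b i)) = b i := fun i => by
    rw [map_smul, hb', smul_smul, inv_mul_cancel₀ i.2, one_smul]
  have hvec : ∀ i : {i // κ i ≠ 0}, ∃ f f', IsH01 O f f' ∧ b i =ᵐ[volume] f ∧
      g ((κ i)⁻¹ • A (b i)) =ᵐ[volume] f' ∧
      p ((κ i)⁻¹ • A (b i)) =ᵐ[volume] fun x => ϖ x * f x := by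
    intro i
    obtain ⟨f, f', h1, h2, h3, h4⟩ := hVrep ((κ i)⁻¹ • A (b i))
    rw [hJA] at h2
    exact ⟨f, f', h1, h2, h3, h4⟩
  choose ψ G hH hψ hG hW using hvec
  refine ⟨{i // κ i ≠ 0}, inferInstance, ψ, G, fun i => (κ i)⁻¹ - 1, ?_, ?_, ?_, ?_⟩
  · intro i
    have hm : MemLp (fun x => ψ i x * (ϖ x ^ 2 - ((κ i)⁻¹ - 1))) 2 (volume : Measure E) := by
      have hc : Continuous fun x => ϖ x ^ 2 - ((κ i)⁻¹ - 1) := by fun_prop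
      exact (hH i).memLp.smul_continuous hOb (hH i).zero hc
    refine ⟨hH i, by simpa [mul_comm] using hm, fun x hx => by simp [(hH i).zero x hx], ?_⟩
    intro η hη
    obtain ⟨e, e1, e2, e3⟩ := hVtest η hη
    have h1 : inner ℝ ((κ i)⁻¹ • A (b i)) e = (κ i)⁻¹ * inner ℝ (b i) (J e) := by
      rw [real_inner_smul_left, hadj]
    have h2 := hVin ((κ i)⁻¹ • A (b i)) e
    rw [hJA] at h2
    rw [h1, integral_inner_congr_Lp (hψ i) e1, integral_inner_congr_Lp (hG i) e2,
      integral_inner_congr_Lp (hW i) e3] at h2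
    simp only [RCLike.inner_apply, conj_trivial] at h2
    have m1 : Integrable fun x => η x * ψ i x := hη.memLp.mul_integrable (hH i).memLp
    have m2 : Integrable fun x => ϖ x * η x * (ϖ x * ψ i x) := by
      have a1 : MemLp (fun x => ϖ x * η x) 2 (volume : Measure E) :=
        (hϖ.mul hη.smooth.continuous).memLp_of_hasCompactSupport hη.compact.mul_left
      have a2 : MemLp (fun x => ϖ x * ψ i x) 2 (volume : Measure E) := by
        simpa using (hH i).memLp.continuous_smul hOb (hH i).zero hϖ
      exact a1.mul_integrable a2
    have h3 : ∫ x, (ϖ x ^ 2 - ((κ i)⁻¹ - 1)) * ψ i x * η x =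
        (∫ x, ϖ x * η x * (ϖ x * ψ i x)) - ((κ i)⁻¹ - 1) * ∫ x, η x * ψ i x := by
      rw [← integral_const_mul, ← integral_sub m2 (m1.const_mul _)]
      congr 1
      funext x
      ring
    rw [h3]
    linarith
  · intro i
    have h1 := integral_inner_congr_Lp (hψ i) (hψ i)
    rw [real_inner_self_eq_norm_sq, hb1] at h1
    simpa [sq] using h1.symm
  · intro i j hij
    have h1 := integral_inner_congr_Lp (hψ j) (hψ i)
    rw [b.orthonormal.2 (fun h => hij (Subtype.ext h.symm))] at h1
    simpa using h1.symm
  · intro f hf hf0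
    have h1 := b.hasSum_inner_mul_inner (hf.toLp f) (hf.toLp f)
    have h2 : inner ℝ (hf.toLp f) (hf.toLp f) = ∫ x, f x ^ 2 := by
      rw [integral_inner_congr_Lp hf.coeFn_toLp hf.coeFn_toLp]
      simp [sq]
    rw [h2] at h1
    have h3 : ∀ i, κ i = 0 → inner ℝ (hf.toLp f) (b i) = 0 := by
      intro i hi
      have hz : A (b i) = 0 := by
        have := hAA i
        rw [hi] at this
        simpa using this
      have h4 : ∀ᵐ x, x ∈ O → b i x = 0 := by
        refine hO.ae_eq_zero_of_integral_contDiff_smul_eq_zero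
          (((Lp.memLp (b i)).locallyIntegrable (by norm_num)).locallyIntegrableOn _) ?_
        intro η k1 k2 k3
        have hη : IsTest O η := ⟨k1, k2, k3⟩
        obtain ⟨e, e1, e2, e3⟩ := hVtest η hη
        have h5 := hadj (b i) e
        rw [hz, inner_zero_left, integral_inner_congr_Lp (EventuallyEq.refl _ _) e1] at h5
        simpa using h5.symm
      rw [integral_inner_congr_Lp hf.coeFn_toLp (EventuallyEq.refl _ _)]
      refine integral_eq_zero_of_ae ?_
      filter_upwards [h4] with x hx
      by_cases hxO : x ∈ O
      · simp [hx hxO]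
      · simp [hf0 x hxO]
    have h4 := (hasSum_subtype_iff_of_support_subset (s := {i | κ i ≠ 0}) (fun i hi hc => hi (by
      simp [h3 i hc]))).2 h1
    have h4' : HasSum (fun i : {i // κ i ≠ 0} => inner ℝ (hf.toLp f) (b i) *
        inner ℝ (b i) (hf.toLp f)) (∫ x, f x ^ 2) := h4
    convert h4' using 1
    funext i
    have h5 := integral_inner_congr_Lp hf.coeFn_toLp (hψ i)
    have h6 := integral_inner_congr_Lp (hψ i) hf.coeFn_toLp
    simp only [h5, h6, sq, RCLike.inner_apply, conj_trivial, mul_comm]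

theorem IsEigenbasis.integral_energy {O : Set E} {ϖ : E → ℝ} {ι : Type*} {ψ : ι → E → ℝ}
    {G : ι → E → E} {lam : ι → ℝ} (h : IsEigenbasis O ϖ ψ G lam) (i : ι) :
    (∫ x, ‖G i x‖ ^ 2) + ∫ x, (ϖ x ^ 2 - lam i) * ψ i x * ψ i x = 0 := by
  have := (h.hasLap i).weak_ext (h.hasLap i).isH01
  simpa [real_inner_self_eq_norm_sq] using this

section L2Curve

variable {F : Type*} [NormedAddCommGroup F] [InnerProductSpace ℝ F]

/-- Pointwise differentiability near time `t` of a curve of functions, dominated in `L²`. -/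
def L2DerivAt (P P' : ℝ → E → F) (t : ℝ) : Prop :=
  ∃ b : E → ℝ, MemLp b 2 (volume : Measure E) ∧ ∀ᶠ s in 𝓝 t,
    AEStronglyMeasurable (P s) (volume : Measure E) ∧
    AEStronglyMeasurable (P' s) (volume : Measure E) ∧
    ∀ x, HasDerivAt (fun s => P s x) (P' s x) s ∧ ‖P s x‖ ≤ b x ∧ ‖P' s x‖ ≤ b x

namespace L2DerivAt

variable {P P' Q Q' : ℝ → E → F} {t : ℝ}

theorem congr (h : L2DerivAt P P' t) {S S' : ℝ → E → F}
    (hS : ∀ᶠ s in 𝓝 t, ∀ x, P s x = S s x) (hS' : ∀ᶠ s in 𝓝 t, ∀ x, P' s x = S' s x) :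
    L2DerivAt S S' t := by
  obtain ⟨b, hb, h⟩ := h
  refine ⟨b, hb, ?_⟩
  filter_upwards [h, hS, hS', hS.eventually_nhds] with s h1 h2 h3 h4
  rw [← (funext h2 : P s = S s), ← (funext h3 : P' s = S' s)]
  refine ⟨h1.1, h1.2.1, fun x => ⟨(h1.2.2 x).1.congr_of_eventuallyEq ?_, (h1.2.2 x).2⟩⟩
  filter_upwards [h4] with r hr
  exact (hr x).symm

theorem memLp (h : L2DerivAt P P' t) : MemLp (P t) 2 (volume : Measure E) := by
  obtain ⟨b, hb, h⟩ := h
  have h1 := h.self_of_nhds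
  exact hb.mono h1.1 (Eventually.of_forall fun x =>
    (h1.2.2 x).2.1.trans (le_abs_self _))

theorem memLp_deriv (h : L2DerivAt P P' t) : MemLp (P' t) 2 (volume : Measure E) := by
  obtain ⟨b, hb, h⟩ := h
  have h1 := h.self_of_nhds
  exact hb.mono h1.2.1 (Eventually.of_forall fun x =>
    (h1.2.2 x).2.2.trans (le_abs_self _))

theorem add (h : L2DerivAt P P' t) (h' : L2DerivAt Q Q' t) :
    L2DerivAt (fun s x => P s x + Q s x) (fun s x => P' s x + Q' s x) t := by
  obtain ⟨b, hb, h⟩ := h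
  obtain ⟨b', hb', h'⟩ := h'
  refine ⟨fun x => b x + b' x, hb.add hb', ?_⟩
  filter_upwards [h, h'] with s h1 h2
  exact ⟨h1.1.add h2.1, h1.2.1.add h2.2.1, fun x => ⟨(h1.2.2 x).1.add (h2.2.2 x).1,
    (norm_add_le _ _).trans (add_le_add (h1.2.2 x).2.1 (h2.2.2 x).2.1),
    (norm_add_le _ _).trans (add_le_add (h1.2.2 x).2.2 (h2.2.2 x).2.2)⟩⟩

theorem of_zero : L2DerivAt (fun _ _ => 0) (fun _ _ => 0 : ℝ → E → F) t :=
  ⟨fun _ => 0, MemLp.zero, Eventually.of_forall fun s =>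
    ⟨aestronglyMeasurable_const, aestronglyMeasurable_const, fun x =>
      ⟨hasDerivAt_const _ _, by simp, by simp⟩⟩⟩

theorem sum {ι : Type*} (s : Finset ι) {P P' : ι → ℝ → E → F}
    (h : ∀ i ∈ s, L2DerivAt (P i) (P' i) t) :
    L2DerivAt (fun r x => ∑ i ∈ s, P i r x) (fun r x => ∑ i ∈ s, P' i r x) t := by
  classical
  induction s using Finset.induction_on with
  | empty => simpa using of_zero
  | insert a s ha ih =>
    simp only [Finset.sum_insert ha]
    exact (h a (by simp)).add (ih fun i hi => h i (by simp [hi]))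

theorem smul_mul {κ κ' : ℝ → E → ℝ} {O : Set E} (h : L2DerivAt P P' t)
    (h0 : ∀ s, ∀ x ∉ O, P s x = 0) (h0' : ∀ s, ∀ x ∉ O, P' s x = 0)
    {C : ℝ} (hκ : ∀ᶠ s in 𝓝 t, Continuous (κ s) ∧ Continuous (κ' s) ∧
      (∀ x, HasDerivAt (fun s => κ s x) (κ' s x) s) ∧ ∀ x ∈ O, |κ s x| ≤ C ∧ |κ' s x| ≤ C) :
    L2DerivAt (fun s x => κ s x • P s x) (fun s x => κ s x • P' s x + κ' s x • P s x) t := by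
  obtain ⟨b, hb, h⟩ := h
  refine ⟨fun x => (2 * |C|) * b x, hb.const_mul _, ?_⟩
  filter_upwards [h, hκ] with s h1 h2
  refine ⟨h2.1.aestronglyMeasurable.smul h1.1, (h2.1.aestronglyMeasurable.smul h1.2.1).add
    (h2.2.1.aestronglyMeasurable.smul h1.1), fun x => ?_⟩
  have h3 := h1.2.2 x
  have hb0 : 0 ≤ b x := (norm_nonneg _).trans h3.2.1
  refine ⟨(h2.2.2.1 x).smul h3.1, ?_⟩
  by_cases hx : x ∈ O
  · obtain ⟨h4, h5⟩ := h2.2.2.2 x hx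
    replace h4 := h4.trans (le_abs_self C)
    replace h5 := h5.trans (le_abs_self C)
    have e1 : ‖κ s x • P s x‖ ≤ |C| * b x := by
      rw [norm_smul]
      exact mul_le_mul h4 h3.2.1 (norm_nonneg _) (abs_nonneg _)
    have e2 : ‖κ s x • P' s x‖ ≤ |C| * b x := by
      rw [norm_smul]
      exact mul_le_mul h4 h3.2.2 (norm_nonneg _) (abs_nonneg _)
    have e3 : ‖κ' s x • P s x‖ ≤ |C| * b x := by
      rw [norm_smul]
      exact mul_le_mul h5 h3.2.1 (norm_nonneg _) (abs_nonneg _)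
    have hCb : 0 ≤ |C| * b x := by positivity
    refine ⟨by linarith, (norm_add_le _ _).trans (by linarith)⟩
  · have hCb : 0 ≤ 2 * |C| * b x := by positivity
    simpa [h0 s x hx, h0' s x hx] using hCb

theorem hasDerivAt_integral_inner (h : L2DerivAt P P' t) (h' : L2DerivAt Q Q' t) :
    HasDerivAt (fun s => ∫ x, inner ℝ (P s x) (Q s x))
      ((∫ x, inner ℝ (P' t x) (Q t x)) + ∫ x, inner ℝ (P t x) (Q' t x)) t := by
  have m1 := h.memLp
  have m2 := h.memLp_deriv
  have m3 := h'.memLp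
  have m4 := h'.memLp_deriv
  obtain ⟨b, hb, h⟩ := h
  obtain ⟨b', hb', h'⟩ := h'
  rw [← integral_add (m2.inner_integrable m3) (m1.inner_integrable m4)]
  have hh := h.and h'
  refine (hasDerivAt_integral_of_dominated_loc_of_deriv_le (s := {s | _}) (μ := volume)
    (F := fun s x => inner ℝ (P s x) (Q s x))
    (F' := fun s x => inner ℝ (P' s x) (Q s x) + inner ℝ (P s x) (Q' s x))
    (bound := fun x => 2 * (b x * b' x)) hh ?_ (m1.inner_integrable m3)
    ((m2.inner_integrable m3).add (m1.inner_integrable m4)).1 ?_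
    ((hb.mul_integrable hb').const_mul _) ?_).2
  · filter_upwards [hh] with s hs
    exact hs.1.1.inner hs.2.1
  · refine Eventually.of_forall fun x s hs => ?_
    obtain ⟨e1, e2, e3⟩ := hs.1.2.2 x
    obtain ⟨e4, e5, e6⟩ := hs.2.2.2 x
    have a1 : |inner ℝ (P' s x) (Q s x)| ≤ b x * b' x :=
      (abs_real_inner_le_norm _ _).trans (mul_le_mul e3 e5 (norm_nonneg _)
        ((norm_nonneg _).trans e2))
    have a2 : |inner ℝ (P s x) (Q' s x)| ≤ b x * b' x :=
      (abs_real_inner_le_norm _ _).trans (mul_le_mul e2 e6 (norm_nonneg _)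
        ((norm_nonneg _).trans e2))
    rw [norm_eq_abs]
    exact (abs_add_le _ _).trans (by linarith)
  · refine Eventually.of_forall fun x s hs => ?_
    rw [add_comm]
    exact (hs.1.2.2 x).1.inner ℝ (hs.2.2.2 x).1

theorem hasDerivAt_integral_sq {P P' : ℝ → E → ℝ} (h : L2DerivAt P P' t) :
    HasDerivAt (fun s => ∫ x, P s x ^ 2) (2 * ∫ x, P t x * P' t x) t := by
  have := h.hasDerivAt_integral_inner h
  simp only [RCLike.inner_apply, conj_trivial] at this
  convert this using 1
  · simp only [sq]
  · rw [two_mul]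
    congr 1
    simp only [mul_comm]

theorem hasDerivAt_integral_normSq {P P' : ℝ → E → F} (h : L2DerivAt P P' t) :
    HasDerivAt (fun s => ∫ x, ‖P s x‖ ^ 2) (2 * ∫ x, inner ℝ (P t x) (P' t x)) t := by
  have := h.hasDerivAt_integral_inner h
  simp only [real_inner_self_eq_norm_sq] at this
  convert this using 1
  rw [two_mul]
  congr 1
  simp only [real_inner_comm]

end L2DerivAt

end L2Curve

/-- Differential inequality behind the monotonicity of the frequency function of a solution of
`v_t = Δv + q v - 2a (x - x₀)·∇v - a d v + f`. -/
theorem frequency_deriv_le {O : Set E} (hO : Bornology.IsBounded O) {v vt : ℝ → E → ℝ}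
    {G Gt : ℝ → E → E} {g f : E → ℝ} {q q' : ℝ → E → ℝ} {a t : ℝ} {x₀ : E}
    (hv : L2DerivAt v vt t) (hG : L2DerivAt G Gt t)
    (hqv : L2DerivAt (fun s x => q s x * v s x)
      (fun s x => q s x * vt s x + q' s x * v s x) t)
    (hlap : HasLap O (v t) (G t) g) (hvt : IsH01 O (vt t) (Gt t)) (hq : ContDiff ℝ ∞ (q t))
    (hf : MemLp f 2 (volume : Measure E))
    (heq : ∀ x, vt t x = g x + q t x * v t x - 2 * a * inner ℝ (x - x₀) (G t x)
      - a * Module.finrank ℝ E * v t x + f x)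
    (hR : a * (∫ x, g x * inner ℝ (x - x₀) (G t x)) ≤
      a * ((Module.finrank ℝ E / 2 - 1) * ∫ x, ‖G t x‖ ^ 2)) :
    HasDerivAt (fun s => ∫ x, v s x ^ 2)
      (-2 * ((∫ x, ‖G t x‖ ^ 2) - ∫ x, q t x * v t x * v t x) + 2 * ∫ x, v t x * f x) t ∧
    ∃ D', HasDerivAt (fun s => (∫ x, ‖G s x‖ ^ 2) - ∫ x, q s x * v s x * v s x) D' t ∧
      D' * (∫ x, v t x ^ 2) - ((∫ x, ‖G t x‖ ^ 2) - ∫ x, q t x * v t x * v t x) *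
        (-2 * ((∫ x, ‖G t x‖ ^ 2) - ∫ x, q t x * v t x * v t x) + 2 * ∫ x, v t x * f x) ≤
      (∫ x, v t x ^ 2) * (-4 * a * (∫ x, ‖G t x‖ ^ 2)
        - (∫ x, (2 * a * inner ℝ (∇ (q t) x) (x - x₀) + q' t x) * v t x ^ 2)
        + 1 / 2 * ∫ x, f x ^ 2) := by
  set d : ℝ := (Module.finrank ℝ E : ℝ) with hd
  have cy : Continuous (fun x : E => x - x₀) := continuous_id.sub continuous_const
  have hH := hlap.isH01
  have mv : MemLp (fun x => v t x) 2 (volume : Measure E) := hH.memLp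
  have mg : MemLp (fun x => g x) 2 (volume : Measure E) := hlap.memLp
  have mq : MemLp (fun x => q t x * v t x) 2 (volume : Measure E) := hqv.memLp
  have mp : MemLp (fun x => inner ℝ (x - x₀) (G t x)) 2 (volume : Measure E) := by
    simpa only [real_inner_comm] using hH.memLp_grad.inner_continuous hO hH.zero_grad cy
  have mf : MemLp (fun x => f x) 2 (volume : Measure E) := hf
  have mqt : MemLp (fun x => q t x * vt t x) 2 (volume : Measure E) := by
    simpa using hvt.memLp.continuous_smul hO hvt.zero hq.continuous
  have mq' : MemLp (fun x => q' t x * v t x) 2 (volume : Measure E) := by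
    have := hqv.memLp_deriv.sub mqt
    refine (memLp_congr_ae (Eventually.of_forall fun x => ?_)).1 this
    simp
  have mgq : MemLp (fun x => inner ℝ (∇ (q t) x) (x - x₀) * v t x) 2 (volume : Measure E) := by
    simpa using hH.memLp.continuous_smul hO hH.zero (hq.continuous_gradient.inner cy)
  have hexp : ∀ h : E → ℝ, MemLp h 2 (volume : Measure E) → ∫ x, h x * vt t x =
      (∫ x, h x * g x) + (∫ x, h x * (q t x * v t x)) -
        2 * a * (∫ x, h x * inner ℝ (x - x₀) (G t x)) - a * d * (∫ x, h x * v t x) +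
        ∫ x, h x * f x := by
    intro h mh
    rw [sub_eq_add_neg, sub_eq_add_neg, ← neg_mul (2 * a), ← neg_mul (a * d),
      ← integral_const_mul, ← integral_const_mul,
      ← integral_add (mh.mul_integrable mg) (mh.mul_integrable mq),
      ← integral_add ((mh.mul_integrable mg).fun_add (mh.mul_integrable mq))
        ((mh.mul_integrable mp).const_mul _),
      ← integral_add (((mh.mul_integrable mg).fun_add (mh.mul_integrable mq)).fun_add
        ((mh.mul_integrable mp).const_mul _)) ((mh.mul_integrable mv).const_mul _),
      ← integral_add ((((mh.mul_integrable mg).fun_add (mh.mul_integrable mq)).fun_add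
        ((mh.mul_integrable mp).const_mul _)).fun_add ((mh.mul_integrable mv).const_mul _))
        (mh.mul_integrable mf)]
    congr 1
    funext x
    rw [heq]
    ring
  have e1 := hexp _ mv
  have e2 := hexp _ mg
  have e3 := hexp _ mq
  have w1 := hlap.weak_ext hH
  have w2 := hlap.weak_ext hvt
  have w3 : 2 * (∫ x, v t x * inner ℝ (x - x₀) (G t x)) + d * (∫ x, v t x * v t x) = 0 := by
    have := hH.virial hO hH (k := fun _ => 1) contDiff_const x₀
    rw [← this, ← integral_const_mul, ← integral_const_mul,
      ← integral_add ((mv.mul_integrable mp).const_mul _) ((mv.mul_integrable mv).const_mul _),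
      ← integral_add]
    · congr 1
      funext x
      simp [gradient, inner_smul_left]
      ring
    · have := mv.mul_integrable mp
      refine this.congr (Eventually.of_forall fun x => ?_)
      simp [inner_smul_left]
    · have := (mp.mul_integrable mv).add ((mv.mul_integrable mv).const_mul d)
      refine this.congr (Eventually.of_forall fun x => ?_)
      simp [gradient]
      ring
  have w4 : 2 * (∫ x, q t x * v t x * inner ℝ (x - x₀) (G t x)) +
      d * (∫ x, q t x * v t x * v t x) +
      (∫ x, inner ℝ (∇ (q t) x) (x - x₀) * v t x * v t x) = 0 := by
    have := hH.virial hO hH (k := q t) hq x₀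
    rw [← this, ← integral_const_mul, ← integral_const_mul,
      ← integral_add ((mq.mul_integrable mp).const_mul _) ((mq.mul_integrable mv).const_mul _),
      ← integral_add (((mq.mul_integrable mp).const_mul _).fun_add
        ((mq.mul_integrable mv).const_mul _)) (mgq.mul_integrable mv), ← integral_add]
    · congr 1
      funext x
      simp [inner_smul_left]
      ring
    · have := mq.mul_integrable mp
      refine this.congr (Eventually.of_forall fun x => ?_)
      simp [inner_smul_left]
      ring
    · have := ((mq.mul_integrable mp).add ((mq.mul_integrable mv).const_mul d)).add
        (mgq.mul_integrable mv)
      refine this.congr (Eventually.of_forall fun x => ?_)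
      simp
      ring
  have hGG : (∫ x, inner ℝ (G t x) (G t x)) = ∫ x, ‖G t x‖ ^ 2 := by
    simp only [real_inner_self_eq_norm_sq]
  rw [hGG] at w1
  have d1 := hv.hasDerivAt_integral_sq
  have d2 := hG.hasDerivAt_integral_normSq
  have d3 := hqv.hasDerivAt_integral_inner hv
  simp only [RCLike.inner_apply, conj_trivial] at d3
  have d3' : HasDerivAt (fun s => ∫ x, q s x * v s x * v s x)
      (2 * (∫ x, q t x * v t x * vt t x) + ∫ x, q' t x * v t x * v t x) t := by
    convert d3 using 1
    · funext s
      congr 1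
      funext x
      ring
    · have i1 : ∫ x, v t x * (q t x * vt t x + q' t x * v t x) =
          (∫ x, q t x * v t x * vt t x) + ∫ x, q' t x * v t x * v t x := by
        rw [← integral_add (mq.mul_integrable hvt.memLp) (mq'.mul_integrable mv)]
        congr 1
        funext x
        ring
      have i2 : ∫ x, vt t x * (q t x * v t x) = ∫ x, q t x * v t x * vt t x := by
        simp only [mul_comm]
      rw [i1, i2]
      ring
  have sv : (∫ x, v t x * v t x) = ∫ x, v t x ^ 2 := by simp only [sq]
  have hcs := sq_integral_mul_le (f := fun x => v t x)
    (g := fun x => g x + q t x * v t x + 1 / 2 * f x) mv ((mg.add mq).add (mf.const_mul _))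
  have c1 : ∫ x, v t x * (g x + q t x * v t x + 1 / 2 * f x) =
      (∫ x, v t x * g x) + (∫ x, v t x * (q t x * v t x)) + 1 / 2 * ∫ x, v t x * f x := by
    rw [← integral_const_mul, ← integral_add (mv.mul_integrable mg) (mv.mul_integrable mq),
      ← integral_add ((mv.mul_integrable mg).fun_add (mv.mul_integrable mq))
        ((mv.mul_integrable mf).const_mul _)]
    congr 1
    funext x
    ring
  have c2 : ∫ x, (g x + q t x * v t x + 1 / 2 * f x) ^ 2 =
      (∫ x, g x * g x) + 2 * (∫ x, g x * (q t x * v t x)) +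
        (∫ x, q t x * v t x * (q t x * v t x)) + (∫ x, g x * f x) + (∫ x, q t x * v t x * f x) +
        1 / 4 * ∫ x, f x ^ 2 := by
    have hff : ∫ x, f x ^ 2 = ∫ x, f x * f x := by simp only [sq]
    rw [hff, ← integral_const_mul, ← integral_const_mul,
      ← integral_add (mg.mul_integrable mg) ((mg.mul_integrable mq).const_mul _),
      ← integral_add ((mg.mul_integrable mg).fun_add ((mg.mul_integrable mq).const_mul _))
        (mq.mul_integrable mq),
      ← integral_add (((mg.mul_integrable mg).fun_add ((mg.mul_integrable mq).const_mul _)).fun_add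
        (mq.mul_integrable mq)) (mg.mul_integrable mf),
      ← integral_add ((((mg.mul_integrable mg).fun_add
        ((mg.mul_integrable mq).const_mul _)).fun_add
        (mq.mul_integrable mq)).fun_add (mg.mul_integrable mf)) (mq.mul_integrable mf),
      ← integral_add (((((mg.mul_integrable mg).fun_add
        ((mg.mul_integrable mq).const_mul _)).fun_add
        (mq.mul_integrable mq)).fun_add (mg.mul_integrable mf)).fun_add (mq.mul_integrable mf))
        ((mf.mul_integrable mf).const_mul _)]
    congr 1
    funext x
    ring
  have c3 : (∫ x, (2 * a * inner ℝ (∇ (q t) x) (x - x₀) + q' t x) * v t x ^ 2) =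
      2 * a * (∫ x, inner ℝ (∇ (q t) x) (x - x₀) * v t x * v t x) +
        ∫ x, q' t x * v t x * v t x := by
    rw [← integral_const_mul, ← integral_add ((mgq.mul_integrable mv).const_mul _)
      (mq'.mul_integrable mv)]
    congr 1
    funext x
    ring
  have k1 : ∫ x, v t x * (q t x * v t x) = ∫ x, q t x * v t x * v t x := by
    simp only [mul_comm]
  have k2 : ∫ x, q t x * v t x * g x = ∫ x, g x * (q t x * v t x) := by
    simp only [mul_comm]
  have k3 : ∫ x, v t x * g x = ∫ x, g x * v t x := by
    simp only [mul_comm]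
  rw [c1, c2, k1, k3] at hcs
  rw [k1, k3, sv] at e1
  rw [k2] at e3
  rw [sv] at w3
  refine ⟨?_, _, d2.sub d3', ?_⟩
  · convert d1 using 1
    rw [e1]
    linear_combination -2 * w1 + 2 * a * w3
  · rw [c3]
    have hH0 : 0 ≤ ∫ x, v t x ^ 2 := integral_nonneg fun x => sq_nonneg _
    have hN : ∫ x, g x * v t x = -∫ x, ‖G t x‖ ^ 2 := by linarith
    have hGt : ∫ x, inner ℝ (G t x) (Gt t x) = -∫ x, g x * vt t x := by linarith
    rw [hGt, e2, e3, hN]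
    rw [hN] at hcs
    have hs := mul_le_mul_of_nonneg_left hR hH0
    generalize (∫ x, v t x ^ 2) = H at *
    generalize (∫ x, ‖G t x‖ ^ 2) = A at *
    generalize (∫ x, q t x * v t x * v t x) = B at *
    generalize (∫ x, v t x * f x) = f1 at *
    generalize (∫ x, q t x * v t x * inner ℝ (x - x₀) (G t x)) = qp at *
    generalize (∫ x, g x * inner ℝ (x - x₀) (G t x)) = gp at *
    have w4' := congrArg (fun r => 2 * a * H * r) w4
    simp only [mul_zero] at w4'
    linarith [hcs, sq_nonneg f1]

/-- Regular solutions of the heat equation `u_t = Δu - μ²‖x‖² u` with Dirichlet condition in `O`. -/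
structure IsFlow (O : Set E) (μ : ℝ) (u ut : ℝ → E → ℝ) (G Gt : ℝ → E → E) : Prop where
  lap : ∀ t, HasLap O (u t) (G t) (fun x => μ ^ 2 * ‖x‖ ^ 2 * u t x + ut t x)
  isH01 : ∀ t, IsH01 O (ut t) (Gt t)
  derivU : ∀ t, L2DerivAt u ut t
  derivG : ∀ t, L2DerivAt G Gt t

/-- Gaussian weight with a radial cutoff. -/
noncomputable def gWeight (X : ℝ → ℝ) (x₀ : E) (α : ℝ) (x : E) : ℝ :=
  X (‖x - x₀‖ ^ 2) * exp (α / 2 * ‖x - x₀‖ ^ 2)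

/-- Radial factor of the gradient of `gWeight`. -/
noncomputable def gWeight' (X : ℝ → ℝ) (x₀ : E) (α : ℝ) (x : E) : ℝ :=
  (α * X (‖x - x₀‖ ^ 2) + 2 * deriv X (‖x - x₀‖ ^ 2)) * exp (α / 2 * ‖x - x₀‖ ^ 2)

theorem eventually_bound_of_continuous {O : Set E} (hO : Bornology.IsBounded O)
    {Φ : ℝ × ℝ × E → ℝ} (hΦ : Continuous Φ) {a b : ℝ → ℝ} {t : ℝ} (ha : ContinuousAt a t)
    (hb : ContinuousAt b t) : ∃ C : ℝ, ∀ᶠ s in 𝓝 t, ∀ x ∈ O, |Φ (a s, b s, x)| ≤ C := by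
  have hK : IsCompact (closedBall (a t) 1 ×ˢ (closedBall (b t) 1 ×ˢ closure O)) :=
    (isCompact_closedBall _ _).prod ((isCompact_closedBall _ _).prod hO.isCompact_closure)
  obtain ⟨C, hC⟩ := hK.exists_bound_of_continuousOn hΦ.continuousOn
  refine ⟨C, ?_⟩
  filter_upwards [ha.eventually (closedBall_mem_nhds _ one_pos),
    hb.eventually (closedBall_mem_nhds _ one_pos)] with s h1 h2 x hx
  exact hC (a s, b s, x) ⟨h1, h2, subset_closure hx⟩

theorem L2DerivAt.smul_field {P P' : ℝ → E → ℝ} {t : ℝ} (h : L2DerivAt P P' t) {O : Set E}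
    (hO : Bornology.IsBounded O) (h0 : ∀ s, ∀ x ∉ O, P s x = 0) (h0' : ∀ s, ∀ x ∉ O, P' s x = 0)
    {w : E → E} (hw : Continuous w) :
    L2DerivAt (fun s x => P s x • w x) (fun s x => P' s x • w x) t := by
  obtain ⟨b, hb, h⟩ := h
  obtain ⟨C, hC0, hC⟩ := hO.exists_bound_of_continuous hw
  refine ⟨fun x => C * b x, hb.const_mul _, ?_⟩
  filter_upwards [h] with s hs
  refine ⟨hs.1.smul hw.aestronglyMeasurable, hs.2.1.smul hw.aestronglyMeasurable, fun x => ?_⟩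
  obtain ⟨h1, h2, h3⟩ := hs.2.2 x
  have hb0 : 0 ≤ b x := (norm_nonneg _).trans h2
  refine ⟨h1.smul_const _, ?_⟩
  by_cases hx : x ∈ O
  · rw [norm_smul, norm_smul, mul_comm, mul_comm ‖P' s x‖]
    exact ⟨mul_le_mul (hC x hx) h2 (norm_nonneg _) hC0,
      mul_le_mul (hC x hx) h3 (norm_nonneg _) hC0⟩
  · have : 0 ≤ C * b x := by positivity
    simpa [h0 s x hx, h0' s x hx] using this

section

variable {X : ℝ → ℝ} (hX : ContDiff ℝ ∞ X) (x₀ : E)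
include hX

theorem contDiff_deriv_of_smooth : ContDiff ℝ ∞ (deriv X) :=
  (contDiff_infty_iff_deriv.1 hX).2

theorem contDiff_gWeight (α : ℝ) : ContDiff ℝ ∞ (gWeight X x₀ α) :=
  contDiff_radial (M := fun r => X r * exp (α / 2 * r))
    (hX.mul (Real.contDiff_exp.comp (contDiff_const.mul contDiff_id))) x₀

theorem contDiff_gWeight' (α : ℝ) : ContDiff ℝ ∞ (gWeight' X x₀ α) :=
  contDiff_radial (M := fun r => (α * X r + 2 * deriv X r) * exp (α / 2 * r))
    (((contDiff_const.mul hX).add (contDiff_const.mul (contDiff_deriv_of_smooth hX))).mul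
      (Real.contDiff_exp.comp (contDiff_const.mul contDiff_id))) x₀

omit hX in
theorem hasDerivAt_exp_mul (c r : ℝ) :
    HasDerivAt (fun r => exp (c * r)) (exp (c * r) * c) r := by
  simpa using ((hasDerivAt_id r).const_mul c).exp

theorem gradient_gWeight (α : ℝ) (x : E) :
    ∇ (gWeight X x₀ α) x = gWeight' X x₀ α x • (x - x₀) := by
  have h1 := ((hX.differentiable (by simp)) (‖x - x₀‖ ^ 2)).hasDerivAt
  have h := gradient_radial (M := fun r => X r * exp (α / 2 * r)) x₀ x
    (h1.mul (hasDerivAt_exp_mul _ _))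
  refine h.trans ?_
  congr 1
  simp only [gWeight']
  ring

theorem gradient_gWeight' (α : ℝ) (x : E) :
    ∇ (gWeight' X x₀ α) x = ((2 * α * deriv X (‖x - x₀‖ ^ 2) + 4 * deriv (deriv X) (‖x - x₀‖ ^ 2)) *
      exp (α / 2 * ‖x - x₀‖ ^ 2) + α * gWeight' X x₀ α x) • (x - x₀) := by
  have h1 := ((hX.differentiable (by simp)) (‖x - x₀‖ ^ 2)).hasDerivAt
  have h2 := (((contDiff_deriv_of_smooth hX).differentiable (by simp)) (‖x - x₀‖ ^ 2)).hasDerivAt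
  have h := gradient_radial (M := fun r => (α * X r + 2 * deriv X r) * exp (α / 2 * r)) x₀ x
    (((h1.const_mul α).add (h2.const_mul 2)).mul (hasDerivAt_exp_mul _ _))
  refine h.trans ?_
  congr 1
  simp only [gWeight', Pi.add_apply]
  ring

theorem hasDerivAt_gWeight {a : ℝ → ℝ} {a' s : ℝ} (ha : HasDerivAt a a' s) (x : E) :
    HasDerivAt (fun s => gWeight X x₀ (a s) x)
      (a' / 2 * ‖x - x₀‖ ^ 2 * gWeight X x₀ (a s) x) s := by
  have h := (((ha.div_const 2).mul_const (‖x - x₀‖ ^ 2)).exp).const_mul (X (‖x - x₀‖ ^ 2))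
  refine h.congr_deriv ?_
  simp only [gWeight]
  ring

theorem hasDerivAt_gWeight' {a : ℝ → ℝ} {a' s : ℝ} (ha : HasDerivAt a a' s) (x : E) :
    HasDerivAt (fun s => gWeight' X x₀ (a s) x)
      (a' * gWeight X x₀ (a s) x + a' / 2 * ‖x - x₀‖ ^ 2 * gWeight' X x₀ (a s) x) s := by
  have h := ((ha.mul_const (X (‖x - x₀‖ ^ 2))).add_const (2 * deriv X (‖x - x₀‖ ^ 2))).mul
    ((ha.div_const 2).mul_const (‖x - x₀‖ ^ 2)).exp
  refine h.congr_deriv ?_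
  simp only [gWeight, gWeight']
  ring

theorem eventually_gWeight {O : Set E} (hO : Bornology.IsBounded O) {a a' : ℝ → ℝ} {t : ℝ}
    (ha : ∀ᶠ s in 𝓝 t, HasDerivAt a (a' s) s) (ha' : ContinuousAt a' t) :
    ∃ C, ∀ᶠ s in 𝓝 t, Continuous (fun x => gWeight X x₀ (a s) x) ∧
      Continuous (fun x => a' s / 2 * ‖x - x₀‖ ^ 2 * gWeight X x₀ (a s) x) ∧
      (∀ x, HasDerivAt (fun s => gWeight X x₀ (a s) x)
        (a' s / 2 * ‖x - x₀‖ ^ 2 * gWeight X x₀ (a s) x) s) ∧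
      ∀ x ∈ O, |gWeight X x₀ (a s) x| ≤ C ∧
        |a' s / 2 * ‖x - x₀‖ ^ 2 * gWeight X x₀ (a s) x| ≤ C := by
  have c1 := hX.continuous
  obtain ⟨C1, h1⟩ := eventually_bound_of_continuous hO (Φ := fun p =>
    X (‖p.2.2 - x₀‖ ^ 2) * exp (p.1 / 2 * ‖p.2.2 - x₀‖ ^ 2)) (by fun_prop)
    ha.self_of_nhds.continuousAt ha'
  obtain ⟨C2, h2⟩ := eventually_bound_of_continuous hO (Φ := fun p =>
    p.2.1 / 2 * ‖p.2.2 - x₀‖ ^ 2 *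
      (X (‖p.2.2 - x₀‖ ^ 2) * exp (p.1 / 2 * ‖p.2.2 - x₀‖ ^ 2))) (by fun_prop)
    ha.self_of_nhds.continuousAt ha'
  refine ⟨max C1 C2, ?_⟩
  filter_upwards [h1, h2, ha] with s e1 e2 e3
  have c2 := (contDiff_gWeight hX x₀ (a s)).continuous
  exact ⟨c2, by fun_prop, fun x => hasDerivAt_gWeight hX x₀ e3 x, fun x hx =>
    ⟨(e1 x hx).trans (le_max_left _ _), (e2 x hx).trans (le_max_right _ _)⟩⟩

theorem eventually_gWeight' {O : Set E} (hO : Bornology.IsBounded O) {a a' : ℝ → ℝ} {t : ℝ}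
    (ha : ∀ᶠ s in 𝓝 t, HasDerivAt a (a' s) s) (ha' : ContinuousAt a' t) :
    ∃ C, ∀ᶠ s in 𝓝 t, Continuous (fun x => gWeight' X x₀ (a s) x) ∧
      Continuous (fun x => a' s * gWeight X x₀ (a s) x +
        a' s / 2 * ‖x - x₀‖ ^ 2 * gWeight' X x₀ (a s) x) ∧
      (∀ x, HasDerivAt (fun s => gWeight' X x₀ (a s) x)
        (a' s * gWeight X x₀ (a s) x + a' s / 2 * ‖x - x₀‖ ^ 2 * gWeight' X x₀ (a s) x) s) ∧
      ∀ x ∈ O, |gWeight' X x₀ (a s) x| ≤ C ∧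
        |a' s * gWeight X x₀ (a s) x + a' s / 2 * ‖x - x₀‖ ^ 2 * gWeight' X x₀ (a s) x| ≤ C := by
  have c1 := hX.continuous
  have c1' := (contDiff_deriv_of_smooth hX).continuous
  obtain ⟨C1, h1⟩ := eventually_bound_of_continuous hO (Φ := fun p =>
    (p.1 * X (‖p.2.2 - x₀‖ ^ 2) + 2 * deriv X (‖p.2.2 - x₀‖ ^ 2)) *
      exp (p.1 / 2 * ‖p.2.2 - x₀‖ ^ 2)) (by fun_prop)
    ha.self_of_nhds.continuousAt ha'
  obtain ⟨C2, h2⟩ := eventually_bound_of_continuous hO (Φ := fun p =>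
    p.2.1 * (X (‖p.2.2 - x₀‖ ^ 2) * exp (p.1 / 2 * ‖p.2.2 - x₀‖ ^ 2)) +
    p.2.1 / 2 * ‖p.2.2 - x₀‖ ^ 2 *
      ((p.1 * X (‖p.2.2 - x₀‖ ^ 2) + 2 * deriv X (‖p.2.2 - x₀‖ ^ 2)) *
      exp (p.1 / 2 * ‖p.2.2 - x₀‖ ^ 2))) (by fun_prop)
    ha.self_of_nhds.continuousAt ha'
  refine ⟨max C1 C2, ?_⟩
  filter_upwards [h1, h2, ha] with s e1 e2 e3
  have c2 := (contDiff_gWeight hX x₀ (a s)).continuous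
  have c3 := (contDiff_gWeight' hX x₀ (a s)).continuous
  exact ⟨c3, by fun_prop, fun x => hasDerivAt_gWeight' hX x₀ e3 x, fun x hx =>
    ⟨(e1 x hx).trans (le_max_left _ _), (e2 x hx).trans (le_max_right _ _)⟩⟩

end

/-- Gradient of `gWeight X x₀ α * u`, where `G` is the gradient of `u`. -/
noncomputable def gGrad (X : ℝ → ℝ) (x₀ : E) (α : ℝ) (u : E → ℝ) (G : E → E) (x : E) : E :=
  gWeight X x₀ α x • G x + u x • (gWeight' X x₀ α x • (x - x₀))

/-- Source term created by the cutoff in the equation for `gWeight X x₀ α * u`. -/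
noncomputable def gSource (X : ℝ → ℝ) (x₀ : E) (α : ℝ) (u : E → ℝ) (G : E → E) (x : E) : ℝ :=
  -((4 * deriv X (‖x - x₀‖ ^ 2) * exp (α / 2 * ‖x - x₀‖ ^ 2)) * inner ℝ (x - x₀) (G x) +
    ((2 * Module.finrank ℝ E * deriv X (‖x - x₀‖ ^ 2) +
      4 * deriv (deriv X) (‖x - x₀‖ ^ 2) * ‖x - x₀‖ ^ 2) *
        exp (α / 2 * ‖x - x₀‖ ^ 2)) * u x)

namespace IsFlow

variable {O : Set E} {μ : ℝ} {u u' : ℝ → E → ℝ} {G G' : ℝ → E → E}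

theorem memLp_gSource {X : ℝ → ℝ} (hX : ContDiff ℝ ∞ X) (hu : IsFlow O μ u u' G G')
    (hO : Bornology.IsBounded O) (x₀ : E) (α t : ℝ) :
    MemLp (gSource X x₀ α (u t) (G t)) 2 (volume : Measure E) := by
  have c1 := (contDiff_deriv_of_smooth hX).continuous
  have c2 := (contDiff_deriv_of_smooth (contDiff_deriv_of_smooth hX)).continuous
  have hH := (hu.lap t).isH01
  have cy : Continuous (fun x : E => x - x₀) := continuous_id.sub continuous_const
  have m1 := (hH.memLp_grad.inner_continuous hO hH.zero_grad cy).continuous_smul hO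
    (fun x hx => by simp [hH.zero_grad x hx]) (m := fun x =>
      4 * deriv X (‖x - x₀‖ ^ 2) * exp (α / 2 * ‖x - x₀‖ ^ 2)) (by fun_prop)
  have m2 := hH.memLp.continuous_smul hO hH.zero (m := fun x =>
      (2 * Module.finrank ℝ E * deriv X (‖x - x₀‖ ^ 2) +
      4 * deriv (deriv X) (‖x - x₀‖ ^ 2) * ‖x - x₀‖ ^ 2) *
        exp (α / 2 * ‖x - x₀‖ ^ 2)) (by fun_prop)
  exact (m1.add m2).neg

theorem hasLap_conj {X : ℝ → ℝ} (hX : ContDiff ℝ ∞ X) (hu : IsFlow O μ u u' G G')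
    (hO : Bornology.IsBounded O) (x₀ : E) {O' : Set E} (hOO : O' ⊆ O) (α t : ℝ)
    (hO' : tsupport (gWeight X x₀ α) ∩ O ⊆ O') :
    HasLap O' (fun x => gWeight X x₀ α x * u t x) (gGrad X x₀ α (u t) (G t))
      (fun x => gWeight X x₀ α x * (μ ^ 2 * ‖x‖ ^ 2 * u t x + u' t x) +
        (2 * (gWeight' X x₀ α x * inner ℝ (x - x₀) (G t x)) +
        (Module.finrank ℝ E * gWeight' X x₀ α x + inner ℝ (∇ (gWeight' X x₀ α) x) (x - x₀)) *
          u t x)) :=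
  (hu.lap t).radial_mul hO hOO (contDiff_gWeight hX x₀ α) (contDiff_gWeight' hX x₀ α)
    (gradient_gWeight hX x₀ α) hO'

theorem gradient_quadratic (b c : ℝ) (x₀ x : E) :
    ∇ (fun x : E => b * ‖x - x₀‖ ^ 2 - c * ‖x‖ ^ 2) x = (2 * b) • (x - x₀) - (2 * c) • x := by
  have h1 := gradient_radial (M := fun r => b * r) x₀ x (((hasDerivAt_id _).const_mul b))
  have h2 := gradient_radial (M := fun r => -c * r) 0 x (((hasDerivAt_id _).const_mul (-c)))
  have e : (fun x : E => b * ‖x - x₀‖ ^ 2 - c * ‖x‖ ^ 2) =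
      fun x => (fun x => b * ‖x - x₀‖ ^ 2) x + (fun x => -c * ‖x - 0‖ ^ 2) x := by
    funext x; simp; ring
  have s1 : ContDiff ℝ ∞ (fun x : E => b * ‖x - x₀‖ ^ 2) := by
    exact contDiff_radial (M := fun r => b * r) (contDiff_const.mul contDiff_id) x₀
  have s2 : ContDiff ℝ ∞ (fun x : E => -c * ‖x - 0‖ ^ 2) := by
    exact contDiff_radial (M := fun r => -c * r) (contDiff_const.mul contDiff_id) 0
  rw [e, gradient_fun_add ((s1.differentiable (by simp)) x) ((s2.differentiable (by simp)) x),
    h1, h2, sub_zero]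
  module

theorem frequency {X : ℝ → ℝ} (hX : ContDiff ℝ ∞ X) (hu : IsFlow O μ u u' G G')
    (hO : Bornology.IsBounded O) (x₀ : E) {a a' a'' : ℝ → ℝ} {t : ℝ}
    (ha : ∀ᶠ s in 𝓝 t, HasDerivAt a (a' s) s) (ha' : ∀ᶠ s in 𝓝 t, HasDerivAt a' (a'' s) s)
    (ha'' : ContinuousAt a'' t)
    (hR : ∀ g, HasLap O (fun x => gWeight X x₀ (a t) x * u t x)
      (gGrad X x₀ (a t) (u t) (G t)) g →
      a t * (∫ x, g x * inner ℝ (x - x₀) (gGrad X x₀ (a t) (u t) (G t) x)) ≤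
      a t * ((Module.finrank ℝ E / 2 - 1) * ∫ x, ‖gGrad X x₀ (a t) (u t) (G t) x‖ ^ 2))
    {v : ℝ → E → ℝ} (hv : v = fun s x => gWeight X x₀ (a s) x * u s x)
    {q : ℝ → E → ℝ} (hq : q = fun s x => (a s ^ 2 + a' s / 2) * ‖x - x₀‖ ^ 2 - μ ^ 2 * ‖x‖ ^ 2)
    {D : ℝ → ℝ} (hD : D = fun s => (∫ x, ‖gGrad X x₀ (a s) (u s) (G s) x‖ ^ 2) -
      ∫ x, q s x * v s x * v s x) {f : E → ℝ} (hf : f = gSource X x₀ (a t) (u t) (G t)) :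
    HasDerivAt (fun s => ∫ x, v s x ^ 2) (-2 * D t + 2 * ∫ x, v t x * f x) t ∧
    ∃ D', HasDerivAt D D' t ∧
      D' * (∫ x, v t x ^ 2) - D t * (-2 * D t + 2 * ∫ x, v t x * f x) ≤
      (∫ x, v t x ^ 2) * (-4 * a t * (∫ x, ‖gGrad X x₀ (a t) (u t) (G t) x‖ ^ 2)
        - (∫ x, (4 * a t * (a t ^ 2 + a' t / 2) * ‖x - x₀‖ ^ 2 -
            4 * a t * μ ^ 2 * inner ℝ x (x - x₀) +
            (2 * a t * a' t + a'' t / 2) * ‖x - x₀‖ ^ 2) * v t x ^ 2)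
        + 1 / 2 * ∫ x, f x ^ 2) := by
  have z := fun s => (hu.lap s).isH01.zero
  have zG := fun s => (hu.lap s).isH01.zero_grad
  have z' := fun s => (hu.isH01 s).zero
  have zG' := fun s => (hu.isH01 s).zero_grad
  have cy : Continuous (fun x : E => x - x₀) := continuous_id.sub continuous_const
  obtain ⟨C1, k1⟩ := eventually_gWeight hX x₀ hO ha ha'.self_of_nhds.continuousAt
  obtain ⟨C2, k2⟩ := eventually_gWeight' hX x₀ hO ha ha'.self_of_nhds.continuousAt
  have d1 := (hu.derivU t).smul_mul z z' k1
  have d2 := (hu.derivG t).smul_mul zG zG' k1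
  have d3 := (((hu.derivU t).smul_mul z z' k2).smul_field hO
    (fun s x hx => by simp [z s x hx]) (fun s x hx => by simp [z s x hx, z' s x hx]) cy)
  have dG : L2DerivAt (fun s => gGrad X x₀ (a s) (u s) (G s)) _ t := (d2.add d3).congr
    (S := fun s => gGrad X x₀ (a s) (u s) (G s)) (Eventually.of_forall fun s x => by
      simp only [gGrad, smul_eq_mul]; module) (Eventually.of_forall fun s x => rfl)
  obtain ⟨C4, k4⟩ := eventually_bound_of_continuous hO (Φ := fun p =>
    (p.1 ^ 2 + p.2.1 / 2) * ‖p.2.2 - x₀‖ ^ 2 - μ ^ 2 * ‖p.2.2‖ ^ 2) (by fun_prop)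
    ha.self_of_nhds.continuousAt ha'.self_of_nhds.continuousAt
  obtain ⟨C5, k5⟩ := eventually_bound_of_continuous hO (Φ := fun p =>
    (2 * p.1 + p.2.1 / 2) * ‖p.2.2 - x₀‖ ^ 2) (by fun_prop)
    (ha.self_of_nhds.continuousAt.mul ha'.self_of_nhds.continuousAt) ha''
  have k6 : ∀ᶠ s in 𝓝 t, Continuous (q s) ∧
      Continuous (fun x => (2 * (a s * a' s) + a'' s / 2) * ‖x - x₀‖ ^ 2) ∧
      (∀ x, HasDerivAt (fun s => q s x) ((2 * (a s * a' s) + a'' s / 2) * ‖x - x₀‖ ^ 2) s) ∧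
      ∀ x ∈ O, |q s x| ≤ max C4 C5 ∧
        |(2 * (a s * a' s) + a'' s / 2) * ‖x - x₀‖ ^ 2| ≤ max C4 C5 := by
    filter_upwards [ha, ha', k4, k5] with s e1 e2 e3 e4
    refine ⟨by rw [hq]; fun_prop, by fun_prop, fun x => ?_, fun x hx =>
      ⟨by rw [hq]; exact (e3 x hx).trans (le_max_left _ _), (e4 x hx).trans (le_max_right _ _)⟩⟩
    rw [hq]
    refine ((((e1.pow 2).add (e2.div_const 2)).mul_const _).sub_const _).congr_deriv ?_
    push_cast
    ring
  have dv : L2DerivAt v (fun s x => gWeight X x₀ (a s) x * u' s x +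
      a' s / 2 * ‖x - x₀‖ ^ 2 * gWeight X x₀ (a s) x * u s x) t := by rw [hv]; exact d1
  have dq := dv.smul_mul (O := O) (fun s x hx => by simp [hv, z s x hx])
    (fun s x hx => by simp [z s x hx, z' s x hx]) k6
  have hL := hu.hasLap_conj hX hO x₀ Subset.rfl (a t) t inter_subset_right
  have s1 := contDiff_gWeight hX x₀ (a t)
  have s3 : ContDiff ℝ ∞ (fun x : E => a' t / 2 * ‖x - x₀‖ ^ 2 * gWeight X x₀ (a t) x) :=
    (contDiff_const.mul ((contDiff_id.sub contDiff_const).norm_sq ℝ)).mul s1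
  have hvt := ((hu.isH01 t).smooth_mul hO s1 (inter_subset_right)).add
    ((hu.lap t).isH01.smooth_mul hO s3 (inter_subset_right))
  have hg3 : ∀ x, ∇ (fun x : E => a' t / 2 * ‖x - x₀‖ ^ 2 * gWeight X x₀ (a t) x) x =
      (a' t * gWeight X x₀ (a t) x + a' t / 2 * ‖x - x₀‖ ^ 2 * gWeight' X x₀ (a t) x) •
        (x - x₀) := by
    intro x
    have hS := gradient_radial (M := fun r => a' t / 2 * r) x₀ x
      ((hasDerivAt_id _).const_mul (a' t / 2))
    rw [gradient_fun_mul (f := fun x : E => a' t / 2 * ‖x - x₀‖ ^ 2), hS,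
      gradient_gWeight hX]
    · module
    · exact ((contDiff_const.mul ((contDiff_id.sub contDiff_const).norm_sq ℝ)).differentiable
        (n := ∞) (by simp)) x
    · exact (s1.differentiable (by simp)) x
  simp only [hg3, gradient_gWeight hX] at hvt
  have qs : ContDiff ℝ ∞ (q t) := by
    rw [hq]
    exact (contDiff_const.mul ((contDiff_id.sub contDiff_const).norm_sq ℝ)).sub
      (contDiff_const.mul (contDiff_id.norm_sq ℝ))
  have mf : MemLp f 2 (volume : Measure E) := by
    rw [hf]; exact hu.memLp_gSource hX hO x₀ (a t) t
  have key := frequency_deriv_le (a := a t) (x₀ := x₀) (f := f) (q := q)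
    (g := fun x => gWeight X x₀ (a t) x * (μ ^ 2 * ‖x‖ ^ 2 * u t x + u' t x) +
        (2 * (gWeight' X x₀ (a t) x * inner ℝ (x - x₀) (G t x)) +
        (Module.finrank ℝ E * gWeight' X x₀ (a t) x +
          inner ℝ (∇ (gWeight' X x₀ (a t)) x) (x - x₀)) * u t x))
    hO dv dG dq (by rw [hv]; exact hL) (Gt := _) ?_ qs mf ?_ (hR _ hL)
  · subst hD
    obtain ⟨r1, D', r2, r3⟩ := key
    refine ⟨r1, D', r2, r3.trans (le_of_eq ?_)⟩
    congr 3
    congr 1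
    funext x
    congr 1
    rw [hq]
    rw [gradient_quadratic, inner_sub_left, inner_smul_left, inner_smul_left,
      real_inner_self_eq_norm_sq]
    simp only [conj_trivial]
    ring
  · convert hvt using 2
    simp only [smul_eq_mul]
    module
  · intro x
    rw [hf, hq, hv]
    simp only [gGrad, gSource, gradient_gWeight' hX, inner_add_right, inner_smul_right,
      inner_smul_left, real_inner_self_eq_norm_sq, conj_trivial]
    simp only [gWeight, gWeight']
    ring

end IsFlow

theorem L2DerivAt.indicator {F : Type*} [NormedAddCommGroup F] [InnerProductSpace ℝ F]
    {P P' : ℝ → E → F} {t : ℝ} (h : L2DerivAt P P' t) {A : Set E} (hA : MeasurableSet A) :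
    L2DerivAt (fun s => A.indicator (P s)) (fun s => A.indicator (P' s)) t := by
  obtain ⟨b, hb, h⟩ := h
  refine ⟨b, hb, ?_⟩
  filter_upwards [h] with s hs
  refine ⟨hs.1.indicator hA, hs.2.1.indicator hA, fun x => ?_⟩
  obtain ⟨h1, h2, h3⟩ := hs.2.2 x
  by_cases hx : x ∈ A
  · simpa [hx] using ⟨h1, h2, h3⟩
  · simpa [hx] using ⟨hasDerivAt_const _ _, (norm_nonneg _).trans h2⟩

theorem L2DerivAt.shift {F : Type*} [NormedAddCommGroup F] [InnerProductSpace ℝ F]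
    {P P' : ℝ → E → F} {t r : ℝ} (h : L2DerivAt P P' (t + r)) :
    L2DerivAt (fun s => P (s + r)) (fun s => P' (s + r)) t := by
  obtain ⟨b, hb, h⟩ := h
  refine ⟨b, hb, ?_⟩
  have hc : Tendsto (fun s => s + r) (𝓝 t) (𝓝 (t + r)) :=
    (continuous_id.add continuous_const).tendsto t
  filter_upwards [hc.eventually h] with s hs
  exact ⟨hs.1, hs.2.1, fun x => ⟨(hs.2.2 x).1.comp_add_const s r, (hs.2.2 x).2⟩⟩

namespace IsFlow

variable {O : Set E} {μ : ℝ} {u u' : ℝ → E → ℝ} {G G' : ℝ → E → E}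

theorem shift (hu : IsFlow O μ u u' G G') (r : ℝ) :
    IsFlow O μ (fun s => u (s + r)) (fun s => u' (s + r)) (fun s => G (s + r))
      (fun s => G' (s + r)) :=
  ⟨fun _ => hu.lap _, fun _ => hu.isH01 _, fun _ => (hu.derivU _).shift,
    fun _ => (hu.derivG _).shift⟩

theorem memLp (hu : IsFlow O μ u u' G G') (t : ℝ) : MemLp (u t) 2 (volume : Measure E) :=
  (hu.lap t).isH01.memLp

theorem integrable_sq (hu : IsFlow O μ u u' G G') (t : ℝ) : Integrable (fun x => u t x ^ 2) := by
  simpa using (hu.memLp t).normSq_integrable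

theorem integrable_mul_sq (hu : IsFlow O μ u u' G G') (hO : Bornology.IsBounded O) {ρ : E → ℝ}
    (hρ : Continuous ρ) (t : ℝ) : Integrable (fun x => ρ x * u t x ^ 2) := by
  have := ((hu.memLp t).continuous_smul hO (hu.lap t).isH01.zero hρ).mul_integrable (hu.memLp t)
  refine this.congr (Eventually.of_forall fun x => ?_)
  simp only [smul_eq_mul]
  ring

theorem integrable_mul_normSq (hu : IsFlow O μ u u' G G') (hO : Bornology.IsBounded O) {ρ : E → ℝ}
    (hρ : Continuous ρ) (t : ℝ) : Integrable (fun x => ρ x * ‖G t x‖ ^ 2) := by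
  have hH := (hu.lap t).isH01
  have := (hH.memLp_grad.continuous_smul hO hH.zero_grad hρ).inner_integrable hH.memLp_grad
  refine this.congr (Eventually.of_forall fun x => ?_)
  simp [inner_smul_left]

theorem continuous_setIntegral_sq (hu : IsFlow O μ u u' G G') {A : Set E} (hA : MeasurableSet A) :
    Continuous fun t => ∫ x in A, u t x ^ 2 := by
  have h : ∀ t, (∫ x in A, u t x ^ 2) = ∫ x, (A.indicator (u t) x) ^ 2 := by
    intro t
    rw [← integral_indicator hA]
    congr 1
    funext x
    by_cases hx : x ∈ A <;> simp [hx]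
  simp only [h]
  exact continuous_iff_continuousAt.2 fun t =>
    ((hu.derivU t).indicator hA).hasDerivAt_integral_sq.continuousAt

theorem continuous_integral_mul_sq (hu : IsFlow O μ u u' G G') (hO : Bornology.IsBounded O)
    {ρ : E → ℝ} (hρ : Continuous ρ) : Continuous fun t => ∫ x, ρ x * u t x ^ 2 := by
  obtain ⟨C, -, hC⟩ := hO.exists_bound_of_continuous hρ
  refine continuous_iff_continuousAt.2 fun t => ?_
  have h1 := (hu.derivU t).smul_mul (O := O) (κ := fun _ => ρ) (κ' := fun _ _ => 0)
    (fun s => (hu.lap s).isH01.zero) (fun s => (hu.isH01 s).zero) (C := C)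
    (Eventually.of_forall fun s => ⟨hρ, continuous_const, fun x => hasDerivAt_const _ _,
      fun x hx => ⟨hC x hx, by simpa using (norm_nonneg _).trans (hC x hx)⟩⟩)
  have := (h1.hasDerivAt_integral_inner (hu.derivU t)).continuousAt
  convert this using 3 with s
  funext x
  simp
  ring

theorem continuous_integral_mul_normSq (hu : IsFlow O μ u u' G G') (hO : Bornology.IsBounded O)
    {ρ : E → ℝ} (hρ : Continuous ρ) : Continuous fun t => ∫ x, ρ x * ‖G t x‖ ^ 2 := by
  obtain ⟨C, -, hC⟩ := hO.exists_bound_of_continuous hρ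
  refine continuous_iff_continuousAt.2 fun t => ?_
  have h1 := (hu.derivG t).smul_mul (O := O) (κ := fun _ => ρ) (κ' := fun _ _ => 0)
    (fun s => (hu.lap s).isH01.zero_grad) (fun s => (hu.isH01 s).zero_grad) (C := C)
    (Eventually.of_forall fun s => ⟨hρ, continuous_const, fun x => hasDerivAt_const _ _,
      fun x hx => ⟨hC x hx, by simpa using (norm_nonneg _).trans (hC x hx)⟩⟩)
  have := (h1.hasDerivAt_integral_inner (hu.derivG t)).continuousAt
  convert this using 3 with s
  funext x
  simp [inner_smul_left]

theorem hasDerivAt_integral_mul_sq (hu : IsFlow O μ u u' G G') (hO : Bornology.IsBounded O)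
    {ρ : E → ℝ} (hρ : ContDiff ℝ ∞ ρ) (t : ℝ) :
    HasDerivAt (fun t => ∫ x, ρ x * u t x ^ 2)
      (-2 * (∫ x, ρ x * ‖G t x‖ ^ 2) - 2 * (∫ x, inner ℝ (u t x • ∇ ρ x) (G t x)) -
        2 * μ ^ 2 * ∫ x, ρ x * ‖x‖ ^ 2 * u t x ^ 2) t := by
  obtain ⟨C, -, hC⟩ := hO.exists_bound_of_continuous hρ.continuous
  have h1 := (hu.derivU t).smul_mul (O := O) (κ := fun _ => ρ) (κ' := fun _ _ => 0)
    (fun s => (hu.lap s).isH01.zero) (fun s => (hu.isH01 s).zero) (C := C)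
    (Eventually.of_forall fun s => ⟨hρ.continuous, continuous_const, fun x => hasDerivAt_const _ _,
      fun x hx => ⟨hC x hx, by simpa using (norm_nonneg _).trans (hC x hx)⟩⟩)
  have h2 := h1.hasDerivAt_integral_inner (hu.derivU t)
  have hH := (hu.lap t).isH01
  have w := (hu.lap t).weak_ext (hH.smooth_mul hO hρ inter_subset_right)
  have m0 : MemLp (fun x => u t x) 2 (volume : Measure E) := hu.memLp t
  have m1 : MemLp (fun x => ρ x * u t x) 2 (volume : Measure E) := by
    simpa using hH.memLp.continuous_smul hO hH.zero hρ.continuous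
  have m2 : MemLp (fun x => ‖x‖ ^ 2 * u t x) 2 (volume : Measure E) := by
    simpa using hH.memLp.continuous_smul hO hH.zero (m := fun x => ‖x‖ ^ 2) (by fun_prop)
  have m3 : MemLp (fun x => u' t x) 2 (volume : Measure E) := (hu.isH01 t).memLp
  have m4 : MemLp (fun x => u t x • ∇ ρ x) 2 (volume : Measure E) :=
    hH.memLp.smul_continuous hO hH.zero hρ.continuous_gradient
  have e1 : (∫ x, inner ℝ (G t x) (ρ x • G t x + u t x • ∇ ρ x)) =
      (∫ x, ρ x * ‖G t x‖ ^ 2) + ∫ x, inner ℝ (u t x • ∇ ρ x) (G t x) := by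
    rw [← integral_add (hu.integrable_mul_normSq hO hρ.continuous t)
      (m4.inner_integrable hH.memLp_grad)]
    congr 1
    funext x
    rw [inner_add_right, inner_smul_right, real_inner_self_eq_norm_sq, real_inner_comm]
  have e2 : (∫ x, (μ ^ 2 * ‖x‖ ^ 2 * u t x + u' t x) * (ρ x * u t x)) =
      μ ^ 2 * (∫ x, ρ x * ‖x‖ ^ 2 * u t x ^ 2) + ∫ x, ρ x * u t x * u' t x := by
    have i := hu.integrable_mul_sq hO (ρ := fun x => ρ x * ‖x‖ ^ 2)
      (hρ.continuous.mul (continuous_norm.pow 2)) t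
    rw [← integral_const_mul, ← integral_add (i.const_mul _) (m1.mul_integrable m3)]
    congr 1
    funext x
    ring
  have e3 : (∫ x, inner ℝ (ρ x • u' t x + (0 : ℝ) • u t x) (u t x)) =
      ∫ x, ρ x * u t x * u' t x := by
    congr 1
    funext x
    simp
    ring
  have e4 : (∫ x, inner ℝ (ρ x • u t x) (u' t x)) = ∫ x, ρ x * u t x * u' t x := by
    congr 1
    funext x
    simp
    ring
  rw [e3, e4] at h2
  rw [e1, e2] at w
  convert h2 using 1
  · funext s
    congr 1
    funext x
    simp
    ring
  · linarith

theorem hasDerivAt_integral_sq (hu : IsFlow O μ u u' G G') (hO : Bornology.IsBounded O) (t : ℝ) :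
    HasDerivAt (fun t => ∫ x, u t x ^ 2)
      (-2 * (∫ x, ‖G t x‖ ^ 2) - 2 * μ ^ 2 * ∫ x, ‖x‖ ^ 2 * u t x ^ 2) t := by
  have h := hu.hasDerivAt_integral_mul_sq hO (ρ := fun _ => 1) contDiff_const t
  have hz : ∀ x : E, ∇ (fun _ : E => (1 : ℝ)) x = 0 := fun x => by simp [gradient]
  simpa [hz] using h

/-- Exponential decay of the energy. -/
theorem integral_sq_le_exp (hu : IsFlow O μ u u' G G') (hO : Bornology.IsBounded O) {Λ : ℝ}
    (hΛ : ∀ t, Λ * (∫ x, u t x ^ 2) ≤ (∫ x, ‖G t x‖ ^ 2) + μ ^ 2 * ∫ x, ‖x‖ ^ 2 * u t x ^ 2)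
    {s t : ℝ} (hst : s ≤ t) :
    (∫ x, u t x ^ 2) ≤ exp (-(2 * Λ * (t - s))) * ∫ x, u s x ^ 2 := by
  have hd : ∀ t, HasDerivAt (fun t => exp (2 * Λ * t) * ∫ x, u t x ^ 2)
      (exp (2 * Λ * t) * (2 * Λ) * (∫ x, u t x ^ 2) + exp (2 * Λ * t) *
        (-2 * (∫ x, ‖G t x‖ ^ 2) - 2 * μ ^ 2 * ∫ x, ‖x‖ ^ 2 * u t x ^ 2)) t := fun t =>
    (hasDerivAt_exp_mul _ _).mul (hu.hasDerivAt_integral_sq hO t)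
  have hanti : Antitone (fun t => exp (2 * Λ * t) * ∫ x, u t x ^ 2) := by
    refine antitone_of_deriv_nonpos (fun t => (hd t).differentiableAt) fun t => ?_
    rw [(hd t).deriv]
    have := mul_le_mul_of_nonneg_left (hΛ t) (exp_pos (2 * Λ * t)).le
    linarith
  have h := hanti hst
  have e : exp (-(2 * Λ * (t - s))) = exp (-(2 * Λ * t)) * exp (2 * Λ * s) := by
    rw [← exp_add]
    ring_nf
  rw [e, mul_assoc]
  calc (∫ x, u t x ^ 2) = exp (-(2 * Λ * t)) * (exp (2 * Λ * t) * ∫ x, u t x ^ 2) := by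
        rw [← mul_assoc, ← exp_add]; simp
    _ ≤ _ := mul_le_mul_of_nonneg_left h (exp_pos _).le

theorem integral_sq_anti (hu : IsFlow O μ u u' G G') (hO : Bornology.IsBounded O) {s t : ℝ}
    (hst : s ≤ t) : (∫ x, u t x ^ 2) ≤ ∫ x, u s x ^ 2 := by
  have := hu.integral_sq_le_exp hO (Λ := 0) (fun t => by
    have h1 : 0 ≤ ∫ x, ‖G t x‖ ^ 2 := integral_nonneg fun x => by positivity
    have h2 : 0 ≤ ∫ x, ‖x‖ ^ 2 * u t x ^ 2 := integral_nonneg fun x => by positivity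
    rw [zero_mul]; positivity) hst
  simpa using this

theorem integral_sq_le_exp_hermite (hu : IsFlow O μ u u' G G') (hO : Bornology.IsBounded O)
    {s t : ℝ} (hst : s ≤ t) :
    (∫ x, u t x ^ 2) ≤
      exp (-(2 * (μ * Module.finrank ℝ E) * (t - s))) * ∫ x, u s x ^ 2 :=
  hu.integral_sq_le_exp hO (fun t => by
    simpa using (hu.lap t).isH01.hermite hO 0 μ) hst

theorem integral_sq_le_exp_poincare {R : ℝ} (hR : 0 < R) (hu : IsFlow (ball 0 R) μ u u' G G')
    {s t : ℝ} (hst : s ≤ t) :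
    (∫ x, u t x ^ 2) ≤
      exp (-(2 * ((Module.finrank ℝ E : ℝ) ^ 2 / (4 * R ^ 2)) * (t - s))) *
        ∫ x, u s x ^ 2 :=
  hu.integral_sq_le_exp isBounded_ball (fun t => by
    have h1 := (hu.lap t).isH01.poincare hR Subset.rfl
    have h2 : 0 ≤ ∫ x, ‖x‖ ^ 2 * u t x ^ 2 := integral_nonneg fun x => by positivity
    have := mul_nonneg (sq_nonneg μ) h2
    linarith) hst

end IsFlow

theorem gWeight_one (x₀ : E) (α : ℝ) (x : E) :
    gWeight (fun _ => 1) x₀ α x = exp (α / 2 * ‖x - x₀‖ ^ 2) := by simp [gWeight]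

theorem gSource_one (x₀ : E) (α : ℝ) (u : E → ℝ) (G : E → E) :
    gSource (fun _ => 1) x₀ α u G = fun _ => 0 := by
  funext x
  have h : deriv (fun _ : ℝ => (1 : ℝ)) = fun _ => 0 := by funext; simp
  simp [gSource, h]

namespace IsFlow

variable {R μ : ℝ} {u u' : ℝ → E → ℝ} {G G' : ℝ → E → E}

/-- Frequency inequalities for the Gaussian weight `exp (-‖x - x₀‖² / (4 (T - s)))`. -/
theorem gaussian_frequency (hu : IsFlow (ball 0 R) μ u u' G G') {x₀ : E} (hx₀ : x₀ ∈ ball 0 R)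
    {T t : ℝ} (ht : t < T) {v : ℝ → E → ℝ}
    (hv : v = fun s x => exp (-1 / (4 * (T - s)) / 2 * ‖x - x₀‖ ^ 2) * u s x) {D : ℝ → ℝ}
    (hD : D = fun s =>
      (∫ x, ‖gGrad (fun _ => 1) x₀ (-1 / (4 * (T - s))) (u s) (G s) x‖ ^ 2) +
      ∫ x, (1 / (16 * (T - s) ^ 2) * ‖x - x₀‖ ^ 2 + μ ^ 2 * ‖x‖ ^ 2) * v s x ^ 2) :
    HasDerivAt (fun s => ∫ x, v s x ^ 2) (-2 * D t) t ∧
    ∃ D', HasDerivAt D D' t ∧ D' * (∫ x, v t x ^ 2) + 2 * D t ^ 2 ≤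
      (∫ x, v t x ^ 2) * ((D t + R ^ 2 / 8 * μ ^ 2 * ∫ x, v t x ^ 2) / (T - t)) := by
  have hO : Bornology.IsBounded (ball (0 : E) R) := isBounded_ball
  set a : ℝ → ℝ := fun s => -1 / (4 * (T - s)) with ha
  set a' : ℝ → ℝ := fun s => -1 / (4 * (T - s) ^ 2) with ha'
  set a'' : ℝ → ℝ := fun s => -1 / (2 * (T - s) ^ 3) with ha''
  have hev : ∀ᶠ s in 𝓝 t, s < T := eventually_lt_nhds ht
  have hT : ∀ s, HasDerivAt (fun s => T - s) (-1) s := fun s => by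
    simpa using (hasDerivAt_id s).const_sub T
  have d1 : ∀ᶠ s in 𝓝 t, HasDerivAt a (a' s) s := by
    filter_upwards [hev] with s hs
    have h0 : T - s ≠ 0 := by linarith
    refine ((hasDerivAt_const s (-1 : ℝ)).div ((hT s).const_mul 4)
      (by simpa using h0)).congr_deriv ?_
    simp only [ha']
    field_simp
    ring
  have d2 : ∀ᶠ s in 𝓝 t, HasDerivAt a' (a'' s) s := by
    filter_upwards [hev] with s hs
    have h0 : T - s ≠ 0 := by linarith
    refine ((hasDerivAt_const s (-1 : ℝ)).div (((hT s).pow 2).const_mul 4)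
      (by simpa using h0)).congr_deriv ?_
    simp only [ha'', Pi.pow_apply]
    field_simp
    push_cast
    ring
  have d3 : ContinuousAt a'' t := by
    have h0 : T - t ≠ 0 := by linarith
    exact continuousAt_const.div (by fun_prop) (by simpa using h0)
  have hpos : 0 < T - t := by linarith
  have hat : a t ≤ 0 := by
    simp only [ha]
    exact div_nonpos_of_nonpos_of_nonneg (by norm_num) (by positivity)
  have hv' : v = fun s x => gWeight (fun _ => 1) x₀ (a s) x * u s x := by
    rw [hv]; funext s x; rw [gWeight_one]
  have mvt : ∀ s, MemLp (v s) 2 (volume : Measure E) := fun s => by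
    have := (hu.memLp s).continuous_smul hO (hu.lap s).isH01.zero
      (contDiff_gWeight (X := fun _ => 1) contDiff_const x₀ (a s)).continuous
    rw [hv']
    simpa using this
  have zv : ∀ s, ∀ x ∉ ball (0 : E) R, v s x = 0 := fun s x hx => by
    simp [hv, (hu.lap s).isH01.zero x hx]
  have iv : ∀ s, ∀ ρ : E → ℝ, Continuous ρ → Integrable (fun x => ρ x * v s x ^ 2) := by
    intro s ρ hρ
    refine (((mvt s).continuous_smul hO (zv s) hρ).mul_integrable (mvt s)).congr
      (Eventually.of_forall fun x => ?_)
    simp only [smul_eq_mul]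
    ring
  have hq : ∀ s, s < T → ∀ x, (a s ^ 2 + a' s / 2) * ‖x - x₀‖ ^ 2 - μ ^ 2 * ‖x‖ ^ 2 =
      -(1 / (16 * (T - s) ^ 2) * ‖x - x₀‖ ^ 2 + μ ^ 2 * ‖x‖ ^ 2) := by
    intro s hs x
    have h0 : T - s ≠ 0 := by linarith
    simp only [ha, ha']
    field_simp
    ring
  have key := hu.frequency (X := fun _ => 1) contDiff_const hO x₀ d1 d2 d3
    (fun g hg => mul_le_mul_of_nonpos_left (hg.rellich_ball hx₀) hat) hv' rfl rfl rfl
  rw [gSource_one] at key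
  have hDe : ∀ s, s < T → D s = (∫ x, ‖gGrad (fun _ => 1) x₀ (a s) (u s) (G s) x‖ ^ 2) -
      ∫ x, ((a s ^ 2 + a' s / 2) * ‖x - x₀‖ ^ 2 - μ ^ 2 * ‖x‖ ^ 2) * v s x * v s x := by
    intro s hs
    simp only [hD, hq s hs, neg_mul, integral_neg, sub_neg_eq_add]
    congr 2
    funext x
    ring
  obtain ⟨k1, D', k2, k3⟩ := key
  simp only [← hDe t ht] at k1 k3
  refine ⟨by simpa using k1, D', k2.congr_of_eventuallyEq (hev.mono fun s hs => hDe s hs), ?_⟩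
  simp only [mul_zero, integral_zero, ne_eq, OfNat.ofNat_ne_zero, not_false_eq_true, zero_pow,
    add_zero] at k3
  have hH0 : 0 ≤ ∫ x, v t x ^ 2 := integral_nonneg fun x => by positivity
  have hmain : -4 * a t * (∫ x, ‖gGrad (fun _ => 1) x₀ (a t) (u t) (G t) x‖ ^ 2) -
      (∫ x, (4 * a t * (a t ^ 2 + a' t / 2) * ‖x - x₀‖ ^ 2 -
            4 * a t * μ ^ 2 * inner ℝ x (x - x₀) +
            (2 * a t * a' t + a'' t / 2) * ‖x - x₀‖ ^ 2) * v t x ^ 2) ≤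
      (D t + R ^ 2 / 8 * μ ^ 2 * ∫ x, v t x ^ 2) / (T - t) := by
    have e : (D t + R ^ 2 / 8 * μ ^ 2 * ∫ x, v t x ^ 2) / (T - t) =
        -4 * a t * (∫ x, ‖gGrad (fun _ => 1) x₀ (a t) (u t) (G t) x‖ ^ 2) +
        ∫ x, (((1 / (16 * (T - t) ^ 2) * ‖x - x₀‖ ^ 2 + μ ^ 2 * ‖x‖ ^ 2) +
          R ^ 2 / 8 * μ ^ 2) / (T - t)) * v t x ^ 2 := by
      have e1 : (∫ x, (((1 / (16 * (T - t) ^ 2) * ‖x - x₀‖ ^ 2 + μ ^ 2 * ‖x‖ ^ 2) +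
          R ^ 2 / 8 * μ ^ 2) / (T - t)) * v t x ^ 2) = (1 / (T - t)) *
          ((∫ x, (1 / (16 * (T - t) ^ 2) * ‖x - x₀‖ ^ 2 + μ ^ 2 * ‖x‖ ^ 2) * v t x ^ 2) +
            R ^ 2 / 8 * μ ^ 2 * ∫ x, v t x ^ 2) := by
        rw [← integral_const_mul (R ^ 2 / 8 * μ ^ 2),
          ← integral_add (iv t _ (by fun_prop)) (iv t (fun _ => R ^ 2 / 8 * μ ^ 2) (by fun_prop)),
          ← integral_const_mul]
        congr 1
        funext x
        ring
      rw [e1]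
      simp only [hD, ha]
      field_simp
      ring
    rw [e, sub_eq_add_neg, ← integral_neg]
    refine add_le_add_right (integral_mono ?_ (iv t _ (by fun_prop)) fun x => ?_) _
    · exact (iv t (fun x => 4 * a t * (a t ^ 2 + a' t / 2) * ‖x - x₀‖ ^ 2 -
            4 * a t * μ ^ 2 * inner ℝ x (x - x₀) +
            (2 * a t * a' t + a'' t / 2) * ‖x - x₀‖ ^ 2)
            (by have : Continuous fun x : E => inner ℝ x (x - x₀) :=
                  continuous_id.inner (continuous_id.sub continuous_const)
                fun_prop)).neg
    · by_cases hx : x ∈ ball (0 : E) R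
      · simp only [← neg_mul]
        refine mul_le_mul_of_nonneg_right ?_ (sq_nonneg _)
        have hx1 : ‖x₀‖ ^ 2 ≤ R ^ 2 := by
          have := mem_ball_zero_iff.1 hx₀
          exact pow_le_pow_left₀ (norm_nonneg _) this.le 2
        have hc : -(‖x‖ ^ 2 + R ^ 2 / 8) ≤ inner ℝ x (x - x₀) := by
          rw [inner_sub_right, real_inner_self_eq_norm_sq]
          have h1 := real_inner_le_norm x x₀
          nlinarith [sq_nonneg (4 * ‖x‖ - ‖x₀‖)]
        have hc2 := mul_le_mul_of_nonneg_left hc (sq_nonneg μ)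
        rw [le_div_iff₀ hpos]
        have e3 : -(4 * a t * (a t ^ 2 + a' t / 2) * ‖x - x₀‖ ^ 2 -
            4 * a t * μ ^ 2 * inner ℝ x (x - x₀) +
            (2 * a t * a' t + a'' t / 2) * ‖x - x₀‖ ^ 2) * (T - t) =
            1 / (16 * (T - t) ^ 2) * ‖x - x₀‖ ^ 2 - μ ^ 2 * inner ℝ x (x - x₀) := by
          simp only [ha, ha', ha'']
          field_simp
          ring
        rw [e3]
        linarith
      · simp [zv t x hx]
  have := mul_le_mul_of_nonneg_left hmain hH0
  nlinarith [k3, this]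

end IsFlow

/-- Integration of the frequency inequalities. -/
theorem frequency_bound {H D : ℝ → ℝ} {τ h c A B κ : ℝ} (hτ : 0 < τ) (hh : 0 < h) (hhτ : h ≤ τ)
    (hc : 0 ≤ c) (hpos : ∀ t ∈ Icc 0 τ, 0 < H t) (hD0 : ∀ t ∈ Icc 0 τ, 0 ≤ D t)
    (hH : ∀ t < τ + h, HasDerivAt H (-2 * D t) t)
    (hD : ∀ t < τ + h, ∃ D', HasDerivAt D D' t ∧
      D' * H t + 2 * D t ^ 2 ≤ H t * ((D t + c * H t) / (τ + h - t)))
    (hA : H 0 ≤ A) (hB0 : 0 < B) (hB : exp (-κ) * B ≤ H (τ / 2)) :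
    h * D τ ≤ (2 * (log A - log B) + 2 * κ + c * τ) * H τ ∨
      h * D τ ≤ c * τ * H τ := by
  have hτm : τ ∈ Icc 0 τ := ⟨hτ.le, le_rfl⟩
  have hanti : AntitoneOn (fun t => (τ + h - t) * (D t / H t) - c * t) (Icc 0 τ) := by
    have hd : ∀ t ∈ Icc 0 τ, ∃ e ≤ 0,
        HasDerivAt (fun t => (τ + h - t) * (D t / H t) - c * t) e t := by
      intro t ht
      have hlt : t < τ + h := by linarith [ht.2]
      obtain ⟨D', d1, d2⟩ := hD t hlt
      have hp := hpos t ht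
      refine ⟨_, ?_, ((((hasDerivAt_id t).const_sub (τ + h)).mul (d1.div (hH t hlt) hp.ne')).sub
        ((hasDerivAt_id t).const_mul c))⟩
      have hl : 0 < τ + h - t := by linarith
      have e : -1 * (D t / H t) + (τ + h - t) * ((D' * H t - D t * (-2 * D t)) / H t ^ 2) - c * 1 =
          ((τ + h - t) * (D' * H t + 2 * D t ^ 2) - H t * (D t + c * H t)) / H t ^ 2 := by
        field_simp
        ring
      simp only [id_eq, Pi.div_apply]
      rw [e]
      refine div_nonpos_of_nonpos_of_nonneg ?_ (sq_nonneg _)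
      have := mul_le_mul_of_nonneg_left d2 hl.le
      have e2 : (τ + h - t) * (H t * ((D t + c * H t) / (τ + h - t))) = H t * (D t + c * H t) := by
        field_simp
      linarith
    refine antitoneOn_of_deriv_nonpos (convex_Icc _ _) (fun t ht => ?_) (fun t ht => ?_)
      fun t ht => ?_
    · obtain ⟨e, -, h2⟩ := hd t ht
      exact h2.continuousAt.continuousWithinAt
    · obtain ⟨e, -, h2⟩ := hd t (interior_subset ht)
      exact h2.differentiableAt.differentiableWithinAt
    · obtain ⟨e, h1, h2⟩ := hd t (interior_subset ht)
      rwa [h2.deriv]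
  set K := h * (D τ / H τ) - c * τ with hK
  have hN : h * D τ = (K + c * τ) * H τ := by
    have := (hpos τ hτm).ne'
    rw [hK]
    field_simp
    ring
  have hle : ∀ t ∈ Icc 0 τ, K ≤ (τ + h - t) * (D t / H t) := by
    intro t ht
    have := hanti ht hτm ht.2
    simp only at this
    have h2 : 0 ≤ c * t := mul_nonneg hc ht.1
    have e : (τ + h - τ) = h := by ring
    rw [e] at this
    linarith
  rcases le_or_gt K 0 with hK0 | hK0
  · right
    rw [hN]
    exact mul_le_mul_of_nonneg_right (by linarith) (hpos τ hτm).le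
  · left
    rw [hN]
    refine mul_le_mul_of_nonneg_right ?_ (hpos τ hτm).le
    have hsub : Icc 0 (τ / 2) ⊆ Icc 0 τ := Icc_subset_Icc_right (by linarith)
    have hlog : AntitoneOn (fun t => log (H t) + K / τ * t) (Icc 0 (τ / 2)) := by
      have hd : ∀ t ∈ Icc 0 (τ / 2), HasDerivAt (fun t => log (H t) + K / τ * t)
          (-2 * D t / H t + K / τ * 1) t := fun t ht =>
        ((hH t (by linarith [ht.2])).log (hpos t (hsub ht)).ne').add
          ((hasDerivAt_id t).const_mul (K / τ))
      refine antitoneOn_of_deriv_nonpos (convex_Icc _ _)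
        (fun t ht => (hd t ht).continuousAt.continuousWithinAt)
        (fun t ht => (hd t (interior_subset ht)).differentiableAt.differentiableWithinAt)
        fun t ht => ?_
      have ht' := interior_subset ht
      rw [(hd t ht').deriv]
      have h1 := hle t (hsub ht')
      have h3 : 0 ≤ D t / H t := div_nonneg (hD0 t (hsub ht')) (hpos t (hsub ht')).le
      have h2 : (τ + h - t) * (D t / H t) ≤ 2 * τ * (D t / H t) :=
        mul_le_mul_of_nonneg_right (by linarith [ht'.1]) h3
      have h4 : K / τ ≤ 2 * (D t / H t) := by
        rw [div_le_iff₀ hτ]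
        linarith
      have e : -2 * D t / H t = -(2 * (D t / H t)) := by ring
      rw [e]
      linarith
    have h1 := hlog (left_mem_Icc.2 (by linarith)) (right_mem_Icc.2 (by linarith))
      (by linarith : (0 : ℝ) ≤ τ / 2)
    simp only [mul_zero, add_zero] at h1
    have h2 := Real.log_le_log (hpos 0 ⟨le_rfl, hτ.le⟩) hA
    have h3 := Real.log_le_log (by positivity) hB
    rw [Real.log_mul (exp_pos _).ne' hB0.ne', Real.log_exp] at h3
    have e : K / τ * (τ / 2) = K / 2 := by field_simp
    rw [e] at h1
    linarith

theorem gaussian_lower_bound {R ℓ : ℝ} (hℓ : 0 < ℓ) {x₀ : E} (hx₀ : x₀ ∈ ball 0 R) {w : E → ℝ}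
    (hw : MemLp w 2 (volume : Measure E)) (hz : ∀ x ∉ ball (0 : E) R, w x = 0)
    (hi : Integrable (fun x => (exp (-1 / (4 * ℓ) / 2 * ‖x - x₀‖ ^ 2) * w x) ^ 2)) :
    exp (-(R ^ 2 / ℓ)) * (∫ x, w x ^ 2) ≤
      ∫ x, (exp (-1 / (4 * ℓ) / 2 * ‖x - x₀‖ ^ 2) * w x) ^ 2 := by
  rw [← integral_const_mul]
  have hwi : Integrable (fun x => w x ^ 2) := by simpa using hw.normSq_integrable
  refine integral_mono (hwi.const_mul _) hi fun x => ?_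
  by_cases hx : x ∈ ball (0 : E) R
  · simp only
    rw [mul_pow, ← Real.exp_nat_mul]
    refine mul_le_mul_of_nonneg_right (exp_le_exp.2 ?_) (sq_nonneg _)
    have h1 : ‖x - x₀‖ ≤ 2 * R := by
      have := norm_sub_le x x₀
      have h2 := mem_ball_zero_iff.1 hx
      have h3 := mem_ball_zero_iff.1 hx₀
      linarith
    have h2 : ‖x - x₀‖ ^ 2 ≤ 4 * R ^ 2 := by nlinarith [norm_nonneg (x - x₀)]
    have e : ((2 : ℕ) : ℝ) * (-1 / (4 * ℓ) / 2 * ‖x - x₀‖ ^ 2) = -(‖x - x₀‖ ^ 2 / 4 / ℓ) := by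
      push_cast
      field_simp
    rw [e, neg_le_neg_iff]
    exact div_le_div_of_nonneg_right (by linarith) hℓ.le
  · simp [hz x hx]

namespace IsFlow

variable {R μ : ℝ} {u u' : ℝ → E → ℝ} {G G' : ℝ → E → E}

/-- Interpolation inequality: observation in a small ball at one instant of time. -/
theorem interpolation (hu : IsFlow (ball 0 R) μ u u' G G') {x₀ : E} (hx₀ : x₀ ∈ ball 0 R)
    {r : ℝ} (hr : 0 < r) (hrR : r ≤ R) {τ : ℝ} (hτ : 0 < τ) {e : ℝ} (he : 0 ≤ e) :
    (∫ x, u τ x ^ 2) ≤ 2 * exp (32 * R ^ 2 / r ^ 2 *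
      (2 * e + 4 * R ^ 2 / τ + R ^ 2 * μ ^ 2 * τ / 8)) * (∫ x in ball x₀ r, u τ x ^ 2) +
      exp (-e) * ∫ x, u 0 x ^ 2 := by
  have hO : Bornology.IsBounded (ball (0 : E) R) := isBounded_ball
  have hR : 0 < R := hr.trans_le hrR
  set A := ∫ x, u 0 x ^ 2 with hA
  set B := ∫ x, u τ x ^ 2 with hB
  set Z := ∫ x in ball x₀ r, u τ x ^ 2 with hZ
  have hA0 : 0 ≤ A := integral_nonneg fun x => by positivity
  have hZ0 : 0 ≤ Z := integral_nonneg fun x => by positivity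
  set Λ := 2 * e + 4 * R ^ 2 / τ + R ^ 2 * μ ^ 2 * τ / 8 with hΛ
  rcases le_or_gt B (exp (-e) * A) with hBA | hBA
  · have : 0 ≤ 2 * exp (32 * R ^ 2 / r ^ 2 * Λ) * Z := by positivity
    linarith
  have hB0 : 0 < B := lt_of_le_of_lt (by positivity) hBA
  have hAB : B ≤ A := hu.integral_sq_anti hO hτ.le
  have hApos : 0 < A := hB0.trans_le hAB
  have hlog : log A - log B ≤ e := by
    have := Real.log_le_log (by positivity) hBA.le
    rw [Real.log_mul (exp_pos _).ne' hApos.ne', Real.log_exp] at this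
    linarith
  have hΛ0 : 4 * R ^ 2 / τ ≤ Λ := by
    have : 0 ≤ R ^ 2 * μ ^ 2 * τ / 8 := by positivity
    linarith
  have hΛpos : 0 < Λ := lt_of_lt_of_le (by positivity) hΛ0
  set h := r ^ 2 / (32 * Λ) with hh
  have hh0 : 0 < h := by positivity
  have hhτ : h ≤ τ := by
    rw [hh, div_le_iff₀ (by positivity)]
    have h1 : 4 * R ^ 2 ≤ τ * Λ := by
      rw [div_le_iff₀ hτ] at hΛ0
      linarith
    nlinarith
  set v : ℝ → E → ℝ := fun s x => exp (-1 / (4 * (τ + h - s)) / 2 * ‖x - x₀‖ ^ 2) * u s x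
    with hv
  set D : ℝ → ℝ := fun s =>
      (∫ x, ‖gGrad (fun _ => 1) x₀ (-1 / (4 * (τ + h - s))) (u s) (G s) x‖ ^ 2) +
      ∫ x, (1 / (16 * (τ + h - s) ^ 2) * ‖x - x₀‖ ^ 2 + μ ^ 2 * ‖x‖ ^ 2) * v s x ^ 2 with hD
  have key := fun t (ht : t < τ + h) => hu.gaussian_frequency hx₀ ht hv hD
  have mv : ∀ s, MemLp (v s) 2 (volume : Measure E) := fun s => by
    simpa using (hu.memLp s).continuous_smul hO (hu.lap s).isH01.zero
      (m := fun x => exp (-1 / (4 * (τ + h - s)) / 2 * ‖x - x₀‖ ^ 2)) (by fun_prop)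
  have zv : ∀ s, ∀ x ∉ ball (0 : E) R, v s x = 0 := fun s x hx => by
    simp [hv, (hu.lap s).isH01.zero x hx]
  have ivv : ∀ s, Integrable (fun x => v s x ^ 2) := fun s => by
    simpa using (mv s).normSq_integrable
  have iv : ∀ s, ∀ ρ : E → ℝ, Continuous ρ → Integrable (fun x => ρ x * v s x ^ 2) := by
    intro s ρ hρ
    refine (((mv s).continuous_smul hO (zv s) hρ).mul_integrable (mv s)).congr
      (Eventually.of_forall fun x => ?_)
    simp only [smul_eq_mul]
    ring
  have hlow : ∀ t, t < τ + h → exp (-(R ^ 2 / (τ + h - t))) * (∫ x, u t x ^ 2) ≤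
      ∫ x, v t x ^ 2 := fun t ht =>
    gaussian_lower_bound (by linarith) hx₀ (hu.memLp t) (hu.lap t).isH01.zero (ivv t)
  have hup : ∀ t, t < τ + h → ∀ x, v t x ^ 2 ≤ u t x ^ 2 := fun t ht x => by
    have h0 : 0 < τ + h - t := by linarith
    simp only [hv, mul_pow]
    refine mul_le_of_le_one_left (sq_nonneg _) ?_
    refine pow_le_one₀ (exp_pos _).le (exp_le_one_iff.2 ?_)
    refine mul_nonpos_of_nonpos_of_nonneg ?_ (sq_nonneg _)
    exact div_nonpos_of_nonpos_of_nonneg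
      (div_nonpos_of_nonpos_of_nonneg (by norm_num) (by positivity)) (by norm_num)
  have hBt : ∀ t ≤ τ, B ≤ ∫ x, u t x ^ 2 := fun t ht => hu.integral_sq_anti hO ht
  have hfb := frequency_bound (H := fun s => ∫ x, v s x ^ 2) (D := D) (c := R ^ 2 / 8 * μ ^ 2)
    (A := A) (B := B) (κ := 2 * R ^ 2 / τ) hτ hh0 hhτ (by positivity)
    (fun t ht => lt_of_lt_of_le (mul_pos (exp_pos _) (hB0.trans_le (hBt t ht.2)))
      (hlow t (by linarith [ht.2])))
    (fun t _ => add_nonneg (integral_nonneg fun x => by positivity)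
      (integral_nonneg fun x => by positivity))
    (fun t ht => (key t ht).1) (fun t ht => (key t ht).2)
    (integral_mono (ivv 0) (hu.integrable_sq 0) (hup 0 (by linarith))) hB0
    (by
      refine le_trans ?_ (hlow (τ / 2) (by linarith))
      refine mul_le_mul (exp_le_exp.2 (neg_le_neg ?_)) (hBt _ (by linarith)) hB0.le
        (exp_pos _).le
      rw [div_le_div_iff₀ (by linarith) hτ]
      nlinarith [sq_nonneg R])
  have hHτ : 0 < ∫ x, v τ x ^ 2 :=
    lt_of_lt_of_le (mul_pos (exp_pos _) hB0) (hlow τ (by linarith))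
  have hfin : h * D τ ≤ Λ * ∫ x, v τ x ^ 2 := by
    have e2 : 0 ≤ 4 * R ^ 2 / τ := by positivity
    rcases hfb with hfb | hfb
    · refine hfb.trans (mul_le_mul_of_nonneg_right ?_ hHτ.le)
      rw [hΛ]
      have e1 : 2 * (2 * R ^ 2 / τ) = 4 * R ^ 2 / τ := by ring
      linarith
    · refine hfb.trans (mul_le_mul_of_nonneg_right ?_ hHτ.le)
      rw [hΛ]
      linarith
  have hS : (∫ x, ‖x - x₀‖ ^ 2 * v τ x ^ 2) ≤ r ^ 2 / 2 * ∫ x, v τ x ^ 2 := by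
    have h1 : (∫ x, ‖x - x₀‖ ^ 2 * v τ x ^ 2) ≤ 16 * h ^ 2 * D τ := by
      have h2 : (∫ x, (1 / (16 * h ^ 2)) * (‖x - x₀‖ ^ 2 * v τ x ^ 2)) ≤ D τ := by
        simp only [hD]
        refine le_add_of_nonneg_of_le (integral_nonneg fun x => by positivity) ?_
        refine integral_mono ((iv τ _ (by fun_prop)).const_mul _) (iv τ _ (by fun_prop)) fun x => ?_
        simp only [add_sub_cancel_left]
        rw [← mul_assoc]
        refine mul_le_mul_of_nonneg_right ?_ (sq_nonneg _)
        have : 0 ≤ μ ^ 2 * ‖x‖ ^ 2 := by positivity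
        linarith
      rw [integral_const_mul] at h2
      have := mul_le_mul_of_nonneg_left h2 (by positivity : 0 ≤ 16 * h ^ 2)
      rw [← mul_assoc] at this
      have e1 : 16 * h ^ 2 * (1 / (16 * h ^ 2)) = 1 := by field_simp
      rwa [e1, one_mul] at this
    refine h1.trans ?_
    have h3 := mul_le_mul_of_nonneg_left hfin (by positivity : 0 ≤ 16 * h)
    have e1 : 16 * h * Λ = r ^ 2 / 2 := by
      rw [hh]
      field_simp
      ring
    have e2 : 16 * h * (Λ * ∫ x, v τ x ^ 2) = r ^ 2 / 2 * ∫ x, v τ x ^ 2 := by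
      rw [← mul_assoc, e1]
    linarith
  have hZv : (∫ x, v τ x ^ 2) ≤ Z + 1 / r ^ 2 * ∫ x, ‖x - x₀‖ ^ 2 * v τ x ^ 2 := by
    rw [hZ, ← integral_indicator measurableSet_ball, ← integral_const_mul,
      ← integral_add ((hu.integrable_sq τ).indicator measurableSet_ball)
        ((iv τ _ (by fun_prop)).const_mul _)]
    refine integral_mono (ivv τ) (((hu.integrable_sq τ).indicator measurableSet_ball).add
        ((iv τ _ (by fun_prop)).const_mul _)) fun x => ?_
    by_cases hx : x ∈ ball x₀ r
    · simp only [indicator_of_mem hx]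
      have := hup τ (by linarith) x
      have h2 : 0 ≤ 1 / r ^ 2 * (‖x - x₀‖ ^ 2 * v τ x ^ 2) := by positivity
      linarith
    · simp only [indicator_of_notMem hx, zero_add]
      rw [← mul_assoc]
      refine le_mul_of_one_le_left (sq_nonneg _) ?_
      rw [one_div, ← div_eq_inv_mul, one_le_div (by positivity)]
      rw [mem_ball, not_lt, dist_eq_norm] at hx
      exact pow_le_pow_left₀ hr.le hx 2
  have hH2 : (∫ x, v τ x ^ 2) ≤ 2 * Z := by
    have := mul_le_mul_of_nonneg_left hS (by positivity : 0 ≤ 1 / r ^ 2)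
    have e1 : 1 / r ^ 2 * (r ^ 2 / 2 * ∫ x, v τ x ^ 2) = (∫ x, v τ x ^ 2) / 2 := by field_simp
    rw [e1] at this
    linarith
  have hl := (hlow τ (by linarith)).trans hH2
  have e3 : R ^ 2 / (τ + h - τ) = 32 * R ^ 2 / r ^ 2 * Λ := by
    rw [add_sub_cancel_left, hh]
    field_simp
  rw [e3, ← hB] at hl
  have hl2 := mul_le_mul_of_nonneg_left hl (exp_pos (32 * R ^ 2 / r ^ 2 * Λ)).le
  rw [← mul_assoc, ← exp_add, add_neg_cancel, exp_zero, one_mul] at hl2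
  have : 0 ≤ exp (-e) * A := by positivity
  linarith

end IsFlow

theorem observability_of_interpolation {M L P : ℝ} (hM0 : 0 < M) (hL0 : 0 < L) (hP0 : 0 ≤ P)
    {B Z : ℝ → ℝ} (hanti : Antitone B) (hB0 : ∀ s, 0 ≤ B s) (cZ : Continuous Z)
    (hZ0 : ∀ s, 0 ≤ Z s)
    (hint : ∀ s σ e : ℝ, 0 < σ → 0 ≤ e → B (s + σ) ≤
      2 * exp (M * (2 * e + L / σ + P * σ)) * Z (s + σ) + exp (-e) * B s)
    {τ : ℝ} (hτ : 0 < τ) :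
    B τ ≤ exp (2 * log 2 + 2 * M * log 2 +
      2 * (M * L + 1) * (2 * (8 * M + 1)) / τ + M * (P * τ)) * ∫ s in (0 : ℝ)..τ, Z s := by
  set κ := 1 / (2 * (8 * M + 1)) with hκ
  have hκ0 : 0 < κ := by positivity
  set θ := 8 * M / (8 * M + 1) with hθ
  have hθ0 : 0 < θ := by positivity
  have hθκ : θ + 2 * κ = 1 := by
    rw [hθ, hκ]
    field_simp
  set F := 2 * (M * L + 1) * (2 * (8 * M + 1)) with hF
  have hF0 : 0 < F := by positivity
  have hFκ : F = 2 * (M * L / κ + 1 / κ) := by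
    rw [hF, hκ]
    field_simp
  clear_value F
  have hl2 : 0 < log 2 := Real.log_pos one_lt_two
  set Ob := ∫ s in (0 : ℝ)..τ, Z s with hOb
  have hOb0 : 0 ≤ Ob := intervalIntegral.integral_nonneg hτ.le fun s _ => hZ0 s
  set K := 2 * exp (2 * M * log 2 + M * (P * τ)) with hK
  have hK0 : 0 < K := by positivity
  have step : ∀ t ∈ Ioc 0 τ, exp (-(F / t)) * B t ≤
      K * Ob + 1 / 2 * (exp (-(F / (θ * t))) * B (θ * t)) := by
    rintro t ⟨ht, htτ⟩
    set e := F / (8 * M * t) + log 2 with he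
    have he0 : 0 ≤ e := by positivity
    set Q := M * (2 * e + L / (κ * t) + P * τ) with hQ
    have hpt : ∀ s ∈ Icc ((1 - κ) * t) t,
        B t - exp (-e) * B (θ * t) ≤ 2 * exp Q * Z s := by
      rintro s ⟨hs1, hs2⟩
      have hσ : κ * t ≤ s - θ * t := by nlinarith
      have hσ0 : 0 < s - θ * t := lt_of_lt_of_le (by positivity) hσ
      have h1 := hint (θ * t) (s - θ * t) e hσ0 he0
      rw [add_sub_cancel] at h1
      have h2 : B t ≤ B s := hanti hs2
      have h4 : M * (2 * e + L / (s - θ * t) + P * (s - θ * t)) ≤ Q := by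
        refine mul_le_mul_of_nonneg_left ?_ hM0.le
        have a1 : L / (s - θ * t) ≤ L / (κ * t) :=
          div_le_div_of_nonneg_left hL0.le (by positivity) hσ
        have a2 : P * (s - θ * t) ≤ P * τ :=
          mul_le_mul_of_nonneg_left (by nlinarith) hP0
        linarith
      have h5 : 2 * exp (M * (2 * e + L / (s - θ * t) + P * (s - θ * t))) * Z s ≤
          2 * exp Q * Z s :=
        mul_le_mul_of_nonneg_right
          (mul_le_mul_of_nonneg_left (exp_le_exp.2 h4) zero_le_two) (hZ0 s)
      linarith
    have hint : κ * t * (B t - exp (-e) * B (θ * t)) ≤ 2 * exp Q * Ob := by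
      have h1 : (∫ _ in ((1 - κ) * t)..t, (B t - exp (-e) * B (θ * t))) ≤
          ∫ s in ((1 - κ) * t)..t, 2 * exp Q * Z s :=
        intervalIntegral.integral_mono_on (by nlinarith) intervalIntegrable_const
          ((cZ.const_mul _).intervalIntegrable _ _) hpt
      rw [intervalIntegral.integral_const, intervalIntegral.integral_const_mul, smul_eq_mul] at h1
      have h2 : (∫ s in ((1 - κ) * t)..t, Z s) ≤ Ob := by
        refine intervalIntegral.integral_mono_interval (by nlinarith) (by nlinarith) htτ
          (Eventually.of_forall fun s => hZ0 s) (cZ.intervalIntegrable _ _)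
      have h3 := mul_le_mul_of_nonneg_left h2 (by positivity : 0 ≤ 2 * exp Q)
      have e1 : t - (1 - κ) * t = κ * t := by ring
      rw [e1] at h1
      linarith
    have hB1 : B t - exp (-e) * B (θ * t) ≤ 2 * exp (Q + 1 / (κ * t)) * Ob := by
      have hk : 0 < κ * t := by positivity
      have h1 : 1 / (κ * t) ≤ exp (1 / (κ * t)) := by
        have := Real.add_one_le_exp (1 / (κ * t))
        linarith
      have h2 : B t - exp (-e) * B (θ * t) ≤ 2 * exp Q * Ob * (1 / (κ * t)) := by
        rw [mul_one_div, le_div_iff₀ hk]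
        linarith
      refine h2.trans ?_
      rw [exp_add]
      have := mul_le_mul_of_nonneg_left h1 (by positivity : 0 ≤ 2 * exp Q * Ob)
      linarith
    have h7 := mul_le_mul_of_nonneg_left hB1 (exp_pos (-(F / t))).le
    have e2 : exp (-(F / t)) * exp (-e) = 1 / 2 * exp (-(F / (θ * t))) := by
      have a1 : -(F / t) + -e = -log 2 + -(F / (θ * t)) := by
        rw [he, hθ]
        field_simp
        ring
      rw [← exp_add, a1, exp_add, Real.exp_neg, Real.exp_log two_pos]
      norm_num
    have e3 : exp (-(F / t)) * (2 * exp (Q + 1 / (κ * t)) * Ob) ≤ K * Ob := by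
      rw [← mul_assoc]
      refine mul_le_mul_of_nonneg_right ?_ hOb0
      rw [mul_left_comm, ← exp_add, hK]
      refine mul_le_mul_of_nonneg_left (exp_le_exp.2 ?_) zero_le_two
      have a1 : -(F / t) + (Q + 1 / (κ * t)) = 2 * M * log 2 + M * (P * τ) -
          F / 4 / t := by
        have b1 : M * (F / (8 * M * t)) = F / 8 / t := by
          field_simp
        have b2 : M * (L / (κ * t)) + 1 / (κ * t) = F / 2 / t := by
          rw [hFκ, div_mul_eq_div_div, div_mul_eq_div_div]
          ring
        rw [hQ, he]
        linear_combination 2 * b1 + b2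
      rw [a1]
      have : 0 ≤ F / 4 / t := by positivity
      linarith
    have e4 : exp (-(F / t)) * (B t - exp (-e) * B (θ * t)) =
        exp (-(F / t)) * B t - 1 / 2 * (exp (-(F / (θ * t))) * B (θ * t)) := by
      rw [mul_sub, ← mul_assoc, e2]
      ring
    linarith
  have iter : ∀ n : ℕ, ∀ t ∈ Ioc 0 τ, exp (-(F / t)) * B t ≤
      2 * K * Ob + (1 / 2) ^ n * B 0 := by
    intro n
    induction n with
    | zero =>
      rintro t ⟨ht, htτ⟩
      have h1 : B t ≤ B 0 := hanti ht.le
      have h2 : exp (-(F / t)) ≤ 1 := exp_le_one_iff.2 (by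
        have : 0 ≤ F / t := by positivity
        linarith)
      have h3 := mul_le_mul h2 h1 (hB0 t) zero_le_one
      have h4 : 0 ≤ 2 * K * Ob := by positivity
      simpa using h3.trans (by linarith)
    | succ n ih =>
      rintro t ⟨ht, htτ⟩
      have h1 := step t ⟨ht, htτ⟩
      have h2 := ih (θ * t) ⟨by positivity, by nlinarith⟩
      rw [pow_succ]
      linarith
  have hlim : exp (-(F / τ)) * B τ ≤ 2 * K * Ob := by
    have ht : Tendsto (fun n : ℕ => 2 * K * Ob + (1 / 2 : ℝ) ^ n * B 0) atTop
        (𝓝 (2 * K * Ob + 0 * B 0)) :=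
      ((tendsto_pow_atTop_nhds_zero_of_lt_one (by norm_num) (by norm_num)).mul_const _).const_add _
    have := ge_of_tendsto' ht fun n => iter n τ ⟨hτ, le_rfl⟩
    simpa using this
  have h8 := mul_le_mul_of_nonneg_left hlim (exp_pos (F / τ)).le
  rw [← mul_assoc, ← exp_add, add_neg_cancel, exp_zero, one_mul] at h8
  refine h8.trans ?_
  rw [← mul_assoc]
  refine mul_le_mul_of_nonneg_right ?_ hOb0
  refine le_of_eq ?_
  have a1 : exp (2 * log 2) = 4 := by
    rw [two_mul, exp_add, Real.exp_log two_pos]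
    norm_num
  have a2 : 2 * log 2 + 2 * M * log 2 + F / τ + M * (P * τ) =
      F / τ + (2 * log 2 + (2 * M * log 2 + M * (P * τ))) := by ring
  rw [a2, exp_add, exp_add (2 * log 2), a1, hK]
  ring

/-- Observability from a set containing a ball, with explicit dependence on `μ` and on time. -/
theorem exists_observability {R r : ℝ} (hr : 0 < r) (hrR : r ≤ R) {x₀ : E} (hx₀ : x₀ ∈ ball 0 R)
    {A : Set E} (hA : MeasurableSet A) (hrA : ball x₀ r ⊆ A) :
    ∃ C : ℝ, 0 < C ∧ ∀ (μ : ℝ) (u u' : ℝ → E → ℝ) (G G' : ℝ → E → E),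
      IsFlow (ball 0 R) μ u u' G G' → ∀ τ : ℝ, 0 < τ →
      (∫ x, u τ x ^ 2) ≤ exp (C * (1 + 1 / τ + μ ^ 2 * τ)) *
        ∫ s in (0 : ℝ)..τ, ∫ x in A, u s x ^ 2 := by
  have hR : 0 < R := hr.trans_le hrR
  set M := 32 * R ^ 2 / r ^ 2 with hM
  have hM0 : 0 < M := by positivity
  have hl2 : 0 < log 2 := Real.log_pos one_lt_two
  set c := 2 * log 2 + 2 * M * log 2 with hc
  set F := 2 * (M * (4 * R ^ 2) + 1) * (2 * (8 * M + 1)) with hF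
  have hc0 : 0 < c := by positivity
  have hF0 : 0 < F := by positivity
  have hN0 : 0 < M * R ^ 2 / 8 := by positivity
  refine ⟨c + F + M * R ^ 2 / 8, by positivity, ?_⟩
  intro μ u u' G G' hu τ hτ
  have hO : Bornology.IsBounded (ball (0 : E) R) := isBounded_ball
  have cZ := hu.continuous_setIntegral_sq hA
  have key := observability_of_interpolation (P := R ^ 2 * μ ^ 2 / 8) (B := fun s => ∫ x, u s x ^ 2)
    (Z := fun s => ∫ x in A, u s x ^ 2) hM0 (by positivity : 0 < 4 * R ^ 2) (by positivity)
    (fun s t hst => hu.integral_sq_anti hO hst) (fun s => integral_nonneg fun x => by positivity)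
    cZ (fun s => integral_nonneg fun x => by positivity) (fun s σ e hσ he => by
      have h1 := (hu.shift s).interpolation hx₀ hr hrR hσ he
      simp only [zero_add, ← hM] at h1
      have h3 : (∫ x in ball x₀ r, u (s + σ) x ^ 2) ≤ ∫ x in A, u (s + σ) x ^ 2 :=
        setIntegral_mono_set (hu.integrable_sq _).integrableOn
          (Eventually.of_forall fun x => sq_nonneg _) hrA.eventuallyLE
      have e1 : R ^ 2 * μ ^ 2 * σ / 8 = R ^ 2 * μ ^ 2 / 8 * σ := by ring
      rw [add_comm σ s, e1] at h1
      have h4 := mul_le_mul_of_nonneg_left h3 (by positivity : 0 ≤ 2 * exp (M *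
        (2 * e + 4 * R ^ 2 / σ + R ^ 2 * μ ^ 2 / 8 * σ)))
      linarith) hτ
  refine key.trans (mul_le_mul_of_nonneg_right (exp_le_exp.2 ?_)
    (intervalIntegral.integral_nonneg hτ.le fun s _ => integral_nonneg fun x => by positivity))
  have hp0 : 0 < 1 / τ := by positivity
  have hm0 : 0 ≤ μ ^ 2 * τ := by positivity
  have e6 : F / τ = F * (1 / τ) := by ring
  rw [e6]
  nlinarith [mul_nonneg hc0.le hp0.le, mul_nonneg hc0.le hm0, mul_nonneg hF0.le hm0,
    mul_nonneg hN0.le hp0.le]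

theorem antitoneOn_Icc_of_hasDerivAt {f f' : ℝ → ℝ} {a b : ℝ}
    (h : ∀ t ∈ Icc a b, HasDerivAt f (f' t) t) (h0 : ∀ t ∈ Icc a b, f' t ≤ 0) :
    AntitoneOn f (Icc a b) := by
  refine antitoneOn_of_deriv_nonpos (convex_Icc a b)
    (fun t ht => (h t ht).continuousAt.continuousWithinAt) (fun t ht => ?_) (fun t ht => ?_)
  · exact (h t (interior_subset ht)).differentiableAt.differentiableWithinAt
  · rw [(h t (interior_subset ht)).deriv]
    exact h0 t (interior_subset ht)

/-- If the frequency `D / H` decays at most exponentially up to a source term, then `H` itself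
decays doubly exponentially. -/
theorem superexponential_decay {H D S I D' : ℝ → ℝ} {τ μ n₀ σ : ℝ} (hτ : 0 < τ) (hμ : 0 < μ)
    (hσ : 0 < σ) (hσn : σ ≤ n₀) (hστ : σ * τ ≤ 1 / 4) (cS : Continuous S) (hS0 : ∀ t, 0 ≤ S t)
    (hH0 : ∀ t, 0 ≤ H t) (hD0 : ∀ t, n₀ * H t ≤ D t)
    (hH : ∀ t, HasDerivAt H (-2 * D t + 2 * I t) t) (hI : ∀ t, I t ^ 2 ≤ H t * S t)
    (hD : ∀ t, HasDerivAt D (D' t) t)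
    (hD' : ∀ t, D' t * H t - D t * (-2 * D t + 2 * I t) ≤ H t * (-4 * μ * D t + 1 / 2 * S t)) :
    H τ ≤ 4 / σ * (∫ s in (0 : ℝ)..τ, S s) +
      exp (5 / 4 - n₀ * (exp (4 * μ * τ) - 1) / (4 * μ)) * H 0 := by
  have hn₀ : 0 < n₀ := hσ.trans_le hσn
  have hτm : τ ∈ Icc 0 τ := ⟨hτ.le, le_rfl⟩
  have h0m : (0 : ℝ) ∈ Icc 0 τ := ⟨le_rfl, hτ.le⟩
  set W : ℝ → ℝ := fun t => ∫ s in (0 : ℝ)..t, S s with hW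
  have dW : ∀ t, HasDerivAt W (S t) t := fun t =>
    intervalIntegral.integral_hasDerivAt_right (cS.intervalIntegrable _ _)
      (cS.stronglyMeasurableAtFilter _ _) cS.continuousAt
  have hW0 : W 0 = 0 := by simp [hW]
  have hWt : ∀ t, 0 ≤ t → 0 ≤ W t := fun t ht =>
    intervalIntegral.integral_nonneg ht fun s _ => hS0 s
  have hHI : ∀ t, 2 * I t ≤ H t / τ + τ * S t := fun t => by
    have h1 : (2 * I t) ^ 2 ≤ (H t / τ + τ * S t) ^ 2 := by
      have e : (H t / τ + τ * S t) ^ 2 = (H t / τ - τ * S t) ^ 2 + 4 * (H t * S t) := by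
        field_simp
        ring
      rw [e]
      nlinarith [hI t, sq_nonneg (H t / τ - τ * S t)]
    have h2 : 0 ≤ H t / τ + τ * S t :=
      add_nonneg (div_nonneg (hH0 t) hτ.le) (mul_nonneg hτ.le (hS0 t))
    exact le_of_sq_le_sq h1 h2
  have hE0 : 0 ≤ exp (5 / 4 - n₀ * (exp (4 * μ * τ) - 1) / (4 * μ)) * H 0 :=
    mul_nonneg (exp_pos _).le (hH0 0)
  by_cases hcase : H τ ≤ 4 / σ * W τ
  · linarith
  rw [not_le] at hcase
  have hHτ : 0 < H τ := lt_of_le_of_lt (mul_nonneg (by positivity) (hWt τ hτ.le)) hcase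
  set m := H τ / 4 with hm
  have hm0 : 0 < m := by positivity
  have hWm : W τ ≤ σ * m := by
    have : 4 / σ * W τ = 4 * W τ / σ := by ring
    rw [this, div_lt_iff₀ hσ] at hcase
    rw [hm]
    linarith
  -- the lower bound for `H`
  have hlow : ∀ t ∈ Icc 0 τ, m ≤ H t := by
    have hanti := antitoneOn_Icc_of_hasDerivAt (a := 0) (b := τ)
      (f := fun t => exp (-(t / τ)) * H t - τ * W t)
      (f' := fun t => exp (-(t / τ)) * (-(1 / τ)) * H t +
        exp (-(t / τ)) * (-2 * D t + 2 * I t) - τ * S t)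
      (fun t _ => ((((hasDerivAt_id t).div_const τ).neg.exp).mul (hH t)).sub ((dW t).const_mul τ))
      (fun t ht => by
        have e1 : exp (-(t / τ)) ≤ 1 := exp_le_one_iff.2 (by
          have := div_nonneg ht.1 hτ.le
          linarith)
        have e2 : 0 < exp (-(t / τ)) := exp_pos _
        have e3 : -(1 / τ) * H t + (-2 * D t + 2 * I t) ≤ τ * S t := by
          have a1 := hHI t
          have a2 : 0 ≤ D t := (mul_nonneg hn₀.le (hH0 t)).trans (hD0 t)
          have a3 : -(1 / τ) * H t = -(H t / τ) := by ring
          linarith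
        have e4 := mul_le_mul_of_nonneg_left e3 e2.le
        have e5 := mul_le_mul_of_nonneg_right e1 (mul_nonneg hτ.le (hS0 t))
        linarith)
    intro t ht
    have h1 := hanti ht hτm ht.2
    simp only [div_self hτ.ne'] at h1
    have h2 : exp (-(t / τ)) * H t ≤ H t := by
      refine mul_le_of_le_one_left (hH0 t) (exp_le_one_iff.2 ?_)
      have := div_nonneg ht.1 hτ.le
      linarith
    have h3 : 0.3125 ≤ exp (-1) := by
      have := Real.exp_neg_one_gt_d9
      linarith
    have h4 := mul_le_mul_of_nonneg_right h3 hHτ.le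
    have h5 : τ * W τ ≤ 1 / 4 * m := by
      calc τ * W τ ≤ τ * (σ * m) := mul_le_mul_of_nonneg_left hWm hτ.le
        _ = (σ * τ) * m := by ring
        _ ≤ 1 / 4 * m := mul_le_mul_of_nonneg_right hστ hm0.le
    have h6 : 0 ≤ τ * W t := mul_nonneg hτ.le (hWt t ht.1)
    rw [hm] at h5 ⊢
    linarith
  have hpos : ∀ t ∈ Icc 0 τ, 0 < H t := fun t ht => hm0.trans_le (hlow t ht)
  -- the lower bound for the frequency
  have hfreq : ∀ t ∈ Icc 0 τ, exp (4 * μ * (τ - t)) * (n₀ / 2) ≤ D t / H t := by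
    have hanti := antitoneOn_Icc_of_hasDerivAt (a := 0) (b := τ)
      (f := fun t => exp (4 * μ * t) * (D t / H t) - exp (4 * μ * τ) / (2 * m) * W t)
      (f' := fun t => exp (4 * μ * t) * (4 * μ) * (D t / H t) + exp (4 * μ * t) *
        ((D' t * H t - D t * (-2 * D t + 2 * I t)) / H t ^ 2) -
          exp (4 * μ * τ) / (2 * m) * S t)
      (fun t ht => by
        have d1 := ((hasDerivAt_id t).const_mul (4 * μ)).exp
        simp only [id, mul_one] at d1
        exact (d1.mul ((hD t).div (hH t) (hpos t ht).ne')).sub ((dW t).const_mul _))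
      (fun t ht => by
        have hp := hpos t ht
        have e2 : 0 < exp (4 * μ * t) := exp_pos _
        have e1 : (D' t * H t - D t * (-2 * D t + 2 * I t)) / H t ^ 2 ≤
            -(4 * μ) * (D t / H t) + 1 / (2 * H t) * S t := by
          rw [div_le_iff₀ (by positivity)]
          refine (hD' t).trans (le_of_eq ?_)
          field_simp
        have e3 := mul_le_mul_of_nonneg_left e1 e2.le
        have e4 : 1 / (2 * H t) ≤ 1 / (2 * m) :=
          one_div_le_one_div_of_le (by positivity) (by linarith [hlow t ht])
        have e5 : exp (4 * μ * t) * (1 / (2 * H t)) ≤ exp (4 * μ * τ) * (1 / (2 * m)) :=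
          mul_le_mul (exp_le_exp.2 (mul_le_mul_of_nonneg_left ht.2 (by positivity))) e4
            (by positivity) (exp_pos _).le
        have e6 := mul_le_mul_of_nonneg_right e5 (hS0 t)
        have e7 : exp (4 * μ * τ) * (1 / (2 * m)) = exp (4 * μ * τ) / (2 * m) := by ring
        rw [e7] at e6
        linarith)
    intro t ht
    have h1 := hanti ht hτm ht.2
    dsimp only at h1
    have h2 : n₀ ≤ D τ / H τ := by
      rw [le_div_iff₀ hHτ]
      exact hD0 τ
    have h3 : exp (4 * μ * τ) / (2 * m) * W τ ≤ exp (4 * μ * τ) * (n₀ / 2) := by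
      calc exp (4 * μ * τ) / (2 * m) * W τ ≤ exp (4 * μ * τ) / (2 * m) * (n₀ * m) :=
            mul_le_mul_of_nonneg_left (hWm.trans (mul_le_mul_of_nonneg_right hσn hm0.le))
              (by positivity)
        _ = _ := by field_simp
    have h4 := mul_le_mul_of_nonneg_left h2 (exp_pos (4 * μ * τ)).le
    have h5 : 0 ≤ exp (4 * μ * τ) / (2 * m) * W t :=
      mul_nonneg (by positivity) (hWt t ht.1)
    have h6 : exp (4 * μ * τ) * (n₀ / 2) ≤ exp (4 * μ * t) * (D t / H t) := by linarith
    have e1 : exp (4 * μ * τ) = exp (4 * μ * t) * exp (4 * μ * (τ - t)) := by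
      rw [← exp_add]
      congr 1
      ring
    rw [e1, mul_assoc] at h6
    exact le_of_mul_le_mul_left h6 (exp_pos _)
  have hanti := antitoneOn_Icc_of_hasDerivAt (a := 0) (b := τ)
    (f := fun t => log (H t) - n₀ / (4 * μ) * exp (4 * μ * (τ - t)) - t / τ
      - τ / m * W t)
    (f' := fun t => (-2 * D t + 2 * I t) / H t -
      n₀ / (4 * μ) * (exp (4 * μ * (τ - t)) * (4 * μ * (-1))) - 1 / τ - τ / m * S t)
    (fun t ht => by
      have d1 := (((hasDerivAt_id t).const_sub τ).const_mul (4 * μ)).exp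
      exact ((((hH t).log (hpos t ht).ne').sub (d1.const_mul _)).sub
        ((hasDerivAt_id t).div_const τ)).sub ((dW t).const_mul _))
    (fun t ht => by
      have hp := hpos t ht
      have e1 := hfreq t ht
      have e2 : (-2 * D t + 2 * I t) / H t ≤ -2 * (D t / H t) + 1 / τ + τ * S t / H t := by
        rw [div_le_iff₀ hp]
        have := hHI t
        have e : (-2 * (D t / H t) + 1 / τ + τ * S t / H t) * H t =
            -2 * D t + (H t / τ + τ * S t) := by
          field_simp
          ring
        rw [e]
        linarith
      have e3 : τ * S t / H t ≤ τ * S t / m :=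
        div_le_div_of_nonneg_left (mul_nonneg hτ.le (hS0 t)) hm0 (hlow t ht)
      have e4 : n₀ / (4 * μ) * (exp (4 * μ * (τ - t)) * (4 * μ * (-1))) =
          -(exp (4 * μ * (τ - t)) * n₀) := by
        field_simp
      have e5 : τ * S t / m = τ / m * S t := by ring
      rw [e4]
      linarith)
  have h1 := hanti h0m hτm hτ.le
  dsimp only at h1
  rw [hW0, sub_self, mul_zero, exp_zero, div_self hτ.ne', zero_div, sub_zero] at h1
  have h2 : τ / m * W τ ≤ 1 / 4 := by
    calc τ / m * W τ ≤ τ / m * (σ * m) := mul_le_mul_of_nonneg_left hWm (by positivity)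
      _ = σ * τ := by field_simp
      _ ≤ 1 / 4 := hστ
  have h3 : log (H τ) ≤
      (5 / 4 - n₀ * (exp (4 * μ * τ) - 1) / (4 * μ)) + log (H 0) := by
    have e : n₀ * (exp (4 * μ * τ) - 1) / (4 * μ) =
        n₀ / (4 * μ) * exp (4 * μ * τ) - n₀ / (4 * μ) := by ring
    rw [e]
    simp only [sub_zero, mul_one] at h1
    linarith
  have h4 := exp_le_exp.2 h3
  rw [exp_add, Real.exp_log hHτ, Real.exp_log (hpos 0 h0m)] at h4
  have h5 : 0 ≤ 4 / σ * W τ := mul_nonneg (by positivity) (hWt τ hτ.le)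
  linarith

theorem integral_le_of_hasDerivAt_le {A A' g k : ℝ → ℝ} (hA : ∀ t, HasDerivAt A (A' t) t)
    (hA0 : ∀ t, 0 ≤ A t) (cg : Continuous g) (ck : Continuous k) (hg : ∀ t, 0 ≤ g t)
    (hk : ∀ t, 0 ≤ k t) (h : ∀ t, A' t ≤ -g t + k t) {b T : ℝ} (hb : 0 ≤ b) (hbT : b ≤ T) :
    b * (∫ s in b..T, g s) ≤ (∫ s in (0 : ℝ)..T, A s) + T * ∫ s in (0 : ℝ)..T, k s := by
  have cA : Continuous A := continuous_iff_continuousAt.2 fun t => (hA t).continuousAt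
  have cT : Continuous fun s => s * g s := continuous_id.mul cg
  have dI : ∀ {F : ℝ → ℝ}, Continuous F → ∀ t,
      HasDerivAt (fun t => ∫ s in (0 : ℝ)..t, F s) (F t) t :=
    fun cF t => intervalIntegral.integral_hasDerivAt_right (cF.intervalIntegrable _ _)
      (cF.stronglyMeasurableAtFilter _ _) cF.continuousAt
  have hT : 0 ≤ T := hb.trans hbT
  have hanti := antitoneOn_Icc_of_hasDerivAt (a := 0) (b := T)
    (f := fun t => t * A t + (∫ s in (0 : ℝ)..t, s * g s) - (∫ s in (0 : ℝ)..t, A s) -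
      T * ∫ s in (0 : ℝ)..t, k s)
    (f' := fun t => 1 * A t + t * A' t + t * g t - A t - T * k t)
    (fun t _ => ((((hasDerivAt_id t).mul (hA t)).add (dI cT t)).sub (dI cA t)).sub
      ((dI ck t).const_mul T))
    (fun t ht => by
      have h1 := mul_le_mul_of_nonneg_left (h t) ht.1
      have h2 := mul_le_mul_of_nonneg_right ht.2 (hk t)
      linarith)
  have h1 := hanti ⟨le_rfl, hT⟩ ⟨hT, le_rfl⟩ hT
  simp only [zero_mul, intervalIntegral.integral_same, mul_zero, sub_zero, add_zero] at h1
  have h2 : b * (∫ s in b..T, g s) ≤ ∫ s in b..T, s * g s := by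
    rw [← intervalIntegral.integral_const_mul]
    exact intervalIntegral.integral_mono_on hbT ((cg.const_mul b).intervalIntegrable _ _)
      (cT.intervalIntegrable _ _) fun s hs => mul_le_mul_of_nonneg_right hs.1 (hg s)
  have h3 : 0 ≤ ∫ s in (0 : ℝ)..b, s * g s :=
    intervalIntegral.integral_nonneg hb fun s hs => mul_nonneg hs.1 (hg s)
  have h4 := intervalIntegral.integral_add_adjacent_intervals
    (cT.intervalIntegrable (μ := volume) 0 b) (cT.intervalIntegrable (μ := volume) b T)
  have h5 : 0 ≤ T * A T := mul_nonneg hT (hA0 T)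
  linarith

theorem le_exp_of_hasDerivAt_le {A A' k : ℝ → ℝ} (hA : ∀ t, HasDerivAt A (A' t) t)
    (ck : Continuous k) (hk : ∀ t, 0 ≤ k t) {c : ℝ} (hc : 0 ≤ c) (h : ∀ t, A' t ≤ -c * A t + k t)
    {T : ℝ} (hT : 0 ≤ T) :
    A T ≤ exp (-(c * T)) * A 0 + ∫ s in (0 : ℝ)..T, k s := by
  have dI : ∀ t, HasDerivAt (fun t => ∫ s in (0 : ℝ)..t, k s) (k t) t :=
    fun t => intervalIntegral.integral_hasDerivAt_right (ck.intervalIntegrable _ _)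
      (ck.stronglyMeasurableAtFilter _ _) ck.continuousAt
  have hanti := antitoneOn_Icc_of_hasDerivAt (a := 0) (b := T)
    (f := fun t => exp (-(c * (T - t))) * A t - ∫ s in (0 : ℝ)..t, k s)
    (f' := fun t => exp (-(c * (T - t))) * (-(c * (-1))) * A t +
      exp (-(c * (T - t))) * A' t - k t)
    (fun t _ => ((((((hasDerivAt_id t).const_sub T).const_mul c).neg).exp).mul (hA t)).sub (dI t))
    (fun t ht => by
      have e1 : exp (-(c * (T - t))) ≤ 1 := exp_le_one_iff.2 (by
        have := mul_nonneg hc (sub_nonneg.2 ht.2)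
        linarith)
      have e2 : 0 < exp (-(c * (T - t))) := exp_pos _
      have e3 := mul_le_mul_of_nonneg_left (h t) e2.le
      have e4 := mul_le_mul_of_nonneg_right e1 (hk t)
      linarith)
  have h1 := hanti ⟨le_rfl, hT⟩ ⟨hT, le_rfl⟩ hT
  simp only [intervalIntegral.integral_same, sub_zero, sub_self, mul_zero, neg_zero,
    exp_zero, one_mul] at h1
  linarith

namespace IsFlow

variable {O : Set E} {μ : ℝ} {u u' : ℝ → E → ℝ} {G G' : ℝ → E → E}

theorem exists_hasDerivAt_integral_sq_mul_sq (hu : IsFlow O μ u u' G G')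
    (hO : Bornology.IsBounded O) {ρ : E → ℝ} (hρ : ContDiff ℝ ∞ ρ) (t : ℝ) :
    ∃ e, HasDerivAt (fun t => ∫ x, ρ x ^ 2 * u t x ^ 2) e t ∧
      e ≤ -(∫ x, ρ x ^ 2 * ‖G t x‖ ^ 2) + 4 * (∫ x, ‖∇ ρ x‖ ^ 2 * u t x ^ 2) -
        2 * μ ^ 2 * ∫ x, ρ x ^ 2 * ‖x‖ ^ 2 * u t x ^ 2 := by
  have hρ2 : ContDiff ℝ ∞ fun x => ρ x ^ 2 := hρ.pow 2
  refine ⟨_, hu.hasDerivAt_integral_mul_sq hO hρ2 t, ?_⟩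
  have cG : Continuous fun x => ‖∇ ρ x‖ ^ 2 := hρ.continuous_gradient.norm.pow 2
  have i1 := hu.integrable_mul_normSq hO hρ2.continuous t
  have i2 := hu.integrable_mul_sq hO cG t
  have hgrad : ∀ x, ∇ (fun x => ρ x ^ 2) x = (2 * ρ x) • ∇ ρ x := fun x => by
    have hd : DifferentiableAt ℝ ρ x := hρ.differentiable (by simp) x
    have : (fun x => ρ x ^ 2) = fun x => ρ x * ρ x := by
      funext x
      ring
    rw [this, gradient_fun_mul hd hd, ← add_smul, two_mul]
  have key : ∀ x, -(inner ℝ (u t x • ∇ (fun x => ρ x ^ 2) x) (G t x)) ≤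
      1 / 2 * (ρ x ^ 2 * ‖G t x‖ ^ 2) + 2 * (‖∇ ρ x‖ ^ 2 * u t x ^ 2) := fun x => by
    rw [hgrad, smul_smul, inner_smul_left, conj_trivial]
    have h1 := abs_real_inner_le_norm (∇ ρ x) (G t x)
    have h2 : -(u t x * (2 * ρ x) * inner ℝ (∇ ρ x) (G t x)) ≤
        2 * ((|u t x| * ‖∇ ρ x‖) * (|ρ x| * ‖G t x‖)) := by
      refine (neg_le_abs _).trans ?_
      rw [abs_mul, abs_mul, abs_mul, abs_two]
      have := mul_le_mul_of_nonneg_left h1 (by positivity : 0 ≤ |u t x| * (2 * |ρ x|))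
      linarith
    have h3 : ρ x ^ 2 * ‖G t x‖ ^ 2 = (|ρ x| * ‖G t x‖) ^ 2 := by rw [mul_pow, sq_abs]
    have h4 : ‖∇ ρ x‖ ^ 2 * u t x ^ 2 = (|u t x| * ‖∇ ρ x‖) ^ 2 := by
      rw [mul_pow, sq_abs, mul_comm]
    rw [h3, h4]
    nlinarith [sq_nonneg (2 * (|u t x| * ‖∇ ρ x‖) - |ρ x| * ‖G t x‖)]
  have h5 : -(∫ x, inner ℝ (u t x • ∇ (fun x => ρ x ^ 2) x) (G t x)) ≤
      1 / 2 * (∫ x, ρ x ^ 2 * ‖G t x‖ ^ 2) + 2 * ∫ x, ‖∇ ρ x‖ ^ 2 * u t x ^ 2 := by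
    have m : MemLp (fun x => u t x • ∇ (fun x => ρ x ^ 2) x) 2 (volume : Measure E) :=
      (hu.memLp t).smul_continuous hO (hu.lap t).isH01.zero hρ2.continuous_gradient
    rw [← integral_neg, ← integral_const_mul, ← integral_const_mul,
      ← integral_add (i1.const_mul _) (i2.const_mul _)]
    exact integral_mono (m.inner_integrable (hu.lap t).isH01.memLp_grad).neg
      ((i1.const_mul _).add (i2.const_mul _)) key
  linarith

theorem caccioppoli (hu : IsFlow O μ u u' G G') (hO : Bornology.IsBounded O) {ξ : E → ℝ}
    (hξ : ContDiff ℝ ∞ ξ) {b T : ℝ} (hb : 0 ≤ b) (hbT : b ≤ T) :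
    b * (∫ s in b..T, ∫ x, ξ x ^ 2 * ‖G s x‖ ^ 2) ≤
      (∫ s in (0 : ℝ)..T, ∫ x, ξ x ^ 2 * u s x ^ 2) +
        T * ∫ s in (0 : ℝ)..T, 4 * ∫ x, ‖∇ ξ x‖ ^ 2 * u s x ^ 2 := by
  choose e he hle using hu.exists_hasDerivAt_integral_sq_mul_sq hO hξ
  have cG : Continuous fun x => ‖∇ ξ x‖ ^ 2 := hξ.continuous_gradient.norm.pow 2
  have cξ : Continuous fun x => ξ x ^ 2 := hξ.continuous.pow 2
  refine integral_le_of_hasDerivAt_le he (fun t => integral_nonneg fun x => by positivity)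
    (hu.continuous_integral_mul_normSq hO cξ)
    ((hu.continuous_integral_mul_sq hO cG).const_mul 4)
    (fun t => integral_nonneg fun x => by positivity)
    (fun t => mul_nonneg (by norm_num) (integral_nonneg fun x => by positivity))
    (fun t => ?_) hb hbT
  have h1 : 0 ≤ ∫ x, ξ x ^ 2 * ‖x‖ ^ 2 * u t x ^ 2 := integral_nonneg fun x => by positivity
  have h2 := mul_nonneg (by positivity : 0 ≤ 2 * μ ^ 2) h1
  linarith [hle t]

/-- Decay away from the degeneracy set `{x = 0}`. -/
theorem outer_decay (hu : IsFlow O μ u u' G G') (hO : Bornology.IsBounded O) {ρ : E → ℝ}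
    (hρ : ContDiff ℝ ∞ ρ) {A : ℝ} (hA : 0 ≤ A) (h0 : ∀ x, ‖x‖ ^ 2 < A → ρ x = 0) {T : ℝ}
    (hT : 0 ≤ T) :
    (∫ x, ρ x ^ 2 * u T x ^ 2) ≤ exp (-(2 * μ ^ 2 * A * T)) * (∫ x, ρ x ^ 2 * u 0 x ^ 2) +
      ∫ s in (0 : ℝ)..T, 4 * ∫ x, ‖∇ ρ x‖ ^ 2 * u s x ^ 2 := by
  choose e he hle using hu.exists_hasDerivAt_integral_sq_mul_sq hO hρ
  have cG : Continuous fun x => ‖∇ ρ x‖ ^ 2 := hρ.continuous_gradient.norm.pow 2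
  refine le_exp_of_hasDerivAt_le he
    ((hu.continuous_integral_mul_sq hO cG).const_mul 4)
    (fun t => mul_nonneg (by norm_num) (integral_nonneg fun x => by positivity))
    (by positivity) (fun t => ?_) hT
  have h1 : 0 ≤ ∫ x, ρ x ^ 2 * ‖G t x‖ ^ 2 := integral_nonneg fun x => by positivity
  have h2 : A * (∫ x, ρ x ^ 2 * u t x ^ 2) ≤ ∫ x, ρ x ^ 2 * ‖x‖ ^ 2 * u t x ^ 2 := by
    rw [← integral_const_mul]
    refine integral_mono ((hu.integrable_mul_sq hO (hρ.continuous.pow 2) t).const_mul _)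
      (hu.integrable_mul_sq hO ((hρ.continuous.pow 2).mul (continuous_norm.pow 2)) t) fun x => ?_
    dsimp only
    by_cases hx : ‖x‖ ^ 2 < A
    · simp [h0 x hx]
    · have := mul_le_mul_of_nonneg_right (not_lt.1 hx) (by positivity : 0 ≤ ρ x ^ 2 * u t x ^ 2)
      linarith
  have h3 := mul_le_mul_of_nonneg_left h2 (by positivity : 0 ≤ 2 * μ ^ 2)
  linarith [hle t]

end IsFlow

theorem contDiff_smoothTransition : ContDiff ℝ ∞ smoothTransition :=
  smoothTransition.contDiff

theorem deriv_smoothTransition_eq_zero {r : ℝ} (hr : r ∉ Icc (0 : ℝ) 1) :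
    deriv smoothTransition r = 0 := by
  rw [mem_Icc, not_and_or, not_le, not_le] at hr
  rcases hr with hr | hr
  · have : smoothTransition =ᶠ[𝓝 r] fun _ => 0 := by
      filter_upwards [eventually_lt_nhds hr] with s hs
      exact smoothTransition.zero_of_nonpos hs.le
    rw [this.deriv_eq, deriv_const]
  · have : smoothTransition =ᶠ[𝓝 r] fun _ => 1 := by
      filter_upwards [eventually_gt_nhds hr] with s hs
      exact smoothTransition.one_of_one_le hs.le
    rw [this.deriv_eq, deriv_const]

theorem deriv_deriv_smoothTransition_eq_zero {r : ℝ} (hr : r ∉ Icc (0 : ℝ) 1) :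
    deriv (deriv smoothTransition) r = 0 := by
  have : deriv smoothTransition =ᶠ[𝓝 r] fun _ => 0 := by
    filter_upwards [isClosed_Icc.isOpen_compl.mem_nhds hr] with s hs
    exact deriv_smoothTransition_eq_zero hs
  rw [this.deriv_eq, deriv_const]

theorem exists_bound_deriv_smoothTransition : ∃ C : ℝ, 0 < C ∧ ∀ r,
    |deriv smoothTransition r| ≤ C ∧ |deriv (deriv smoothTransition) r| ≤ C := by
  have c1 : Continuous (deriv smoothTransition) :=
    (contDiff_deriv_of_smooth contDiff_smoothTransition).continuous
  have c2 : Continuous (deriv (deriv smoothTransition)) :=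
    (contDiff_deriv_of_smooth (contDiff_deriv_of_smooth contDiff_smoothTransition)).continuous
  obtain ⟨C1, h1⟩ := isCompact_Icc.exists_bound_of_continuousOn (s := Icc (0 : ℝ) 1) c1.continuousOn
  obtain ⟨C2, h2⟩ := isCompact_Icc.exists_bound_of_continuousOn (s := Icc (0 : ℝ) 1) c2.continuousOn
  refine ⟨|C1| + |C2| + 1, by positivity, fun r => ?_⟩
  by_cases hr : r ∈ Icc (0 : ℝ) 1
  · have a1 := h1 r hr
    have a2 := h2 r hr
    rw [norm_eq_abs] at a1 a2
    constructor
    · linarith [le_abs_self C1, abs_nonneg C2]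
    · linarith [le_abs_self C2, abs_nonneg C1]
  · rw [deriv_smoothTransition_eq_zero hr, deriv_deriv_smoothTransition_eq_zero hr, abs_zero]
    constructor <;> positivity

/-- The smooth step function increasing from `0` to `1` on `[c, c + h]`. -/
noncomputable def smoothStep (c h S : ℝ) : ℝ := smoothTransition ((S - c) / h)

section

variable {c h S : ℝ}

theorem contDiff_smoothStep : ContDiff ℝ ∞ (smoothStep c h) :=
  contDiff_smoothTransition.comp ((contDiff_id.sub contDiff_const).div_const h)

theorem smoothStep_nonneg : 0 ≤ smoothStep c h S := smoothTransition.nonneg _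

theorem smoothStep_le_one : smoothStep c h S ≤ 1 := smoothTransition.le_one _

theorem smoothStep_eq_zero (hh : 0 < h) (hS : S ≤ c) : smoothStep c h S = 0 :=
  smoothTransition.zero_of_nonpos (div_nonpos_of_nonpos_of_nonneg (by linarith) hh.le)

theorem smoothStep_eq_one (hh : 0 < h) (hS : c + h ≤ S) : smoothStep c h S = 1 :=
  smoothTransition.one_of_one_le ((one_le_div hh).2 (by linarith))

theorem hasDerivAt_smoothStep :
    HasDerivAt (smoothStep c h) (deriv smoothTransition ((S - c) / h) / h) S := by
  have h1 := (contDiff_smoothTransition.differentiable (by simp) ((S - c) / h)).hasDerivAt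
  have h2 : HasDerivAt (fun S => (S - c) / h) (1 / h) S :=
    ((hasDerivAt_id S).sub_const c).div_const h
  exact (h1.comp S h2).congr_deriv (by ring)

theorem deriv_smoothStep :
    deriv (smoothStep c h) = fun S => deriv smoothTransition ((S - c) / h) / h :=
  funext fun _ => hasDerivAt_smoothStep.deriv

theorem deriv_deriv_smoothStep :
    deriv (deriv (smoothStep c h)) =
      fun S => deriv (deriv smoothTransition) ((S - c) / h) / h ^ 2 := by
  funext S
  rw [deriv_smoothStep]
  have h1 := ((contDiff_deriv_of_smooth contDiff_smoothTransition).differentiable (by simp)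
    ((S - c) / h)).hasDerivAt
  have h2 : HasDerivAt (fun S => (S - c) / h) (1 / h) S :=
    ((hasDerivAt_id S).sub_const c).div_const h
  refine (((h1.comp S h2).div_const h).congr_deriv ?_).deriv
  ring

theorem sub_div_notMem_Icc (hh : 0 < h) (hS : S ∉ Icc c (c + h)) : (S - c) / h ∉ Icc (0 : ℝ) 1 := by
  intro hm
  refine hS ⟨?_, ?_⟩
  · have := (le_div_iff₀ hh).1 hm.1
    linarith
  · have := (div_le_iff₀ hh).1 hm.2
    linarith

theorem deriv_smoothStep_eq_zero (hh : 0 < h) (hS : S ∉ Icc c (c + h)) :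
    deriv (smoothStep c h) S = 0 := by
  rw [deriv_smoothStep]
  dsimp only
  rw [deriv_smoothTransition_eq_zero (sub_div_notMem_Icc hh hS), zero_div]

theorem deriv_deriv_smoothStep_eq_zero (hh : 0 < h) (hS : S ∉ Icc c (c + h)) :
    deriv (deriv (smoothStep c h)) S = 0 := by
  rw [deriv_deriv_smoothStep]
  dsimp only
  rw [deriv_deriv_smoothTransition_eq_zero (sub_div_notMem_Icc hh hS), zero_div]

theorem exists_bound_deriv_smoothStep : ∃ C : ℝ, 0 < C ∧ ∀ c h S : ℝ, 0 < h →
    |deriv (smoothStep c h) S| ≤ C / h ∧ |deriv (deriv (smoothStep c h)) S| ≤ C / h ^ 2 := by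
  obtain ⟨C, hC, hb⟩ := exists_bound_deriv_smoothTransition
  refine ⟨C, hC, fun c h S hh => ⟨?_, ?_⟩⟩
  · rw [deriv_smoothStep]
    dsimp only
    rw [abs_div, abs_of_pos hh]
    exact div_le_div_of_nonneg_right (hb _).1 hh.le
  · rw [deriv_deriv_smoothStep]
    dsimp only
    rw [abs_div, abs_of_pos (pow_pos hh 2)]
    exact div_le_div_of_nonneg_right (hb _).2 (by positivity)

end

theorem norm_gradient_radial_sq_le {M : ℝ → ℝ} (hM : Differentiable ℝ M) {K R : ℝ} {x : E}
    (hK : |deriv M (‖x‖ ^ 2)| ≤ K) (hx : ‖x‖ ^ 2 ≤ R ^ 2) :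
    ‖∇ (fun x : E => M (‖x‖ ^ 2)) x‖ ^ 2 ≤ 4 * K ^ 2 * R ^ 2 := by
  have h := gradient_radial (0 : E) x (M := M) (M' := deriv M (‖x‖ ^ 2))
    (by rw [sub_zero]; exact (hM _).hasDerivAt)
  simp only [sub_zero] at h
  rw [h, norm_smul, mul_pow, norm_eq_abs, sq_abs]
  have h1 : (2 * deriv M (‖x‖ ^ 2)) ^ 2 ≤ 4 * K ^ 2 := by
    have := sq_le_sq' (neg_le_of_abs_le hK) (le_of_abs_le hK)
    linarith
  exact mul_le_mul h1 hx (by positivity) (by positivity)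

theorem gradient_radial_eq_zero {M : ℝ → ℝ} (hM : Differentiable ℝ M) {x : E}
    (h0 : deriv M (‖x‖ ^ 2) = 0) : ∇ (fun x : E => M (‖x‖ ^ 2)) x = 0 := by
  have h := gradient_radial (0 : E) x (M := M) (M' := deriv M (‖x‖ ^ 2))
    (by rw [sub_zero]; exact (hM _).hasDerivAt)
  simp only [sub_zero] at h
  rw [h, h0, mul_zero, zero_smul]

namespace IsFlow

variable {O : Set E} {R μ : ℝ} {u u' : ℝ → E → ℝ} {G G' : ℝ → E → E}

/-- Frequency inequalities for the weight `exp (μ ‖x‖² / 2)` which removes the potential. -/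
theorem quadratic_frequency (hu : IsFlow (ball 0 R) μ u u' G G') {R' : ℝ} (hR : 0 < R)
    (hRR : R' < R) (hμ : 0 ≤ μ) {X : ℝ → ℝ} (hX : ContDiff ℝ ∞ X)
    (hX' : tsupport (gWeight X 0 μ) ⊆ ball (0 : E) R') {H D : ℝ → ℝ}
    (hH : H = fun t => ∫ x, (gWeight X 0 μ x * u t x) ^ 2)
    (hD : D = fun t => ∫ x, ‖gGrad X 0 μ (u t) (G t) x‖ ^ 2) (t : ℝ) :
    ∃ I D' : ℝ, HasDerivAt H (-2 * D t + 2 * I) t ∧ HasDerivAt D D' t ∧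
      I ^ 2 ≤ H t * (∫ x, gSource X 0 μ (u t) (G t) x ^ 2) ∧
      D' * H t - D t * (-2 * D t + 2 * I) ≤
        H t * (-4 * μ * D t + 1 / 2 * ∫ x, gSource X 0 μ (u t) (G t) x ^ 2) ∧
      (Module.finrank ℝ E) ^ 2 / (4 * R ^ 2) * H t ≤ D t := by
  have hO : Bornology.IsBounded (ball (0 : E) R) := isBounded_ball
  have hB : ball (0 : E) R' ⊆ ball 0 R := ball_subset_ball hRR.le
  have hL := hu.hasLap_conj hX hO 0 hB μ t (inter_subset_left.trans hX')
  set v : ℝ → E → ℝ := fun s x => gWeight X 0 μ x * u s x with hv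
  set q : ℝ → E → ℝ := fun _ x => (μ ^ 2 + (0 : ℝ) / 2) * ‖x - 0‖ ^ 2 - μ ^ 2 * ‖x‖ ^ 2 with hq
  have hq0 : ∀ s x, q s x = 0 := fun s x => by simp [hq]
  have hDv : D = fun s => (∫ x, ‖gGrad X 0 μ (u s) (G s) x‖ ^ 2) - ∫ x, q s x * v s x * v s x := by
    rw [hD]
    funext s
    simp [hq0]
  obtain ⟨h1, D', h2, h3⟩ := hu.frequency hX hO 0 (a := fun _ => μ) (a' := fun _ => 0)
    (a'' := fun _ => 0) (t := t) (Eventually.of_forall fun s => hasDerivAt_const _ _)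
    (Eventually.of_forall fun s => hasDerivAt_const _ _) continuousAt_const
    (fun g hg => mul_le_mul_of_nonneg_left (hg.rellich_interior hRR hL.isH01) hμ)
    hv hq hDv rfl
  have mv : MemLp (v t) 2 (volume : Measure E) := hL.isH01.memLp
  refine ⟨∫ x, v t x * gSource X 0 μ (u t) (G t) x, D', ?_, h2, ?_, ?_, ?_⟩
  · rw [hH]
    exact h1
  · rw [hH]
    exact sq_integral_mul_le mv (hu.memLp_gSource hX hO 0 μ t)
  · have e : (∫ x, (4 * μ * (μ ^ 2 + 0 / 2) * ‖x - 0‖ ^ 2 - 4 * μ * μ ^ 2 * inner ℝ x (x - 0) +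
        (2 * μ * 0 + 0 / 2) * ‖x - 0‖ ^ 2) * v t x ^ 2) = 0 := by
      refine integral_eq_zero_of_ae (Eventually.of_forall fun x => ?_)
      dsimp only [Pi.zero_apply]
      rw [sub_zero, real_inner_self_eq_norm_sq]
      ring
    rw [e, sub_zero] at h3
    rw [hH]
    have e2 : D t = ∫ x, ‖gGrad X 0 μ (u t) (G t) x‖ ^ 2 := by rw [hD]
    rw [← e2] at h3
    exact h3
  · rw [hH, hD]
    exact hL.isH01.poincare hR hB

theorem integral_mul_sq_le_setIntegral (hu : IsFlow O μ u u' G G') (hO : Bornology.IsBounded O)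
    {m : E → ℝ} (hm : Continuous m) {K : ℝ} {A : Set E} (hA : MeasurableSet A)
    (hK : ∀ x ∈ A, m x ≤ K) (h0 : ∀ x ∉ A, m x = 0) (t : ℝ) :
    (∫ x, m x * u t x ^ 2) ≤ K * ∫ x in A, u t x ^ 2 := by
  rw [← integral_const_mul, ← integral_indicator hA]
  refine integral_mono (hu.integrable_mul_sq hO hm t)
    (((hu.integrable_sq t).const_mul K).indicator hA) fun x => ?_
  by_cases hx : x ∈ A
  · rw [indicator_of_mem hx]
    exact mul_le_mul_of_nonneg_right (hK x hx) (sq_nonneg _)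
  · rw [indicator_of_notMem hx]
    simp [h0 x hx]

/-- The source term created by a radial cutoff of slope `1 / h`. -/
theorem integral_gSource_sq_le (hu : IsFlow O μ u u' G G') (hO : Bornology.IsBounded O)
    (hμ : 0 ≤ μ) {X : ℝ → ℝ} (hX : ContDiff ℝ ∞ X) {C h B R : ℝ} (hC : 0 ≤ C)
    (hh : 0 < h) (hh1 : h ≤ 1) (hB : B ≤ R ^ 2) {ξ : E → ℝ} (hξ : Continuous ξ)
    (h1 : ∀ S, |deriv X S| ≤ C / h) (h2 : ∀ S, |deriv (deriv X) S| ≤ C / h ^ 2)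
    (h0 : ∀ x : E, (‖x‖ ^ 2 ≤ B ∧ ξ x = 1) ∨
      (deriv X (‖x‖ ^ 2) = 0 ∧ deriv (deriv X) (‖x‖ ^ 2) = 0)) (t : ℝ) :
    (∫ x, gSource X 0 μ (u t) (G t) x ^ 2) ≤
      (2 * C ^ 2 * (16 * R ^ 2 + (2 * Module.finrank ℝ E + 4 * R ^ 2) ^ 2) / h ^ 4 *
        exp (μ * B)) * ((∫ x, ξ x ^ 2 * ‖G t x‖ ^ 2) + ∫ x, ξ x ^ 2 * u t x ^ 2) := by
  have hξ2 : Continuous fun x => ξ x ^ 2 := hξ.pow 2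
  have i1 := hu.integrable_mul_normSq hO hξ2 t
  have i2 := hu.integrable_mul_sq hO hξ2 t
  have m := hu.memLp_gSource hX hO 0 μ t
  have i3 : Integrable fun x => gSource X 0 μ (u t) (G t) x ^ 2 := by
    simpa using m.normSq_integrable
  rw [← integral_add i1 i2, ← integral_const_mul]
  refine integral_mono i3 ((i1.add i2).const_mul _) fun x => ?_
  dsimp only
  rcases h0 x with ⟨hS, hξ1⟩ | ⟨e1, e2⟩
  swap
  · simp only [gSource, sub_zero, e1, e2]
    simp only [mul_zero, zero_mul, add_zero, neg_zero, ne_eq, OfNat.ofNat_ne_zero,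
      not_false_eq_true, zero_pow]
    positivity
  rw [hξ1, one_pow, one_mul, one_mul]
  simp only [gSource, sub_zero]
  set d : ℝ := (Module.finrank ℝ E : ℝ) with hd
  have hd0 : 0 ≤ d := by positivity
  set X1 := deriv X (‖x‖ ^ 2)
  set X2 := deriv (deriv X) (‖x‖ ^ 2)
  set e := exp (μ / 2 * ‖x‖ ^ 2) with he
  have hX1 : |X1| ≤ C / h ^ 2 := (h1 _).trans (by
    refine div_le_div_of_nonneg_left hC (by positivity) ?_
    nlinarith)
  have hX2 : |X2| ≤ C / h ^ 2 := h2 _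
  set K := C / h ^ 2 with hK
  have hK0 : 0 ≤ K := (abs_nonneg _).trans hX2
  have hSR : ‖x‖ ^ 2 ≤ R ^ 2 := hS.trans hB
  have he2 : e ^ 2 ≤ exp (μ * B) := by
    rw [he, ← Real.exp_nat_mul]
    refine exp_le_exp.2 ?_
    push_cast
    nlinarith [mul_le_mul_of_nonneg_left hS hμ]
  have a1 : (4 * X1 * inner ℝ x (G t x)) ^ 2 ≤ 16 * K ^ 2 * R ^ 2 * ‖G t x‖ ^ 2 := by
    have b1 : X1 ^ 2 ≤ K ^ 2 := sq_le_sq' (neg_le_of_abs_le hX1) (le_of_abs_le hX1)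
    have b2 : inner ℝ x (G t x) ^ 2 ≤ R ^ 2 * ‖G t x‖ ^ 2 := by
      have := abs_real_inner_le_norm x (G t x)
      have c1 := sq_le_sq' (neg_le_of_abs_le this) (le_of_abs_le this)
      rw [mul_pow] at c1
      exact c1.trans (mul_le_mul_of_nonneg_right hSR (sq_nonneg _))
    have b3 := mul_le_mul b1 b2 (sq_nonneg _) (sq_nonneg _)
    rw [mul_pow, mul_pow]
    linarith
  have a2 : ((2 * d * X1 + 4 * X2 * ‖x‖ ^ 2) * u t x) ^ 2 ≤
      K ^ 2 * (2 * d + 4 * R ^ 2) ^ 2 * u t x ^ 2 := by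
    have b1 : |2 * d * X1 + 4 * X2 * ‖x‖ ^ 2| ≤ K * (2 * d + 4 * R ^ 2) := by
      refine (abs_add_le _ _).trans ?_
      rw [abs_mul (2 * d), abs_mul (4 * X2), abs_mul 4, abs_of_nonneg (by positivity : 0 ≤ 2 * d),
        abs_of_nonneg (by norm_num : (0 : ℝ) ≤ 4), abs_of_nonneg (sq_nonneg ‖x‖)]
      have c1 := mul_le_mul_of_nonneg_left hX1 (by positivity : 0 ≤ 2 * d)
      have c2 := mul_le_mul hX2 hSR (sq_nonneg _) hK0
      linarith
    have b2 := sq_le_sq' (neg_le_of_abs_le b1) (le_of_abs_le b1)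
    rw [mul_pow, ← mul_pow K]
    exact mul_le_mul_of_nonneg_right b2 (sq_nonneg _)
  have a3 : (-(4 * X1 * e * inner ℝ x (G t x) + (2 * d * X1 + 4 * X2 * ‖x‖ ^ 2) * e * u t x)) ^ 2 ≤
      e ^ 2 * (2 * (4 * X1 * inner ℝ x (G t x)) ^ 2 +
        2 * ((2 * d * X1 + 4 * X2 * ‖x‖ ^ 2) * u t x) ^ 2) := by
    nlinarith [sq_nonneg (e * (4 * X1 * inner ℝ x (G t x) -
      (2 * d * X1 + 4 * X2 * ‖x‖ ^ 2) * u t x))]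
  have hKe : C ^ 2 / h ^ 4 = K ^ 2 := by
    rw [hK, div_pow, ← pow_mul]
  have a4 : 2 * C ^ 2 * (16 * R ^ 2 + (2 * d + 4 * R ^ 2) ^ 2) / h ^ 4 * exp (μ * B) *
      (‖G t x‖ ^ 2 + u t x ^ 2) = exp (μ * B) * (2 * (K ^ 2 *
        (16 * R ^ 2 + (2 * d + 4 * R ^ 2) ^ 2) * (‖G t x‖ ^ 2 + u t x ^ 2))) := by
    rw [← hKe]
    ring
  rw [a4]
  refine a3.trans (mul_le_mul he2 ?_ (by positivity) (exp_pos _).le)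
  have a5 : 0 ≤ K ^ 2 * R ^ 2 * u t x ^ 2 := by positivity
  have a6 : 0 ≤ K ^ 2 * (2 * d + 4 * R ^ 2) ^ 2 * ‖G t x‖ ^ 2 := by positivity
  linarith

/-- Doubly exponential decay of the part of the flow close to the degeneracy. -/
theorem inner_decay (hu : IsFlow (ball 0 R) μ u u' G G') {R' : ℝ} (hR' : 0 < R') (hRR : R' < R)
    (hμ : 0 < μ) {X : ℝ → ℝ} (hX : ContDiff ℝ ∞ X) (hX0 : ∀ S, 0 ≤ X S) (hX1 : ∀ S, X S ≤ 1)
    {C h B : ℝ} (hC : 0 ≤ C) (hh : 0 < h) (hh1 : h ≤ 1) (hB : B < R' ^ 2)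
    (hXB : ∀ S, B ≤ S → X S = 0) {ξ : E → ℝ} (hξ : Continuous ξ)
    (h1 : ∀ S, |deriv X S| ≤ C / h) (h2 : ∀ S, |deriv (deriv X) S| ≤ C / h ^ 2)
    (h0 : ∀ x : E, (‖x‖ ^ 2 ≤ B ∧ ξ x = 1) ∨
      (deriv X (‖x‖ ^ 2) = 0 ∧ deriv (deriv X) (‖x‖ ^ 2) = 0)) {σ τ : ℝ} (hσ : 0 < σ)
    (hσn : σ ≤ (Module.finrank ℝ E) ^ 2 / (4 * R ^ 2)) (hτ : 0 < τ) (hστ : σ * τ ≤ 1 / 4) :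
    (∫ x, X (‖x‖ ^ 2) ^ 2 * u τ x ^ 2) ≤
      4 / σ * (2 * C ^ 2 * (16 * R' ^ 2 + (2 * Module.finrank ℝ E + 4 * R' ^ 2) ^ 2) / h ^ 4 *
        exp (μ * B)) * (∫ s in (0 : ℝ)..τ,
          ((∫ x, ξ x ^ 2 * ‖G s x‖ ^ 2) + ∫ x, ξ x ^ 2 * u s x ^ 2)) +
      exp (5 / 4 - (Module.finrank ℝ E) ^ 2 / (4 * R ^ 2) *
        (exp (4 * μ * τ) - 1) / (4 * μ)) * (exp (μ * B) * ∫ x, u 0 x ^ 2) := by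
  have hR : 0 < R := hR'.trans hRR
  have hO : Bornology.IsBounded (ball (0 : E) R) := isBounded_ball
  have hξ2 : Continuous fun x => ξ x ^ 2 := hξ.pow 2
  have cW := (contDiff_gWeight hX (0 : E) μ).continuous
  have hX' : tsupport (gWeight X 0 μ) ⊆ ball (0 : E) R' := by
    have hc : IsClosed {x : E | ‖x‖ ^ 2 ≤ B} :=
      isClosed_le (continuous_norm.pow 2) continuous_const
    refine (closure_minimal (fun x hx => ?_) hc).trans fun x hx => ?_
    · by_contra hn
      rw [mem_ofPred_eq, not_le] at hn
      exact hx (by simp [gWeight, hXB _ hn.le])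
    · rw [mem_ball_zero_iff]
      exact lt_of_pow_lt_pow_left₀ 2 hR'.le (lt_of_le_of_lt hx hB)
  have key := fun t => hu.quadratic_frequency hR hRR hμ.le hX hX' rfl rfl t
  choose I D' k1 k2 k3 k4 k5 using key
  set H : ℝ → ℝ := fun t => ∫ x, (gWeight X 0 μ x * u t x) ^ 2 with hH
  have hH0 : ∀ t, 0 ≤ H t := fun t => integral_nonneg fun x => sq_nonneg _
  set Ks := 2 * C ^ 2 * (16 * R' ^ 2 + (2 * Module.finrank ℝ E + 4 * R' ^ 2) ^ 2) / h ^ 4 *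
    exp (μ * B) with hKs
  have hKs0 : 0 ≤ Ks := by positivity
  have hS := fun t => hu.integral_gSource_sq_le hO hμ.le hX hC hh hh1 hB.le hξ h1 h2 h0 t
  have cS : Continuous fun t => (∫ x, ξ x ^ 2 * ‖G t x‖ ^ 2) + ∫ x, ξ x ^ 2 * u t x ^ 2 :=
    (hu.continuous_integral_mul_normSq hO hξ2).add (hu.continuous_integral_mul_sq hO hξ2)
  have fin := superexponential_decay (S := fun t => Ks * ((∫ x, ξ x ^ 2 * ‖G t x‖ ^ 2) +
      ∫ x, ξ x ^ 2 * u t x ^ 2)) hτ hμ hσ hσn hστ (cS.const_mul Ks)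
    (fun t => mul_nonneg hKs0 (add_nonneg (integral_nonneg fun x => by positivity)
      (integral_nonneg fun x => by positivity))) hH0 k5 k1
    (fun t => (k3 t).trans (mul_le_mul_of_nonneg_left (hS t) (hH0 t))) k2
    (fun t => (k4 t).trans (mul_le_mul_of_nonneg_left (by linarith [hS t]) (hH0 t)))
  rw [intervalIntegral.integral_const_mul, ← mul_assoc] at fin
  have iH : ∀ t, Integrable fun x => (gWeight X 0 μ x * u t x) ^ 2 := fun t => by
    have := hu.integrable_mul_sq hO (cW.pow 2) t
    refine this.congr (Eventually.of_forall fun x => ?_)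
    simp [mul_pow]
  have cX : Continuous fun x : E => X (‖x‖ ^ 2) ^ 2 :=
    (hX.continuous.comp (continuous_norm.pow 2)).pow 2
  have e1 : (∫ x, X (‖x‖ ^ 2) ^ 2 * u τ x ^ 2) ≤ H τ := by
    refine integral_mono (hu.integrable_mul_sq hO cX τ) (iH τ) fun x => ?_
    have a1 : X (‖x‖ ^ 2) ≤ gWeight X 0 μ x := by
      rw [gWeight, sub_zero]
      exact le_mul_of_one_le_right (hX0 _) (Real.one_le_exp (by positivity))
    dsimp only
    rw [mul_pow]
    exact mul_le_mul_of_nonneg_right (pow_le_pow_left₀ (hX0 _) a1 2) (sq_nonneg _)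
  have e2 : H 0 ≤ exp (μ * B) * ∫ x, u 0 x ^ 2 := by
    rw [← integral_const_mul]
    refine integral_mono (iH 0) ((hu.integrable_sq 0).const_mul _) fun x => ?_
    dsimp only
    rw [mul_pow]
    refine mul_le_mul_of_nonneg_right ?_ (sq_nonneg _)
    rw [gWeight, sub_zero, mul_pow, ← Real.exp_nat_mul]
    by_cases hx : B ≤ ‖x‖ ^ 2
    · rw [hXB _ hx]
      simpa using (exp_pos _).le
    · have a1 : X (‖x‖ ^ 2) ^ 2 ≤ 1 := pow_le_one₀ (hX0 _) (hX1 _)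
      refine (mul_le_mul a1 (exp_le_exp.2 ?_) (exp_pos _).le zero_le_one).trans
        (one_mul _).le
      have := mul_le_mul_of_nonneg_left (not_le.1 hx).le hμ.le
      push_cast
      linarith
  exact e1.trans (fin.trans (by gcongr))

end IsFlow

/-- The final bookkeeping in `exists_high_frequency`. -/
theorem high_frequency_bookkeeping {C R₂ σ D h b T e μB Q I1 I2 N Ob U0 Ub Obb g : ℝ}
    (hσ : 0 < σ) (hC : 0 < C) (hh : 0 < h) (hh1 : h ≤ 1) (hb : 0 < b) (hb1 : b ≤ 1) (hT : T ≤ 2)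
    (hD : 0 ≤ D) (hOb : 0 ≤ Ob) (hOb' : Obb ≤ Ob)
    (he1 : 1 ≤ e) (hN : 0 ≤ N) (hg : 0 ≤ g) (hUb : Ub ≤ U0)
    (hI1 : b * I1 ≤ 1 * Ob + T * (4 * (4 * (C / h + C / h) ^ 2 * R₂ ^ 2 * Ob)))
    (hI2 : I2 ≤ 1 * Ob)
    (hin : μB ≤ 4 / σ * (D / h ^ 4 * e) * (I1 + I2) + N * (e * Ub))
    (hout : Q ≤ g * Ub + 4 * (4 * (C / h) ^ 2 * R₂ ^ 2 * Obb)) :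
    μB + Q ≤ (4 / σ * D * (2 + 128 * C ^ 2 * R₂ ^ 2) + 16 * C ^ 2 * R₂ ^ 2) / (b * h ^ 6) * e * Ob +
      (g + N * e) * U0 := by
  have hh2 : 0 < h ^ 2 := by positivity
  have i1 : I1 + I2 ≤ (2 + 128 * C ^ 2 * R₂ ^ 2) / (b * h ^ 2) * Ob := by
    have a0 : T * (4 * (4 * (C / h + C / h) ^ 2 * R₂ ^ 2 * Ob)) ≤
        2 * (4 * (4 * (C / h + C / h) ^ 2 * R₂ ^ 2 * Ob)) :=
      mul_le_mul_of_nonneg_right hT (by positivity)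
    have a1 : 2 * (4 * (4 * (C / h + C / h) ^ 2 * R₂ ^ 2 * Ob)) =
        128 * C ^ 2 * R₂ ^ 2 / h ^ 2 * Ob := by
      field_simp
      ring
    have a2 : 1 ≤ 1 / h ^ 2 := by
      rw [le_div_iff₀ hh2]
      nlinarith
    have a3 : b * I2 ≤ 1 / h ^ 2 * Ob := by
      have c1 : b * I2 ≤ b * (1 * Ob) := mul_le_mul_of_nonneg_left hI2 hb.le
      have c2 : b * (1 * Ob) ≤ 1 / h ^ 2 * Ob := by
        rw [one_mul]
        exact mul_le_mul_of_nonneg_right (hb1.trans a2) hOb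
      linarith
    have a4 := mul_le_mul_of_nonneg_right a2 hOb
    have a5 : (2 + 128 * C ^ 2 * R₂ ^ 2) / (b * h ^ 2) * Ob =
        (2 * (1 / h ^ 2 * Ob) + 128 * C ^ 2 * R₂ ^ 2 / h ^ 2 * Ob) / b := by
      field_simp
    rw [a5, le_div_iff₀ hb]
    linarith
  have i2 : 4 / σ * (D / h ^ 4 * e) * (I1 + I2) ≤
      4 / σ * D * (2 + 128 * C ^ 2 * R₂ ^ 2) / (b * h ^ 6) * e * Ob := by
    refine (mul_le_mul_of_nonneg_left i1 (by positivity)).trans (le_of_eq ?_)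
    field_simp
  have i3 : 4 * (4 * (C / h) ^ 2 * R₂ ^ 2 * Obb) ≤ 16 * C ^ 2 * R₂ ^ 2 / (b * h ^ 6) * e * Ob := by
    have a1 : 1 / h ^ 2 ≤ 1 / (b * h ^ 6) := by
      refine one_div_le_one_div_of_le (by positivity) ?_
      have c1 : h ^ 6 ≤ h ^ 2 := pow_le_pow_of_le_one hh.le hh1 (by norm_num)
      have c2 : b * h ^ 6 ≤ 1 * h ^ 6 := mul_le_mul_of_nonneg_right hb1 (by positivity)
      linarith
    have a2 : 1 / h ^ 2 ≤ 1 / (b * h ^ 6) * e := by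
      have : 1 / (b * h ^ 6) * 1 ≤ 1 / (b * h ^ 6) * e :=
        mul_le_mul_of_nonneg_left he1 (by positivity)
      linarith
    calc 4 * (4 * (C / h) ^ 2 * R₂ ^ 2 * Obb) = 16 * C ^ 2 * R₂ ^ 2 * (1 / h ^ 2 * Obb) := by
          field_simp
          ring
      _ ≤ 16 * C ^ 2 * R₂ ^ 2 * (1 / h ^ 2 * Ob) :=
          mul_le_mul_of_nonneg_left (mul_le_mul_of_nonneg_left hOb' (by positivity)) (by positivity)
      _ ≤ 16 * C ^ 2 * R₂ ^ 2 * (1 / (b * h ^ 6) * e * Ob) :=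
          mul_le_mul_of_nonneg_left (mul_le_mul_of_nonneg_right a2 hOb) (by positivity)
      _ = _ := by ring
  have i4 : N * (e * Ub) ≤ N * (e * U0) :=
    mul_le_mul_of_nonneg_left (mul_le_mul_of_nonneg_left hUb (by linarith)) hN
  have i5 : g * Ub ≤ g * U0 := mul_le_mul_of_nonneg_left hUb hg
  have i6 : (4 / σ * D * (2 + 128 * C ^ 2 * R₂ ^ 2) + 16 * C ^ 2 * R₂ ^ 2) / (b * h ^ 6) * e * Ob =
      4 / σ * D * (2 + 128 * C ^ 2 * R₂ ^ 2) / (b * h ^ 6) * e * Ob +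
        16 * C ^ 2 * R₂ ^ 2 / (b * h ^ 6) * e * Ob := by ring
  rw [i6]
  linarith

set_option maxHeartbeats 1600000 in
/-- Weak observability from an annulus for high frequencies, with loss `exp (μ R₁²)`. -/
theorem exists_high_frequency (hE : 0 < Module.finrank ℝ E) {R₁ R₂ R : ℝ} (hR₁ : 0 < R₁)
    (h12 : R₁ < R₂) (h2R : R₂ < R) :
    ∃ C n₀ : ℝ, 0 < C ∧ 0 < n₀ ∧ ∀ h : ℝ, 0 < h → h ≤ 1 → R₁ ^ 2 + 4 * h ≤ R₂ ^ 2 →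
      ∀ μ : ℝ, 0 < μ → ∀ (u u' : ℝ → E → ℝ) (G G' : ℝ → E → E), IsFlow (ball 0 R) μ u u' G G' →
      ∀ b τ : ℝ, 0 < b → b ≤ 1 → 0 < τ → τ ≤ 1 →
      (∫ x, u (b + τ) x ^ 2) ≤ C / (b * h ^ 6) * exp (μ * (R₁ ^ 2 + 4 * h)) *
        (∫ s in (0 : ℝ)..(b + τ), ∫ x in {x : E | R₁ < ‖x‖ ∧ ‖x‖ < R₂}, u s x ^ 2) +
        (exp (-(2 * μ ^ 2 * R₁ ^ 2 * τ)) +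
          exp (5 / 4 - n₀ * (exp (4 * μ * τ) - 1) / (4 * μ)) *
            exp (μ * (R₁ ^ 2 + 4 * h))) * ∫ x, u 0 x ^ 2 := by
  obtain ⟨C, hC, hCb⟩ := exists_bound_deriv_smoothStep
  have hR₂ : 0 < R₂ := hR₁.trans h12
  have hR : 0 < R := hR₂.trans h2R
  have hd : (0 : ℝ) < Module.finrank ℝ E := by exact_mod_cast hE
  set n₀ : ℝ := (Module.finrank ℝ E) ^ 2 / (4 * R ^ 2) with hn₀
  have hn₀0 : 0 < n₀ := by positivity
  set σ := min n₀ (1 / 4) with hσ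
  have hσ0 : 0 < σ := lt_min hn₀0 (by norm_num)
  set D := 2 * C ^ 2 * (16 * R₂ ^ 2 + (2 * (Module.finrank ℝ E : ℝ) + 4 * R₂ ^ 2) ^ 2) with hD
  have hD0 : 0 ≤ D := by positivity
  refine ⟨4 / σ * D * (2 + 128 * C ^ 2 * R₂ ^ 2) + 16 * C ^ 2 * R₂ ^ 2, n₀, by positivity, hn₀0, ?_⟩
  intro h hh hh1 hhR μ hμ u u' G G' hu b τ hb hb1 hτ hτ1
  have hO : Bornology.IsBounded (ball (0 : E) R) := isBounded_ball
  set A := R₁ ^ 2 with hA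
  have hA0 : 0 < A := by positivity
  set ϖ : Set E := {x : E | R₁ < ‖x‖ ∧ ‖x‖ < R₂} with hϖ
  have hϖm : MeasurableSet ϖ :=
    ((isOpen_lt continuous_const continuous_norm).inter
      (isOpen_lt continuous_norm continuous_const)).measurableSet
  have hϖ' : ∀ x : E, A < ‖x‖ ^ 2 → ‖x‖ ^ 2 < A + 4 * h → x ∈ ϖ := fun x hx1 hx2 =>
    ⟨lt_of_pow_lt_pow_left₀ 2 (norm_nonneg x) hx1,
      lt_of_pow_lt_pow_left₀ 2 hR₂.le (hx2.trans_le hhR)⟩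
  set Z : ℝ → ℝ := fun s => ∫ x in ϖ, u s x ^ 2 with hZ
  have cZ : Continuous Z := hu.continuous_setIntegral_sq hϖm
  have hZ0 : ∀ s, 0 ≤ Z s := fun s => integral_nonneg fun x => sq_nonneg _
  have hsm : ∀ {M : ℝ → ℝ}, ContDiff ℝ ∞ M → ContDiff ℝ ∞ fun x : E => M (‖x‖ ^ 2) :=
    fun hM => hM.comp (contDiff_norm_sq ℝ)
  -- the cutoff functions
  set X : ℝ → ℝ := fun S => 1 - smoothStep (A + 2 * h) h S with hX
  have hXs : ContDiff ℝ ∞ X := contDiff_const.sub contDiff_smoothStep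
  have dX : deriv X = fun S => -deriv (smoothStep (A + 2 * h) h) S := by
    funext S
    rw [hX, deriv_const_sub]
  have ddX : deriv (deriv X) = fun S => -deriv (deriv (smoothStep (A + 2 * h) h)) S := by
    funext S
    rw [dX, deriv.fun_neg]
  set P : ℝ → ℝ := smoothStep (A + h) h with hP
  have hPs : ContDiff ℝ ∞ P := contDiff_smoothStep
  set Y : ℝ → ℝ := fun S => P S * (1 - smoothStep (A + 3 * h) h S) with hY
  have hYs : ContDiff ℝ ∞ Y := hPs.mul (contDiff_const.sub contDiff_smoothStep)
  have dY : ∀ S, HasDerivAt Y (deriv P S * (1 - smoothStep (A + 3 * h) h S) +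
      P S * (-deriv (smoothStep (A + 3 * h) h) S)) S := fun S =>
    (hPs.differentiable (by simp) S).hasDerivAt.mul
      ((contDiff_smoothStep.differentiable (by simp) S).hasDerivAt.const_sub 1)
  have bY : ∀ S, |deriv Y S| ≤ C / h + C / h := fun S => by
    rw [(dY S).deriv]
    refine (abs_add_le _ _).trans (add_le_add ?_ ?_)
    · rw [abs_mul]
      refine (mul_le_mul (hCb _ _ _ hh).1 ?_ (abs_nonneg _) (by positivity)).trans (mul_one _).le
      rw [abs_le]
      constructor <;> linarith [smoothStep_nonneg (c := A + 3 * h) (h := h) (S := S),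
        smoothStep_le_one (c := A + 3 * h) (h := h) (S := S)]
    · rw [abs_mul, abs_neg]
      refine (mul_le_mul ?_ (hCb _ _ _ hh).1 (abs_nonneg _) zero_le_one).trans (one_mul _).le
      rw [abs_le]
      constructor <;> linarith [smoothStep_nonneg (c := A + h) (h := h) (S := S),
        smoothStep_le_one (c := A + h) (h := h) (S := S)]
  have Y0 : ∀ S, 0 ≤ Y S := fun S => mul_nonneg smoothStep_nonneg (by
    linarith [smoothStep_le_one (c := A + 3 * h) (h := h) (S := S)])
  have Y1 : ∀ S, Y S ≤ 1 := fun S => mul_le_one₀ smoothStep_le_one (by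
    linarith [smoothStep_le_one (c := A + 3 * h) (h := h) (S := S)]) (by
    linarith [smoothStep_nonneg (c := A + 3 * h) (h := h) (S := S)])
  have Yz : ∀ S, ¬ (A < S ∧ S < A + 4 * h) → Y S = 0 := fun S hS => by
    rw [not_and_or, not_lt, not_lt] at hS
    rcases hS with hS | hS
    · simp only [hY, hP]
      rw [smoothStep_eq_zero hh (by linarith), zero_mul]
    · simp only [hY]
      rw [smoothStep_eq_one hh (by linarith), sub_self, mul_zero]
  have zY : ∀ S, ¬ (A < S ∧ S < A + 4 * h) → deriv Y S = 0 := fun S hS =>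
    IsLocalMin.deriv_eq_zero (Eventually.of_forall fun r => by
      rw [Yz S hS]
      exact Y0 r)
  -- observation bounds for the cutoffs
  have oY : ∀ s, (∫ x, Y (‖x‖ ^ 2) ^ 2 * u s x ^ 2) ≤ 1 * Z s := fun s =>
    hu.integral_mul_sq_le_setIntegral hO ((hsm hYs).continuous.pow 2) hϖm
      (fun x _ => pow_le_one₀ (Y0 _) (Y1 _)) (fun x hx => by
        have : Y (‖x‖ ^ 2) = 0 := Yz _ fun hS => hx (hϖ' x hS.1 hS.2)
        simp [this]) s
  have onabla : ∀ {M : ℝ → ℝ} (hM : ContDiff ℝ ∞ M) {K : ℝ} (_ : ∀ S, |deriv M S| ≤ K)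
      (_ : ∀ S, ¬ (A < S ∧ S < A + 4 * h) → deriv M S = 0) (s : ℝ),
      (∫ x, ‖∇ (fun x : E => M (‖x‖ ^ 2)) x‖ ^ 2 * u s x ^ 2) ≤ 4 * K ^ 2 * R₂ ^ 2 * Z s :=
    fun hM K hK hz s =>
    hu.integral_mul_sq_le_setIntegral hO ((hsm hM).continuous_gradient.norm.pow 2) hϖm
      (fun x hx => norm_gradient_radial_sq_le (hM.differentiable (by simp)) (hK _)
        (pow_le_pow_left₀ (norm_nonneg x) hx.2.le 2))
      (fun x hx => by
        simp [gradient_radial_eq_zero (hM.differentiable (by simp))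
          (hz _ fun hS => hx (hϖ' x hS.1 hS.2))]) s
  have zP : ∀ S, ¬ (A < S ∧ S < A + 4 * h) → deriv P S = 0 := fun S hS => by
    refine deriv_smoothStep_eq_zero hh fun hm => hS ?_
    constructor <;> linarith [hm.1, hm.2]
  have hbτ : 0 ≤ b + τ := by linarith
  have iZ : ∀ c d : ℝ, IntervalIntegrable Z volume c d := fun c d => cZ.intervalIntegrable c d
  have cξG : Continuous fun s => ∫ x, Y (‖x‖ ^ 2) ^ 2 * ‖G s x‖ ^ 2 :=
    hu.continuous_integral_mul_normSq hO ((hsm hYs).continuous.pow 2)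
  have cξu : Continuous fun s => ∫ x, Y (‖x‖ ^ 2) ^ 2 * u s x ^ 2 :=
    hu.continuous_integral_mul_sq hO ((hsm hYs).continuous.pow 2)
  have cY' : Continuous fun s => ∫ x, ‖∇ (fun x : E => Y (‖x‖ ^ 2)) x‖ ^ 2 * u s x ^ 2 :=
    hu.continuous_integral_mul_sq hO ((hsm hYs).continuous_gradient.norm.pow 2)
  have cP' : Continuous fun s => ∫ x, ‖∇ (fun x : E => P (‖x‖ ^ 2)) x‖ ^ 2 * u s x ^ 2 :=
    hu.continuous_integral_mul_sq hO ((hsm hPs).continuous_gradient.norm.pow 2)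
  have hOb' : (∫ s in b..(b + τ), Z s) ≤ ∫ s in (0 : ℝ)..(b + τ), Z s := by
    rw [← intervalIntegral.integral_add_adjacent_intervals (iZ 0 b) (iZ b (b + τ))]
    have : 0 ≤ ∫ s in (0 : ℝ)..b, Z s := intervalIntegral.integral_nonneg hb.le fun s _ => hZ0 s
    linarith
  have hI1 := hu.caccioppoli hO (hsm hYs) hb.le (show b ≤ b + τ by linarith)
  have hI1' : b * (∫ s in b..(b + τ), ∫ x, Y (‖x‖ ^ 2) ^ 2 * ‖G s x‖ ^ 2) ≤
      1 * (∫ s in (0 : ℝ)..(b + τ), Z s) + (b + τ) *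
        (4 * (4 * (C / h + C / h) ^ 2 * R₂ ^ 2 * ∫ s in (0 : ℝ)..(b + τ), Z s)) := by
    refine hI1.trans (add_le_add ?_ (mul_le_mul_of_nonneg_left ?_ hbτ))
    · rw [← intervalIntegral.integral_const_mul]
      exact intervalIntegral.integral_mono_on hbτ (cξu.intervalIntegrable _ _)
        ((iZ _ _).const_mul 1) fun s _ => oY s
    · rw [intervalIntegral.integral_const_mul]
      refine mul_le_mul_of_nonneg_left ?_ (by norm_num)
      rw [← intervalIntegral.integral_const_mul]
      exact intervalIntegral.integral_mono_on hbτ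
        (cY'.intervalIntegrable _ _) ((iZ _ _).const_mul _) fun s _ => onabla hYs bY zY s
  have hI2' : (∫ s in b..(b + τ), ∫ x, Y (‖x‖ ^ 2) ^ 2 * u s x ^ 2) ≤
      1 * ∫ s in (0 : ℝ)..(b + τ), Z s := by
    refine le_trans ?_ (mul_le_mul_of_nonneg_left hOb' zero_le_one)
    rw [← intervalIntegral.integral_const_mul]
    exact intervalIntegral.integral_mono_on (by linarith) (cξu.intervalIntegrable _ _)
      ((iZ _ _).const_mul 1) fun s _ => oY s
  have hw := hu.shift b
  have hin := hw.inner_decay hR₂ h2R hμ hXs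
    (fun S => by
      simp only [hX]
      linarith [smoothStep_le_one (c := A + 2 * h) (h := h) (S := S)])
    (fun S => by
      simp only [hX]
      linarith [smoothStep_nonneg (c := A + 2 * h) (h := h) (S := S)]) hC.le hh hh1
    (B := A + 3 * h) (by linarith)
    (fun S hS => by
      simp only [hX]
      rw [smoothStep_eq_one hh (by linarith), sub_self]) (hsm hYs).continuous
    (fun S => by
      rw [dX]
      simpa using (hCb _ _ S hh).1)
    (fun S => by
      rw [ddX]
      simpa using (hCb _ _ S hh).2)
    (fun x => by
      by_cases hS : ‖x‖ ^ 2 ∈ Icc (A + 2 * h) (A + 2 * h + h)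
      · left
        refine ⟨by linarith [hS.2], ?_⟩
        simp only [hY, hP]
        rw [smoothStep_eq_one hh (by linarith [hS.1]),
          smoothStep_eq_zero hh (by linarith [hS.2])]
        ring
      · right
        rw [ddX, dX]
        dsimp only
        rw [deriv_smoothStep_eq_zero hh hS, deriv_deriv_smoothStep_eq_zero hh hS, neg_zero]
        exact ⟨rfl, rfl⟩) hσ0 (min_le_left _ _) hτ
    (by
      have : σ ≤ 1 / 4 := min_le_right _ _
      nlinarith)
  have hout := hw.outer_decay hO (hsm hPs) hA0.le (fun x hx => smoothStep_eq_zero hh (by linarith))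
    hτ.le
  rw [zero_add, intervalIntegral.integral_comp_add_right (fun s =>
    (∫ x, Y (‖x‖ ^ 2) ^ 2 * ‖G s x‖ ^ 2) + ∫ x, Y (‖x‖ ^ 2) ^ 2 * u s x ^ 2),
    intervalIntegral.integral_add (cξG.intervalIntegrable _ _) (cξu.intervalIntegrable _ _),
    zero_add, add_comm τ b] at hin
  rw [zero_add, intervalIntegral.integral_comp_add_right (fun s =>
    4 * ∫ x, ‖∇ (fun x : E => P (‖x‖ ^ 2)) x‖ ^ 2 * u s x ^ 2), zero_add, add_comm τ b] at hout
  have hUb : (∫ x, u b x ^ 2) ≤ ∫ x, u 0 x ^ 2 := hu.integral_sq_anti hO hb.le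
  have hPb : (∫ x, P (‖x‖ ^ 2) ^ 2 * u b x ^ 2) ≤ ∫ x, u b x ^ 2 :=
    integral_mono (hu.integrable_mul_sq hO ((hsm hPs).continuous.pow 2) b) (hu.integrable_sq b)
      fun x => mul_le_of_le_one_left (sq_nonneg _)
        (pow_le_one₀ smoothStep_nonneg smoothStep_le_one)
  have hsplit : (∫ x, u (b + τ) x ^ 2) ≤ (∫ x, X (‖x‖ ^ 2) ^ 2 * u (b + τ) x ^ 2) +
      ∫ x, P (‖x‖ ^ 2) ^ 2 * u (b + τ) x ^ 2 := by
    have i1 := hu.integrable_mul_sq hO (ρ := fun x => X (‖x‖ ^ 2) ^ 2)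
      ((hsm hXs).continuous.pow 2) (b + τ)
    have i2 := hu.integrable_mul_sq hO (ρ := fun x => P (‖x‖ ^ 2) ^ 2)
      ((hsm hPs).continuous.pow 2) (b + τ)
    rw [← integral_add i1 i2]
    refine integral_mono (hu.integrable_sq _) (i1.add i2) fun x => ?_
    have hs : 1 ≤ X (‖x‖ ^ 2) ^ 2 + P (‖x‖ ^ 2) ^ 2 := by
      rcases le_total (‖x‖ ^ 2) (A + 2 * h) with hS | hS
      · have : X (‖x‖ ^ 2) = 1 := by
          simp only [hX]
          rw [smoothStep_eq_zero hh hS, sub_zero]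
        rw [this]
        nlinarith [sq_nonneg (P (‖x‖ ^ 2))]
      · have : P (‖x‖ ^ 2) = 1 := smoothStep_eq_one hh (by linarith)
        rw [this]
        nlinarith [sq_nonneg (X (‖x‖ ^ 2))]
    have := mul_le_mul_of_nonneg_right hs (sq_nonneg (u (b + τ) x))
    simp only
    linarith
  have hnn : ∀ {f : E → ℝ}, (∀ x, 0 ≤ f x) → 0 ≤ ∫ x, f x := fun hf => integral_nonneg hf
  have hBe : exp (μ * (A + 3 * h)) ≤ exp (μ * (A + 4 * h)) :=
    exp_le_exp.2 (mul_le_mul_of_nonneg_left (by linarith) hμ.le)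
  refine hsplit.trans (high_frequency_bookkeeping
    (I1 := ∫ s in b..(b + τ), ∫ x, Y (‖x‖ ^ 2) ^ 2 * ‖G s x‖ ^ 2)
    (I2 := ∫ s in b..(b + τ), ∫ x, Y (‖x‖ ^ 2) ^ 2 * u s x ^ 2)
    (Ub := ∫ x, u b x ^ 2) hσ0 hC hh hh1 hb hb1 (T := b + τ) (by linarith) hD0
    (intervalIntegral.integral_nonneg hbτ fun s _ => hZ0 s) hOb'
    (Real.one_le_exp (by positivity)) (exp_nonneg _) (exp_nonneg _) hUb hI1' hI2'
    (hin.trans (add_le_add ?_ ?_)) (hout.trans (add_le_add ?_ ?_)))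
  · refine mul_le_mul_of_nonneg_right (mul_le_mul_of_nonneg_left (mul_le_mul_of_nonneg_left hBe
      (by positivity)) (by positivity)) (add_nonneg ?_ ?_)
    · exact intervalIntegral.integral_nonneg (by linarith) fun s _ => hnn fun x => by positivity
    · exact intervalIntegral.integral_nonneg (by linarith) fun s _ => hnn fun x => by positivity
  · exact mul_le_mul_of_nonneg_left (mul_le_mul_of_nonneg_right hBe (hnn fun x => sq_nonneg _))
      (exp_nonneg _)
  · exact mul_le_mul_of_nonneg_left hPb (exp_nonneg _)
  · rw [intervalIntegral.integral_const_mul]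
    refine mul_le_mul_of_nonneg_left ?_ (by norm_num)
    rw [← intervalIntegral.integral_const_mul]
    exact intervalIntegral.integral_mono_on (by linarith)
      (cP'.intervalIntegrable _ _) ((iZ _ _).const_mul _)
      fun s _ => onabla hPs (fun S => (hCb _ _ S hh).1) zP s

theorem exists_low_frequency_bound {β : ℝ} (hβ : 1 < β) {C X : ℝ} (hC : 1 ≤ C) (hX : 1 ≤ X) :
    ∃ K : ℝ, 0 < K ∧ ∀ μ δ : ℝ, 0 ≤ μ → 0 < δ → δ ≤ 1 →
      (μ * δ < X ∨ exp (μ * δ) < C * μ ^ 2) → μ ^ 2 * δ ≤ K / δ ^ β := by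
  have hp : 0 < β - 1 := by linarith
  obtain ⟨n, hn⟩ := exists_nat_ge (4 / (β - 1))
  have hn' : 4 ≤ (β - 1) * n := by
    rw [div_le_iff₀ hp] at hn
    linarith
  have hn0 : n ≠ 0 := by
    rintro rfl
    norm_num at hn'
  set K₀ : ℝ := C * (n + 2).factorial with hK₀
  have hf : (1 : ℝ) ≤ (n + 2).factorial := by
    exact_mod_cast Nat.one_le_iff_ne_zero.2 (Nat.factorial_ne_zero _)
  have hK₀1 : 1 ≤ K₀ := one_le_mul_of_one_le_of_one_le hC hf
  refine ⟨X ^ 2 + K₀ ^ 2, by positivity, fun μ δ hμ hδ hδ1 h => ?_⟩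
  have hδβ : 0 < δ ^ β := Real.rpow_pos_of_pos hδ _
  have hδp : 0 < δ ^ (β - 1) := Real.rpow_pos_of_pos hδ _
  have hsplit : δ ^ β = δ ^ (β - 1) * δ := by
    rw [← Real.rpow_add_one hδ.ne', sub_add_cancel]
  rw [le_div_iff₀ hδβ, hsplit]
  have hgoal : μ ^ 2 * δ * (δ ^ (β - 1) * δ) = (μ * δ) ^ 2 * δ ^ (β - 1) := by ring
  rw [hgoal]
  have hx : 0 ≤ μ * δ := by positivity
  have hδp1 : δ ^ (β - 1) ≤ 1 := Real.rpow_le_one hδ.le hδ1 hp.le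
  rcases h with h | h
  · have h1 : (μ * δ) ^ 2 ≤ X ^ 2 := pow_le_pow_left₀ hx h.le 2
    have h2 : (μ * δ) ^ 2 * δ ^ (β - 1) ≤ (μ * δ) ^ 2 * 1 :=
      mul_le_mul_of_nonneg_left hδp1 (by positivity)
    nlinarith [sq_nonneg K₀]
  · set x := μ * δ with hxd
    have h1 : x ^ (n + 2) / (n + 2).factorial ≤ exp x := Real.pow_div_factorial_le_exp x hx _
    have hxpos : 0 < x := by
      rcases hx.eq_or_lt with h0 | h0
      · have hμ0 : μ = 0 := by
          rcases mul_eq_zero.1 (hxd ▸ h0.symm) with h | h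
          · exact h
          · exact absurd h hδ.ne'
        rw [hμ0] at h
        have := exp_pos x
        norm_num at h
        linarith
      · exact h0
    have h2 : x ^ n * δ ^ 2 < K₀ := by
      have h3 : x ^ (n + 2) < C * μ ^ 2 * (n + 2).factorial :=
        (div_lt_iff₀ (by positivity)).1 (h1.trans_lt h)
      have h4 : x ^ (n + 2) * δ ^ 2 < C * μ ^ 2 * (n + 2).factorial * δ ^ 2 :=
        mul_lt_mul_of_pos_right h3 (by positivity)
      have h5 : x ^ 2 * (x ^ n * δ ^ 2) < x ^ 2 * K₀ := by
        calc x ^ 2 * (x ^ n * δ ^ 2) = x ^ (n + 2) * δ ^ 2 := by ring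
          _ < _ := h4
          _ = x ^ 2 * K₀ := by
            rw [hxd, hK₀]
            ring
      exact lt_of_mul_lt_mul_left h5 (by positivity)
    by_contra hcon
    rw [not_le] at hcon
    have h3 : K₀ ^ 2 < x ^ 2 * δ ^ (β - 1) := by nlinarith [sq_nonneg X]
    have h4 : (K₀ ^ 2) ^ n ≤ (x ^ 2 * δ ^ (β - 1)) ^ n := pow_le_pow_left₀ (by positivity) h3.le n
    have h5 : K₀ ^ 2 ≤ (K₀ ^ 2) ^ n := le_self_pow₀ (by nlinarith) hn0
    have h6 : (δ ^ (β - 1)) ^ n ≤ δ ^ 4 := by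
      rw [← Real.rpow_natCast, ← Real.rpow_mul hδ.le, ← Real.rpow_natCast δ 4]
      exact Real.rpow_le_rpow_of_exponent_ge hδ hδ1 (by exact_mod_cast hn')
    have h7 : (x ^ 2 * δ ^ (β - 1)) ^ n ≤ (x ^ n * δ ^ 2) ^ 2 := by
      calc (x ^ 2 * δ ^ (β - 1)) ^ n = (x ^ n) ^ 2 * (δ ^ (β - 1)) ^ n := by ring
        _ ≤ (x ^ n) ^ 2 * δ ^ 4 := mul_le_mul_of_nonneg_left h6 (by positivity)
        _ = _ := by ring
    have h8 : (x ^ n * δ ^ 2) ^ 2 < K₀ ^ 2 :=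
      pow_lt_pow_left₀ h2 (by positivity) two_ne_zero
    linarith

theorem exists_pow_seven_le_exp (C : ℝ) (hC : 0 ≤ C) : ∃ K : ℝ, 0 < K ∧ ∀ δ : ℝ, 0 < δ → δ ≤ 1 →
    C / δ ^ 7 + 2 ≤ exp (K / δ) := by
  have hM : (0 : ℝ) < (C + 2) * Nat.factorial 7 := by positivity
  have hM1 : (1 : ℝ) ≤ (C + 2) * Nat.factorial 7 := by
    norm_num [Nat.factorial]
    linarith
  refine ⟨log ((C + 2) * Nat.factorial 7) + 1, by
    linarith [Real.log_nonneg hM1], fun δ hδ hδ1 => ?_⟩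
  have h1 : (1 / δ) ^ 7 / Nat.factorial 7 ≤ exp (1 / δ) :=
    Real.pow_div_factorial_le_exp _ (by positivity) 7
  have h2 : (1 / δ) ^ 7 ≤ exp (1 / δ) * Nat.factorial 7 := (div_le_iff₀ (by positivity)).1 h1
  have h3 : (1 : ℝ) ≤ (1 / δ) ^ 7 := one_le_pow₀ ((one_le_div hδ).2 hδ1)
  calc C / δ ^ 7 + 2 ≤ (C + 2) * (1 / δ) ^ 7 := by
        have : C / δ ^ 7 = C * (1 / δ) ^ 7 := by
          field_simp
        rw [this]
        linarith
    _ ≤ (C + 2) * (exp (1 / δ) * Nat.factorial 7) :=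
        mul_le_mul_of_nonneg_left h2 (by linarith)
    _ = exp (log ((C + 2) * Nat.factorial 7)) * exp (1 / δ) := by
        rw [Real.exp_log hM]
        ring
    _ ≤ exp (log ((C + 2) * Nat.factorial 7) / δ) * exp (1 / δ) := by
        refine mul_le_mul_of_nonneg_right (exp_le_exp.2 ?_) (exp_nonneg _)
        rw [le_div_iff₀ hδ]
        have := Real.log_nonneg hM1
        nlinarith
    _ = _ := by
        rw [← exp_add, add_div]

/-- The bookkeeping for high frequencies: `U₁`, `U₂`, `U₃` are the energies at the successive
times and `O` is the observed energy. -/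
theorem high_frequency_energy_le {μ δ d A κ C n₀ C₃ U₁ U₂ U₃ O : ℝ} (hd : 0 < d) (hδ : 0 < δ)
    (hδ1 : δ ≤ 1) (hA : 0 < A) (hC : 0 < C) (hn₀ : 0 < n₀) (hC₃ : 0 < C₃) (hκ : 0 < κ)
    (hκd : 8 * κ ≤ d)
    (hO : 0 ≤ O) (hμδ : 8 ≤ μ * δ) (hμδ' : 6 * C₃ / A ≤ μ * δ)
    (hexp : (1 + (5 + 12 * C₃) / n₀) * μ ^ 2 ≤ exp (μ * δ))
    (h₁ : U₁ ≤ exp (C₃ * (1 + 2 * μ)) * O)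
    (h₂ : U₂ ≤ C / (1 / μ * (κ * δ) ^ 6) * exp (μ * (A + 4 * (κ * δ))) * O +
      (exp (-(2 * μ ^ 2 * A * (δ / 4))) +
        exp (5 / 4 - n₀ * (exp (4 * μ * (δ / 4)) - 1) / (4 * μ)) *
          exp (μ * (A + 4 * (κ * δ)))) * U₁)
    (h₃ : U₃ ≤ exp (-(μ * A + μ * d * δ)) * U₂) :
    U₃ ≤ (2 * C / (d * κ ^ 6) / δ ^ 7 + 2) * O := by
  have hμ8 : 8 ≤ μ := by
    by_contra hcon
    rw [not_le] at hcon
    nlinarith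
  have hμ : 0 < μ := by linarith
  set e₁ := exp (-(μ * A + μ * d * δ)) with he₁
  have hμκ : 4 * μ * (κ * δ) ≤ μ * d * δ / 2 := by
    have : μ * δ * (8 * κ) ≤ μ * δ * d := mul_le_mul_of_nonneg_left hκd (by positivity)
    linarith
  have t1 : e₁ * (C / (1 / μ * (κ * δ) ^ 6) * exp (μ * (A + 4 * (κ * δ)))) ≤
      2 * C / (d * κ ^ 6) / δ ^ 7 := by
    have a1 : e₁ * exp (μ * (A + 4 * (κ * δ))) ≤ exp (-(μ * d * δ / 2)) := by
      rw [he₁, ← exp_add]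
      exact exp_le_exp.2 (by linarith)
    have a2 : exp (-(μ * d * δ / 2)) * μ ≤ 2 / (d * δ) := by
      have b1 : μ * d * δ / 2 ≤ exp (μ * d * δ / 2) := by
        linarith [Real.add_one_le_exp (μ * d * δ / 2)]
      rw [Real.exp_neg, inv_mul_le_iff₀ (exp_pos _), ← div_le_iff₀ (by positivity)]
      refine le_trans (le_of_eq ?_) b1
      field_simp
    calc e₁ * (C / (1 / μ * (κ * δ) ^ 6) * exp (μ * (A + 4 * (κ * δ)))) =
        C / (κ * δ) ^ 6 * μ * (e₁ * exp (μ * (A + 4 * (κ * δ)))) := by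
          field_simp
      _ ≤ C / (κ * δ) ^ 6 * μ * exp (-(μ * d * δ / 2)) :=
          mul_le_mul_of_nonneg_left a1 (by positivity)
      _ = C / (κ * δ) ^ 6 * (exp (-(μ * d * δ / 2)) * μ) := by ring
      _ ≤ C / (κ * δ) ^ 6 * (2 / (d * δ)) := mul_le_mul_of_nonneg_left a2 (by positivity)
      _ = _ := by
        field_simp
  have he₁1 : e₁ ≤ 1 := exp_le_one_iff.2 (neg_nonpos.2 (by positivity))
  have t2 : exp (-(2 * μ ^ 2 * A * (δ / 4))) * exp (C₃ * (1 + 2 * μ)) ≤ 1 := by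
    rw [← exp_add, exp_le_one_iff]
    have : 6 * C₃ ≤ μ * δ * A := (div_le_iff₀ hA).1 hμδ'
    have h6 : μ * (6 * C₃) ≤ μ * (μ * δ * A) := mul_le_mul_of_nonneg_left this hμ.le
    nlinarith
  have t3 : e₁ * (exp (5 / 4 - n₀ * (exp (4 * μ * (δ / 4)) - 1) / (4 * μ)) *
      exp (μ * (A + 4 * (κ * δ)))) * exp (C₃ * (1 + 2 * μ)) ≤ 1 := by
    rw [he₁, ← exp_add, ← exp_add, ← exp_add, exp_le_one_iff]
    have hm : 4 * μ * (δ / 4) = μ * δ := by ring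
    rw [hm]
    have b1 : (n₀ + (5 + 12 * C₃)) * μ ^ 2 ≤ n₀ * exp (μ * δ) := by
      have := mul_le_mul_of_nonneg_left hexp hn₀.le
      refine le_trans (le_of_eq ?_) this
      field_simp
    have b2 : 5 / 4 + C₃ * (1 + 2 * μ) ≤ n₀ * (exp (μ * δ) - 1) / (4 * μ) := by
      rw [le_div_iff₀ (by positivity)]
      have b3 : μ ≤ μ ^ 2 := by nlinarith
      have b4 : 1 ≤ μ ^ 2 := by nlinarith
      have b5 := mul_le_mul_of_nonneg_left b4 hn₀.le
      have b6 := mul_le_mul_of_nonneg_left b3 hC₃.le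
      nlinarith
    have b3 : 0 ≤ μ * d * δ := by positivity
    linarith
  have e₁0 : 0 ≤ e₁ := exp_nonneg _
  set F := exp (-(2 * μ ^ 2 * A * (δ / 4))) with hF
  set H := exp (5 / 4 - n₀ * (exp (4 * μ * (δ / 4)) - 1) / (4 * μ)) *
      exp (μ * (A + 4 * (κ * δ))) with hH
  set J := exp (C₃ * (1 + 2 * μ)) with hJ
  set L := C / (1 / μ * (κ * δ) ^ 6) * exp (μ * (A + 4 * (κ * δ))) with hL
  have hF0 : 0 ≤ F := exp_nonneg _
  have hH0 : 0 ≤ H := by positivity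
  have hJ0 : 0 ≤ J := exp_nonneg _
  have c1 : U₂ ≤ L * O + (F + H) * (J * O) :=
    h₂.trans (add_le_add le_rfl (mul_le_mul_of_nonneg_left h₁ (add_nonneg hF0 hH0)))
  have c2 : U₃ ≤ (e₁ * L + (e₁ * (F * J) + e₁ * H * J)) * O :=
    (h₃.trans (mul_le_mul_of_nonneg_left c1 e₁0)).trans (le_of_eq (by ring))
  refine c2.trans (mul_le_mul_of_nonneg_right ?_ hO)
  have c3 : e₁ * (F * J) ≤ 1 := mul_le_one₀ he₁1 (by positivity) t2
  linarith

theorem measurableSet_annulus {R₁ R₂ : ℝ} : MeasurableSet {x : E | R₁ < ‖x‖ ∧ ‖x‖ < R₂} :=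
  ((isOpen_lt continuous_const continuous_norm).inter
      (isOpen_lt continuous_norm continuous_const)).measurableSet

theorem exists_observability_annulus (hE : 0 < Module.finrank ℝ E) {R₁ R₂ R : ℝ} (hR₁ : 0 < R₁)
    (h12 : R₁ < R₂) (h2R : R₂ < R) :
    ∃ C : ℝ, 0 < C ∧ ∀ (μ : ℝ) (u u' : ℝ → E → ℝ) (G G' : ℝ → E → E),
      IsFlow (ball 0 R) μ u u' G G' → ∀ τ : ℝ, 0 < τ →
      (∫ x, u τ x ^ 2) ≤ exp (C * (1 + 1 / τ + μ ^ 2 * τ)) *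
        ∫ s in (0 : ℝ)..τ, ∫ x in {x : E | R₁ < ‖x‖ ∧ ‖x‖ < R₂}, u s x ^ 2 := by
  have : Nontrivial E := Module.nontrivial_of_finrank_pos hE
  obtain ⟨x₀, hx₀⟩ := exists_norm_eq E (show (0 : ℝ) ≤ (R₁ + R₂) / 2 by linarith)
  refine exists_observability (r := (R₂ - R₁) / 2) (by linarith) (by linarith) (x₀ := x₀)
    (by rw [mem_ball_zero_iff, hx₀]; linarith) measurableSet_annulus fun x hx => ?_
  rw [mem_ball_iff_norm] at hx
  have h1 := norm_sub_norm_le x x₀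
  have h2 := norm_sub_norm_le x₀ x
  rw [norm_sub_rev] at h2
  constructor <;> linarith

theorem exists_small_time_observability (hE : 0 < Module.finrank ℝ E) {R₁ R₂ R : ℝ} (hR₁ : 0 < R₁)
    (h12 : R₁ < R₂) (h2R : R₂ < R) {β : ℝ} (hβ : 1 < β) :
    ∃ C : ℝ, 0 < C ∧ ∀ μ : ℝ, 0 ≤ μ → ∀ (u u' : ℝ → E → ℝ) (G G' : ℝ → E → E),
      IsFlow (ball 0 R) μ u u' G G' → ∀ T δ : ℝ, 0 < δ → δ ≤ 1 →
      T = R₁ ^ 2 / (2 * Module.finrank ℝ E) + δ →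
      (∫ x, u T x ^ 2) ≤ exp (C / δ ^ β) *
        ∫ s in (0 : ℝ)..T, ∫ x in {x : E | R₁ < ‖x‖ ∧ ‖x‖ < R₂}, u s x ^ 2 := by
  obtain ⟨C₃, hC₃, hobs⟩ := exists_observability_annulus hE hR₁ h12 h2R
  obtain ⟨C, n₀, hC, hn₀, hhigh⟩ := exists_high_frequency hE hR₁ h12 h2R
  have hd : (0 : ℝ) < Module.finrank ℝ E := by exact_mod_cast hE
  have hA : 0 < R₁ ^ 2 := by positivity
  have hAR : R₁ ^ 2 < R₂ ^ 2 := pow_lt_pow_left₀ h12 hR₁.le two_ne_zero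
  obtain ⟨κ, hκ, hκd, hκ1, hκR⟩ : ∃ κ : ℝ, 0 < κ ∧ 8 * κ ≤ Module.finrank ℝ E ∧ κ ≤ 1 ∧
      R₁ ^ 2 + 4 * κ ≤ R₂ ^ 2 := by
    refine ⟨min (min (Module.finrank ℝ E / 8) 1) ((R₂ ^ 2 - R₁ ^ 2) / 4),
      lt_min (lt_min (by positivity) one_pos) (by linarith), ?_, ?_, ?_⟩
    · have := (min_le_left (min ((Module.finrank ℝ E : ℝ) / 8) 1) ((R₂ ^ 2 - R₁ ^ 2) / 4)).trans
        (min_le_left _ _)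
      linarith
    · exact (min_le_left _ _).trans (min_le_right _ _)
    · have := min_le_right (min ((Module.finrank ℝ E : ℝ) / 8) 1) ((R₂ ^ 2 - R₁ ^ 2) / 4)
      linarith
  have hX : (1 : ℝ) ≤ max 8 (6 * C₃ / R₁ ^ 2) := le_trans (by norm_num) (le_max_left _ _)
  obtain ⟨K, hK, hlow⟩ := exists_low_frequency_bound hβ
    (C := 1 + (5 + 12 * C₃) / n₀) (le_add_of_nonneg_right (by positivity)) hX
  obtain ⟨K', hK', hpow⟩ := exists_pow_seven_le_exp (2 * C / (Module.finrank ℝ E * κ ^ 6))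
    (by positivity)
  refine ⟨C₃ * (2 + K) + K', by positivity, fun μ hμ u u' G G' hu T δ hδ hδ1 hT => ?_⟩
  have hO : Bornology.IsBounded (ball (0 : E) R) := isBounded_ball
  obtain ⟨Z, hZ⟩ : ∃ Z : ℝ → ℝ, Z = fun s => ∫ x in {x : E | R₁ < ‖x‖ ∧ ‖x‖ < R₂}, u s x ^ 2 :=
    ⟨_, rfl⟩
  have cZ : Continuous Z := by
    rw [hZ]
    exact hu.continuous_setIntegral_sq measurableSet_annulus
  have hZ0 : ∀ s, 0 ≤ Z s := fun s => by
    rw [hZ]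
    exact integral_nonneg fun x => sq_nonneg _
  have hTs : 0 < R₁ ^ 2 / (2 * Module.finrank ℝ E) := by positivity
  have hOle : ∀ a b, 0 ≤ a → a ≤ b → b ≤ T → (∫ s in a..b, Z s) ≤ ∫ s in (0 : ℝ)..T, Z s :=
    fun a b ha hab hbT => intervalIntegral.integral_mono_interval ha hab hbT
      (Eventually.of_forall hZ0) (cZ.intervalIntegrable _ _)
  have hO0 : 0 ≤ ∫ s in (0 : ℝ)..T, Z s :=
    intervalIntegral.integral_nonneg (by linarith) fun s _ => hZ0 s
  have hδβ : 0 < δ ^ β := Real.rpow_pos_of_pos hδ _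
  have hδβ1 : δ ^ β ≤ δ := by
    simpa using Real.rpow_le_rpow_of_exponent_ge hδ hδ1 hβ.le
  have hinv : 1 / δ ≤ 1 / δ ^ β := one_div_le_one_div_of_le hδβ hδβ1
  have hinv1 : 1 ≤ 1 / δ := (one_le_div hδ).2 hδ1
  change _ ≤ _ * ∫ s in (0 : ℝ)..T, (fun s => ∫ x in {x : E | R₁ < ‖x‖ ∧ ‖x‖ < R₂}, u s x ^ 2) s
  rw [← hZ]
  by_cases hcase : μ * δ < max 8 (6 * C₃ / R₁ ^ 2) ∨
      exp (μ * δ) < (1 + (5 + 12 * C₃) / n₀) * μ ^ 2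
  · have h1 := hlow μ δ hμ hδ hδ1 hcase
    have h2 := hobs μ u u' G G' hu δ hδ
    have h3 : (∫ x, u T x ^ 2) ≤ ∫ x, u δ x ^ 2 := hu.integral_sq_anti hO (by linarith)
    refine (h3.trans h2).trans (mul_le_mul (exp_le_exp.2 ?_) ?_ ?_ (exp_nonneg _))
    · have h4 : 1 + 1 / δ + μ ^ 2 * δ ≤ (2 + K) * (1 / δ ^ β) := by
        rw [← mul_one_div] at h1
        linarith
      calc C₃ * (1 + 1 / δ + μ ^ 2 * δ) ≤ C₃ * ((2 + K) * (1 / δ ^ β)) :=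
            mul_le_mul_of_nonneg_left h4 hC₃.le
        _ = C₃ * (2 + K) / δ ^ β := by ring
        _ ≤ _ := by
          rw [add_div]
          exact le_add_of_nonneg_right (by positivity)
    · have := hOle 0 δ le_rfl hδ.le (by linarith)
      rwa [hZ] at this ⊢
    · exact intervalIntegral.integral_nonneg hδ.le fun s _ => integral_nonneg fun x => sq_nonneg _
  · rw [not_or, not_lt, not_lt] at hcase
    obtain ⟨hx, hexp⟩ := hcase
    have hx8 : 8 ≤ μ * δ := (le_max_left _ _).trans hx
    have hμ8 : 8 ≤ μ := by
      by_contra hcon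
      rw [not_le] at hcon
      nlinarith
    have hμ0 : 0 < μ := by linarith
    have hb : 0 < 1 / μ := by positivity
    have hb1 : 1 / μ ≤ 1 := by
      rw [div_le_one hμ0]
      linarith
    have hbδ : 1 / μ ≤ δ / 8 := by
      rw [div_le_iff₀ hμ0]
      linarith
    have hT2 : 1 / μ + δ / 4 + 1 / μ ≤ T := by linarith
    have hκδ : κ * δ ≤ κ := mul_le_of_le_one_right hκ.le hδ1
    have h₁ := hobs μ u u' G G' hu (1 / μ) hb
    have e1 : 1 + 1 / (1 / μ) + μ ^ 2 * (1 / μ) = 1 + 2 * μ := by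
      field_simp
      ring
    rw [e1] at h₁
    have h₂ := hhigh (κ * δ) (by positivity) (by linarith) (by linarith) μ hμ0 _ _ _ _
      (hu.shift (1 / μ)) (1 / μ) (δ / 4) hb hb1 (by positivity) (by linarith)
    rw [zero_add, intervalIntegral.integral_comp_add_right
      (fun s => ∫ x in {x : E | R₁ < ‖x‖ ∧ ‖x‖ < R₂}, u s x ^ 2), ← hZ, zero_add] at h₂
    have h₃ := hu.integral_sq_le_exp_hermite hO (s := 1 / μ + δ / 4 + 1 / μ) (t := T) hT2
    have hfin := high_frequency_energy_le (U₁ := ∫ x, u (1 / μ) x ^ 2)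
      (U₂ := ∫ x, u (1 / μ + δ / 4 + 1 / μ) x ^ 2) (U₃ := ∫ x, u T x ^ 2)
      (O := ∫ s in (0 : ℝ)..T, Z s) hd hδ hδ1 hA hC hn₀ hC₃ hκ hκd hO0 hx8
      ((le_max_right _ _).trans hx) hexp ?_ ?_ ?_
    · refine hfin.trans (mul_le_mul_of_nonneg_right ((hpow δ hδ hδ1).trans
        (exp_le_exp.2 ?_)) hO0)
      have i1 : K' / δ ≤ K' / δ ^ β := by
        rw [← mul_one_div, ← mul_one_div K']
        exact mul_le_mul_of_nonneg_left hinv hK'.le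
      have i2 : 0 ≤ C₃ * (2 + K) / δ ^ β := by positivity
      rw [add_div]
      linarith
    · refine h₁.trans (mul_le_mul_of_nonneg_left ?_ (exp_nonneg _))
      have := hOle 0 (1 / μ) le_rfl hb.le (by linarith)
      rwa [hZ] at this ⊢
    · refine h₂.trans (add_le_add (mul_le_mul_of_nonneg_left ?_ (by positivity)) le_rfl)
      exact hOle _ _ hb.le (by linarith) hT2
    · refine h₃.trans (mul_le_mul_of_nonneg_right (exp_le_exp.2 ?_)
        (integral_nonneg fun x => sq_nonneg _))
      have i1 : R₁ ^ 2 / (2 * Module.finrank ℝ E) + δ / 2 ≤ T - (1 / μ + δ / 4 + 1 / μ) := by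
        linarith
      have i2 := mul_le_mul_of_nonneg_left i1 (show 0 ≤ 2 * (μ * Module.finrank ℝ E) by positivity)
      have i3 : 2 * (μ * Module.finrank ℝ E) * (R₁ ^ 2 / (2 * Module.finrank ℝ E) + δ / 2) =
          μ * R₁ ^ 2 + μ * Module.finrank ℝ E * δ := by
        field_simp
      linarith

/-- Observability from an annulus, uniformly in the frequency, with the optimal waiting time. -/
theorem exists_uniform_observability (hE : 0 < Module.finrank ℝ E) {R₁ R₂ R : ℝ} (hR₁ : 0 < R₁)
    (h12 : R₁ < R₂) (h2R : R₂ < R) {β : ℝ} (hβ : 1 < β) :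
    ∃ C : ℝ, 0 < C ∧ ∀ μ : ℝ, 0 ≤ μ → ∀ (u u' : ℝ → E → ℝ) (G G' : ℝ → E → E),
      IsFlow (ball 0 R) μ u u' G G' → ∀ T : ℝ, R₁ ^ 2 / (2 * Module.finrank ℝ E) < T →
      (∫ x, u T x ^ 2) ≤ exp (C / (T - R₁ ^ 2 / (2 * Module.finrank ℝ E)) ^ β) *
        ∫ s in (0 : ℝ)..T, ∫ x in {x : E | R₁ < ‖x‖ ∧ ‖x‖ < R₂}, u s x ^ 2 := by
  obtain ⟨C, hC, hsmall⟩ := exists_small_time_observability hE hR₁ h12 h2R hβ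
  have hR : 0 < R := by linarith
  have hd : (0 : ℝ) < Module.finrank ℝ E := by exact_mod_cast hE
  obtain ⟨p, hp⟩ : ∃ p : ℝ, p = 2 * ((Module.finrank ℝ E) ^ 2 / (4 * R ^ 2)) := ⟨_, rfl⟩
  have hp0 : 0 < p := by
    rw [hp]
    positivity
  have hs1 : 1 ≤ 1 + C / p := le_add_of_nonneg_right (by positivity)
  have hs : 1 ≤ (1 + C / p) ^ β := Real.one_le_rpow hs1 (by linarith)
  refine ⟨C * (1 + C / p) ^ β, by positivity, fun μ hμ u u' G G' hu T hT => ?_⟩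
  have hO : Bornology.IsBounded (ball (0 : E) R) := isBounded_ball
  obtain ⟨S, hS⟩ : ∃ S : ℝ, S = R₁ ^ 2 / (2 * Module.finrank ℝ E) := ⟨_, rfl⟩
  have hS0 : 0 < S := by
    rw [hS]
    positivity
  rw [← hS] at hT ⊢
  have cZ : Continuous fun s => ∫ x in {x : E | R₁ < ‖x‖ ∧ ‖x‖ < R₂}, u s x ^ 2 :=
    hu.continuous_setIntegral_sq measurableSet_annulus
  have hZ0 : ∀ s, 0 ≤ ∫ x in {x : E | R₁ < ‖x‖ ∧ ‖x‖ < R₂}, u s x ^ 2 :=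
    fun s => integral_nonneg fun x => sq_nonneg _
  have hO0 : 0 ≤ ∫ s in (0 : ℝ)..T, ∫ x in {x : E | R₁ < ‖x‖ ∧ ‖x‖ < R₂}, u s x ^ 2 :=
    intervalIntegral.integral_nonneg (by linarith) fun s _ => hZ0 s
  have hδ : 0 < T - S := by linarith
  have hδβ : 0 < (T - S) ^ β := Real.rpow_pos_of_pos hδ _
  rcases le_total (T - S) 1 with h1 | h1
  · refine (hsmall μ hμ u u' G G' hu T (T - S) hδ h1 (by linarith)).trans
      (mul_le_mul_of_nonneg_right (exp_le_exp.2 ?_) hO0)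
    exact div_le_div_of_nonneg_right (le_mul_of_one_le_right hC.le hs) hδβ.le
  · have h2 := hsmall μ hμ u u' G G' hu (S + 1) 1 one_pos le_rfl (by rw [hS])
    rw [Real.one_rpow, div_one] at h2
    have h3 : (∫ s in (0 : ℝ)..(S + 1), ∫ x in {x : E | R₁ < ‖x‖ ∧ ‖x‖ < R₂}, u s x ^ 2) ≤
        ∫ s in (0 : ℝ)..T, ∫ x in {x : E | R₁ < ‖x‖ ∧ ‖x‖ < R₂}, u s x ^ 2 :=
      intervalIntegral.integral_mono_interval le_rfl (by linarith) (by linarith)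
        (Eventually.of_forall hZ0) (cZ.intervalIntegrable _ _)
    have h4 := hu.integral_sq_le_exp_poincare hR (s := S + 1) (t := T) (by linarith)
    rw [← hp] at h4
    have h5 := h4.trans (mul_le_mul_of_nonneg_left (h2.trans (mul_le_mul_of_nonneg_left h3
      (exp_nonneg _))) (exp_nonneg _))
    rw [← mul_assoc, ← exp_add] at h5
    refine h5.trans (mul_le_mul_of_nonneg_right (exp_le_exp.2 ?_) hO0)
    rcases le_total (T - S) (1 + C / p) with h6 | h6
    · have h7 : (T - S) ^ β ≤ (1 + C / p) ^ β := Real.rpow_le_rpow hδ.le h6 (by linarith)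
      have h8 : C ≤ C * (1 + C / p) ^ β / (T - S) ^ β := by
        rw [le_div_iff₀ hδβ]
        exact mul_le_mul_of_nonneg_left h7 hC.le
      have h9 : 0 ≤ p * (T - (S + 1)) := mul_nonneg hp0.le (by linarith)
      linarith
    · have h7 : C / p ≤ T - (S + 1) := by linarith
      have h8 : C ≤ (T - (S + 1)) * p := (div_le_iff₀ hp0).1 h7
      have h9 : 0 ≤ C * (1 + C / p) ^ β / (T - S) ^ β := by positivity
      linarith

end Flow

section Truncation

theorem contDiff_of_hasDerivAt {f f' : ℝ → ℝ} (h : ∀ r, HasDerivAt f (f' r) r)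
    (hf' : ContDiff ℝ ∞ f') : ContDiff ℝ ∞ f := by
  rw [contDiff_infty_iff_deriv]
  refine ⟨fun r => (h r).differentiableAt, ?_⟩
  rwa [show deriv f = f' from funext fun r => (h r).deriv]

/-- A smooth monotone truncation `p` of the identity near zero, with its primitive `Ψ` and its
derivative `q`. -/
structure IsTruncation (ε : ℝ) (Ψ p q : ℝ → ℝ) : Prop where
  smooth_primitive : ContDiff ℝ ∞ Ψ
  smooth : ContDiff ℝ ∞ p
  hasDerivAt_primitive : ∀ r, HasDerivAt Ψ (p r) r
  hasDerivAt : ∀ r, HasDerivAt p (q r) r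
  deriv_nonneg : ∀ r, 0 ≤ q r
  deriv_le_one : ∀ r, q r ≤ 1
  eq_zero : ∀ r, |r| ≤ ε → p r = 0
  primitive_eq_zero : ∀ r, |r| ≤ ε → Ψ r = 0
  abs_sub_le : ∀ r, |p r - r| ≤ 2 * ε
  abs_le : ∀ r, |p r| ≤ |r|
  abs_primitive_le : ∀ r, |Ψ r| ≤ r ^ 2

theorem exists_isTruncation {ε : ℝ} (hε : 0 < ε) : ∃ Ψ p q : ℝ → ℝ, IsTruncation ε Ψ p q := by
  obtain ⟨q, hq⟩ : ∃ q : ℝ → ℝ, q = fun r => smoothTransition ((r / ε) ^ 2 - 1) := ⟨_, rfl⟩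
  have hqs : ContDiff ℝ ∞ q := by
    rw [hq]
    exact contDiff_smoothTransition.comp (((contDiff_id.div_const ε).pow 2).sub contDiff_const)
  have q0 : ∀ r, 0 ≤ q r := fun r => by
    rw [hq]
    exact smoothTransition.nonneg _
  have q1 : ∀ r, q r ≤ 1 := fun r => by
    rw [hq]
    exact smoothTransition.le_one _
  have qz : ∀ r, |r| ≤ ε → q r = 0 := fun r hr => by
    rw [hq]
    refine smoothTransition.zero_of_nonpos ?_
    have : (r / ε) ^ 2 ≤ 1 := by
      rw [sq_le_one_iff_abs_le_one, abs_div, abs_of_pos hε]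
      exact (div_le_one hε).2 hr
    linarith
  have qo : ∀ r, 2 * ε ≤ |r| → q r = 1 := fun r hr => by
    rw [hq]
    refine smoothTransition.one_of_one_le ?_
    have h1 : 2 ≤ |r / ε| := by
      rw [abs_div, abs_of_pos hε]
      exact (le_div_iff₀ hε).2 hr
    have h2 : (r / ε) ^ 2 = |r / ε| ^ 2 := (sq_abs _).symm
    rw [h2]
    nlinarith
  obtain ⟨p, hp⟩ : ∃ p : ℝ → ℝ, p = fun r => ∫ s in (0 : ℝ)..r, q s := ⟨_, rfl⟩
  have dp : ∀ r, HasDerivAt p (q r) r := fun r => by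
    rw [hp]
    exact hqs.continuous.integral_hasStrictDerivAt 0 r |>.hasDerivAt
  have hps : ContDiff ℝ ∞ p := contDiff_of_hasDerivAt dp hqs
  have pa : ∀ r, |p r| ≤ |r| := fun r => by
    have h1 : ∀ s ∈ uIoc (0 : ℝ) r, ‖q s‖ ≤ 1 := fun s _ => by
      rw [norm_eq_abs, abs_of_nonneg (q0 s)]
      exact q1 s
    have := intervalIntegral.norm_integral_le_of_norm_le_const h1
    rw [hp]
    simpa using this
  have pz : ∀ r, |r| ≤ ε → p r = 0 := fun r hr => by
    rw [hp]
    refine (intervalIntegral.integral_congr fun s hs => ?_).trans intervalIntegral.integral_zero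
    refine qz s (le_trans ?_ hr)
    have := abs_sub_left_of_mem_uIcc hs
    simpa using this
  obtain ⟨Ψ, hΨ⟩ : ∃ Ψ : ℝ → ℝ, Ψ = fun r => ∫ s in (0 : ℝ)..r, p s := ⟨_, rfl⟩
  have dΨ : ∀ r, HasDerivAt Ψ (p r) r := fun r => by
    rw [hΨ]
    exact hps.continuous.integral_hasStrictDerivAt 0 r |>.hasDerivAt
  have hsub : ∀ r, |p r - r| ≤ 2 * ε := fun r => by
    have hc : Continuous fun s => q s - 1 := hqs.continuous.sub continuous_const
    have e1 : ∀ r, p r - r = ∫ s in (0 : ℝ)..r, (q s - 1) := fun r => by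
      rw [intervalIntegral.integral_sub (hqs.continuous.intervalIntegrable _ _)
        (continuous_const.intervalIntegrable _ _), hp]
      simp
    have e2 : ∀ r, |p r - r| ≤ |r| := fun r => by
      have h1 : ∀ s ∈ uIoc (0 : ℝ) r, ‖q s - 1‖ ≤ 1 := fun s _ => by
        rw [norm_eq_abs, _root_.abs_le]
        constructor <;> linarith [q0 s, q1 s]
      have := intervalIntegral.norm_integral_le_of_norm_le_const h1
      rw [e1]
      simpa using this
    have e3 : ∀ r r₀, (∀ s ∈ uIcc r₀ r, 2 * ε ≤ |s|) → p r - r = p r₀ - r₀ := fun r r₀ h => by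
      rw [e1, e1, ← intervalIntegral.integral_add_adjacent_intervals
        (hc.intervalIntegrable 0 r₀) (hc.intervalIntegrable r₀ r)]
      rw [show (∫ s in r₀..r, (q s - 1)) = 0 from
        (intervalIntegral.integral_congr fun s hs => by
          simp [qo s (h s hs)]).trans intervalIntegral.integral_zero, add_zero]
    rcases le_or_gt |r| (2 * ε) with h | h
    · exact (e2 r).trans h
    · rcases lt_abs.1 h with h' | h'
      · rw [e3 r (2 * ε) fun s hs => by
          rw [uIcc_of_le h'.le] at hs
          exact hs.1.trans (le_abs_self s)]
        exact (e2 _).trans (abs_of_pos (by positivity)).le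
      · rw [e3 r (-(2 * ε)) fun s hs => by
          rw [uIcc_of_ge (by linarith)] at hs
          exact (by linarith [hs.2] : 2 * ε ≤ -s).trans (neg_le_abs s)]
        refine (e2 _).trans (le_of_eq ?_)
        rw [abs_neg, abs_of_pos (by positivity)]
  refine ⟨Ψ, p, q, contDiff_of_hasDerivAt dΨ hps, hps, dΨ, dp, q0, q1, pz, ?_, hsub, pa, ?_⟩
  · intro r hr
    rw [hΨ]
    refine (intervalIntegral.integral_congr fun s hs => ?_).trans intervalIntegral.integral_zero
    refine pz s (le_trans ?_ hr)
    have := abs_sub_left_of_mem_uIcc hs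
    simpa using this
  · intro r
    have h1 : ∀ s ∈ uIoc (0 : ℝ) r, ‖p s‖ ≤ |r| := fun s hs => by
      rw [norm_eq_abs]
      refine (pa s).trans ?_
      have := abs_sub_left_of_mem_uIcc (uIoc_subset_uIcc hs)
      simpa using this
    have := intervalIntegral.norm_integral_le_of_norm_le_const h1
    rw [hΨ]
    simpa [← sq] using this

end Truncation

section DirectionalCalculus

variable {V : Type*} [NormedAddCommGroup V] [NormedSpace ℝ V] [FiniteDimensional ℝ V]
  [MeasurableSpace V] [BorelSpace V] {ν : Measure V} [ν.IsAddHaarMeasure]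

theorem ContDiff.fderiv_apply_const {g : V → ℝ} (hg : ContDiff ℝ ∞ g) (e : V) :
    ContDiff ℝ ∞ (fun v => fderiv ℝ g v e) :=
  (hg.fderiv_right (m := ∞) (by simp)).clm_apply contDiff_const

theorem integral_weighted_green {ρ f g : V → ℝ} {e : V} (hρ : ContDiff ℝ ∞ ρ)
    (hρ0 : ∀ v, fderiv ℝ ρ v e = 0) (hf : ContDiff ℝ ∞ f) (hf' : HasCompactSupport f)
    (hg : ContDiff ℝ ∞ g) :
    ∫ v, f v * (ρ v * fderiv ℝ (fun w => fderiv ℝ g w e) v e) ∂ν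
      = - ∫ v, ρ v * (fderiv ℝ f v e * fderiv ℝ g v e) ∂ν := by
  have hg1 := hg.fderiv_apply_const e
  have hF : ContDiff ℝ ∞ (fun v => ρ v * f v) := hρ.mul hf
  have hFc : HasCompactSupport (fun v => ρ v * f v) := hf'.mul_left
  have hd : ∀ v, fderiv ℝ (fun v => ρ v * f v) v e = ρ v * fderiv ℝ f v e := fun v => by
    rw [fderiv_fun_mul (hρ.differentiable (by simp) v) (hf.differentiable (by simp) v)]
    simp [hρ0]
  have key := integral_mul_fderiv_eq_neg_fderiv_mul_of_integrable (μ := ν)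
    (f := fun v => ρ v * f v) (g := fun v => fderiv ℝ g v e) (v := e)
    (((hF.fderiv_apply_const e).continuous.mul hg1.continuous).integrable_of_hasCompactSupport
      ((hFc.fderiv_apply ℝ e).mul_right))
    ((hF.continuous.mul (hg1.fderiv_apply_const e).continuous).integrable_of_hasCompactSupport
      hFc.mul_right)
    ((hF.continuous.mul hg1.continuous).integrable_of_hasCompactSupport hFc.mul_right)
    (fun v _ => hF.differentiable (by simp) v) (fun v _ => hg1.differentiable (by simp) v)
  simp only [hd] at key
  calc _ = ∫ v, ρ v * f v * fderiv ℝ (fun w => fderiv ℝ g w e) v e ∂ν := by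
        congr 1; ext v; ring
    _ = _ := by rw [key]; congr 2; ext v; ring

theorem hasDerivAt_integral_of_contDiffOn {g : ℝ → V → ℝ} {a b : ℝ} {K : Set V}
    (hK : IsCompact K)
    (hg : ContDiffOn ℝ ∞ (fun p : ℝ × V => g p.1 p.2) (Ioo a b ×ˢ univ))
    (h0 : ∀ t ∈ Ioo a b, ∀ v ∉ K, g t v = 0) {t : ℝ} (ht : t ∈ Ioo a b) :
    HasDerivAt (fun s => ∫ v, g s v ∂ν) (∫ v, deriv (fun s => g s v) t ∂ν) t := by
  have hO : IsOpen (Ioo a b ×ˢ (univ : Set V)) := isOpen_Ioo.prod isOpen_univ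
  have hdiff : ∀ s ∈ Ioo a b, ∀ v, DifferentiableAt ℝ (fun p : ℝ × V => g p.1 p.2) (s, v) :=
    fun s hs v => (hg.contDiffAt (hO.mem_nhds ⟨hs, mem_univ v⟩)).differentiableAt (by simp)
  have hder : ∀ s ∈ Ioo a b, ∀ v, HasDerivAt (fun r => g r v)
      (fderiv ℝ (fun p : ℝ × V => g p.1 p.2) (s, v) (1, 0)) s := fun s hs v => by
    have h1 : HasDerivAt (fun r : ℝ => (r, v)) ((1 : ℝ), (0 : V)) s :=
      (hasDerivAt_id s).prodMk (hasDerivAt_const s v)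
    exact (hdiff s hs v).hasFDerivAt.comp_hasDerivAt s h1
  have hcont' : ContinuousOn (fun p : ℝ × V => fderiv ℝ (fun p : ℝ × V => g p.1 p.2) p (1, 0))
      (Ioo a b ×ˢ univ) :=
    (hg.continuousOn_fderiv_of_isOpen hO (by simp)).clm_apply continuousOn_const
  have hslice : ∀ s ∈ Ioo a b, Continuous (g s) := fun s hs =>
    (hg.continuousOn.comp_continuous (f := fun v => (s, v)) (by fun_prop)
      fun v => ⟨hs, mem_univ v⟩)
  have hsupp : ∀ s ∈ Ioo a b, HasCompactSupport (g s) := fun s hs =>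
    HasCompactSupport.intro hK fun v hv => h0 s hs v hv
  obtain ⟨δ, hδ, hδt⟩ := Metric.isOpen_iff.1 (isOpen_Ioo (a := a) (b := b)) t ht
  have hIcc : Metric.closedBall t (δ / 2) ⊆ Ioo a b :=
    (Metric.closedBall_subset_ball (by linarith)).trans hδt
  obtain ⟨C, hC⟩ := ((isCompact_closedBall t (δ / 2)).prod hK).exists_bound_of_continuousOn
    (hcont'.mono (Set.prod_mono hIcc (subset_univ K)))
  refine (hasDerivAt_integral_of_dominated_loc_of_deriv_le (F := g)
    (F' := fun s v => deriv (fun r => g r v) s) (s := Metric.closedBall t (δ / 2))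
    (bound := K.indicator fun _ => C) (Metric.closedBall_mem_nhds t (by linarith)) ?_
    ((hslice t ht).integrable_of_hasCompactSupport (hsupp t ht)) ?_ ?_ ?_ ?_).2
  · filter_upwards [isOpen_Ioo.mem_nhds ht] with s hs using (hslice s hs).aestronglyMeasurable
  · have : (fun v => deriv (fun r => g r v) t)
        = fun v => fderiv ℝ (fun p : ℝ × V => g p.1 p.2) (t, v) (1, 0) :=
      funext fun v => (hder t ht v).deriv
    rw [this]
    exact (hcont'.comp_continuous (f := fun v => (t, v)) (by fun_prop)
      fun v => ⟨ht, mem_univ v⟩).aestronglyMeasurable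
  · refine Eventually.of_forall fun v s hs => ?_
    by_cases hv : v ∈ K
    · rw [indicator_of_mem hv, (hder s (hIcc hs) v).deriv]
      exact hC (s, v) ⟨hs, hv⟩
    · rw [indicator_of_notMem hv]
      have : (fun r => g r v) =ᶠ[𝓝 s] fun _ => 0 := by
        filter_upwards [isOpen_Ioo.mem_nhds (hIcc hs)] with r hr using h0 r hr v hv
      rw [this.deriv_eq]
      simp
  · exact (integrable_indicator_iff hK.measurableSet).2
      (integrableOn_const hK.measure_lt_top.ne)
  · exact Eventually.of_forall fun v s hs => (hder s (hIcc hs) v).differentiableAt.hasDerivAt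

/-- Smooth cutoff functions equal to one near a compact set. -/
theorem exists_smooth_cutoff {K U : Set V} (hK : IsCompact K) (hU : IsOpen U) (hKU : K ⊆ U) :
    ∃ χ : V → ℝ, ContDiff ℝ ∞ χ ∧ HasCompactSupport χ ∧ tsupport χ ⊆ U ∧
      (∀ v, 0 ≤ χ v) ∧ (∀ v, χ v ≤ 1) ∧ ∃ N, IsOpen N ∧ K ⊆ N ∧ ∀ v ∈ N, χ v = 1 := by
  obtain ⟨K₁, hK₁, hKK₁, hK₁U⟩ := exists_compact_between hK hU hKU
  obtain ⟨f, hf1, hf0, hf⟩ := exists_contMDiffMap_one_nhds_of_subset_interior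
    (n := (⊤ : ℕ∞)) (modelWithCornersSelf ℝ V) hK.isClosed hKK₁
  have hsup : tsupport f ⊆ K₁ := by
    refine closure_minimal (fun v hv => ?_) hK₁.isClosed
    by_contra h
    exact hv (hf0 v h)
  obtain ⟨N, hN, hKN, hN1⟩ := mem_nhdsSet_iff_exists.1 hf1
  exact ⟨f, f.contMDiff.contDiff, HasCompactSupport.intro hK₁ hf0, hsup.trans hK₁U,
    fun v => (hf v).1, fun v => (hf v).2, N, hN, hKN, hN1⟩

end DirectionalCalculus

section Diffusion

variable {V : Type*} [NormedAddCommGroup V] [NormedSpace ℝ V] [FiniteDimensional ℝ V]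
  [MeasurableSpace V] [BorelSpace V] {ν : Measure V} [ν.IsAddHaarMeasure]
  {ι : Type*} [Fintype ι] {e : ι → V} {ρ : ι → V → ℝ}

/-- Weights `ρ i ≥ 0` that do not depend on the direction `e i`, so that `∑ ρ i ∂_{e i}²` is
symmetric. -/
structure IsDiffusion (e : ι → V) (ρ : ι → V → ℝ) : Prop where
  smooth : ∀ i, ContDiff ℝ ∞ (ρ i)
  nonneg : ∀ i v, 0 ≤ ρ i v
  invariant : ∀ i v, fderiv ℝ (ρ i) v (e i) = 0

/-- The operator `∑ ρ i ∂_{e i}²`. -/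
noncomputable def diffusion (e : ι → V) (ρ : ι → V → ℝ) (f : V → ℝ) (v : V) : ℝ :=
  ∑ i, ρ i v * fderiv ℝ (fun w => fderiv ℝ f w (e i)) v (e i)

theorem Filter.EventuallyEq.diffusion_eq {f g : V → ℝ} {v : V} (h : f =ᶠ[𝓝 v] g) :
    diffusion e ρ f v = diffusion e ρ g v := by
  refine Finset.sum_congr rfl fun i _ => ?_
  have : (fun w => fderiv ℝ f w (e i)) =ᶠ[𝓝 v] fun w => fderiv ℝ g w (e i) := by
    filter_upwards [h.fderiv (𝕜 := ℝ)] with w hw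
    rw [hw]
  rw [this.fderiv_eq]

namespace IsDiffusion

theorem continuous_diffusion (hρ : IsDiffusion e ρ) {f : V → ℝ} (hf : ContDiff ℝ ∞ f) :
    Continuous (diffusion e ρ f) :=
  continuous_finsetSum _ fun i _ => (hρ.smooth i).continuous.mul
    ((hf.fderiv_apply_const (e i)).fderiv_apply_const (e i)).continuous

theorem integral_mul_diffusion (hρ : IsDiffusion e ρ) {f g : V → ℝ} (hf : ContDiff ℝ ∞ f)
    (hf' : HasCompactSupport f) (hg : ContDiff ℝ ∞ g) :
    ∫ v, f v * diffusion e ρ g v ∂ν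
      = - ∑ i, ∫ v, ρ i v * (fderiv ℝ f v (e i) * fderiv ℝ g v (e i)) ∂ν := by
  simp only [diffusion, Finset.mul_sum]
  rw [integral_finsetSum, ← Finset.sum_neg_distrib]
  · exact Finset.sum_congr rfl fun i _ =>
      integral_weighted_green (hρ.smooth i) (hρ.invariant i) hf hf' hg
  · intro i _
    exact (hf.continuous.mul ((hρ.smooth i).continuous.mul
      ((hg.fderiv_apply_const (e i)).fderiv_apply_const
        (e i)).continuous)).integrable_of_hasCompactSupport
      hf'.mul_right

theorem integral_mul_diffusion_comm (hρ : IsDiffusion e ρ) {f g : V → ℝ} (hf : ContDiff ℝ ∞ f)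
    (hf' : HasCompactSupport f) (hg : ContDiff ℝ ∞ g) (hg' : HasCompactSupport g) :
    ∫ v, f v * diffusion e ρ g v ∂ν = ∫ v, g v * diffusion e ρ f v ∂ν := by
  rw [hρ.integral_mul_diffusion hf hf' hg, hρ.integral_mul_diffusion hg hg' hf]
  simp only [mul_comm]

end IsDiffusion

/-- `y` solves `∂_t y = ∑ ρ i ∂_{e i}² y` on `(0,T) × U` with zero boundary values. -/
structure IsDiffusionSolution (e : ι → V) (ρ : ι → V → ℝ) (U : Set V) (T : ℝ) (y : ℝ → V → ℝ) :
    Prop where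
  continuousOn : ContinuousOn (fun p : ℝ × V => y p.1 p.2) (Icc 0 T ×ˢ closure U)
  smoothOn : ContDiffOn ℝ ∞ (fun p : ℝ × V => y p.1 p.2) (Ioo 0 T ×ˢ U)
  eqn : ∀ t ∈ Ioo 0 T, ∀ v ∈ U, deriv (fun s => y s v) t = diffusion e ρ (y t) v
  boundary : ∀ t ∈ Ioo 0 T, ∀ v ∈ frontier U, y t v = 0

namespace IsDiffusionSolution

variable {U : Set V} {T : ℝ} {y : ℝ → V → ℝ}

theorem contDiffOn_cutoff (hy : IsDiffusionSolution e ρ U T y) (hU : IsOpen U) {χ : V → ℝ}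
    (hχ : ContDiff ℝ ∞ χ) (hχU : tsupport χ ⊆ U) :
    ContDiffOn ℝ ∞ (fun p : ℝ × V => χ p.2 * y p.1 p.2) (Ioo 0 T ×ˢ univ) := by
  rintro ⟨t, v⟩ ⟨ht, -⟩
  refine ContDiffAt.contDiffWithinAt ?_
  by_cases hv : v ∈ U
  · exact (hχ.contDiffAt.comp (t, v) contDiffAt_snd).mul
      (hy.smoothOn.contDiffAt ((isOpen_Ioo.prod hU).mem_nhds ⟨ht, hv⟩))
  · have h0 : ∀ᶠ w in 𝓝 v, χ w = 0 :=
      notMem_tsupport_iff_eventuallyEq.1 fun h => hv (hχU h)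
    refine (contDiffAt_const (c := (0 : ℝ))).congr_of_eventuallyEq ?_
    have h1 : Tendsto (fun p : ℝ × V => p.2) (𝓝 (t, v)) (𝓝 v) := continuous_snd.continuousAt
    filter_upwards [h1.eventually h0] with p hp
    rw [hp, zero_mul]

theorem exists_cutoff (hy : IsDiffusionSolution e ρ U T y) (hU : IsOpen U)
    (hUb : Bornology.IsBounded U) {a b ε : ℝ} (ha : 0 < a) (hb : b < T) (hε : 0 < ε) {h : V → ℝ}
    (hhc : HasCompactSupport h) (hhU : tsupport h ⊆ U) :
    ∃ χ : V → ℝ, ContDiff ℝ ∞ χ ∧ HasCompactSupport χ ∧ tsupport χ ⊆ U ∧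
      (∀ v, 0 ≤ χ v) ∧ (∀ v, χ v ≤ 1) ∧ ∃ N, IsOpen N ∧ tsupport h ⊆ N ∧ (∀ v ∈ N, χ v = 1) ∧
        ∀ t ∈ Icc a b, ∀ v ∈ U, v ∉ N → |y t v| < ε := by
  have hsub : Icc a b ⊆ Icc 0 T := Icc_subset_Icc ha.le hb.le
  have hcl : IsCompact (Icc a b ×ˢ closure U) := isCompact_Icc.prod hUb.isCompact_closure
  have hKc : IsCompact {p ∈ Icc a b ×ˢ closure U | ε ≤ |y p.1 p.2|} := by
    have hc : ContinuousOn (fun p : ℝ × V => |y p.1 p.2|) (Icc a b ×ˢ closure U) :=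
      (hy.continuousOn.mono (prod_mono hsub subset_rfl)).abs
    exact hcl.of_isClosed_subset (hc.preimage_isClosed_of_isClosed hcl.isClosed isClosed_Ici)
      fun p hp => hp.1
  have hK2 := hKc.image continuous_snd
  have hKU : Prod.snd '' {p ∈ Icc a b ×ˢ closure U | ε ≤ |y p.1 p.2|} ⊆ U := by
    rintro v ⟨⟨t, v⟩, ⟨⟨ht, hv⟩, hp⟩, rfl⟩
    by_contra hvU
    have hfr : v ∈ frontier U := by
      rw [frontier, hU.interior_eq]
      exact ⟨hv, hvU⟩
    have h0 := hy.boundary t ⟨ha.trans_le ht.1, ht.2.trans_lt hb⟩ v hfr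
    simp only [h0, abs_zero] at hp
    linarith
  obtain ⟨χ, h1, h2, h3, h4, h5, N, hN, hKN, hN1⟩ := exists_smooth_cutoff (hK2.union hhc) hU
    (union_subset hKU hhU)
  refine ⟨χ, h1, h2, h3, h4, h5, N, hN, subset_union_right.trans hKN, hN1, fun t ht v hv hvN => ?_⟩
  by_contra hlt
  exact hvN (hKN (Or.inl ⟨(t, v), ⟨⟨ht, subset_closure hv⟩, not_lt.1 hlt⟩, rfl⟩))

theorem differentiableAt_time (hy : IsDiffusionSolution e ρ U T y) (hU : IsOpen U) {t : ℝ}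
    (ht : t ∈ Ioo 0 T) {v : V} (hv : v ∈ U) : DifferentiableAt ℝ (fun s => y s v) t := by
  have h1 := (hy.smoothOn.contDiffAt (x := (t, v))
    ((isOpen_Ioo.prod hU).mem_nhds ⟨ht, hv⟩)).differentiableAt (by simp)
  exact h1.comp (f := fun s : ℝ => (s, v)) t (by fun_prop)

/-- Energy dissipation of a truncated solution, and the evolution of its moments. -/
theorem exists_truncation (hρ : IsDiffusion e ρ) (hy : IsDiffusionSolution e ρ U T y)
    (hU : IsOpen U)
    (hUb : Bornology.IsBounded U) {a b ε : ℝ} (ha : 0 < a) (hb : b < T) (hε : 0 < ε)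
    {Ψ p q : ℝ → ℝ} (hp : IsTruncation ε Ψ p q) {h : V → ℝ} (hh : ContDiff ℝ ∞ h)
    (hhc : HasCompactSupport h) (hhU : tsupport h ⊆ U) {t : ℝ} (ht : t ∈ Ioo a b) :
    ∃ w : V → ℝ, ContDiff ℝ ∞ w ∧ HasCompactSupport w ∧ tsupport w ⊆ U ∧
      (∀ v ∈ U, w v = p (y t v)) ∧
      (∃ D, HasDerivAt (fun s => ∫ v in U, Ψ (y s v) ∂ν) (-D) t ∧
        ∑ i, ∫ v, ρ i v * (fderiv ℝ w v (e i)) ^ 2 ∂ν ≤ D) ∧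
      ∃ c', HasDerivAt (fun s => ∫ v, h v * y s v ∂ν) c' t ∧
        |c' + ∑ i, ∫ v, ρ i v * (fderiv ℝ w v (e i) * fderiv ℝ h v (e i)) ∂ν|
          ≤ 2 * ε * ∫ v, |diffusion e ρ h v| ∂ν := by
  obtain ⟨χ, hχ, hχc, hχU, hχ0, hχ1, N, hN, hhN, hN1, hyN⟩ :=
    hy.exists_cutoff hU hUb ha hb hε hhc hhU
  have hab : Ioo a b ⊆ Ioo 0 T := Ioo_subset_Ioo ha.le hb.le
  have hNU : N ⊆ U := fun v hv => hχU (subset_tsupport _ (by simp [hN1 v hv]))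
  have hχz : ∀ v ∉ U, χ v = 0 := fun v hv => image_eq_zero_of_notMem_tsupport fun h => hv (hχU h)
  have hhz : ∀ v ∉ N, h v = 0 := fun v hv => image_eq_zero_of_notMem_tsupport fun h => hv (hhN h)
  have p0 : p 0 = 0 := hp.eq_zero 0 (by simpa using hε.le)
  have Ψ0 : Ψ 0 = 0 := hp.primitive_eq_zero 0 (by simpa using hε.le)
  have hsm := (hy.contDiffOn_cutoff hU hχ hχU).mono (prod_mono hab (subset_refl univ))
  have hO : IsOpen (Ioo a b ×ˢ (univ : Set V)) := isOpen_Ioo.prod isOpen_univ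
  have hsmall : ∀ s ∈ Ioo a b, ∀ v ∉ N, |χ v * y s v| ≤ ε := fun s hs v hv => by
    by_cases hvU : v ∈ U
    · rw [abs_mul, abs_of_nonneg (hχ0 v)]
      have := hyN s (Ioo_subset_Icc_self hs) v hvU hv
      nlinarith [hχ0 v, hχ1 v, abs_nonneg (y s v)]
    · simp [hχz v hvU, hε.le]
  have hYs : ContDiff ℝ ∞ (fun v => χ v * y t v) := by
    have : ContDiffOn ℝ ∞ (fun v => χ v * y t v) univ :=
      hsm.comp (f := fun v : V => (t, v)) (contDiff_const.prodMk contDiff_id).contDiffOn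
        fun v _ => ⟨ht, mem_univ v⟩
    exact contDiffOn_univ.1 this
  have hYc : HasCompactSupport (fun v => χ v * y t v) := hχc.mul_right
  have hYU : tsupport (fun v => χ v * y t v) ⊆ U := (tsupport_mul_subset_left).trans hχU
  have hdY : ∀ v ∈ N, deriv (fun s => y s v) t = diffusion e ρ (fun v => χ v * y t v) v := by
    intro v hv
    rw [hy.eqn t (hab ht) v (hNU hv)]
    refine Filter.EventuallyEq.diffusion_eq ?_
    filter_upwards [hN.mem_nhds hv] with w hw
    rw [hN1 w hw, one_mul]
  have hws : ContDiff ℝ ∞ (fun v => p (χ v * y t v)) := hp.smooth.comp hYs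
  have hwc : HasCompactSupport (fun v => p (χ v * y t v)) := hYc.comp_left p0
  have hdw : ∀ v i, fderiv ℝ (fun v => p (χ v * y t v)) v (e i)
      = q (χ v * y t v) * fderiv ℝ (fun v => χ v * y t v) v (e i) := fun v i => by
    have h1 := (hYs.differentiable (by simp) v).hasFDerivAt
    have h2 := ((hp.hasDerivAt (χ v * y t v)).comp_hasFDerivAt v h1).fderiv
    rw [show (fun v => p (χ v * y t v)) = p ∘ fun v => χ v * y t v from rfl, h2]
    simp
  have hint : ∀ (i : ι) (f g : V → ℝ), ContDiff ℝ ∞ f → ContDiff ℝ ∞ g → HasCompactSupport f →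
      Integrable (fun v => ρ i v * (fderiv ℝ f v (e i) * fderiv ℝ g v (e i))) ν :=
    fun i f g hf hg hfc => ((hρ.smooth i).continuous.mul
      ((hf.fderiv_apply_const (e i)).continuous.mul
        (hg.fderiv_apply_const (e i)).continuous)).integrable_of_hasCompactSupport
        ((hfc.fderiv_apply ℝ (e i)).mul_right.mul_left)
  refine ⟨fun v => p (χ v * y t v), hws, hwc,
    (closure_mono fun v hv => ?_).trans hYU, fun v hv => ?_, ?_, ?_⟩
  · intro h0
    exact hv (by simp only [h0, p0])
  · dsimp only
    by_cases hvN : v ∈ N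
    · rw [hN1 v hvN, one_mul]
    · rw [hp.eq_zero _ (hsmall t ht v hvN),
        hp.eq_zero _ (hyN t (Ioo_subset_Icc_self ht) v hv hvN).le]
  · have hg : ContDiffOn ℝ ∞ (fun r : ℝ × V => Ψ (χ r.2 * y r.1 r.2)) (Ioo a b ×ˢ univ) :=
      hp.smooth_primitive.comp_contDiffOn hsm
    have key := hasDerivAt_integral_of_contDiffOn (ν := ν) (g := fun s v => Ψ (χ v * y s v)) hχc
      hg (fun s _ v hv => by
        rw [image_eq_zero_of_notMem_tsupport hv, zero_mul, Ψ0]) ht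
    have hd : ∀ v, deriv (fun s => Ψ (χ v * y s v)) t
        = p (χ v * y t v) * diffusion e ρ (fun v => χ v * y t v) v := fun v => by
      by_cases hvN : v ∈ N
      · have h1 : HasDerivAt (fun s => χ v * y s v) (χ v * deriv (fun s => y s v) t) t :=
          (hy.differentiableAt_time hU (hab ht) (hNU hvN)).hasDerivAt.const_mul _
        have h2 := ((hp.hasDerivAt_primitive (χ v * y t v)).comp t h1).deriv
        rw [show (fun s => Ψ (χ v * y s v)) = Ψ ∘ fun s => χ v * y s v from rfl, h2, hdY v hvN,
          hN1 v hvN, one_mul, one_mul]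
      · have : (fun s => Ψ (χ v * y s v)) =ᶠ[𝓝 t] fun _ => 0 := by
          filter_upwards [isOpen_Ioo.mem_nhds ht] with s hs
          exact hp.primitive_eq_zero _ (hsmall s hs v hvN)
        rw [this.deriv_eq, hp.eq_zero _ (hsmall t ht v hvN)]
        simp
    simp only [hd] at key
    rw [hρ.integral_mul_diffusion hws hwc hYs] at key
    refine ⟨_, key.congr_of_eventuallyEq ?_, Finset.sum_le_sum fun i _ => ?_⟩
    · filter_upwards [isOpen_Ioo.mem_nhds ht] with s hs
      rw [← integral_indicator hU.measurableSet]
      congr 1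
      ext v
      by_cases hvU : v ∈ U
      · rw [indicator_of_mem hvU]
        by_cases hvN : v ∈ N
        · rw [hN1 v hvN, one_mul]
        · rw [hp.primitive_eq_zero _ (hsmall s hs v hvN),
            hp.primitive_eq_zero _ (hyN s (Ioo_subset_Icc_self hs) v hvU hvN).le]
      · rw [indicator_of_notMem hvU, hχz v hvU, zero_mul, Ψ0]
    · refine integral_mono ?_ (hint i _ _ hws hYs hwc) fun v => ?_
      · simpa only [sq] using hint i _ _ hws hws hwc
      · refine mul_le_mul_of_nonneg_left ?_ (hρ.nonneg i v)
        rw [hdw]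
        nlinarith [hp.deriv_nonneg (χ v * y t v), hp.deriv_le_one (χ v * y t v),
          mul_nonneg (mul_nonneg (hp.deriv_nonneg (χ v * y t v))
            (sub_nonneg.2 (hp.deriv_le_one (χ v * y t v))))
            (sq_nonneg (fderiv ℝ (fun v => χ v * y t v) v (e i)))]
  · have hg : ContDiffOn ℝ ∞ (fun r : ℝ × V => h r.2 * (χ r.2 * y r.1 r.2)) (Ioo a b ×ˢ univ) :=
      (hh.comp contDiff_snd).contDiffOn.mul hsm
    have key := hasDerivAt_integral_of_contDiffOn (ν := ν) (g := fun s v => h v * (χ v * y s v))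
      hχc hg (fun s _ v hv => by
        rw [image_eq_zero_of_notMem_tsupport hv, zero_mul, mul_zero]) ht
    have heq : ∀ s v, h v * (χ v * y s v) = h v * y s v := fun s v => by
      by_cases hvN : v ∈ N
      · rw [hN1 v hvN, one_mul]
      · rw [hhz v hvN, zero_mul, zero_mul]
    have hd : ∀ v, deriv (fun s => h v * y s v) t
        = h v * diffusion e ρ (fun v => χ v * y t v) v := fun v => by
      by_cases hvN : v ∈ N
      · rw [((hy.differentiableAt_time hU (hab ht) (hNU hvN)).hasDerivAt.const_mul _).deriv,
          hdY v hvN]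
      · simp [hhz v hvN]
    simp only [heq, hd] at key
    rw [hρ.integral_mul_diffusion_comm hh hhc hYs hYc] at key
    refine ⟨_, key, ?_⟩
    have hAc := hρ.continuous_diffusion hh
    have hAz : HasCompactSupport (diffusion e ρ h) := by
      refine HasCompactSupport.intro hhc fun v hv => ?_
      rw [(notMem_tsupport_iff_eventuallyEq.1 hv).diffusion_eq]
      simp [diffusion]
    have h1 := hρ.integral_mul_diffusion (ν := ν) hws hwc hh
    rw [← neg_eq_iff_eq_neg] at h1
    have hi1 : Integrable (fun v => χ v * y t v * diffusion e ρ h v) ν :=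
      (hYs.continuous.mul hAc).integrable_of_hasCompactSupport hYc.mul_right
    have hi2 : Integrable (fun v => p (χ v * y t v) * diffusion e ρ h v) ν :=
      (hws.continuous.mul hAc).integrable_of_hasCompactSupport hwc.mul_right
    rw [← h1, ← sub_eq_add_neg, ← integral_sub hi1 hi2, ← integral_const_mul]
    refine (abs_integral_le_integral_abs).trans (integral_mono_of_nonneg
      (Eventually.of_forall fun v => abs_nonneg _)
      ((hAc.abs.integrable_of_hasCompactSupport hAz.abs).const_mul _)
      (Eventually.of_forall fun v => ?_))
    dsimp only
    rw [← sub_mul, abs_mul]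
    refine mul_le_mul_of_nonneg_right ?_ (abs_nonneg _)
    rw [abs_sub_comm]
    exact hp.abs_sub_le _

end IsDiffusionSolution

theorem abs_integral_mul_le_half {α : Type*} [MeasurableSpace α] {μ : Measure α} {f g : α → ℝ}
    (hf : MemLp f 2 μ) (hg : MemLp g 2 μ) {κ : ℝ} (hκ : 0 < κ) :
    |∫ x, f x * g x ∂μ| ≤ κ / 2 * ∫ x, f x ^ 2 ∂μ + 1 / (2 * κ) * ∫ x, g x ^ 2 ∂μ := by
  have hf2 := hf.integrable_sq
  have hg2 := hg.integrable_sq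
  rw [← integral_const_mul, ← integral_const_mul,
    ← integral_add (hf2.const_mul _) (hg2.const_mul _)]
  refine abs_integral_le_integral_abs.trans (integral_mono (hf.mul_integrable hg).abs
    ((hf2.const_mul _).add (hg2.const_mul _)) fun x => ?_)
  dsimp only
  have h1 : κ / 2 * f x ^ 2 + 1 / (2 * κ) * g x ^ 2 - |f x * g x|
      = (κ * |f x| - |g x|) ^ 2 / (2 * κ) := by
    rw [abs_mul, ← sq_abs (f x), ← sq_abs (g x)]
    field_simp
    ring
  have h2 : 0 ≤ (κ * |f x| - |g x|) ^ 2 / (2 * κ) := by positivity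
  linarith

/-- A weak Dirichlet eigenfunction of `-∑ ρ i ∂_{e i}²` on `U`; `Γ i` is `√(ρ i) ∂_{e i} Θ`. -/
structure IsWeakEigenfunction (ν : Measure V) (e : ι → V) (ρ : ι → V → ℝ) (U : Set V)
    (Θ : V → ℝ) (Γ : ι → V → ℝ) (lam : ℝ) : Prop where
  memLp : MemLp Θ 2 ν
  zero : ∀ v ∉ U, Θ v = 0
  memLp_grad : ∀ i, MemLp (Γ i) 2 ν
  weak : ∀ w : V → ℝ, ContDiff ℝ ∞ w → HasCompactSupport w → tsupport w ⊆ U →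
    ∑ i, ∫ v, √(ρ i v) * fderiv ℝ w v (e i) * Γ i v ∂ν = lam * ∫ v, w v * Θ v ∂ν
  approx : ∀ δ > 0, ∃ h : V → ℝ, ContDiff ℝ ∞ h ∧ HasCompactSupport h ∧ tsupport h ⊆ U ∧
    ∫ v, (h v - Θ v) ^ 2 ∂ν ≤ δ ∧
    ∑ i, ∫ v, (√(ρ i v) * fderiv ℝ h v (e i) - Γ i v) ^ 2 ∂ν ≤ δ

theorem IsDiffusion.memLp_sqrt_mul_fderiv (hρ : IsDiffusion e ρ) {w : V → ℝ} (hw : ContDiff ℝ ∞ w)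
    (hwc : HasCompactSupport w) (i : ι) : MemLp (fun v => √(ρ i v) * fderiv ℝ w v (e i)) 2 ν :=
  ((hρ.smooth i).continuous.sqrt.mul
    (hw.fderiv_apply_const (e i)).continuous).memLp_of_hasCompactSupport
    (hwc.fderiv_apply ℝ (e i)).mul_left

theorem IsWeakEigenfunction.abs_form_sub_le (hρ : IsDiffusion e ρ) {U : Set V} {Θ : V → ℝ}
    {Γ : ι → V → ℝ} {lam : ℝ} (hΘ : IsWeakEigenfunction ν e ρ U Θ Γ lam) {w h : V → ℝ}
    (hw : ContDiff ℝ ∞ w) (hwc : HasCompactSupport w) (hwU : tsupport w ⊆ U)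
    (hh : ContDiff ℝ ∞ h) (hhc : HasCompactSupport h) {κ : ℝ} (hκ : 0 < κ) :
    |∑ i, ∫ v, ρ i v * (fderiv ℝ w v (e i) * fderiv ℝ h v (e i)) ∂ν - lam * ∫ v, w v * Θ v ∂ν|
      ≤ κ / 2 * ∑ i, ∫ v, ρ i v * fderiv ℝ w v (e i) ^ 2 ∂ν
        + 1 / (2 * κ) * ∑ i, ∫ v, (√(ρ i v) * fderiv ℝ h v (e i) - Γ i v) ^ 2 ∂ν := by
  rw [← hΘ.weak w hw hwc hwU, ← Finset.sum_sub_distrib, Finset.mul_sum, Finset.mul_sum,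
    ← Finset.sum_add_distrib]
  refine (Finset.abs_sum_le_sum_abs _ _).trans (Finset.sum_le_sum fun i _ => ?_)
  have hW := hρ.memLp_sqrt_mul_fderiv (ν := ν) hw hwc i
  have hH := hρ.memLp_sqrt_mul_fderiv (ν := ν) hh hhc i
  have hG := hΘ.memLp_grad i
  have hρs : ∀ v, √(ρ i v) * √(ρ i v) = ρ i v := fun v => Real.mul_self_sqrt (hρ.nonneg i v)
  have key := abs_integral_mul_le_half hW (hH.sub hG) hκ
  simp only [Pi.sub_apply] at key
  have h1 : ∫ v, ρ i v * (fderiv ℝ w v (e i) * fderiv ℝ h v (e i)) ∂ν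
      = ∫ v, (√(ρ i v) * fderiv ℝ w v (e i)) * (√(ρ i v) * fderiv ℝ h v (e i)) ∂ν := by
    congr 1
    ext v
    linear_combination (-(fderiv ℝ w v (e i) * fderiv ℝ h v (e i))) * hρs v
  have h2 : ∫ v, ρ i v * fderiv ℝ w v (e i) ^ 2 ∂ν
      = ∫ v, (√(ρ i v) * fderiv ℝ w v (e i)) ^ 2 ∂ν := by
    congr 1
    ext v
    rw [mul_pow, Real.sq_sqrt (hρ.nonneg i v)]
  rw [h1, h2, ← integral_sub (hW.mul_integrable hH) (hW.mul_integrable hG)]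
  simpa only [← mul_sub] using key

namespace IsDiffusionSolution

variable {U : Set V} {T : ℝ} {y : ℝ → V → ℝ}

theorem exists_bound (hy : IsDiffusionSolution e ρ U T y) (hUb : Bornology.IsBounded U) :
    ∃ B, 0 ≤ B ∧ ∀ t ∈ Icc 0 T, ∀ v ∈ U, |y t v| ≤ B := by
  obtain ⟨C, hC⟩ := (isCompact_Icc.prod hUb.isCompact_closure).exists_bound_of_continuousOn
    hy.continuousOn
  exact ⟨max C 0, le_max_right _ _, fun t ht v hv =>
    (hC (t, v) ⟨ht, subset_closure hv⟩).trans (le_max_left _ _)⟩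

theorem continuousOn_slice (hy : IsDiffusionSolution e ρ U T y) {t : ℝ} (ht : t ∈ Icc 0 T) :
    ContinuousOn (y t) U :=
  hy.continuousOn.comp (f := fun v : V => (t, v)) (by fun_prop) fun _ hv =>
    ⟨ht, subset_closure hv⟩

theorem memLp_indicator (hy : IsDiffusionSolution e ρ U T y) (hU : IsOpen U)
    (hUb : Bornology.IsBounded U) {t : ℝ} (ht : t ∈ Icc 0 T) :
    MemLp (U.indicator (y t)) 2 ν := by
  obtain ⟨B, hB, hyB⟩ := hy.exists_bound hUb
  rw [memLp_indicator_iff_restrict hU.measurableSet]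
  have : IsFiniteMeasure (ν.restrict U) :=
    isFiniteMeasure_restrict.2 hUb.measure_lt_top.ne
  exact MemLp.of_bound ((hy.continuousOn_slice ht).aestronglyMeasurable hU.measurableSet) B
    (ae_restrict_of_forall_mem hU.measurableSet fun v hv => hyB t ht v hv)

theorem integral_sq_indicator_le {B : ℝ} (hUb : Bornology.IsBounded U) (hU : IsOpen U)
    {f : V → ℝ} (hf : ∀ v ∈ U, |f v| ≤ B) :
    ∫ v, U.indicator f v ^ 2 ∂ν ≤ B ^ 2 * ν.real U := by
  have : IsFiniteMeasure (ν.restrict U) :=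
    isFiniteMeasure_restrict.2 hUb.measure_lt_top.ne
  have h1 : (fun v => U.indicator f v ^ 2) = U.indicator fun v => f v ^ 2 := by
    ext v
    by_cases hv : v ∈ U <;> simp [hv]
  rw [h1, integral_indicator hU.measurableSet]
  calc ∫ v in U, f v ^ 2 ∂ν ≤ ∫ v in U, B ^ 2 ∂ν := by
        refine integral_mono_of_nonneg (Eventually.of_forall fun v => sq_nonneg _)
          (integrable_const _) ?_
        filter_upwards [ae_restrict_mem hU.measurableSet] with v hv
        exact sq_le_sq' (by linarith [abs_le.1 (hf v hv)]) (abs_le.1 (hf v hv)).2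
    _ = B ^ 2 * ν.real U := by simp [mul_comm]

end IsDiffusionSolution

theorem abs_exp_mul_sub_le_of_hasDerivAt {c c' m D : ℝ → ℝ} {lam s t T k S : ℝ}
    (hs : 0 ≤ s) (hst : s ≤ t) (ht : t ≤ T)
    (hm : ∀ r ∈ Icc s t, HasDerivAt m (-D r) r) (hc : ∀ r ∈ Icc s t, HasDerivAt c (c' r) r)
    (hle : ∀ r ∈ Icc s t, |c' r + lam * c r| ≤ k * D r + S) :
    |exp (lam * t) * c t - exp (lam * s) * c s|
      ≤ exp (|lam| * T) * (k * (m s - m t) + S * (t - s)) := by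
  have hder : ∀ r ∈ Icc s t, HasDerivAt (fun r => exp (lam * r) * c r)
      (exp (lam * r) * (c' r + lam * c r)) r := fun r hr => by
    have h1 : HasDerivAt (fun r => exp (lam * r)) (exp (lam * r) * (lam * 1)) r :=
      ((hasDerivAt_id r).const_mul lam).exp
    exact (h1.mul (hc r hr)).congr_deriv (by ring)
  have hbd : ∀ r ∈ Icc s t, |exp (lam * r) * (c' r + lam * c r)|
      ≤ exp (|lam| * T) * (k * D r + S) := fun r hr => by
    rw [abs_mul, abs_of_pos (exp_pos _)]
    refine mul_le_mul (exp_le_exp.2 ?_) (hle r hr) (abs_nonneg _) (exp_pos _).le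
    exact mul_le_mul (le_abs_self _) (hr.2.trans ht) (hs.trans hr.1) (abs_nonneg _)
  have hcomp : ∀ r ∈ Icc s t, HasDerivAt
      (fun r => exp (|lam| * T) * (S * r - k * m r))
      (exp (|lam| * T) * (k * D r + S)) r := fun r hr => by
    exact ((((hasDerivAt_id r).const_mul S).sub ((hm r hr).const_mul k)).const_mul
      (exp (|lam| * T))).congr_deriv (by ring)
  have h1 := antitoneOn_Icc_of_hasDerivAt (fun r hr => (hder r hr).sub (hcomp r hr))
    (fun r hr => by linarith [(abs_le.1 (hbd r hr)).2]) (left_mem_Icc.2 hst) (right_mem_Icc.2 hst)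
    hst
  have h2 := antitoneOn_Icc_of_hasDerivAt (fun r hr => (hder r hr).neg.sub (hcomp r hr))
    (fun r hr => by linarith [(abs_le.1 (hbd r hr)).1]) (left_mem_Icc.2 hst) (right_mem_Icc.2 hst)
    hst
  simp only [Pi.sub_apply, Pi.neg_apply] at h1 h2
  rw [abs_le]
  constructor <;> linarith

namespace IsDiffusionSolution

variable {U : Set V} {T : ℝ} {y : ℝ → V → ℝ}

theorem exists_moment_inequality (hρ : IsDiffusion e ρ) (hy : IsDiffusionSolution e ρ U T y)
    (hU : IsOpen U) (hUb : Bornology.IsBounded U) {Θ : V → ℝ} {Γ : ι → V → ℝ} {lam : ℝ}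
    (hΘ : IsWeakEigenfunction ν e ρ U Θ Γ lam) {a b ε κ B : ℝ} (ha : 0 < a) (hb : b < T)
    (hε : 0 < ε) (hκ : 0 < κ) (hB : ∀ t ∈ Icc 0 T, ∀ v ∈ U, |y t v| ≤ B)
    {Ψ p q : ℝ → ℝ} (hp : IsTruncation ε Ψ p q) {h : V → ℝ} (hh : ContDiff ℝ ∞ h)
    (hhc : HasCompactSupport h) (hhU : tsupport h ⊆ U)
    (hhΘ : ∫ v, (h v - Θ v) ^ 2 ∂ν ≤ κ ^ 2)
    (hhΓ : ∑ i, ∫ v, (√(ρ i v) * fderiv ℝ h v (e i) - Γ i v) ^ 2 ∂ν ≤ κ ^ 2)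
    (hεA : 2 * ε * ∫ v, |diffusion e ρ h v| ∂ν ≤ κ) (hεh : 2 * ε * ∫ v, |h v| ∂ν ≤ κ)
    {t : ℝ} (ht : t ∈ Ioo a b) :
    ∃ D c', HasDerivAt (fun s => ∫ v in U, Ψ (y s v) ∂ν) (-D) t ∧
      HasDerivAt (fun s => ∫ v, h v * y s v ∂ν) c' t ∧
      |c' + lam * ∫ v, h v * y t v ∂ν|
        ≤ κ / 2 * D + κ * (3 / 2 + |lam| * (B ^ 2 * ν.real U / 2 + 3 / 2)) := by
  have htT : t ∈ Icc 0 T := ⟨(ha.trans ht.1).le, (ht.2.trans hb).le⟩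
  obtain ⟨w, hw, hwc, hwU, hwy, ⟨D, hD, hDw⟩, c', hc, hcw⟩ :=
    hy.exists_truncation (ν := ν) hρ hU hUb ha hb hε hp hh hhc hhU ht
  have hform := hΘ.abs_form_sub_le hρ hw hwc hwU hh hhc hκ
  have hw2 : MemLp w 2 ν := hw.continuous.memLp_of_hasCompactSupport hwc
  have hh2 : MemLp h 2 ν := hh.continuous.memLp_of_hasCompactSupport hhc
  have hY := hy.memLp_indicator (ν := ν) hU hUb htT
  have hwz : ∀ v ∉ U, w v = 0 := fun v hv => image_eq_zero_of_notMem_tsupport fun h => hv (hwU h)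
  have hhz : ∀ v ∉ U, h v = 0 := fun v hv => image_eq_zero_of_notMem_tsupport fun h => hv (hhU h)
  have hwint : ∫ v, w v ^ 2 ∂ν ≤ B ^ 2 * ν.real U := by
    have : w = U.indicator w := by
      ext v
      by_cases hv : v ∈ U
      · rw [indicator_of_mem hv]
      · rw [indicator_of_notMem hv, hwz v hv]
    rw [this]
    exact integral_sq_indicator_le hUb hU fun v hv => by
      rw [hwy v hv]
      exact (hp.abs_le _).trans (hB t htT v hv)
  have hhY : (fun v => h v * y t v) = fun v => h v * U.indicator (y t) v := by
    ext v
    by_cases hv : v ∈ U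
    · rw [indicator_of_mem hv]
    · rw [hhz v hv, zero_mul, zero_mul]
  have h1 := abs_integral_mul_le_half hw2 (hh2.sub hΘ.memLp) hκ
  simp only [Pi.sub_apply] at h1
  have h2 : |∫ v, h v * (w v - U.indicator (y t) v) ∂ν| ≤ 2 * ε * ∫ v, |h v| ∂ν := by
    rw [← integral_const_mul]
    refine abs_integral_le_integral_abs.trans (integral_mono_of_nonneg
      (Eventually.of_forall fun v => abs_nonneg _)
      ((hh.continuous.abs.integrable_of_hasCompactSupport hhc.abs).const_mul _)
      (Eventually.of_forall fun v => ?_))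
    dsimp only
    by_cases hv : v ∈ U
    · rw [abs_mul, mul_comm, indicator_of_mem hv, hwy v hv]
      exact mul_le_mul_of_nonneg_right (hp.abs_sub_le _) (abs_nonneg _)
    · simp [hhz v hv]
  have h3 : ∫ v, w v * Θ v ∂ν - ∫ v, h v * y t v ∂ν
      = ∫ v, h v * (w v - U.indicator (y t) v) ∂ν - ∫ v, w v * (h v - Θ v) ∂ν := by
    rw [hhY]
    simp only [mul_sub]
    rw [integral_sub (hh2.mul_integrable hw2) (hh2.mul_integrable hY),
      integral_sub (hw2.mul_integrable hh2) (hw2.mul_integrable hΘ.memLp)]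
    simp only [mul_comm (h _) (w _)]
    ring
  refine ⟨D, c', hD, hc, ?_⟩
  have hκi : 1 / (2 * κ) * κ ^ 2 = κ / 2 := by field_simp
  have hi0 : (0 : ℝ) ≤ 1 / (2 * κ) := by positivity
  have h4 := mul_le_mul_of_nonneg_left hhΘ hi0
  have h5 := mul_le_mul_of_nonneg_left hhΓ hi0
  have h6 := mul_le_mul_of_nonneg_left hDw (half_pos hκ).le
  have h7 := mul_le_mul_of_nonneg_left hwint (half_pos hκ).le
  have h8 : |∫ v, w v * Θ v ∂ν - ∫ v, h v * y t v ∂ν|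
      ≤ κ * (B ^ 2 * ν.real U / 2 + 3 / 2) := by
    rw [h3]
    refine (abs_sub _ _).trans ?_
    linarith
  have h9 := mul_le_mul_of_nonneg_left h8 (abs_nonneg lam)
  rw [← abs_mul] at h9
  generalize (∑ i, ∫ v, ρ i v * (fderiv ℝ w v (e i) * fderiv ℝ h v (e i)) ∂ν) = Q at *
  generalize (∫ v, w v * Θ v ∂ν) = W at *
  generalize (∫ v, h v * y t v ∂ν) = c at *
  have e1 : c' + lam * c = (c' + Q) - (Q - lam * W) - lam * (W - c) := by ring
  rw [e1]
  refine (abs_sub _ _).trans ((add_le_add_left (abs_sub _ _) _).trans ?_)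
  linarith

theorem abs_exp_mul_moment_sub_le (hρ : IsDiffusion e ρ) (hy : IsDiffusionSolution e ρ U T y)
    (hU : IsOpen U) (hUb : Bornology.IsBounded U) {Θ : V → ℝ} {Γ : ι → V → ℝ} {lam : ℝ}
    (hΘ : IsWeakEigenfunction ν e ρ U Θ Γ lam) {κ B : ℝ}
    (hκ : 0 < κ) (hB : ∀ t ∈ Icc 0 T, ∀ v ∈ U, |y t v| ≤ B) {h : V → ℝ} (hh : ContDiff ℝ ∞ h)
    (hhc : HasCompactSupport h) (hhU : tsupport h ⊆ U)
    (hhΘ : ∫ v, (h v - Θ v) ^ 2 ∂ν ≤ κ ^ 2)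
    (hhΓ : ∑ i, ∫ v, (√(ρ i v) * fderiv ℝ h v (e i) - Γ i v) ^ 2 ∂ν ≤ κ ^ 2)
    {s t : ℝ} (hs : 0 < s) (hst : s ≤ t) (ht : t < T) :
    |exp (lam * t) * (∫ v, h v * y t v ∂ν) - exp (lam * s) * ∫ v, h v * y s v ∂ν|
      ≤ κ * (exp (|lam| * T) * (B ^ 2 * ν.real U
        + (3 / 2 + |lam| * (B ^ 2 * ν.real U / 2 + 3 / 2)) * T)) := by
  have hA0 : 0 ≤ ∫ v, |diffusion e ρ h v| ∂ν := integral_nonneg fun v => abs_nonneg _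
  have hH0 : 0 ≤ ∫ v, |h v| ∂ν := integral_nonneg fun v => abs_nonneg _
  have hsT : 0 < T := hs.trans_le (hst.trans ht.le)
  obtain ⟨ε, hε, hεA, hεh⟩ : ∃ ε > 0, 2 * ε * ∫ v, |diffusion e ρ h v| ∂ν ≤ κ ∧
      2 * ε * ∫ v, |h v| ∂ν ≤ κ := by
    generalize (∫ v, |diffusion e ρ h v| ∂ν) = A at *
    generalize (∫ v, |h v| ∂ν) = H at *
    refine ⟨κ / (2 * (A + H + 1)), by positivity, ?_, ?_⟩
    · rw [show 2 * (κ / (2 * (A + H + 1))) * A = κ * A / (A + H + 1) by field_simp,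
        div_le_iff₀ (by positivity)]
      nlinarith
    · rw [show 2 * (κ / (2 * (A + H + 1))) * H = κ * H / (A + H + 1) by field_simp,
        div_le_iff₀ (by positivity)]
      nlinarith
  obtain ⟨Ψ, p, q, hp⟩ := exists_isTruncation hε
  have key : ∀ r ∈ Icc s t, ∃ D c', HasDerivAt (fun s => ∫ v in U, Ψ (y s v) ∂ν) (-D) r ∧
      HasDerivAt (fun s => ∫ v, h v * y s v ∂ν) c' r ∧
      |c' + lam * ∫ v, h v * y r v ∂ν|
        ≤ κ / 2 * D + κ * (3 / 2 + |lam| * (B ^ 2 * ν.real U / 2 + 3 / 2)) := fun r hr =>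
    hy.exists_moment_inequality hρ hU hUb hΘ (half_pos hs) (b := (t + T) / 2) (by linarith) hε hκ
      hB hp hh hhc hhU hhΘ hhΓ hεA hεh ⟨by linarith [hr.1], by linarith [hr.2]⟩
  choose! D c' hD hc hle using key
  have hM0 : 0 ≤ B ^ 2 * ν.real U := by positivity
  have hmle : ∀ r ∈ Icc 0 T, |∫ v in U, Ψ (y r v) ∂ν| ≤ B ^ 2 * ν.real U := fun r hr => by
    have h1 := norm_setIntegral_le_of_norm_le_const (f := fun v => Ψ (y r v)) (C := B ^ 2)
      (hUb.measure_lt_top (μ := ν)) fun v hv =>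
        (hp.abs_primitive_le _).trans (sq_le_sq' (by linarith [abs_le.1 (hB r hr v hv)])
          (abs_le.1 (hB r hr v hv)).2)
    exact h1
  have hS0 : 0 ≤ 3 / 2 + |lam| * (B ^ 2 * ν.real U / 2 + 3 / 2) := by positivity
  have h1 := abs_exp_mul_sub_le_of_hasDerivAt (lam := lam) hs.le hst ht.le hD hc hle
  have h2 := abs_le.1 (hmle s ⟨hs.le, hst.trans ht.le⟩)
  have h3 := abs_le.1 (hmle t ⟨hs.le.trans hst, ht.le⟩)
  refine h1.trans ?_
  rw [mul_left_comm]
  refine mul_le_mul_of_nonneg_left ?_ (exp_pos _).le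
  have h4 := mul_le_mul_of_nonneg_left (show t - s ≤ T by linarith) (mul_nonneg hκ.le hS0)
  nlinarith

theorem continuousOn_integral_mul (hy : IsDiffusionSolution e ρ U T y) (hU : IsOpen U)
    (hUb : Bornology.IsBounded U) {Θ : V → ℝ} (hΘ : MemLp Θ 2 ν) (hΘ0 : ∀ v ∉ U, Θ v = 0) :
    ContinuousOn (fun t => ∫ v, Θ v * y t v ∂ν) (Icc 0 T) := by
  obtain ⟨B, hB0, hB⟩ := hy.exists_bound hUb
  have hΘ1 : Integrable (U.indicator fun v => |Θ v|) ν := by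
    have : IsFiniteMeasure (ν.restrict U) := isFiniteMeasure_restrict.2 hUb.measure_lt_top.ne
    exact (integrable_indicator_iff hU.measurableSet).2
      ((hΘ.restrict U).integrable (by norm_num)).abs
  refine continuousOn_of_dominated (bound := fun v => B * U.indicator (fun v => |Θ v|) v)
    (fun t ht => ?_) (fun t ht => Eventually.of_forall fun v => ?_) (hΘ1.const_mul B)
    (Eventually.of_forall fun v => ?_)
  · have : (fun v => Θ v * y t v) = fun v => Θ v * U.indicator (y t) v := by
      ext v
      by_cases hv : v ∈ U
      · rw [indicator_of_mem hv]
      · rw [hΘ0 v hv, zero_mul, zero_mul]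
    rw [this]
    exact (hΘ.mul_integrable (hy.memLp_indicator hU hUb ht)).aestronglyMeasurable
  · by_cases hv : v ∈ U
    · rw [indicator_of_mem hv, norm_mul, mul_comm]
      exact mul_le_mul_of_nonneg_right (hB t ht v hv) (abs_nonneg _)
    · simp [hΘ0 v hv, hv]
  · by_cases hv : v ∈ U
    · exact continuousOn_const.mul (hy.continuousOn.comp (f := fun t : ℝ => (t, v)) (by fun_prop)
        fun _ ht => ⟨ht, subset_closure hv⟩)
    · simp only [hΘ0 v hv, zero_mul]
      exact continuousOn_const

/-- The coefficient of a solution along a weak eigenfunction decays exponentially. -/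
theorem integral_mul_eigenfunction_eq (hρ : IsDiffusion e ρ) (hT : 0 < T)
    (hy : IsDiffusionSolution e ρ U T y) (hU : IsOpen U) (hUb : Bornology.IsBounded U)
    {Θ : V → ℝ} {Γ : ι → V → ℝ} {lam : ℝ} (hΘ : IsWeakEigenfunction ν e ρ U Θ Γ lam) {t : ℝ}
    (ht : t ∈ Icc 0 T) :
    ∫ v, Θ v * y t v ∂ν = exp (-(lam * t)) * ∫ v, Θ v * y 0 v ∂ν := by
  obtain ⟨B, hB0, hB⟩ := hy.exists_bound hUb
  have hM0 : 0 ≤ B ^ 2 * ν.real U := by positivity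
  have happ : ∀ r ∈ Icc 0 T, ∀ κ > 0, ∀ h : V → ℝ, ContDiff ℝ ∞ h → HasCompactSupport h →
      tsupport h ⊆ U → ∫ v, (h v - Θ v) ^ 2 ∂ν ≤ κ ^ 2 →
      |∫ v, h v * y r v ∂ν - ∫ v, Θ v * y r v ∂ν| ≤ κ * (B ^ 2 * ν.real U / 2 + 1 / 2) := by
    intro r hr κ hκ h hh hhc hhU hhΘ
    have hhz : ∀ v ∉ U, h v = 0 :=
      fun v hv => image_eq_zero_of_notMem_tsupport fun h => hv (hhU h)
    have hh2 : MemLp h 2 ν := hh.continuous.memLp_of_hasCompactSupport hhc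
    have hY := hy.memLp_indicator (ν := ν) hU hUb hr
    have e1 : ∫ v, h v * y r v ∂ν - ∫ v, Θ v * y r v ∂ν
        = ∫ v, U.indicator (y r) v * (h v - Θ v) ∂ν := by
      simp only [mul_sub]
      rw [integral_sub (hY.mul_integrable hh2) (hY.mul_integrable hΘ.memLp)]
      congr 2 <;> ext v <;> by_cases hv : v ∈ U
      · rw [indicator_of_mem hv, mul_comm]
      · rw [hhz v hv, zero_mul, mul_zero]
      · rw [indicator_of_mem hv, mul_comm]
      · rw [hΘ.zero v hv, zero_mul, mul_zero]
    have h1 := abs_integral_mul_le_half hY (hh2.sub hΘ.memLp) hκ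
    simp only [Pi.sub_apply] at h1
    rw [e1]
    have hκi : 1 / (2 * κ) * κ ^ 2 = κ / 2 := by field_simp
    have hi0 : (0 : ℝ) ≤ 1 / (2 * κ) := by positivity
    have h4 := mul_le_mul_of_nonneg_left hhΘ hi0
    have h7 := mul_le_mul_of_nonneg_left
      (integral_sq_indicator_le (ν := ν) hUb hU fun v hv => hB r hr v hv) (half_pos hκ).le
    linarith
  have hconst : ∀ s r, 0 < s → s ≤ r → r < T →
      exp (lam * r) * (∫ v, Θ v * y r v ∂ν) = exp (lam * s) * ∫ v, Θ v * y s v ∂ν := by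
    intro s r hs hsr hr
    obtain ⟨C, hC⟩ : ∃ C, C = exp (|lam| * T) * (B ^ 2 * ν.real U
        + (3 / 2 + |lam| * (B ^ 2 * ν.real U / 2 + 3 / 2)) * T)
        + (exp (lam * r) + exp (lam * s)) * (B ^ 2 * ν.real U / 2 + 1 / 2) := ⟨_, rfl⟩
    have hC0 : 0 < C := by rw [hC]; positivity
    have hle : ∀ κ > 0, |exp (lam * r) * (∫ v, Θ v * y r v ∂ν)
        - exp (lam * s) * ∫ v, Θ v * y s v ∂ν| ≤ κ * C := by
      intro κ hκ
      obtain ⟨h, hh, hhc, hhU, hhΘ, hhΓ⟩ := hΘ.approx (κ ^ 2) (by positivity)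
      have h1 := hy.abs_exp_mul_moment_sub_le hρ hU hUb hΘ hκ hB hh hhc hhU hhΘ hhΓ hs hsr hr
      have h2 := happ r ⟨(hs.trans_le hsr).le, hr.le⟩ κ hκ h hh hhc hhU hhΘ
      have h3 := happ s ⟨hs.le, hsr.trans hr.le⟩ κ hκ h hh hhc hhU hhΘ
      have h4 := mul_le_mul_of_nonneg_left h2 (exp_pos (lam * r)).le
      have h5 := mul_le_mul_of_nonneg_left h3 (exp_pos (lam * s)).le
      rw [← abs_of_pos (exp_pos (lam * r)), ← abs_mul,
        abs_of_pos (exp_pos (lam * r))] at h4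
      rw [← abs_of_pos (exp_pos (lam * s)), ← abs_mul,
        abs_of_pos (exp_pos (lam * s))] at h5
      rw [abs_le] at *
      rw [hC]
      constructor <;> nlinarith
    by_contra hne
    have hpos := abs_pos.2 (sub_ne_zero.2 hne)
    have := hle _ (div_pos hpos (mul_pos two_pos hC0))
    rw [show ∀ A : ℝ, A / (2 * C) * C = A / 2 from fun A => by field_simp] at this
    linarith
  have hcont : ContinuousOn (fun r => exp (lam * r) * ∫ v, Θ v * y r v ∂ν) (Icc 0 T) :=
    (by fun_prop : Continuous fun r => exp (lam * r)).continuousOn.mul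
      (hy.continuousOn_integral_mul hU hUb hΘ.memLp hΘ.zero)
  have hEq : EqOn (fun r => exp (lam * r) * ∫ v, Θ v * y r v ∂ν)
      (fun _ => exp (lam * (T / 2)) * ∫ v, Θ v * y (T / 2) v ∂ν) (Ioo 0 T) := fun r hr => by
    rcases le_total r (T / 2) with h | h
    · exact (hconst r (T / 2) hr.1 h (by linarith)).symm
    · exact hconst (T / 2) r (by linarith) h hr.2
  have hEq' := hEq.of_subset_closure hcont continuousOn_const Ioo_subset_Icc_self
    (closure_Ioo hT.ne).ge
  have h1 := (hEq' ht).trans (hEq' (left_mem_Icc.2 hT.le)).symm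
  simp only [mul_zero, exp_zero, one_mul] at h1
  rw [← h1, ← mul_assoc, ← exp_add]
  simp

end IsDiffusionSolution

end Diffusion

section ProductEigenfunction

section ProductMeasure

variable {α β : Type*} [MeasurableSpace α] [MeasurableSpace β] {μ : Measure α} {ν : Measure β}
  [SFinite μ] [SFinite ν]

theorem MeasureTheory.MemLp.prod_mul {f : α → ℝ} {g : β → ℝ} (hf : MemLp f 2 μ)
    (hg : MemLp g 2 ν) : MemLp (fun v : α × β => f v.1 * g v.2) 2 (μ.prod ν) := by
  refine (memLp_two_iff_integrable_sq (hf.1.comp_fst.mul hg.1.comp_snd)).2 ?_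
  simpa only [Pi.mul_apply, mul_pow] using hf.integrable_sq.mul_prod hg.integrable_sq

theorem tendsto_integral_sq_prod_mul_sub {f : ℕ → α → ℝ} {g : ℕ → β → ℝ} {f₀ : α → ℝ} {g₀ : β → ℝ}
    (hf : ∀ j, MemLp (f j) 2 μ) (hg : ∀ j, MemLp (g j) 2 ν) (hf₀ : MemLp f₀ 2 μ)
    (hg₀ : MemLp g₀ 2 ν) (hff : TendstoL2 μ f f₀) (hgg : TendstoL2 ν g g₀) :
    Tendsto (fun j => ∫ v, (f j v.1 * g j v.2 - f₀ v.1 * g₀ v.2) ^ 2 ∂(μ.prod ν)) atTop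
      (𝓝 0) := by
  have hff' : Tendsto (fun j => ∫ x, (f j x - f₀ x) ^ 2 ∂μ) atTop (𝓝 0) := by
    simpa only [TendstoL2, norm_eq_abs, sq_abs] using hff
  have hgg' : Tendsto (fun j => ∫ x, (g j x - g₀ x) ^ 2 ∂ν) atTop (𝓝 0) := by
    simpa only [TendstoL2, norm_eq_abs, sq_abs] using hgg
  have hlim : Tendsto (fun j => 2 * ((∫ x, (f j x - f₀ x) ^ 2 ∂μ) *
      (2 * ∫ z, (g j z - g₀ z) ^ 2 ∂ν + 2 * ∫ z, g₀ z ^ 2 ∂ν))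
      + 2 * ((∫ x, f₀ x ^ 2 ∂μ) * ∫ z, (g j z - g₀ z) ^ 2 ∂ν)) atTop (𝓝 0) := by
    have h1 := (hff'.mul ((hgg'.const_mul 2).add_const (2 * ∫ z, g₀ z ^ 2 ∂ν))).const_mul 2
    have h2 := (hgg'.const_mul (∫ x, f₀ x ^ 2 ∂μ)).const_mul 2
    simpa using h1.add h2
  refine squeeze_zero (fun j => integral_nonneg fun v => sq_nonneg _) (fun j => ?_) hlim
  have hd := (hf j).sub hf₀
  have hd' := (hg j).sub hg₀
  have i1 : Integrable (fun v : α × β => (f j v.1 - f₀ v.1) ^ 2 * g j v.2 ^ 2) (μ.prod ν) :=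
    hd.integrable_sq.mul_prod (hg j).integrable_sq
  have i2 : Integrable (fun v : α × β => f₀ v.1 ^ 2 * (g j v.2 - g₀ v.2) ^ 2) (μ.prod ν) :=
    hf₀.integrable_sq.mul_prod hd'.integrable_sq
  have h1 : ∫ z, g j z ^ 2 ∂ν ≤ 2 * ∫ z, (g j z - g₀ z) ^ 2 ∂ν + 2 * ∫ z, g₀ z ^ 2 ∂ν := by
    have i3 : Integrable (fun z => 2 * (g j z - g₀ z) ^ 2) ν := hd'.integrable_sq.const_mul 2
    have i4 : Integrable (fun z => 2 * g₀ z ^ 2) ν := hg₀.integrable_sq.const_mul 2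
    rw [← integral_const_mul, ← integral_const_mul, ← integral_add i3 i4]
    refine integral_mono (hg j).integrable_sq (i3.add i4) fun z => ?_
    simp only
    nlinarith [sq_nonneg (g j z - 2 * g₀ z)]
  calc _ ≤ ∫ v, (2 * ((f j v.1 - f₀ v.1) ^ 2 * g j v.2 ^ 2)
        + 2 * (f₀ v.1 ^ 2 * (g j v.2 - g₀ v.2) ^ 2)) ∂(μ.prod ν) := by
        refine integral_mono_of_nonneg (Eventually.of_forall fun v => sq_nonneg _)
          ((i1.const_mul 2).add (i2.const_mul 2)) (Eventually.of_forall fun v => ?_)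
        dsimp only
        nlinarith [sq_nonneg ((f j v.1 - f₀ v.1) * g j v.2 - f₀ v.1 * (g j v.2 - g₀ v.2))]
    _ = 2 * ((∫ x, (f j x - f₀ x) ^ 2 ∂μ) * ∫ z, g j z ^ 2 ∂ν)
        + 2 * ((∫ x, f₀ x ^ 2 ∂μ) * ∫ z, (g j z - g₀ z) ^ 2 ∂ν) := by
        rw [integral_add (i1.const_mul 2) (i2.const_mul 2), integral_const_mul, integral_const_mul,
          integral_prod_mul (fun x => (f j x - f₀ x) ^ 2) fun z => g j z ^ 2,
          integral_prod_mul (fun x => f₀ x ^ 2) fun z => (g j z - g₀ z) ^ 2]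
    _ ≤ _ := by
        refine add_le_add_left (mul_le_mul_of_nonneg_left (mul_le_mul_of_nonneg_left h1
          (integral_nonneg fun x => sq_nonneg _)) two_pos.le) _

end ProductMeasure

variable {E : Type*} [NormedAddCommGroup E] [InnerProductSpace ℝ E] [FiniteDimensional ℝ E]
  [MeasurableSpace E] [BorelSpace E]
  {F : Type*} [NormedAddCommGroup F] [InnerProductSpace ℝ F] [FiniteDimensional ℝ F]
  [MeasurableSpace F] [BorelSpace F]
  {I J : Type*} [Fintype I] [Fintype J]

theorem fderiv_slice_fst {w : E × F → ℝ} {x : E} {z : F} (hw : DifferentiableAt ℝ w (x, z))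
    (u : E) : fderiv ℝ (fun x => w (x, z)) x u = fderiv ℝ w (x, z) (u, 0) := by
  have h1 : HasFDerivAt (fun x : E => (x, z)) (ContinuousLinearMap.inl ℝ E F) x := by
    simpa using! (hasFDerivAt_id x).prodMk (hasFDerivAt_const z x)
  rw [show (fun x => w (x, z)) = w ∘ fun x => (x, z) from rfl,
    (hw.hasFDerivAt.comp x h1).fderiv]
  simp

theorem fderiv_slice_snd {w : E × F → ℝ} {x : E} {z : F} (hw : DifferentiableAt ℝ w (x, z))
    (u : F) : fderiv ℝ (fun z => w (x, z)) z u = fderiv ℝ w (x, z) (0, u) := by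
  have h1 : HasFDerivAt (fun z : F => (x, z)) (ContinuousLinearMap.inr ℝ E F) z := by
    simpa using! (hasFDerivAt_const x z).prodMk (hasFDerivAt_id z)
  rw [show (fun z => w (x, z)) = w ∘ fun z => (x, z) from rfl,
    (hw.hasFDerivAt.comp z h1).fderiv]
  simp

theorem isTest_slice {A : Set E} {B : Set F} {w : E × F → ℝ} (hw : ContDiff ℝ ∞ w)
    (hwc : HasCompactSupport w) (hwA : tsupport w ⊆ A ×ˢ B) (z : F) :
    IsTest A (fun x => w (x, z)) := by
  have hsub : tsupport (fun x => w (x, z)) ⊆ (fun x => (x, z)) ⁻¹' tsupport w :=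
    closure_minimal (fun x hx => subset_tsupport w hx)
      ((isClosed_tsupport w).preimage (by fun_prop))
  refine ⟨hw.comp (contDiff_id.prodMk contDiff_const), ?_, fun x hx => (hwA (hsub hx)).1⟩
  refine HasCompactSupport.intro (hwc.isCompact.image continuous_fst) fun x hx => ?_
  by_contra h
  exact hx ⟨(x, z), subset_tsupport w h, rfl⟩

theorem HasLap.sum_integral_fst {A : Set E} {B : Set F} {ψ : E → ℝ} {G : E → E} {L : E → ℝ}
    (hψ : HasLap A ψ G L) {m : F → ℝ} (hm : MemLp m 2 volume) {w : E × F → ℝ}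
    (hw : ContDiff ℝ ∞ w) (hwc : HasCompactSupport w) (hwA : tsupport w ⊆ A ×ˢ B)
    (b : OrthonormalBasis I ℝ E) :
    ∑ i, ∫ v, fderiv ℝ w v (b i, 0) * (inner ℝ (G v.1) (b i) * m v.2)
        ∂((volume : Measure E).prod (volume : Measure F))
      = - ∫ v, w v * (L v.1 * m v.2) ∂((volume : Measure E).prod (volume : Measure F)) := by
  have hG : ∀ i, MemLp (fun x => inner ℝ (G x) (b i)) 2 (volume : Measure E) := fun i =>
    hψ.isH01.memLp_grad.inner_const (b i)
  have hwi : ∀ i, MemLp (fun v => fderiv ℝ w v (b i, 0)) 2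
      ((volume : Measure E).prod (volume : Measure F)) := fun i =>
    (hw.fderiv_apply_const _).continuous.memLp_of_hasCompactSupport (hwc.fderiv_apply ℝ _)
  have hint : ∀ i, Integrable (fun v => fderiv ℝ w v (b i, 0) * (inner ℝ (G v.1) (b i) * m v.2))
      ((volume : Measure E).prod (volume : Measure F)) := fun i =>
    (hwi i).mul_integrable ((hG i).prod_mul hm)
  have hint2 : Integrable (fun v => w v * (L v.1 * m v.2))
      ((volume : Measure E).prod (volume : Measure F)) :=
    (hw.continuous.memLp_of_hasCompactSupport hwc).mul_integrable (hψ.memLp.prod_mul hm)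
  rw [← integral_finsetSum _ fun i _ => hint i, integral_prod_symm _
    (integrable_finsetSum _ fun i _ => hint i), integral_prod_symm _ hint2, ← integral_neg]
  congr 1
  ext z
  have ht := isTest_slice hw hwc hwA z
  have h1 := hψ.weak _ ht
  have h2 : ∀ x, ∑ i, fderiv ℝ w (x, z) (b i, 0) * (inner ℝ (G x) (b i) * m z)
      = m z * inner ℝ (G x) (∇ (fun x => w (x, z)) x) := fun x => by
    rw [← b.sum_inner_mul_inner, Finset.mul_sum]
    refine Finset.sum_congr rfl fun i _ => ?_
    have h3 : inner ℝ (b i) (∇ (fun x => w (x, z)) x) = fderiv ℝ w (x, z) (b i, 0) := by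
      rw [real_inner_comm, inner_gradient_eq,
        fderiv_slice_fst (hw.differentiable (by simp) (x, z))]
    rw [h3]
    ring
  simp only [h2]
  rw [integral_const_mul, eq_neg_of_add_eq_zero_left h1, mul_neg, ← integral_const_mul]
  congr 2
  ext x
  ring

theorem HasLap.sum_integral_snd {A : Set E} {B : Set F} {φ : F → ℝ} {G : F → F} {L : F → ℝ}
    (hφ : HasLap B φ G L) {m : E → ℝ} (hm : MemLp m 2 volume) {w : E × F → ℝ}
    (hw : ContDiff ℝ ∞ w) (hwc : HasCompactSupport w) (hwA : tsupport w ⊆ A ×ˢ B)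
    (b : OrthonormalBasis J ℝ F) :
    ∑ j, ∫ v, fderiv ℝ w v (0, b j) * (m v.1 * inner ℝ (G v.2) (b j))
        ∂((volume : Measure E).prod (volume : Measure F))
      = - ∫ v, w v * (m v.1 * L v.2) ∂((volume : Measure E).prod (volume : Measure F)) := by
  have hG : ∀ i, MemLp (fun x => inner ℝ (G x) (b i)) 2 (volume : Measure F) := fun i =>
    hφ.isH01.memLp_grad.inner_const (b i)
  have hwi : ∀ i, MemLp (fun v => fderiv ℝ w v (0, b i)) 2
      ((volume : Measure E).prod (volume : Measure F)) := fun i =>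
    (hw.fderiv_apply_const _).continuous.memLp_of_hasCompactSupport (hwc.fderiv_apply ℝ _)
  have hint : ∀ i, Integrable (fun v => fderiv ℝ w v (0, b i) * (m v.1 * inner ℝ (G v.2) (b i)))
      ((volume : Measure E).prod (volume : Measure F)) := fun i =>
    (hwi i).mul_integrable (hm.prod_mul (hG i))
  have hint2 : Integrable (fun v => w v * (m v.1 * L v.2))
      ((volume : Measure E).prod (volume : Measure F)) :=
    (hw.continuous.memLp_of_hasCompactSupport hwc).mul_integrable (hm.prod_mul hφ.memLp)
  rw [← integral_finsetSum _ fun i _ => hint i, integral_prod _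
    (integrable_finsetSum _ fun i _ => hint i), integral_prod _ hint2, ← integral_neg]
  congr 1
  ext x
  have hswap : tsupport (fun v : F × E => w v.swap) ⊆ B ×ˢ A := fun v hv => by
    have : tsupport (fun v : F × E => w v.swap) ⊆ Prod.swap ⁻¹' tsupport w :=
      closure_minimal (fun v hv => subset_tsupport w hv)
        ((isClosed_tsupport w).preimage continuous_swap)
    exact (hwA (this hv)).symm
  have ht : IsTest B (fun z => w (x, z)) :=
    isTest_slice (w := fun v : F × E => w v.swap)
      (hw.comp (contDiff_snd.prodMk contDiff_fst))
      (hwc.comp_homeomorph (Homeomorph.prodComm F E)) hswap x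
  have h1 := hφ.weak _ ht
  have h2 : ∀ z, ∑ i, fderiv ℝ w (x, z) (0, b i) * (m x * inner ℝ (G z) (b i))
      = m x * inner ℝ (G z) (∇ (fun z => w (x, z)) z) := fun z => by
    rw [← b.sum_inner_mul_inner, Finset.mul_sum]
    refine Finset.sum_congr rfl fun i _ => ?_
    have h3 : inner ℝ (b i) (∇ (fun z => w (x, z)) z) = fderiv ℝ w (x, z) (0, b i) := by
      rw [real_inner_comm, inner_gradient_eq,
        fderiv_slice_snd (hw.differentiable (by simp) (x, z))]
    rw [h3]
    ring
  simp only [h2]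
  rw [integral_const_mul, eq_neg_of_add_eq_zero_left h1, mul_neg, ← integral_const_mul]
  congr 2
  ext z
  ring

/-- The directions of differentiation of the Baouendi–Grushin operator. -/
noncomputable def grushinDir (b : OrthonormalBasis I ℝ E) (b' : OrthonormalBasis J ℝ F) :
    I ⊕ J → E × F :=
  Sum.elim (fun i => (b i, 0)) (fun j => (0, b' j))

variable (E F I J) in
/-- The weights of the Baouendi–Grushin operator. -/
noncomputable def grushinWeight : I ⊕ J → E × F → ℝ :=
  Sum.elim (fun _ _ => 1) (fun _ v => ‖v.1‖ ^ 2)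

theorem isDiffusion_grushin (b : OrthonormalBasis I ℝ E) (b' : OrthonormalBasis J ℝ F) :
    IsDiffusion (grushinDir b b') (grushinWeight E F I J) where
  smooth := by
    rintro (i | j)
    · exact contDiff_const
    · exact (contDiff_norm_sq ℝ).comp contDiff_fst
  nonneg := by
    rintro (i | j) v
    · exact zero_le_one
    · exact sq_nonneg _
  invariant := by
    rintro (i | j) v
    · simp [grushinWeight]
    · have h : DifferentiableAt ℝ (fun v : E × F => ‖v.1‖ ^ 2) (v.1, v.2) :=
        (((contDiff_norm_sq ℝ).comp contDiff_fst : ContDiff ℝ 1 _).differentiable (by simp)) _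
      exact (fderiv_slice_snd h (b' j)).symm.trans (by simp)

theorem isTest_prod_mul {A : Set E} {B : Set F} {η : E → ℝ} {ζ : F → ℝ} (hη : IsTest A η)
    (hζ : IsTest B ζ) :
    ContDiff ℝ ∞ (fun v : E × F => η v.1 * ζ v.2) ∧
      HasCompactSupport (fun v : E × F => η v.1 * ζ v.2) ∧
      tsupport (fun v : E × F => η v.1 * ζ v.2) ⊆ A ×ˢ B := by
  have hsub : tsupport (fun v : E × F => η v.1 * ζ v.2) ⊆ tsupport η ×ˢ tsupport ζ :=
    closure_minimal (fun v hv => ⟨subset_tsupport η (left_ne_zero_of_mul hv),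
      subset_tsupport ζ (right_ne_zero_of_mul hv)⟩)
      ((isClosed_tsupport η).prod (isClosed_tsupport ζ))
  exact ⟨(hη.smooth.comp contDiff_fst).mul (hζ.smooth.comp contDiff_snd),
    (hη.compact.isCompact.prod hζ.compact.isCompact).of_isClosed_subset (isClosed_tsupport _) hsub,
    hsub.trans (prod_mono hη.subset hζ.subset)⟩

theorem TendstoL2.inner_basis {H : ℕ → E → E} {G : E → E} (hH : ∀ j, MemLp (H j) 2 volume)
    (hG : MemLp G 2 volume) (h : TendstoL2 volume H G) (b : OrthonormalBasis I ℝ E) (i : I) :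
    TendstoL2 volume (fun j x => inner ℝ (H j x) (b i)) (fun x => inner ℝ (G x) (b i)) := by
  refine TendstoL2.of_le hH hG h 1 fun j x => ?_
  rw [← inner_sub_left]
  simpa [mul_comm] using norm_inner_le_norm (𝕜 := ℝ) (H j x - G x) (b i)

theorem HasLap.isWeakEigenfunction {A : Set E} {B : Set F} (hA : Bornology.IsBounded A)
    {ψ : E → ℝ} {P : E → E} {φ : F → ℝ} {Q : F → F} {μ lam : ℝ}
    (hψ : HasLap A ψ P (fun x => ((μ * ‖x‖) ^ 2 - lam) * ψ x))
    (hφ : HasLap B φ Q (fun z => (0 ^ 2 - μ ^ 2) * φ z))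
    (b : OrthonormalBasis I ℝ E) (b' : OrthonormalBasis J ℝ F) :
    IsWeakEigenfunction ((volume : Measure E).prod (volume : Measure F)) (grushinDir b b')
      (grushinWeight E F I J) (A ×ˢ B) (fun v => ψ v.1 * φ v.2)
      (Sum.elim (fun i v => inner ℝ (P v.1) (b i) * φ v.2)
        (fun j v => (‖v.1‖ * ψ v.1) * inner ℝ (Q v.2) (b' j))) lam := by
  obtain ⟨K, hK⟩ := hA.exists_norm_le
  have hm : ∀ k : ℕ, ∀ f : E → ℝ, MemLp f 2 (volume : Measure E) → (∀ x ∉ A, f x = 0) →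
      MemLp (fun x => ‖x‖ ^ k * f x) 2 (volume : Measure E) := fun k f hf h0 =>
    hf.continuous_smul hA h0 (continuous_norm.pow k)
  have hPi : ∀ i, MemLp (fun x => inner ℝ (P x) (b i)) 2 (volume : Measure E) := fun i =>
    hψ.isH01.memLp_grad.inner_const (b i)
  have hQj : ∀ j, MemLp (fun z => inner ℝ (Q z) (b' j)) 2 (volume : Measure F) := fun j =>
    hφ.isH01.memLp_grad.inner_const (b' j)
  have hm1 : MemLp (fun x => ‖x‖ * ψ x) 2 (volume : Measure E) := by
    simpa using hm 1 ψ hψ.isH01.memLp hψ.isH01.zero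
  have hm2 := hm 2 ψ hψ.isH01.memLp hψ.isH01.zero
  refine ⟨hψ.isH01.memLp.prod_mul hφ.isH01.memLp, fun v hv => ?_, ?_, fun w hw hwc hwU => ?_,
    fun δ hδ => ?_⟩
  · by_cases h : v.1 ∈ A
    · rw [hφ.isH01.zero v.2 fun h' => hv ⟨h, h'⟩, mul_zero]
    · rw [hψ.isH01.zero v.1 h, zero_mul]
  · rintro (i | j)
    · exact (hPi i).prod_mul hφ.isH01.memLp
    · exact hm1.prod_mul (hQj j)
  · have h1 := hψ.sum_integral_fst hφ.isH01.memLp hw hwc hwU b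
    have h2 := hφ.sum_integral_snd hm2 hw hwc hwU b'
    have hwm := hw.continuous.memLp_of_hasCompactSupport (p := 2)
      (μ := (volume : Measure E).prod (volume : Measure F)) hwc
    have i1 : Integrable (fun v : E × F => w v * (((μ * ‖v.1‖) ^ 2 - lam) * ψ v.1 * φ v.2))
        ((volume : Measure E).prod volume) :=
      hwm.mul_integrable (hψ.memLp.prod_mul hφ.isH01.memLp)
    have i2 : Integrable (fun v : E × F => w v * (‖v.1‖ ^ 2 * ψ v.1 * ((0 ^ 2 - μ ^ 2) * φ v.2)))
        ((volume : Measure E).prod volume) :=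
      hwm.mul_integrable (hm2.prod_mul hφ.memLp)
    rw [Fintype.sum_sum_type]
    simp only [grushinWeight, grushinDir, Sum.elim_inl, Sum.elim_inr, Real.sqrt_one, one_mul,
      Real.sqrt_sq (norm_nonneg _)]
    have h3 : ∀ j, ∫ v : E × F, ‖v.1‖ * fderiv ℝ w v (0, b' j)
          * (‖v.1‖ * ψ v.1 * inner ℝ (Q v.2) (b' j)) ∂((volume : Measure E).prod volume)
        = ∫ v : E × F, fderiv ℝ w v (0, b' j) * (‖v.1‖ ^ 2 * ψ v.1 * inner ℝ (Q v.2) (b' j))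
          ∂((volume : Measure E).prod volume) := fun j => by
      congr 1
      ext v
      ring
    rw [Finset.sum_congr rfl fun j _ => h3 j, h1, h2, ← neg_add, ← integral_add i1 i2,
      ← integral_neg, ← integral_const_mul]
    congr 1
    ext v
    ring
  · obtain ⟨η, hη, hη1, hη2⟩ := hψ.isH01.approx
    obtain ⟨ζ, hζ, hζ1, hζ2⟩ := hφ.isH01.approx
    have hη3 : TendstoL2 volume (fun n x => ‖x‖ * η n x) (fun x => ‖x‖ * ψ x) := by
      refine TendstoL2.of_le (fun n => (hη n).memLp) hψ.isH01.memLp hη1 |K| fun n x => ?_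
      by_cases hx : x ∈ A
      · rw [← mul_sub, norm_mul, norm_norm]
        exact mul_le_mul_of_nonneg_right ((hK x hx).trans (le_abs_self K)) (norm_nonneg _)
      · rw [hψ.isH01.zero x hx, (hη n).eq_zero hx]
        simp
    have hη3m : ∀ n, MemLp (fun x => ‖x‖ * η n x) 2 (volume : Measure E) := fun n => by
      simpa using hm 1 (η n) (hη n).memLp fun x hx => (hη n).eq_zero hx
    have t1 := tendsto_integral_sq_prod_mul_sub (fun n => (hη n).memLp) (fun n => (hζ n).memLp)
      hψ.isH01.memLp hφ.isH01.memLp hη1 hζ1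
    have t2 : ∀ k, Tendsto (fun n => ∫ v, (√(grushinWeight E F I J k v)
        * fderiv ℝ (fun v : E × F => η n v.1 * ζ n v.2) v (grushinDir b b' k)
        - Sum.elim (fun i v => inner ℝ (P v.1) (b i) * φ v.2)
        (fun j v => (‖v.1‖ * ψ v.1) * inner ℝ (Q v.2) (b' j)) k v) ^ 2
        ∂((volume : Measure E).prod (volume : Measure F))) atTop (𝓝 0) := by
      rintro (i | j)
      · refine (tendsto_integral_sq_prod_mul_sub
          (fun n => (hη n).memLp_gradient.inner_const (b i)) (fun n => (hζ n).memLp)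
          (hPi i) hφ.isH01.memLp (hη2.inner_basis (fun n => (hη n).memLp_gradient)
            hψ.isH01.memLp_grad b i) hζ1).congr fun n => ?_
        congr 1
        ext v
        have hd : DifferentiableAt ℝ (fun v : E × F => η n v.1 * ζ n v.2) (v.1, v.2) :=
          (isTest_prod_mul (hη n) (hζ n)).1.differentiable (by simp) _
        have h4 := fderiv_slice_fst hd (b i)
        dsimp only at h4
        rw [fderiv_mul_const ((hη n).differentiableAt v.1)] at h4
        simp only [grushinWeight, grushinDir, Sum.elim_inl, Real.sqrt_one, one_mul,
          inner_gradient_eq]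
        rw [← h4]
        simp [mul_comm]
      · refine (tendsto_integral_sq_prod_mul_sub hη3m
          (fun n => (hζ n).memLp_gradient.inner_const (b' j)) hm1 (hQj j) hη3
          (hζ2.inner_basis (fun n => (hζ n).memLp_gradient)
            hφ.isH01.memLp_grad b' j)).congr fun n => ?_
        congr 1
        ext v
        have hd : DifferentiableAt ℝ (fun v : E × F => η n v.1 * ζ n v.2) (v.1, v.2) :=
          (isTest_prod_mul (hη n) (hζ n)).1.differentiable (by simp) _
        have h4 := fderiv_slice_snd hd (b' j)
        dsimp only at h4
        rw [fderiv_const_mul ((hζ n).differentiableAt v.2)] at h4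
        simp only [grushinWeight, grushinDir, Sum.elim_inr, Real.sqrt_sq (norm_nonneg _),
          inner_gradient_eq]
        rw [← h4]
        simp [mul_assoc]
    have t3 := tendsto_finsetSum Finset.univ fun k _ => t2 k
    rw [Finset.sum_const_zero] at t3
    obtain ⟨n, hn1, hn2⟩ := ((t1.eventually (gt_mem_nhds hδ)).and
      (t3.eventually (gt_mem_nhds hδ))).exists
    obtain ⟨a1, a2, a3⟩ := isTest_prod_mul (hη n) (hζ n)
    exact ⟨_, a1, a2, a3, hn1.le, hn2.le⟩

theorem ContDiffAt.differentiableAt_fderiv_apply {V : Type*} [NormedAddCommGroup V]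
    [NormedSpace ℝ V] {g : V → ℝ} {v : V} (hg : ContDiffAt ℝ ∞ g v) (e : V) :
    DifferentiableAt ℝ (fun w => fderiv ℝ g w e) v :=
  ((hg.fderiv_right (m := ∞) (by exact_mod_cast le_top)).differentiableAt (by simp)).clm_apply
    (differentiableAt_const e)

theorem fderiv_fderiv_slice_fst {g : E × F → ℝ} {U : Set (E × F)} (hU : IsOpen U)
    (hg : ContDiffOn ℝ ∞ g U) {x : E} {z : F} (h : (x, z) ∈ U) (u : E) :
    fderiv ℝ (fun x₁ => fderiv ℝ (fun x' => g (x', z)) x₁ u) x u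
      = fderiv ℝ (fun w => fderiv ℝ g w (u, 0)) (x, z) (u, 0) := by
  have hev : (fun x₁ => fderiv ℝ (fun x' => g (x', z)) x₁ u)
      =ᶠ[𝓝 x] fun x₁ => (fun w => fderiv ℝ g w (u, 0)) (x₁, z) := by
    have hc : Continuous fun x₁ : E => (x₁, z) := by fun_prop
    filter_upwards [hc.continuousAt.preimage_mem_nhds (hU.mem_nhds h)] with x₁ hx₁
    exact fderiv_slice_fst ((hg.contDiffAt (hU.mem_nhds hx₁)).differentiableAt (by simp)) u
  rw [hev.fderiv_eq, fderiv_slice_fst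
    ((hg.contDiffAt (hU.mem_nhds h)).differentiableAt_fderiv_apply _)]

theorem fderiv_fderiv_slice_snd {g : E × F → ℝ} {U : Set (E × F)} (hU : IsOpen U)
    (hg : ContDiffOn ℝ ∞ g U) {x : E} {z : F} (h : (x, z) ∈ U) (u : F) :
    fderiv ℝ (fun z₁ => fderiv ℝ (fun z' => g (x, z')) z₁ u) z u
      = fderiv ℝ (fun w => fderiv ℝ g w (0, u)) (x, z) (0, u) := by
  have hev : (fun z₁ => fderiv ℝ (fun z' => g (x, z')) z₁ u)
      =ᶠ[𝓝 z] fun z₁ => (fun w => fderiv ℝ g w (0, u)) (x, z₁) := by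
    have hc : Continuous fun z₁ : F => (x, z₁) := by fun_prop
    filter_upwards [hc.continuousAt.preimage_mem_nhds (hU.mem_nhds h)] with z₁ hz₁
    exact fderiv_slice_snd ((hg.contDiffAt (hU.mem_nhds hz₁)).differentiableAt (by simp)) u
  rw [hev.fderiv_eq, fderiv_slice_snd
    ((hg.contDiffAt (hU.mem_nhds h)).differentiableAt_fderiv_apply _)]

end ProductEigenfunction

theorem IsGrushinSolution.isDiffusionSolution {d dt : ℕ} {R T : ℝ}
    {Ωt : Set (EuclideanSpace ℝ (Fin dt))} (hΩ : IsOpen Ωt)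
    {y : ℝ → EuclideanSpace ℝ (Fin d) → EuclideanSpace ℝ (Fin dt) → ℝ}
    (hy : IsGrushinSolution d dt R T Ωt y) :
    IsDiffusionSolution
      (grushinDir (EuclideanSpace.basisFun (Fin d) ℝ) (EuclideanSpace.basisFun (Fin dt) ℝ))
      (grushinWeight _ _ (Fin d) (Fin dt)) (ball (0 : EuclideanSpace ℝ (Fin d)) R ×ˢ Ωt) T
      (fun t v => y t v.1 v.2) where
  continuousOn := hy.continuousOn
  smoothOn := hy.smoothOn
  boundary := hy.boundary
  eqn := fun t ht v hv => by
    have h := hy.eqn t ht v.1 hv.1 v.2 hv.2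
    have hU : IsOpen (ball (0 : EuclideanSpace ℝ (Fin d)) R ×ˢ Ωt) := isOpen_ball.prod hΩ
    have hg : ContDiffOn ℝ ∞ (fun v : EuclideanSpace ℝ (Fin d) × EuclideanSpace ℝ (Fin dt) =>
        y t v.1 v.2) (ball (0 : EuclideanSpace ℝ (Fin d)) R ×ˢ Ωt) :=
      hy.smoothOn.comp (contDiff_const.prodMk contDiff_id).contDiffOn fun v hv => ⟨ht, hv⟩
    have h1 : lapl (fun x' => y t x' v.2) v.1 = ∑ i, fderiv ℝ (fun w => fderiv ℝ
        (fun v : EuclideanSpace ℝ (Fin d) × EuclideanSpace ℝ (Fin dt) => y t v.1 v.2) w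
          (EuclideanSpace.single i 1, 0)) v (EuclideanSpace.single i 1, 0) :=
      Finset.sum_congr rfl fun i _ => fderiv_fderiv_slice_fst hU hg hv _
    have h2 : lapl (fun z' => y t v.1 z') v.2 = ∑ j, fderiv ℝ (fun w => fderiv ℝ
        (fun v : EuclideanSpace ℝ (Fin d) × EuclideanSpace ℝ (Fin dt) => y t v.1 v.2) w
          (0, EuclideanSpace.single j 1)) v (0, EuclideanSpace.single j 1) :=
      Finset.sum_congr rfl fun j _ => fderiv_fderiv_slice_snd hU hg hv _
    rw [diffusion, Fintype.sum_sum_type]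
    simp only [grushinWeight, grushinDir, Sum.elim_inl, Sum.elim_inr, one_mul,
      EuclideanSpace.basisFun_apply]
    rw [← Finset.mul_sum, ← h1, ← h2]
    linarith

section EigenExpansion

variable {E : Type*} [NormedAddCommGroup E] [InnerProductSpace ℝ E] [FiniteDimensional ℝ E]
  [MeasurableSpace E] [BorelSpace E]

theorem L2DerivAt.smul_const {F : Type*} [NormedAddCommGroup F] [InnerProductSpace ℝ F]
    {g : E → F} (hg : MemLp g 2 (volume : Measure E)) {κ κ' : ℝ → ℝ}
    (hκ : ∀ s, HasDerivAt κ (κ' s) s) (hκ' : Continuous κ') (t : ℝ) :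
    L2DerivAt (fun s x => κ s • g x) (fun s x => κ' s • g x) t := by
  have hκc : Continuous κ := continuous_iff_continuousAt.2 fun s => (hκ s).continuousAt
  refine ⟨fun x => (|κ t| + |κ' t| + 1) * ‖g x‖, hg.norm.const_mul _, ?_⟩
  filter_upwards [hκc.abs.continuousAt.eventually_lt continuousAt_const (lt_add_one |κ t|),
    hκ'.abs.continuousAt.eventually_lt continuousAt_const (lt_add_one |κ' t|)] with s h1 h2
  refine ⟨hg.1.const_smul _, hg.1.const_smul _, fun x => ⟨(hκ s).smul_const (g x), ?_, ?_⟩⟩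
  · rw [norm_smul, norm_eq_abs]
    exact mul_le_mul_of_nonneg_right (by linarith [abs_nonneg (κ' t)]) (norm_nonneg _)
  · rw [norm_smul, norm_eq_abs]
    exact mul_le_mul_of_nonneg_right (by linarith [abs_nonneg (κ t)]) (norm_nonneg _)

namespace IsEigenbasis

variable {O : Set E} {ϖ : E → ℝ} {ι : Type*} {ψ : ι → E → ℝ} {G : ι → E → E} {lam : ι → ℝ}

theorem memLp (h : IsEigenbasis O ϖ ψ G lam) (i : ι) : MemLp (ψ i) 2 (volume : Measure E) :=
  (h.hasLap i).isH01.memLp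

theorem eigenvalue_nonneg (h : IsEigenbasis O ϖ ψ G lam) (hO : Bornology.IsBounded O)
    (hϖ : Continuous ϖ) (i : ι) : 0 ≤ lam i := by
  have h1 := h.integral_energy i
  have i1 : Integrable (fun x => ϖ x ^ 2 * ψ i x * ψ i x) :=
    ((h.memLp i).continuous_smul hO (h.hasLap i).isH01.zero (hϖ.pow 2)).mul_integrable (h.memLp i)
  have i2 : Integrable (fun x => lam i * (ψ i x * ψ i x)) :=
    ((h.memLp i).mul_integrable (h.memLp i)).const_mul _
  have h2 : ∫ x, (ϖ x ^ 2 - lam i) * ψ i x * ψ i x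
      = (∫ x, ϖ x ^ 2 * ψ i x * ψ i x) - lam i := by
    have h5 := integral_const_mul (μ := (volume : Measure E)) (lam i) fun x => ψ i x * ψ i x
    rw [h.norm_one i, mul_one] at h5
    refine Eq.trans ?_ (congrArg (fun r => (∫ x, ϖ x ^ 2 * ψ i x * ψ i x) - r) h5)
    rw [← integral_sub i1 i2]
    congr 1
    ext x
    ring
  have h3 : 0 ≤ ∫ x, ‖G i x‖ ^ 2 := integral_nonneg fun x => sq_nonneg _
  have h4 : 0 ≤ ∫ x, ϖ x ^ 2 * ψ i x * ψ i x := integral_nonneg fun x => by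
    rw [mul_assoc]
    exact mul_nonneg (sq_nonneg _) (mul_self_nonneg _)
  linarith

theorem memLp_sum (h : IsEigenbasis O ϖ ψ G lam) (s : Finset ι) (c : ι → ℝ) :
    MemLp (fun x => ∑ i ∈ s, c i * ψ i x) 2 (volume : Measure E) :=
  memLp_finsetSum s fun i _ => (h.memLp i).const_mul (c i)

theorem integral_mul_sum (h : IsEigenbasis O ϖ ψ G lam) (s : Finset ι) (c : ι → ℝ) {f : E → ℝ}
    (hf : MemLp f 2 (volume : Measure E)) :
    ∫ x, f x * ∑ i ∈ s, c i * ψ i x = ∑ i ∈ s, c i * ∫ x, f x * ψ i x := by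
  have h1 : ∀ i ∈ s, Integrable (fun x => c i * (f x * ψ i x)) := fun i _ =>
    (hf.mul_integrable (h.memLp i)).const_mul (c i)
  simp only [← integral_const_mul]
  rw [← integral_finsetSum s h1]
  congr 1
  ext x
  rw [Finset.mul_sum]
  exact Finset.sum_congr rfl fun i _ => by ring

theorem integral_sum_sq (h : IsEigenbasis O ϖ ψ G lam) (s : Finset ι) (c : ι → ℝ) :
    ∫ x, (∑ i ∈ s, c i * ψ i x) ^ 2 = ∑ i ∈ s, c i ^ 2 := by
  classical
  simp only [sq]
  rw [h.integral_mul_sum s c (h.memLp_sum s c)]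
  refine Finset.sum_congr rfl fun j hj => ?_
  simp only [mul_comm _ (ψ j _)]
  rw [h.integral_mul_sum s c (h.memLp j), Finset.sum_eq_single_of_mem j hj fun i _ hij => by
    rw [h.orthogonal j i (Ne.symm hij), mul_zero], h.norm_one, mul_one]

theorem integral_sub_sum_sq (h : IsEigenbasis O ϖ ψ G lam) (s : Finset ι) {f : E → ℝ}
    (hf : MemLp f 2 (volume : Measure E)) :
    ∫ x, (f x - ∑ i ∈ s, (∫ y, f y * ψ i y) * ψ i x) ^ 2
      = (∫ x, f x ^ 2) - ∑ i ∈ s, (∫ y, f y * ψ i y) ^ 2 := by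
  have hs := h.memLp_sum s fun i => ∫ y, f y * ψ i y
  have h1 := h.integral_sum_sq s fun i => ∫ y, f y * ψ i y
  have h2 := h.integral_mul_sum s (fun i => ∫ y, f y * ψ i y) hf
  simp only [← sq] at h2
  have i1 : Integrable (fun x => f x ^ 2 - 2 * (f x * ∑ i ∈ s, (∫ y, f y * ψ i y) * ψ i x)) :=
    hf.integrable_sq.sub ((hf.mul_integrable hs).const_mul 2)
  calc _ = ∫ x, ((f x ^ 2 - 2 * (f x * ∑ i ∈ s, (∫ y, f y * ψ i y) * ψ i x))
        + (∑ i ∈ s, (∫ y, f y * ψ i y) * ψ i x) ^ 2) := by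
        congr 1
        ext x
        ring
    _ = _ := by
        rw [integral_add i1 hs.integrable_sq, integral_sub hf.integrable_sq
          ((hf.mul_integrable hs).const_mul 2), integral_const_mul, h1, h2]
        ring

theorem isFlow_sum {μ : ℝ} (h : IsEigenbasis O (fun x => μ * ‖x‖) ψ G lam) (s : Finset ι)
    (c : ι → ℝ) :
    IsFlow O μ (fun t x => ∑ i ∈ s, (exp (-(lam i * t)) * c i) * ψ i x)
      (fun t x => ∑ i ∈ s, (-lam i * (exp (-(lam i * t)) * c i)) * ψ i x)
      (fun t x => ∑ i ∈ s, (exp (-(lam i * t)) * c i) • G i x)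
      (fun t x => ∑ i ∈ s, (-lam i * (exp (-(lam i * t)) * c i)) • G i x) := by
  have hd : ∀ i t, HasDerivAt (fun t => exp (-(lam i * t)) * c i)
      (-lam i * (exp (-(lam i * t)) * c i)) t := fun i t =>
    ((((hasDerivAt_id t).const_mul (lam i)).neg.exp).mul_const (c i)).congr_deriv (by
      simp only [id, Pi.neg_apply]
      ring)
  have hc : ∀ i, Continuous fun t => -lam i * (exp (-(lam i * t)) * c i) := fun i => by
    fun_prop
  refine ⟨fun t => ?_, fun t => IsH01.sum s fun i _ => (h.hasLap i).isH01.const_mul _,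
    fun t => L2DerivAt.sum s fun i _ => L2DerivAt.smul_const (h.memLp i) (hd i) (hc i) t,
    fun t => L2DerivAt.sum s fun i _ =>
      L2DerivAt.smul_const (h.hasLap i).isH01.memLp_grad (hd i) (hc i) t⟩
  have h1 := HasLap.sum s fun i _ => (h.hasLap i).const_mul (exp (-(lam i * t)) * c i)
  refine cast (congrArg _ (funext fun x => ?_)) h1
  rw [Finset.mul_sum, ← Finset.sum_add_distrib]
  refine Finset.sum_congr rfl fun i _ => ?_
  ring

/-- An observability inequality for all finite sums of modes extends to solutions whose modes
decay exponentially. -/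
theorem integral_sq_le_of_flow {μ : ℝ} (h : IsEigenbasis O (fun x => μ * ‖x‖) ψ G lam)
    (hlam : ∀ i, 0 ≤ lam i) {S : Set E} (hS : MeasurableSet S) {T K : ℝ} (hT : 0 ≤ T) (hK : 0 ≤ K)
    (hobs : ∀ u u' G G', IsFlow O μ u u' G G' →
      (∫ x, u T x ^ 2) ≤ K * ∫ t in (0 : ℝ)..T, ∫ x in S, u t x ^ 2)
    {a : ℝ → E → ℝ} (ha : ∀ t ∈ Icc 0 T, MemLp (a t) 2 (volume : Measure E))
    (ha0 : ∀ t ∈ Icc 0 T, ∀ x ∉ O, a t x = 0)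
    (hcoef : ∀ t ∈ Icc 0 T, ∀ i,
      ∫ x, a t x * ψ i x = exp (-(lam i * t)) * ∫ x, a 0 x * ψ i x)
    (hint : IntervalIntegrable (fun t => ∫ x in S, a t x ^ 2) volume 0 T) :
    (∫ x, a T x ^ 2) ≤ K * ∫ t in (0 : ℝ)..T, ∫ x in S, a t x ^ 2 := by
  have h0 : (0 : ℝ) ∈ Icc 0 T := ⟨le_rfl, hT⟩
  have hTT : T ∈ Icc 0 T := ⟨hT, le_rfl⟩
  set u : Finset ι → ℝ → E → ℝ := fun s t x =>
    ∑ i ∈ s, (exp (-(lam i * t)) * ∫ y, a 0 y * ψ i y) * ψ i x with hu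
  have hfl := fun s => h.isFlow_sum s fun i => ∫ y, a 0 y * ψ i y
  have hu' : ∀ s, ∀ t ∈ Icc 0 T, ∀ x, u s t x = ∑ i ∈ s, (∫ y, a t y * ψ i y) * ψ i x :=
    fun s t ht x => Finset.sum_congr rfl fun i _ => by rw [hcoef t ht i]
  have hp := fun t ht => h.parseval (a t) (ha t ht) (ha0 t ht)
  have hrem : ∀ s, ∀ t ∈ Icc 0 T, ∫ x, (a t x - u s t x) ^ 2
      ≤ (∫ x, a 0 x ^ 2) - ∑ i ∈ s, (∫ y, a 0 y * ψ i y) ^ 2 := fun s t ht => by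
    simp only [hu' s t ht]
    rw [h.integral_sub_sum_sq s (ha t ht)]
    have h1 := sum_le_hasSum s (fun i _ => ?_) ((hp 0 h0).sub (hp t ht))
    · rw [Finset.sum_sub_distrib] at h1
      linarith
    · rw [hcoef t ht i, mul_pow, sub_nonneg]
      refine mul_le_of_le_one_left (sq_nonneg _) (pow_le_one₀ (exp_pos _).le ?_)
      rw [exp_le_one_iff, neg_nonpos]
      exact mul_nonneg (hlam i) ht.1
  have hlim : ∀ t ∈ Icc 0 T, Tendsto (fun s : Finset ι => (∫ x, a t x ^ 2)
      - ∑ i ∈ s, (∫ y, a t y * ψ i y) ^ 2) atTop (𝓝 0) := fun t ht => by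
    have h1 : Tendsto (fun s : Finset ι => ∑ i ∈ s, (∫ y, a t y * ψ i y) ^ 2) atTop
      (𝓝 (∫ x, a t x ^ 2)) := hp t ht
    have h2 := (tendsto_const_nhds (x := ∫ x, a t x ^ 2)).sub h1
    rwa [sub_self] at h2
  have hmain : ∀ κ > 0, (∫ x, a T x ^ 2)
      ≤ K * ((1 + κ) * ∫ t in (0 : ℝ)..T, ∫ x in S, a t x ^ 2) := fun κ hκ => by
    have hl := (tendsto_const_nhds (x := ∫ x, a T x ^ 2)).sub (hlim T hTT)
    have hr := (((hlim 0 h0).const_mul ((1 + 1 / κ) * T)).const_add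
      ((1 + κ) * ∫ t in (0 : ℝ)..T, ∫ x in S, a t x ^ 2)).const_mul K
    rw [mul_zero, add_zero] at hr
    rw [sub_zero] at hl
    refine le_of_tendsto_of_tendsto' hl hr fun s => ?_
    have h1 := hobs _ _ _ _ (hfl s)
    change (∫ x, u s T x ^ 2) ≤ K * ∫ t in (0 : ℝ)..T, ∫ x in S, u s t x ^ 2 at h1
    have h2 : ∫ x, u s T x ^ 2 = ∑ i ∈ s, (∫ y, a T y * ψ i y) ^ 2 := by
      simp only [hu' s T hTT]
      exact h.integral_sum_sq s _
    rw [sub_sub_cancel, ← h2]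
    refine h1.trans (mul_le_mul_of_nonneg_left ?_ hK)
    set r := (∫ x, a 0 x ^ 2) - ∑ i ∈ s, (∫ y, a 0 y * ψ i y) ^ 2
    have h3 : ∀ t ∈ Icc 0 T, ∫ x in S, u s t x ^ 2
        ≤ (1 + κ) * (∫ x in S, a t x ^ 2) + (1 + 1 / κ) * r := fun t ht => by
      have m1 := ha t ht
      have m2 : MemLp (u s t) 2 (volume : Measure E) := (hfl s).memLp t
      have m3 : Integrable (fun x => (a t x - u s t x) ^ 2) := (m1.sub m2).integrable_sq
      have h4 : ∫ x in S, (a t x - u s t x) ^ 2 ≤ r :=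
        (setIntegral_le_integral m3 (Eventually.of_forall fun x => sq_nonneg _)).trans
          (hrem s t ht)
      have h5 : ∫ x in S, u s t x ^ 2 ≤ (1 + κ) * (∫ x in S, a t x ^ 2)
          + (1 + 1 / κ) * ∫ x in S, (a t x - u s t x) ^ 2 := by
        rw [← integral_const_mul, ← integral_const_mul, ← integral_add
          (m1.integrable_sq.const_mul _).integrableOn (m3.const_mul _).integrableOn]
        refine integral_mono m2.integrable_sq.integrableOn
          ((m1.integrable_sq.const_mul _).add (m3.const_mul _)).integrableOn fun x => ?_
        have h6 : (1 + κ) * a t x ^ 2 + (1 + 1 / κ) * (a t x - u s t x) ^ 2 - u s t x ^ 2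
            = (κ * a t x + (a t x - u s t x)) ^ 2 / κ := by
          field_simp
          ring
        have h7 : 0 ≤ (κ * a t x + (a t x - u s t x)) ^ 2 / κ := by positivity
        simp only
        linarith
      refine h5.trans (add_le_add_right (mul_le_mul_of_nonneg_left h4 (by positivity)) _)
    calc ∫ t in (0 : ℝ)..T, ∫ x in S, u s t x ^ 2
        ≤ ∫ t in (0 : ℝ)..T, ((1 + κ) * (∫ x in S, a t x ^ 2) + (1 + 1 / κ) * r) :=
          intervalIntegral.integral_mono_on hT
            (((hfl s).continuous_setIntegral_sq hS).intervalIntegrable _ _)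
            ((hint.const_mul _).add intervalIntegrable_const) h3
      _ = _ := by
          rw [intervalIntegral.integral_add (hint.const_mul _) intervalIntegrable_const,
            intervalIntegral.integral_const_mul, intervalIntegral.integral_const, smul_eq_mul]
          ring
  have hlim2 : Tendsto (fun κ : ℝ => K * ((1 + κ) * ∫ t in (0 : ℝ)..T, ∫ x in S, a t x ^ 2))
      (𝓝[>] 0) (𝓝 (K * ((1 + 0) * ∫ t in (0 : ℝ)..T, ∫ x in S, a t x ^ 2))) :=
    ((by fun_prop : Continuous fun κ : ℝ => K * ((1 + κ) * ∫ t in (0 : ℝ)..T,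
      ∫ x in S, a t x ^ 2)).tendsto 0).mono_left nhdsWithin_le_nhds
  rw [add_zero, one_mul] at hlim2
  exact ge_of_tendsto hlim2 (eventually_mem_nhdsWithin.mono fun κ hκ => hmain κ hκ)

end IsEigenbasis

end EigenExpansion

section ModeSummation

theorem memLp_two_of_abs_le {E : Type*} [NormedAddCommGroup E] [InnerProductSpace ℝ E]
    [FiniteDimensional ℝ E] [MeasurableSpace E] [BorelSpace E] {A : Set E} (hA : IsOpen A)
    (hAb : Bornology.IsBounded A) {f : E → ℝ} (hf : AEStronglyMeasurable f (volume : Measure E))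
    {C : ℝ} (hC : ∀ x, |f x| ≤ C) (h0 : ∀ x ∉ A, f x = 0) : MemLp f 2 (volume : Measure E) := by
  refine (memLp_indicator_const 2 hA.measurableSet C (Or.inr hAb.measure_lt_top.ne)).mono hf
    (Eventually.of_forall fun x => ?_)
  by_cases hx : x ∈ A
  · rw [indicator_of_mem hx]
    exact (hC x).trans (le_abs_self C)
  · simp [h0 x hx, hx]

variable {E F : Type*} [NormedAddCommGroup E] [InnerProductSpace ℝ E] [FiniteDimensional ℝ E]
  [MeasurableSpace E] [BorelSpace E]
  [NormedAddCommGroup F] [InnerProductSpace ℝ F] [FiniteDimensional ℝ F]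
  [MeasurableSpace F] [BorelSpace F]

/-- An observability inequality uniform in the frequency gives observability of functions of
`(t, x, z)` whose modes on the product domain decay exponentially. -/
theorem integral_sq_le_of_uniform_observability {A S : Set E} (hA : IsOpen A)
    (hAb : Bornology.IsBounded A) (hS : MeasurableSet S) (hSA : S ⊆ A) {B : Set F} (hB : IsOpen B)
    (hBb : Bornology.IsBounded B) {T K : ℝ} (hT : 0 ≤ T) (hK : 0 ≤ K)
    (hobs : ∀ μ : ℝ, 0 ≤ μ → ∀ u u' G G', IsFlow A μ u u' G G' →
      (∫ x, u T x ^ 2) ≤ K * ∫ t in (0 : ℝ)..T, ∫ x in S, u t x ^ 2)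
    {Z : ℝ → E → F → ℝ} (hZ : Measurable fun p : (ℝ × E) × F => Z p.1.1 p.1.2 p.2) {M : ℝ}
    (hM : ∀ t x z, |Z t x z| ≤ M) (hZA : ∀ t, ∀ x ∉ A, ∀ z, Z t x z = 0)
    (hZB : ∀ t x, ∀ z ∉ B, Z t x z = 0)
    (hcoef : ∀ (μ lam : ℝ) (ψ : E → ℝ) (P : E → E) (φ : F → ℝ) (Q : F → F),
      HasLap A ψ P (fun x => ((μ * ‖x‖) ^ 2 - lam) * ψ x) →
      HasLap B φ Q (fun z => (0 ^ 2 - μ ^ 2) * φ z) → ∀ t ∈ Icc 0 T,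
      ∫ x, (∫ z, Z t x z * φ z) * ψ x
        = exp (-(lam * t)) * ∫ x, (∫ z, Z 0 x z * φ z) * ψ x) :
    (∫ x in A, ∫ z, Z T x z ^ 2)
      ≤ K * ∫ t in Ioc 0 T, ∫ x in S, ∫ z, Z t x z ^ 2 := by
  obtain ⟨ι, _, φ, Q, κ, hφ⟩ := exists_isEigenbasis hB hBb (continuous_const (y := (0 : ℝ)))
  have hκ := hφ.eigenvalue_nonneg hBb continuous_const
  have hZt : ∀ t, Measurable fun p : E × F => Z t p.1 p.2 := fun t =>
    hZ.comp (by fun_prop : Measurable fun p : E × F => ((t, p.1), p.2))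
  have hZtx : ∀ t x, MemLp (Z t x) 2 (volume : Measure F) := fun t x =>
    memLp_two_of_abs_le hB hBb ((hZt t).comp (measurable_prodMk_left (x := x))).aestronglyMeasurable
      (hM t x) (hZB t x)
  set a : ι → ℝ → E → ℝ := fun n t x => ∫ z, Z t x z * φ n z with ha
  set W : ℝ → E → ℝ := fun t x => ∫ z, Z t x z ^ 2 with hW
  have hsum : ∀ t x, HasSum (fun n => a n t x ^ 2) (W t x) := fun t x =>
    hφ.parseval _ (hZtx t x) (hZB t x)
  have hle : ∀ n t x, a n t x ^ 2 ≤ W t x := fun n t x =>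
    le_hasSum (hsum t x) n fun m _ => sq_nonneg _
  have hWle : ∀ t x, W t x ≤ M ^ 2 * (volume : Measure F).real B := fun t x => by
    have h1 : ∫ z in B, Z t x z ^ 2 = W t x :=
      setIntegral_eq_integral_of_forall_compl_eq_zero fun z hz => by simp [hZB t x z hz]
    rw [← h1]
    refine (Real.le_norm_self _).trans (norm_setIntegral_le_of_norm_le_const hBb.measure_lt_top
      fun z _ => ?_)
    rw [norm_eq_abs, abs_of_nonneg (sq_nonneg _), ← sq_abs]
    exact pow_le_pow_left₀ (abs_nonneg _) (hM t x z) 2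
  have hW0 : ∀ t x, 0 ≤ W t x := fun t x => integral_nonneg fun z => sq_nonneg _
  have hWm : StronglyMeasurable fun p : ℝ × E => W p.1 p.2 :=
    (hZ.pow_const 2).stronglyMeasurable.integral_prod_right'
  have hm1 : ∀ (m : Measure (ℝ × E)) [SFinite m] (n : ι),
      AEStronglyMeasurable (fun p : ℝ × E => a n p.1 p.2) m := fun m _ n =>
    (hZ.aestronglyMeasurable.mul (hφ.memLp n).1.comp_snd :
      AEStronglyMeasurable (fun p : (ℝ × E) × F => Z p.1.1 p.1.2 p.2 * φ n p.2)
        (m.prod volume)).integral_prod_right'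
  have hm2 : ∀ (n : ι) (t : ℝ), AEStronglyMeasurable (a n t) (volume : Measure E) := fun n t =>
    ((hZt t).aestronglyMeasurable.mul (hφ.memLp n).1.comp_snd :
      AEStronglyMeasurable (fun p : E × F => Z t p.1 p.2 * φ n p.2)
        ((volume : Measure E).prod volume)).integral_prod_right'
  have ha0 : ∀ n t, ∀ x ∉ A, a n t x = 0 := fun n t x hx => by simp [ha, hZA t x hx]
  have hmem : ∀ n t, MemLp (a n t) 2 (volume : Measure E) := fun n t =>
    memLp_two_of_abs_le hA hAb (hm2 n t)
      (fun x => Real.abs_le_sqrt ((hle n t x).trans (hWle t x))) (ha0 n t)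
  have hfA : IsFiniteMeasure ((volume : Measure E).restrict A) :=
    isFiniteMeasure_restrict.2 hAb.measure_lt_top.ne
  have hfS : IsFiniteMeasure ((volume : Measure E).restrict S) :=
    isFiniteMeasure_restrict.2 (hAb.subset hSA).measure_lt_top.ne
  have hWi : ∀ (m : Measure (ℝ × E)) [IsFiniteMeasure m],
      Integrable (fun p : ℝ × E => W p.1 p.2) m := fun m _ =>
    Integrable.of_bound hWm.aestronglyMeasurable (M ^ 2 * (volume : Measure F).real B)
      (Eventually.of_forall fun p => by
        rw [norm_eq_abs, abs_of_nonneg (hW0 _ _)]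
        exact hWle _ _)
  have hai : ∀ (m : Measure (ℝ × E)) [IsFiniteMeasure m] (n : ι),
      Integrable (fun p : ℝ × E => a n p.1 p.2 ^ 2) m := fun m _ n =>
    (hWi m).mono' ((hm1 m n).pow 2) (Eventually.of_forall fun p => by
      rw [norm_eq_abs, abs_of_nonneg (sq_nonneg _)]
      exact hle _ _ _)
  have hWTi : Integrable (W T) ((volume : Measure E).restrict A) :=
    Integrable.of_bound (hWm.comp_measurable (measurable_prodMk_left (x := T))).aestronglyMeasurable
      (M ^ 2 * (volume : Measure F).real B) (Eventually.of_forall fun x => by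
        rw [norm_eq_abs, abs_of_nonneg (hW0 _ _)]
        exact hWle _ _)
  have hs1 : HasSum (fun n => ∫ x in A, a n T x ^ 2) (∫ x in A, W T x) :=
    hasSum_integral_of_dominated_convergence (fun n x => a n T x ^ 2)
      (fun n => (hmem n T).1.restrict.pow 2)
      (fun n => Eventually.of_forall fun x => by
        rw [norm_eq_abs, abs_of_nonneg (sq_nonneg _)])
      (Eventually.of_forall fun x => (hsum T x).summable)
      (hWTi.congr (Eventually.of_forall fun x => (hsum T x).tsum_eq.symm))
      (Eventually.of_forall fun x => hsum T x)
  set m := ((volume : Measure ℝ).restrict (Ioc 0 T)).prod ((volume : Measure E).restrict S)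
    with hm
  have hs2 : HasSum (fun n => ∫ p, a n p.1 p.2 ^ 2 ∂m) (∫ p, W p.1 p.2 ∂m) :=
    hasSum_integral_of_dominated_convergence (fun n p => a n p.1 p.2 ^ 2)
      (fun n => (hm1 m n).pow 2)
      (fun n => Eventually.of_forall fun x => by
        rw [norm_eq_abs, abs_of_nonneg (sq_nonneg _)])
      (Eventually.of_forall fun p => (hsum p.1 p.2).summable)
      ((hWi m).congr (Eventually.of_forall fun p => (hsum p.1 p.2).tsum_eq.symm))
      (Eventually.of_forall fun p => hsum p.1 p.2)
  have hR : ∫ p, W p.1 p.2 ∂m = ∫ t in Ioc 0 T, ∫ x in S, W t x := integral_prod _ (hWi m)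
  change (∫ x in A, W T x) ≤ K * ∫ t in Ioc 0 T, ∫ x in S, W t x
  rw [← hR]
  refine hasSum_le (fun n => ?_) hs1 (hs2.mul_left K)
  obtain ⟨μ, hμ, hμκ⟩ : ∃ μ : ℝ, 0 ≤ μ ∧ μ ^ 2 = κ n :=
    ⟨√(κ n), Real.sqrt_nonneg _, Real.sq_sqrt (hκ n)⟩
  obtain ⟨ι', _, ψ, P, lam, hψ⟩ := exists_isEigenbasis hA hAb
    (continuous_const.mul continuous_norm : Continuous fun x : E => μ * ‖x‖)
  have hφn := hφ.hasLap n
  rw [← hμκ] at hφn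
  have h1 := hψ.integral_sq_le_of_flow
    (hψ.eigenvalue_nonneg hAb (continuous_const.mul continuous_norm)) hS hT hK (hobs μ hμ)
    (a := a n) (fun t _ => hmem n t) (fun t _ => ha0 n t)
    (fun t ht i => hcoef μ (lam i) (ψ i) (P i) (φ n) (Q n) (hψ.hasLap i) hφn t ht)
    ((intervalIntegrable_iff_integrableOn_Ioc_of_le hT).2 (hai m n).integral_prod_left)
  rw [intervalIntegral.integral_of_le hT] at h1
  rw [setIntegral_eq_integral_of_forall_compl_eq_zero fun x hx => by simp [ha0 n T x hx],
    integral_prod _ (hai m n)]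
  exact h1

end ModeSummation

section GrushinObservability

variable {d dt : ℕ} {R T : ℝ} {Ωt : Set (EuclideanSpace ℝ (Fin dt))}
  {y : ℝ → EuclideanSpace ℝ (Fin d) → EuclideanSpace ℝ (Fin dt) → ℝ}

variable (T R Ωt y) in
/-- The extension of `y` by zero outside of `[0, T] × B_R × Ωt`. -/
noncomputable def zeroExtension (t : ℝ) (x : EuclideanSpace ℝ (Fin d))
    (z : EuclideanSpace ℝ (Fin dt)) : ℝ :=
  (Icc 0 T ×ˢ (ball (0 : EuclideanSpace ℝ (Fin d)) R ×ˢ Ωt)).indicator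
    (fun p => y p.1 p.2.1 p.2.2) (t, (x, z))

theorem zeroExtension_eq {t : ℝ} (ht : t ∈ Icc 0 T) {x : EuclideanSpace ℝ (Fin d)}
    (hx : x ∈ ball (0 : EuclideanSpace ℝ (Fin d)) R) (z : EuclideanSpace ℝ (Fin dt)) :
    zeroExtension R T Ωt y t x z = Ωt.indicator (y t x) z := by
  by_cases hz : z ∈ Ωt
  · rw [indicator_of_mem hz]
    exact indicator_of_mem (show (t, (x, z)) ∈
      Icc 0 T ×ˢ (ball (0 : EuclideanSpace ℝ (Fin d)) R ×ˢ Ωt) from ⟨ht, hx, hz⟩) _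
  · rw [indicator_of_notMem hz, zeroExtension, indicator_of_notMem fun h => hz h.2.2]

theorem zeroExtension_eq_zero {t : ℝ} {x : EuclideanSpace ℝ (Fin d)}
    {z : EuclideanSpace ℝ (Fin dt)} (h : (x, z) ∉ ball (0 : EuclideanSpace ℝ (Fin d)) R ×ˢ Ωt) :
    zeroExtension R T Ωt y t x z = 0 :=
  indicator_of_notMem (fun h' => h h'.2) _

theorem integral_zeroExtension_sq (hΩ : IsOpen Ωt) {t : ℝ} (ht : t ∈ Icc 0 T)
    {x : EuclideanSpace ℝ (Fin d)} (hx : x ∈ ball (0 : EuclideanSpace ℝ (Fin d)) R) :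
    ∫ z, zeroExtension R T Ωt y t x z ^ 2 = ∫ z in Ωt, y t x z ^ 2 := by
  rw [← integral_indicator hΩ.measurableSet]
  congr 1
  ext z
  rw [zeroExtension_eq ht hx]
  by_cases hz : z ∈ Ωt <;> simp [hz]

namespace IsGrushinSolution

theorem measurable_zeroExtension (hy : IsGrushinSolution d dt R T Ωt y) (hΩ : IsOpen Ωt) :
    Measurable fun p : ℝ × (EuclideanSpace ℝ (Fin d) × EuclideanSpace ℝ (Fin dt)) =>
      zeroExtension R T Ωt y p.1 p.2.1 p.2.2 := by
  classical
  have h1 : ContinuousOn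
      (fun p : ℝ × (EuclideanSpace ℝ (Fin d) × EuclideanSpace ℝ (Fin dt)) => y p.1 p.2.1 p.2.2)
      (Icc 0 T ×ˢ (ball (0 : EuclideanSpace ℝ (Fin d)) R ×ˢ Ωt)) :=
    hy.continuousOn.mono (prod_mono Subset.rfl subset_closure)
  have h2 := h1.measurable_piecewise (g := 0) continuousOn_const
    (measurableSet_Icc.prod (measurableSet_ball.prod hΩ.measurableSet))
  rwa [piecewise_eq_indicator] at h2

theorem exists_bound_zeroExtension (hy : IsGrushinSolution d dt R T Ωt y) (hΩ : IsOpen Ωt)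
    (hΩb : Bornology.IsBounded Ωt) : ∃ M, ∀ t x z, |zeroExtension R T Ωt y t x z| ≤ M := by
  obtain ⟨M, hM0, hM⟩ := (hy.isDiffusionSolution hΩ).exists_bound (isBounded_ball.prod hΩb)
  refine ⟨M, fun t x z => ?_⟩
  by_cases h : (t, (x, z)) ∈ Icc 0 T ×ˢ (ball (0 : EuclideanSpace ℝ (Fin d)) R ×ˢ Ωt)
  · rw [zeroExtension, indicator_of_mem h]
    exact hM t h.1 (x, z) h.2
  · rw [zeroExtension, indicator_of_notMem h, abs_zero]
    exact hM0

theorem integral_mode_eq (hy : IsGrushinSolution d dt R T Ωt y) (hT : 0 < T) (hΩ : IsOpen Ωt)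
    (hΩb : Bornology.IsBounded Ωt) {μ lam : ℝ} {ψ : EuclideanSpace ℝ (Fin d) → ℝ}
    {P : EuclideanSpace ℝ (Fin d) → EuclideanSpace ℝ (Fin d)} {φ : EuclideanSpace ℝ (Fin dt) → ℝ}
    {Q : EuclideanSpace ℝ (Fin dt) → EuclideanSpace ℝ (Fin dt)}
    (hψ : HasLap (ball 0 R) ψ P (fun x => ((μ * ‖x‖) ^ 2 - lam) * ψ x))
    (hφ : HasLap Ωt φ Q (fun z => (0 ^ 2 - μ ^ 2) * φ z)) {t : ℝ} (ht : t ∈ Icc 0 T) :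
    ∫ x, (∫ z, zeroExtension R T Ωt y t x z * φ z) * ψ x
      = exp (-(lam * t)) * ∫ x, (∫ z, zeroExtension R T Ωt y 0 x z * φ z) * ψ x := by
  have hU : IsOpen (ball (0 : EuclideanSpace ℝ (Fin d)) R ×ˢ Ωt) := isOpen_ball.prod hΩ
  have hUb : Bornology.IsBounded (ball (0 : EuclideanSpace ℝ (Fin d)) R ×ˢ Ωt) :=
    isBounded_ball.prod hΩb
  have hΘ := hψ.isWeakEigenfunction isBounded_ball hφ (EuclideanSpace.basisFun (Fin d) ℝ)
    (EuclideanSpace.basisFun (Fin dt) ℝ)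
  have hy' := hy.isDiffusionSolution hΩ
  have key : ∀ s ∈ Icc 0 T, ∫ x, (∫ z, zeroExtension R T Ωt y s x z * φ z) * ψ x
      = ∫ v : EuclideanSpace ℝ (Fin d) × EuclideanSpace ℝ (Fin dt),
        ψ v.1 * φ v.2 * y s v.1 v.2 ∂(volume.prod volume) := fun s hs => by
    have hm : MemLp ((ball (0 : EuclideanSpace ℝ (Fin d)) R ×ˢ Ωt).indicator
        fun v => y s v.1 v.2) 2 (volume.prod volume) := hy'.memLp_indicator hU hUb hs
    have he : (fun v : EuclideanSpace ℝ (Fin d) × EuclideanSpace ℝ (Fin dt) =>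
        ψ v.1 * φ v.2 * y s v.1 v.2) = fun v => ψ v.1 * φ v.2 *
        (ball (0 : EuclideanSpace ℝ (Fin d)) R ×ˢ Ωt).indicator (fun v => y s v.1 v.2) v := by
      ext v
      by_cases hv : v ∈ ball (0 : EuclideanSpace ℝ (Fin d)) R ×ˢ Ωt
      · rw [indicator_of_mem hv]
      · rw [hΘ.zero v hv, zero_mul, zero_mul]
    rw [he, integral_prod _ (hΘ.memLp.mul_integrable hm)]
    congr 1
    ext x
    rw [← integral_mul_const]
    congr 1
    ext z
    have h1 : zeroExtension R T Ωt y s x z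
        = (ball (0 : EuclideanSpace ℝ (Fin d)) R ×ˢ Ωt).indicator (fun v => y s v.1 v.2) (x, z) := by
      by_cases hv : (x, z) ∈ ball (0 : EuclideanSpace ℝ (Fin d)) R ×ˢ Ωt
      · rw [indicator_of_mem hv]
        exact indicator_of_mem (show (s, (x, z)) ∈
          Icc 0 T ×ˢ (ball (0 : EuclideanSpace ℝ (Fin d)) R ×ˢ Ωt) from ⟨hs, hv⟩) _
      · rw [indicator_of_notMem hv, zeroExtension_eq_zero hv]
    rw [h1]
    ring
  rw [key t ht, key 0 ⟨le_rfl, hT.le⟩]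
  exact hy'.integral_mul_eigenfunction_eq (isDiffusion_grushin _ _) hT hU hUb hΘ ht

end IsGrushinSolution

end GrushinObservability

end

/-- Observability of the Baouendi–Grushin equation from the full
annulus `ω = {R₁ < ‖x‖ < R₂}` times `Ω̃`, for `T > T* = R₁²/(2d)`, with the improved cost
`e^{c_β/(T−T*)^β}`. -/
theorem statement15
    (d dt : ℕ) (hd : 2 ≤ d) (hdt : 1 ≤ dt) (R R₁ R₂ : ℝ)
    (hR₁ : 0 < R₁) (hR₁₂ : R₁ < R₂) (hR₂ : R₂ < R)
    (Ωt : Set (EuclideanSpace ℝ (Fin dt))) (hΩo : IsOpen Ωt)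
    (hΩb : Bornology.IsBounded Ωt) (hΩne : Ωt.Nonempty)
    (β : ℝ) (hβ : 1 < β) :
    ∃ cβ : ℝ, 0 < cβ ∧
      ∀ T : ℝ, R₁ ^ 2 / (2 * d) < T →
      ∀ y : ℝ → EuclideanSpace ℝ (Fin d) → EuclideanSpace ℝ (Fin dt) → ℝ,
        IsGrushinSolution d dt R T Ωt y →
        (∫ x in ball (0 : EuclideanSpace ℝ (Fin d)) R, ∫ z in Ωt, (y T x z) ^ 2) ≤
          Real.exp (cβ / (T - R₁ ^ 2 / (2 * d)) ^ β) *
            ∫ t in Ioc (0:ℝ) T,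
              ∫ x in {x : EuclideanSpace ℝ (Fin d) | R₁ < ‖x‖ ∧ ‖x‖ < R₂},
                ∫ z in Ωt, (y t x z) ^ 2 := by
  have hfin : Module.finrank ℝ (EuclideanSpace ℝ (Fin d)) = d := finrank_euclideanSpace_fin
  have hd0 : 0 < d := by omega
  obtain ⟨C, hC, hobs⟩ := exists_uniform_observability (E := EuclideanSpace ℝ (Fin d))
    (by rw [hfin]; exact hd0) hR₁ hR₁₂ hR₂ hβ
  rw [hfin] at hobs
  refine ⟨C, hC, fun T hT y hy => ?_⟩
  have hd1 : (0 : ℝ) < d := by exact_mod_cast hd0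
  have hT0 : 0 < T := lt_of_le_of_lt (by positivity) hT
  obtain ⟨M, hM⟩ := hy.exists_bound_zeroExtension hΩo hΩb
  have hSA : {x : EuclideanSpace ℝ (Fin d) | R₁ < ‖x‖ ∧ ‖x‖ < R₂} ⊆ ball 0 R := fun x hx =>
    mem_ball_zero_iff.2 (hx.2.trans hR₂)
  have h1 := integral_sq_le_of_uniform_observability isOpen_ball isBounded_ball
    measurableSet_annulus hSA hΩo hΩb hT0.le (Real.exp_pos _).le
    (fun μ hμ u u' G G' hu => hobs μ hμ u u' G G' hu T hT)
    ((hy.measurable_zeroExtension hΩo).comp (by fun_prop : Measurable fun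
      p : (ℝ × EuclideanSpace ℝ (Fin d)) × EuclideanSpace ℝ (Fin dt) => (p.1.1, (p.1.2, p.2))))
    hM (fun t x hx z => zeroExtension_eq_zero fun h => hx h.1)
    (fun t x z hz => zeroExtension_eq_zero fun h => hz h.2)
    (fun μ lam ψ P φ Q hψ hφ t ht => hy.integral_mode_eq hT0 hΩo hΩb hψ hφ ht)
  rw [setIntegral_congr_fun measurableSet_ball fun x hx =>
    integral_zeroExtension_sq hΩo ⟨hT0.le, le_rfl⟩ hx] at h1
  rwa [setIntegral_congr_fun measurableSet_Ioc fun t ht =>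
    setIntegral_congr_fun measurableSet_annulus fun x hx =>
      integral_zeroExtension_sq hΩo (Ioc_subset_Icc_self ht) (hSA hx)] at h1
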